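/- Let K be an algebraically closed field of arbitrary characteristic and φ₁, φ₂ : Z → X dominant rational maps between algebraic varieties over K whose generic fibres are geometrically reduced. Then the following are equivalent: (1) there exists a finitely generated subfield k ⊆ K and infinitely many hypersurfaces H on X, each defined over the separable closure k^sep, satisfying φ₁*H = φ₂*H; (2) there exists g ∈ K(X) \ K such that g∘φ₁ = g∘φ₂. -/

import Mathlib

/-!
# Theorem 8.1: the positive characteristic statement

`K` is an algebraically closed field of arbitrary characteristic.  The algebraic varieties
`Z`, `X` over `K` are modelled by (affine models with) coordinate rings `S`, `R`: finitely
generated `K`-algebra domains with function fields `FS = Frac(S)` and `FR = Frac(R)`.  The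
dominant rational maps `φ₁, φ₂ : Z → X` are modelled by injective `K`-algebra maps
`f₁, f₂ : R → S`, with induced embeddings `F₁, F₂ : FR → FS` of function fields.  The
generic fibre of `φᵢ` is geometrically reduced exactly when `FS` admits a separating
transcendence basis over `Fᵢ(FR)`.

Condition (1): there is a finitely generated subfield `k ⊆ K` and infinitely many
hypersurfaces `H = V(I)` on `X`, each defined over the separable closure `k^sep ⊆ K` of
`k`, with `φ₁*H = φ₂*H`.  "Defined over `k^sep`" is expressed via a `k^sep`-form of `R`: a
subring `R₀ ⊆ R` stable under multiplication by the scalars in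
`k^sep = {c ∈ K | c is separably algebraic over k}`, which `K`-spans `R` and over which
`k^sep`-linear independence implies `K`-linear independence (i.e. `R ≅ K ⊗_{k^sep} R₀`);
the ideal `I` is defined over `k^sep` when it is generated by `I ∩ R₀`.

Condition (2): a nonconstant rational function `g = a/b ∈ K(X) \ K` with `g∘φ₁ = g∘φ₂`,
expressed denominator-freely by `f₁(a)·f₂(b) = f₂(a)·f₁(b)`.
-/

/-- A prime ideal `P` of a commutative ring has height one. -/
def HeightOnePrime {R : Type*} [CommRing R] (P : Ideal R) : Prop :=
  P.IsPrime ∧ P ≠ ⊥ ∧ ∀ Q : Ideal R, Q.IsPrime → Q < P → Q = ⊥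

/-- `I` is the radical vanishing ideal of a nonempty Zariski closed subset of pure
codimension one. -/
def IsHypersurfaceIdeal {R : Type*} [CommRing R] (I : Ideal R) : Prop :=
  I.IsRadical ∧ I ≠ ⊤ ∧ ∀ P ∈ I.minimalPrimes, HeightOnePrime P

/-- The vanishing ideal of the proper transform of `V(I)` along the dominant map induced
by `f`. -/
def properTransform {R S : Type*} [CommRing R] [CommRing S] (f : R →+* S) (I : Ideal R) :
    Ideal S :=
  sInf {Q : Ideal S | Q ∈ (I.map f).minimalPrimes ∧ Q.comap f ∈ I.minimalPrimes}

/-- `x ∈ K` is separably algebraic over the subfield `k ⊆ K`, i.e. `x ∈ k^sep`. -/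
def SepAlgOver {K : Type*} [Field K] (k : Subfield K) (x : K) : Prop :=
  ∃ p : Polynomial K, p.Monic ∧ p.Separable ∧ (∀ i, p.coeff i ∈ k) ∧ p.eval x = 0

/-- The field extension `FS / F(FR)` admits a separating transcendence basis; equivalently
(for function fields of varieties) the corresponding dominant rational map has
geometrically reduced generic fibre. -/
def SeparablyGeneratedVia {FR FS : Type*} [Field FR] [Field FS] (F : FR →+* FS) : Prop :=
  ∃ (n : ℕ) (x : Fin n → FS),
    AlgebraicIndependent F.fieldRange x ∧
    Algebra.IsSeparable (IntermediateField.adjoin F.fieldRange (Set.range x)) FS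

section
open IsDedekindDomain

/-- valuation rings of `M` over `A` centred at the prime element `ρ` -/
def ValOver {A M : Type*} [CommRing A] [Field M] (φ : A →+* M) (ρ : A) :
    Set (ValuationSubring M) :=
  {v | (∀ a, φ a ∈ v) ∧ ∀ a, φ a ∈ v.nonunits ↔ ρ ∣ a}

theorem ValuationSubring.nonunits_add {M : Type*} [Field M] {v : ValuationSubring M} {a b : M}
    (ha : a ∈ v.nonunits) (hb : b ∈ v.nonunits) : a + b ∈ v.nonunits := by
  rw [ValuationSubring.mem_nonunits_iff] at *
  exact lt_of_le_of_lt (v.valuation.map_add a b) (max_lt ha hb)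

theorem ValuationSubring.nonunits_mul_left {M : Type*} [Field M] {v : ValuationSubring M} {a b : M}
    (ha : a ∈ v) (hb : b ∈ v.nonunits) : a * b ∈ v.nonunits := by
  rw [ValuationSubring.mem_nonunits_iff] at *
  rw [map_mul]
  exact mul_lt_one_of_nonneg_of_lt_one_right ((v.valuation_le_one_iff a).2 ha) zero_le hb

theorem ValuationSubring.inv_mem_of_not_nonunit {M : Type*} [Field M] {v : ValuationSubring M}
    {a : M} (ha : a ∉ v.nonunits) : a⁻¹ ∈ v := by
  rw [ValuationSubring.mem_nonunits_iff_or] at ha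
  push Not at ha
  exact ha.2

theorem ValuationSubring.one_notMem_nonunits {M : Type*} [Field M] (v : ValuationSubring M) :
    (1 : M) ∉ v.nonunits := by
  rw [ValuationSubring.mem_nonunits_iff]; simp

/-- The kernel-of-reduction prime ideal of a ring hom landing in a valuation ring. -/
def ValuationSubring.centre {A M : Type*} [CommRing A] [Field M] (v : ValuationSubring M)
    (φ : A →+* M) (h : ∀ a, φ a ∈ v) : Ideal A :=
  (IsLocalRing.maximalIdeal v).comap (φ.codRestrict v.toSubring h)

theorem ValuationSubring.mem_centre {A M : Type*} [CommRing A] [Field M] (v : ValuationSubring M)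
    (φ : A →+* M) (h : ∀ a, φ a ∈ v) (a : A) : a ∈ v.centre φ h ↔ φ a ∈ v.nonunits :=
  (ValuationSubring.coe_mem_nonunits_iff (a := (φ.codRestrict v.toSubring h) a)).symm

instance ValuationSubring.centre_isPrime {A M : Type*} [CommRing A] [Field M]
    (v : ValuationSubring M) (φ : A →+* M) (h : ∀ a, φ a ∈ v) : (v.centre φ h).IsPrime := by
  unfold ValuationSubring.centre
  infer_instance

theorem ValuationSubring.mem_of_isIntegral {A M : Type*} [CommRing A] [Field M] [Algebra A M]
    (v : ValuationSubring M) (h : ∀ a, algebraMap A M a ∈ v) {x : M} (hx : IsIntegral A x) :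
    x ∈ v := by
  obtain ⟨p, hp, hpx⟩ := hx
  have h1 : IsIntegral v x := by
    refine ⟨p.map ((algebraMap A M).codRestrict v.toSubring h), hp.map _, ?_⟩
    rw [Polynomial.eval₂_map]
    exact hpx
  obtain ⟨y, hy⟩ := IsIntegrallyClosed.isIntegral_iff.1 h1
  rw [← hy]
  exact y.2

section Dvr

variable {O E M : Type*} [CommRing O] [IsDomain O] [IsDiscreteValuationRing O]
  [Field E] [Algebra O E] [IsFractionRing O E] [Field M] [Algebra E M] [Algebra O M]
  [IsScalarTower O E M] [FiniteDimensional E M] [Algebra.IsSeparable E M]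

/-- Valuation rings of `M` dominating a discrete valuation ring `O`. -/
def DomVal (O M : Type*) [CommRing O] [IsLocalRing O] [Field M] [Algebra O M] :
    Set (ValuationSubring M) :=
  {v | (∀ a, algebraMap O M a ∈ v) ∧ ∀ a ∈ IsLocalRing.maximalIdeal O,
    algebraMap O M a ∈ v.nonunits}

include E in
theorem exists_heightOne_of_domVal {v : ValuationSubring M} (hv : v ∈ DomVal O M) :
    letI : IsDedekindDomain (integralClosure O M) := integralClosure.isDedekindDomain O E M
    letI : IsFractionRing (integralClosure O M) M := integralClosure.isFractionRing_of_finite_extension E M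
    ∃ P : HeightOneSpectrum (integralClosure O M),
      P.asIdeal.comap (algebraMap O (integralClosure O M)) = IsLocalRing.maximalIdeal O ∧
      v = (P.valuation M).valuationSubring := by
  letI : IsDedekindDomain (integralClosure O M) := integralClosure.isDedekindDomain O E M
  letI : IsFractionRing (integralClosure O M) M :=
    integralClosure.isFractionRing_of_finite_extension E M
  have hC : ∀ c : integralClosure O M, algebraMap (integralClosure O M) M c ∈ v := fun c =>
    v.mem_of_isIntegral hv.1 c.2
  set I := v.centre _ hC with hI
  have hIm : I.comap (algebraMap O (integralClosure O M)) = IsLocalRing.maximalIdeal O := by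
    symm
    apply (IsLocalRing.maximalIdeal.isMaximal O).eq_of_le (Ideal.IsPrime.ne_top inferInstance)
    intro a ha
    rw [Ideal.mem_comap, ValuationSubring.mem_centre, ← IsScalarTower.algebraMap_apply]
    exact hv.2 a ha
  have hinj : Function.Injective (algebraMap O (integralClosure O M)) := by
    have : Function.Injective (algebraMap O M) := by
      rw [IsScalarTower.algebraMap_eq O E M]
      exact (algebraMap E M).injective.comp (IsFractionRing.injective O E)
    rw [IsScalarTower.algebraMap_eq O (integralClosure O M) M, RingHom.coe_comp] at this
    exact Function.Injective.of_comp this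
  have hne : I ≠ ⊥ := by
    intro h
    rw [h, ← RingHom.ker_eq_comap_bot, (RingHom.injective_iff_ker_eq_bot _).1 hinj] at hIm
    exact IsDiscreteValuationRing.not_a_field O hIm.symm
  let P : HeightOneSpectrum (integralClosure O M) := ⟨I, inferInstance, hne⟩
  refine ⟨P, hIm, ?_⟩
  rw [← HeightOneSpectrum.valuationSubringAtPrime_eq_valuationSubring]
  symm
  apply ValuationSubring.eq_of_le_of_ne_top
  · intro x hx
    obtain ⟨a, s, hs, rfl⟩ := hx
    refine v.mul_mem _ _ (hC a) (v.inv_mem_of_not_nonunit ?_)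
    rw [← v.mem_centre _ hC]
    exact hs
  · rintro rfl
    obtain ⟨a, ha, ha0⟩ := Submodule.exists_mem_ne_zero_of_ne_bot
      (IsDiscreteValuationRing.not_a_field O)
    have := hv.2 a ha
    rw [ValuationSubring.mem_nonunits_iff_or] at this
    rcases this with h | h
    · rw [IsScalarTower.algebraMap_apply O (integralClosure O M) M] at h
      apply ha0
      apply hinj
      rw [map_zero]
      exact (map_eq_zero_iff _ (IsFractionRing.injective (integralClosure O M) M)).1 h
    · exact h (ValuationSubring.mem_top _)

include E in
theorem domVal_finite : (DomVal O M).Finite := by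
  letI : IsDedekindDomain (integralClosure O M) := integralClosure.isDedekindDomain O E M
  letI : IsFractionRing (integralClosure O M) M :=
    integralClosure.isFractionRing_of_finite_extension E M
  haveI : Module.Finite O (integralClosure O M) := IsIntegralClosure.finite O E M _
  have h := Algebra.QuasiFinite.finite_primesOver (S := integralClosure O M)
    (IsLocalRing.maximalIdeal O)
  have h2 : {P : HeightOneSpectrum (integralClosure O M) |
      P.asIdeal ∈ (IsLocalRing.maximalIdeal O).primesOver (integralClosure O M)}.Finite := by
    apply Set.Finite.preimage _ h
    intro a _ b _ hab
    exact HeightOneSpectrum.ext hab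
  refine (h2.image fun P => (P.valuation M).valuationSubring).subset ?_
  intro v hv
  obtain ⟨P, hP, rfl⟩ := exists_heightOne_of_domVal (E := E) hv
  exact ⟨P, ⟨inferInstance, ⟨hP.symm⟩⟩, rfl⟩

include E in
theorem domVal_archimedean {v : ValuationSubring M} (hv : v ∈ DomVal O M) {w : M}
    (hw : w ∈ v.nonunits) (u : M) : ∃ m : ℕ, w ^ m * u ∈ v := by
  letI : IsDedekindDomain (integralClosure O M) := integralClosure.isDedekindDomain O E M
  letI : IsFractionRing (integralClosure O M) M :=
    integralClosure.isFractionRing_of_finite_extension E M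
  obtain ⟨P, hP, rfl⟩ := exists_heightOne_of_domVal (E := E) hv
  rcases eq_or_ne u 0 with rfl | hu
  · exact ⟨0, by simp⟩
  have hw1 : P.valuation M w < 1 := by
    rw [ValuationSubring.mem_nonunits_iff_or] at hw
    rcases hw with rfl | hw
    · simp
    · rw [Valuation.mem_valuationSubring_iff, map_inv₀, not_le] at hw
      by_contra hcon
      rw [not_lt] at hcon
      exact absurd (inv_le_one_of_one_le₀ hcon) (not_le.2 hw)
  obtain ⟨m, hm⟩ := exists_pow_lt₀ hw1 (Units.mk0 (P.valuation M u)⁻¹ (by simpa using hu))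
  refine ⟨m, ?_⟩
  rw [Valuation.mem_valuationSubring_iff, map_mul, map_pow]
  rw [Units.val_mk0] at hm
  have h0 : 0 < P.valuation M u := zero_lt_iff.2 (by simpa using hu)
  calc _ ≤ (P.valuation M u)⁻¹ * P.valuation M u := mul_le_mul_left hm.le _
    _ = 1 := inv_mul_cancel₀ h0.ne'

include E in
theorem isIntegral_of_forall_domVal {u : M} (hu : ∀ v ∈ DomVal O M, u ∈ v) : IsIntegral O u := by
  have key : u ∈ (integralClosure O M).toSubring := by
    rw [Subring.eq_iInf_of_isIntegrallyClosedIn (R := (integralClosure O M).toSubring),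
      Subring.mem_iInf]
    rintro ⟨v, hv⟩
    have h1 : ∀ a, algebraMap O M a ∈ v := fun a =>
      hv (Subalgebra.algebraMap_mem (integralClosure O M) a)
    by_cases h2 : ∀ a ∈ IsLocalRing.maximalIdeal O, algebraMap O M a ∈ v.nonunits
    · exact hu v ⟨h1, h2⟩
    · push Not at h2
      obtain ⟨a, ha, hav⟩ := h2
      have hE : ∀ e : E, algebraMap E M e ∈ v := by
        intro e
        have hinj : Function.Injective (algebraMap O M) := by
          rw [IsScalarTower.algebraMap_eq O E M]
          exact (algebraMap E M).injective.comp (IsFractionRing.injective O E)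
        have hcen : v.centre (algebraMap O M) h1 = ⊥ := by
          by_contra hne
          have := IsLocalRing.eq_maximalIdeal
            (Ideal.IsPrime.isMaximal (inferInstance : (v.centre (algebraMap O M) h1).IsPrime) hne)
          rw [← this, ValuationSubring.mem_centre] at ha
          exact hav ha
        obtain ⟨x, y, hy, rfl⟩ := IsFractionRing.div_surjective (A := O) e
        rw [map_div₀, ← IsScalarTower.algebraMap_apply, ← IsScalarTower.algebraMap_apply,
          div_eq_mul_inv]
        refine v.mul_mem _ _ (h1 x) (v.inv_mem_of_not_nonunit ?_)
        rw [← v.mem_centre _ h1, hcen]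
        exact nonZeroDivisors.ne_zero hy
      exact v.mem_of_isIntegral hE (Algebra.IsIntegral.isIntegral u)
  exact key

end Dvr

end

section
open IsDedekindDomain

/-- `M` is a finite separable extension of the fraction field of `A`, embedded via `φ`. -/
structure FinSepOver {A M : Type*} [CommRing A] [Field M] (φ : A →+* M) : Prop where
  inj : Function.Injective φ
  fin : Module.Finite (Subfield.closure (Set.range φ)) M
  sep : Algebra.IsSeparable (Subfield.closure (Set.range φ)) M

section
variable {A M : Type*} [CommRing A] [Field M] (φ : A →+* M)

/-- The corestriction of `φ` to the subfield generated by its range. -/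
def toClosure : A →+* Subfield.closure (Set.range φ) :=
  φ.codRestrict _ fun a => Subfield.subset_closure ⟨a, rfl⟩

theorem exists_div_of_mem_closure {x : M} (hx : x ∈ Subfield.closure (Set.range φ)) :
    ∃ a b : A, φ b ≠ 0 ∧ x = φ a / φ b := by
  rw [Subfield.mem_closure_iff] at hx
  have hr : Subring.closure (Set.range φ) = φ.range := by
    rw [← RingHom.coe_range]; exact Subring.closure_eq _
  rw [hr] at hx
  obtain ⟨_, ⟨a, rfl⟩, _, ⟨b, rfl⟩, rfl⟩ := hx
  by_cases hb : φ b = 0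
  · refine ⟨0, 1, by simp, by simp [hb]⟩
  · exact ⟨a, b, hb, rfl⟩

theorem isFractionRing_toClosure (hφ : Function.Injective φ) [IsDomain A] :
    letI := (toClosure φ).toAlgebra
    IsFractionRing A (Subfield.closure (Set.range φ)) := by
  letI := (toClosure φ).toAlgebra
  refine (isLocalization_iff _ _).2 ⟨?_, ?_, ?_⟩
  · rintro ⟨y, hy⟩
    rw [isUnit_iff_ne_zero]
    intro h
    have : φ y = 0 := congrArg Subtype.val h
    exact nonZeroDivisors.ne_zero hy ((map_eq_zero_iff φ hφ).1 this)
  · rintro ⟨x, hx⟩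
    obtain ⟨a, b, hb, rfl⟩ := exists_div_of_mem_closure φ hx
    refine ⟨⟨a, b, mem_nonZeroDivisors_of_ne_zero ?_⟩, Subtype.ext ?_⟩
    · rintro rfl; simp at hb
    · exact div_mul_cancel₀ _ hb
  · intro x y hxy
    exact ⟨1, by rw [hφ (congrArg Subtype.val hxy)]⟩

theorem dvr_of_prime [IsDomain A] [IsNoetherianRing A] {ρ : A} (hρ : Prime ρ)
    [(Ideal.span {ρ}).IsPrime] :
    IsDiscreteValuationRing (Localization.AtPrime (Ideal.span {ρ})) := by
  have h0 : ¬ IsField (Localization.AtPrime (Ideal.span {ρ})) := by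
    intro h
    rw [IsLocalRing.isField_iff_maximalIdeal_eq, ← Localization.AtPrime.map_eq_maximalIdeal,
      Ideal.map_span, Ideal.span_eq_bot] at h
    have h1 := h (algebraMap _ _ ρ) ⟨ρ, rfl, rfl⟩
    rw [map_eq_zero_iff _ (IsLocalization.injective _
      (Ideal.primeCompl_le_nonZeroDivisors (Ideal.span {ρ})))] at h1
    exact hρ.ne_zero h1
  haveI : IsNoetherianRing (Localization.AtPrime (Ideal.span {ρ})) :=
    IsLocalization.isNoetherianRing (Ideal.span {ρ}).primeCompl _ inferInstance
  refine ((IsDiscreteValuationRing.TFAE _ h0).out 4 0).1 ?_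
  rw [← Localization.AtPrime.map_eq_maximalIdeal, Ideal.map_span, Set.image_singleton]
  exact ⟨_, rfl⟩

theorem valOver_aux [IsDomain A] [IsNoetherianRing A] (h : FinSepOver φ) {ρ : A} (hρ : Prime ρ) :
    (ValOver φ ρ).Finite ∧
    (∀ v ∈ ValOver φ ρ, ∀ w ∈ v.nonunits, ∀ u : M, ∃ m : ℕ, w ^ m * u ∈ v) ∧
    ∀ u : M, (∀ v ∈ ValOver φ ρ, u ∈ v) → ∃ p, ¬ ρ ∣ p ∧ φ.IsIntegralElem (φ p * u) := by
  haveI hP : (Ideal.span {ρ}).IsPrime := (Ideal.span_singleton_prime hρ.ne_zero).2 hρ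
  haveI := dvr_of_prime hρ
  let E := Subfield.closure (Set.range φ)
  letI : Algebra A E := (toClosure φ).toAlgebra
  letI : Algebra A M := φ.toAlgebra
  haveI : IsScalarTower A E M := IsScalarTower.of_algebraMap_eq fun a => rfl
  haveI := h.fin
  haveI := h.sep
  haveI hfr : IsFractionRing A E := isFractionRing_toClosure φ h.inj
  let O := Localization.AtPrime (Ideal.span {ρ})
  have hu : ∀ y : (Ideal.span {ρ}).primeCompl, IsUnit (algebraMap A E y) := fun y =>
    IsLocalization.map_units E (M := nonZeroDivisors A)
      ⟨y, Ideal.primeCompl_le_nonZeroDivisors _ y.2⟩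
  letI : Algebra O E := (IsLocalization.lift hu : O →+* E).toAlgebra
  haveI : IsScalarTower A O E := IsScalarTower.of_algebraMap_eq fun a =>
    (IsLocalization.lift_eq hu a).symm
  haveI : IsFractionRing O E := IsFractionRing.isFractionRing_of_isDomain_of_isLocalization
    (Ideal.span {ρ}).primeCompl O E
  letI : Algebra O M := ((algebraMap E M).comp (algebraMap O E)).toAlgebra
  haveI : IsScalarTower O E M := IsScalarTower.of_algebraMap_eq fun a => rfl
  haveI : IsScalarTower A O M := IsScalarTower.of_algebraMap_eq fun a => by
    rw [IsScalarTower.algebraMap_apply O E M, ← IsScalarTower.algebraMap_apply A O E]; rfl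
  have heq : ValOver φ ρ = DomVal O M := by
    ext v
    constructor
    · rintro ⟨h1, h2⟩
      have hO : ∀ a, algebraMap O M a ∈ v := by
        intro a
        obtain ⟨x, y, rfl⟩ := IsLocalization.exists_mk'_eq (Ideal.span {ρ}).primeCompl a
        have hy : φ y ∉ v.nonunits := by
          rw [h2]; intro hd; exact y.2 (Ideal.mem_span_singleton.2 hd)
        have hy0 : φ y ≠ 0 := fun h0 => hy (v.mem_nonunits_iff_or.2 (Or.inl h0))
        have : algebraMap O M (IsLocalization.mk' O x y) = φ x * (φ y)⁻¹ := by
          rw [eq_mul_inv_iff_mul_eq₀ hy0]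
          have h3 := congrArg (algebraMap O M) (IsLocalization.mk'_spec O x y)
          rw [map_mul, ← IsScalarTower.algebraMap_apply, ← IsScalarTower.algebraMap_apply] at h3
          exact h3
        rw [this]
        exact v.mul_mem _ _ (h1 x) (v.inv_mem_of_not_nonunit hy)
      refine ⟨hO, fun a ha => ?_⟩
      rw [← Localization.AtPrime.map_eq_maximalIdeal, Ideal.map_span, Set.image_singleton,
        Ideal.mem_span_singleton'] at ha
      obtain ⟨c, rfl⟩ := ha
      rw [map_mul, ← IsScalarTower.algebraMap_apply]
      exact v.nonunits_mul_left (hO c) ((h2 ρ).2 dvd_rfl)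
    · rintro ⟨h1, h2⟩
      have hA : ∀ a, φ a = algebraMap O M (algebraMap A O a) := fun a =>
        IsScalarTower.algebraMap_apply A O M a
      refine ⟨fun a => by rw [hA]; exact h1 _, fun a => ?_⟩
      rw [hA, ← Ideal.mem_span_singleton, ← v.mem_centre _ h1]
      have : v.centre _ h1 = IsLocalRing.maximalIdeal O := by
        symm
        apply (IsLocalRing.maximalIdeal.isMaximal O).eq_of_le (Ideal.IsPrime.ne_top inferInstance)
        intro a ha
        rw [ValuationSubring.mem_centre]
        exact h2 a ha
      rw [this]
      exact IsLocalization.AtPrime.to_map_mem_maximal_iff O _ a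
  rw [heq]
  refine ⟨domVal_finite (E := E), fun v hv w hw u => domVal_archimedean (E := E) hv hw u, ?_⟩
  intro u hu
  have h1 : IsIntegral O u := isIntegral_of_forall_domVal (E := E) hu
  obtain ⟨⟨p, hp⟩, hpu⟩ := h1.exists_multiple_integral_of_isLocalization (Ideal.span {ρ}).primeCompl
  refine ⟨p, fun hd => hp (Ideal.mem_span_singleton.2 hd), ?_⟩
  rw [Submonoid.smul_def, Algebra.smul_def] at hpu
  exact hpu

variable {φ}
variable [IsDomain A] [IsNoetherianRing A] (h : FinSepOver φ) {ρ : A} (hρ : Prime ρ)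
include h hρ

theorem valOver_finite : (ValOver φ ρ).Finite := (valOver_aux φ h hρ).1

theorem valOver_archimedean {v : ValuationSubring M} (hv : v ∈ ValOver φ ρ) {w : M}
    (hw : w ∈ v.nonunits) (u : M) : ∃ m : ℕ, w ^ m * u ∈ v := (valOver_aux φ h hρ).2.1 v hv w hw u

theorem exists_integral_of_forall_valOver {u : M} (hu : ∀ v ∈ ValOver φ ρ, u ∈ v) :
    ∃ p, ¬ ρ ∣ p ∧ φ.IsIntegralElem (φ p * u) := (valOver_aux φ h hρ).2.2 u hu

end

end

section
open MvPolynomial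

section
variable {K ι : Type*} [Field K] [Fintype ι] [DecidableEq ι]

/-- coordinates in the chart at infinity -/
noncomputable def infChart {M : Type*} [Field M] (z : ι → M) (i0 : ι) : ι → M :=
  fun i => if i = i0 then (z i0)⁻¹ else z i / z i0

theorem infChart_prod {M : Type*} [Field M] (z : ι → M) (i0 : ι) (h0 : z i0 ≠ 0) (m : ι →₀ ℕ)
    {k : ℕ} (hk : m.degree ≤ k) :
    ((m.erase i0 + Finsupp.single i0 (k - m.degree)).prod fun i e => infChart z i0 i ^ e) =
      ((z i0)⁻¹) ^ k * m.prod fun i e => z i ^ e := by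
  rw [Finsupp.prod_fintype _ _ (by simp), Finsupp.prod_fintype _ _ (by simp)]
  rw [← Finset.mul_prod_erase _ _ (Finset.mem_univ i0),
    ← Finset.mul_prod_erase _ (fun i => z i ^ m i) (Finset.mem_univ i0)]
  have h1 : ∏ x ∈ Finset.univ.erase i0,
      infChart z i0 x ^ (m.erase i0 + Finsupp.single i0 (k - m.degree)) x
      = (z i0)⁻¹ ^ (∑ x ∈ Finset.univ.erase i0, m x) * ∏ x ∈ Finset.univ.erase i0, z x ^ m x := by
    rw [← Finset.prod_pow_eq_pow_sum, ← Finset.prod_mul_distrib]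
    refine Finset.prod_congr rfl fun i hi => ?_
    have hi' := Finset.ne_of_mem_erase hi
    simp only [infChart, if_neg hi', Finsupp.add_apply, Finsupp.erase_ne hi',
      Finsupp.single_apply, if_neg hi'.symm, add_zero]
    rw [div_eq_mul_inv, mul_pow, mul_comm]
  have h2 : m.degree = m i0 + ∑ x ∈ Finset.univ.erase i0, m x := by
    rw [Finsupp.degree_eq_sum, Finset.add_sum_erase _ _ (Finset.mem_univ i0)]
  rw [h1]
  simp only [infChart, if_true, Finsupp.add_apply, Finsupp.erase_same, Finsupp.single_eq_same,
    zero_add]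
  have h3 : k = (k - m.degree) + m i0 + ∑ x ∈ Finset.univ.erase i0, m x := by omega
  generalize ∑ x ∈ Finset.univ.erase i0, m x = s at *
  generalize k - m.degree = t at *
  subst h3
  rw [pow_add, pow_add]
  have : (z i0)⁻¹ ^ m i0 * z i0 ^ m i0 = 1 := by rw [← mul_pow, inv_mul_cancel₀ h0, one_pow]
  generalize ∏ x ∈ Finset.univ.erase i0, z x ^ m x = P
  calc _ = (z i0)⁻¹ ^ t * (z i0)⁻¹ ^ s * P * 1 := by ring
    _ = _ := by rw [← this]; ring

/-- homogenise to degree `k` with respect to the variable `i0`, the variable `i0` itself being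
dehomogenised. -/
noncomputable def swapHom (i0 : ι) (k : ℕ) (c : MvPolynomial ι K) : MvPolynomial ι K :=
  ∑ m ∈ c.support, monomial (m.erase i0 + Finsupp.single i0 (k - m.degree)) (coeff m c)

theorem aeval_swapHom {M : Type*} [Field M] [Algebra K M] (z : ι → M) (i0 : ι) (h0 : z i0 ≠ 0)
    (c : MvPolynomial ι K) {k : ℕ} (hk : c.totalDegree ≤ k) :
    aeval (infChart z i0) (swapHom i0 k c) = (z i0)⁻¹ ^ k * aeval z c := by
  conv_rhs => rw [c.as_sum]
  rw [swapHom, map_sum, map_sum, Finset.mul_sum]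
  refine Finset.sum_congr rfl fun m hm => ?_
  rw [aeval_monomial, aeval_monomial, infChart_prod z i0 h0 m
    ((le_totalDegree hm).trans hk)]
  ring

theorem not_X_dvd_swapHom (i0 : ι) {c : MvPolynomial ι K} (hc : c ≠ 0) :
    ¬ X i0 ∣ swapHom i0 c.totalDegree c := by
  obtain ⟨m0, hm0, hd⟩ : ∃ m ∈ c.support, m.degree = c.totalDegree := by
    have := Finset.exists_mem_eq_sup c.support (by simpa using hc) (fun m => m.degree)
    obtain ⟨m, hm, h⟩ := this
    exact ⟨m, hm, h.symm⟩
  rintro ⟨g, hg⟩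
  have h1 : coeff (m0.erase i0) (swapHom i0 c.totalDegree c) = coeff m0 c := by
    rw [swapHom, coeff_sum, Finset.sum_eq_single m0]
    · rw [hd, Nat.sub_self]; simp
    · intro m hm hne
      rw [coeff_monomial, if_neg]
      intro h
      apply hne
      have h2 := DFunLike.congr_fun h i0
      simp only [Finsupp.add_apply, Finsupp.erase_same, Finsupp.single_eq_same, zero_add] at h2
      have h3 : m.degree = m0.degree :=
        le_antisymm ((le_totalDegree hm).trans hd.ge) (by omega)
      rw [h2, Finsupp.single_zero, add_zero] at h
      have h4 : ∀ i ≠ i0, m i = m0 i := fun i hi => by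
        have := DFunLike.congr_fun h i
        simpa [Finsupp.erase_ne hi] using this
      rw [Finsupp.degree_eq_sum, Finsupp.degree_eq_sum,
        ← Finset.add_sum_erase _ _ (Finset.mem_univ i0),
        ← Finset.add_sum_erase _ m0 (Finset.mem_univ i0)] at h3
      rw [Finset.sum_congr rfl fun i hi => h4 i (Finset.ne_of_mem_erase hi)] at h3
      ext i
      by_cases hi : i = i0
      · rw [hi]; exact Nat.add_right_cancel h3
      · exact h4 i hi
    · intro h; exact absurd hm0 h
  rw [hg, coeff_X_mul', if_neg (by simp)] at h1
  exact (mem_support_iff.1 hm0) h1.symm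

end

end

section
open MvPolynomial

section
variable {A M : Type*} [CommRing A] [Field M] {φ : A →+* M}
  [IsDomain A] [IsNoetherianRing A]

theorem exists_trace_mul_eq [UniqueFactorizationMonoid A] (h : FinSepOver φ) {E : Subfield M}
    (hE : Subfield.closure (Set.range φ) = E) {ρ : A} (hρ : Prime ρ) {u b : M}
    (hu : ∀ v ∈ ValOver φ ρ, u ∈ v) (hb : φ.IsIntegralElem b) :
    ∃ p, ¬ ρ ∣ p ∧ ∃ c, φ p * (Algebra.trace E M (u * b) : M) = φ c := by
  subst hE
  obtain ⟨p, hp, hpu⟩ := exists_integral_of_forall_valOver h hρ hu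
  refine ⟨p, hp, ?_⟩
  let E := Subfield.closure (Set.range φ)
  letI : Algebra A E := (toClosure φ).toAlgebra
  letI : Algebra A M := φ.toAlgebra
  haveI : IsScalarTower A E M := IsScalarTower.of_algebraMap_eq fun a => rfl
  haveI := h.fin
  haveI := h.sep
  haveI hfr : IsFractionRing A E := isFractionRing_toClosure φ h.inj
  have h1 : IsIntegral A (φ p * u * b) := IsIntegral.mul hpu hb
  have h2 : IsIntegral A (Algebra.trace E M (φ p * u * b)) := Algebra.isIntegral_trace h1
  obtain ⟨c, hc⟩ := IsIntegrallyClosed.isIntegral_iff.1 h2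
  refine ⟨c, ?_⟩
  have h3 : φ p * u * b = algebraMap A E p • (u * b) := by
    rw [Algebra.smul_def, ← IsScalarTower.algebraMap_apply, mul_assoc]; rfl
  rw [h3, map_smul, smul_eq_mul] at hc
  exact (congrArg Subtype.val hc).symm

theorem exists_eq_of_forall_prime [UniqueFactorizationMonoid A] (hφ : Function.Injective φ) {e : M}
    (he : e ∈ Subfield.closure (Set.range φ))
    (H : ∀ ρ : A, Prime ρ → ∃ p, ¬ ρ ∣ p ∧ ∃ c, φ p * e = φ c) : ∃ c, φ c = e := by
  obtain ⟨a, b, hb, rfl⟩ := exists_div_of_mem_closure φ he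
  have hb0 : b ≠ 0 := by rintro rfl; simp at hb
  obtain ⟨a', b', c', hrel, rfl, rfl⟩ :=
    UniqueFactorizationMonoid.exists_reduced_factors' a b hb0
  rw [map_mul] at hb
  have hc0 := left_ne_zero_of_mul hb
  have hb0' := right_ne_zero_of_mul hb
  have hu : IsUnit b' := by
    by_contra hnu
    obtain ⟨ρ, hρ, hd⟩ := WfDvdMonoid.exists_irreducible_factor hnu
      (by rintro rfl; simp at hb0)
    have hρ' := hρ.prime
    obtain ⟨p, hp, c, hc⟩ := H ρ hρ'
    rw [map_mul, map_mul, mul_div_mul_left _ _ hc0, mul_div_assoc', div_eq_iff hb0', ← map_mul,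
      ← map_mul] at hc
    have h1 : ρ ∣ p * a' := by rw [hφ hc]; exact hd.mul_left c
    rcases hρ'.dvd_or_dvd h1 with h | h
    · exact hp h
    · exact hρ.not_isUnit (hrel h hd)
  obtain ⟨w, rfl⟩ := hu
  refine ⟨a' * ↑w⁻¹, ?_⟩
  rw [map_mul, map_mul, map_mul, mul_div_mul_left _ _ hc0, eq_div_iff hb0', mul_assoc, ← map_mul,
    Units.inv_mul, map_one, mul_one]

end

section
variable {K ι M : Type*} [Field K] [Fintype ι] [DecidableEq ι] [Field M] [Algebra K M]

/-- evaluation of polynomials at `z`, as a ring homomorphism -/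
noncomputable abbrev evalAt (K : Type*) {ι M : Type*} [Field K] [Field M] [Algebra K M]
    (z : ι → M) : MvPolynomial ι K →+* M :=
  ((aeval z : MvPolynomial ι K →ₐ[K] M) : MvPolynomial ι K →+* M)

theorem closure_evalAt_eq (z : ι → M) :
    Subfield.closure (Set.range (evalAt K z)) =
      Subfield.closure (Set.range (algebraMap K M) ∪ Set.range z) := by
  apply le_antisymm
  · rw [Subfield.closure_le]
    rintro _ ⟨p, rfl⟩
    induction p using MvPolynomial.induction_on with
    | C a =>
      have : algebraMap K M a ∈ Subfield.closure (Set.range (algebraMap K M) ∪ Set.range z) :=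
        Subfield.subset_closure (Or.inl ⟨a, rfl⟩)
      simpa using this
    | add p q hp hq => rw [map_add]; exact add_mem hp hq
    | mul_X p i hp =>
      have : z i ∈ Subfield.closure (Set.range (algebraMap K M) ∪ Set.range z) :=
        Subfield.subset_closure (Or.inr ⟨i, rfl⟩)
      rw [map_mul]; exact mul_mem hp (by simpa using this)
  · rw [Subfield.closure_le]
    rintro _ (⟨a, rfl⟩ | ⟨i, rfl⟩)
    · exact Subfield.subset_closure ⟨C a, by simp⟩
    · exact Subfield.subset_closure ⟨X i, by simp⟩

theorem infChart_infChart (z : ι → M) (i0 : ι) (h0 : z i0 ≠ 0) :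
    infChart (infChart z i0) i0 = z := by
  funext i
  by_cases hi : i = i0
  · subst hi; simp [infChart]
  · simp [infChart, hi, h0]

theorem closure_infChart_le (z : ι → M) (i0 : ι) :
    Subfield.closure (Set.range (evalAt K (infChart z i0))) ≤
      Subfield.closure (Set.range (evalAt K z)) := by
  rw [closure_evalAt_eq, closure_evalAt_eq, Subfield.closure_le]
  rintro _ (⟨a, rfl⟩ | ⟨i, rfl⟩)
  · exact Subfield.subset_closure (Or.inl ⟨a, rfl⟩)
  · have hz : ∀ j, z j ∈ Subfield.closure (Set.range (algebraMap K M) ∪ Set.range z) :=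
      fun j => Subfield.subset_closure (Or.inr ⟨j, rfl⟩)
    simp only [infChart]
    split_ifs
    · exact inv_mem (hz _)
    · exact div_mem (hz _) (hz _)

theorem FinSepOver.infChart {z : ι → M} (h : FinSepOver (evalAt K z)) (i0 : ι) :
    z i0 ≠ 0 ∧ Subfield.closure (Set.range (evalAt K (infChart z i0))) =
      Subfield.closure (Set.range (evalAt K z)) ∧ FinSepOver (evalAt K (infChart z i0)) := by
  have h0 : z i0 ≠ 0 := by
    intro h0
    have : evalAt K z (X i0) = evalAt K z 0 := by simp [h0]
    exact X_ne_zero i0 (h.inj this)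
  have h1 : Subfield.closure (Set.range (evalAt K (_root_.infChart z i0))) =
      Subfield.closure (Set.range (evalAt K z)) := by
    apply le_antisymm (closure_infChart_le z i0)
    conv_lhs => rw [← infChart_infChart z i0 h0]
    exact closure_infChart_le _ i0
  refine ⟨h0, h1, ?_, by rw [h1]; exact h.fin, by rw [h1]; exact h.sep⟩
  rw [injective_iff_map_eq_zero]
  intro p hp
  by_contra hp0
  apply not_X_dvd_swapHom i0 hp0
  have h2 := aeval_swapHom (K := K) (_root_.infChart z i0) i0 (by simp [_root_.infChart, h0]) p le_rfl
  rw [infChart_infChart z i0 h0] at h2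
  have h3 : (aeval (_root_.infChart z i0)) p = 0 := hp
  rw [h3, mul_zero] at h2
  have : swapHom i0 p.totalDegree p = 0 := h.inj (by rw [map_zero]; exact h2)
  rw [this]
  exact dvd_zero _

theorem totalDegree_le_of_infChart {z : ι → M} (h : FinSepOver (evalAt K z)) (i0 : ι)
    {c p r : MvPolynomial ι K} {D : ℕ} (hp : ¬ X i0 ∣ p)
    (he : evalAt K (infChart z i0) p * ((z i0)⁻¹ ^ D * evalAt K z c) =
      evalAt K (infChart z i0) r) : c.totalDegree ≤ D := by
  obtain ⟨h0, -, h'⟩ := h.infChart i0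
  by_contra! hlt
  obtain ⟨k, hk⟩ := Nat.exists_eq_add_of_lt hlt
  have hc : c ≠ 0 := by rintro rfl; simp at hlt
  have h1 := aeval_swapHom (K := K) z i0 h0 c le_rfl
  have h2 : p * swapHom i0 c.totalDegree c = X i0 ^ (k + 1) * r := by
    apply h'.inj
    rw [map_mul, map_mul, ← he, map_pow]
    have h3 : evalAt K (_root_.infChart z i0) (X i0) = (z i0)⁻¹ := by simp [_root_.infChart]
    have h4 : evalAt K (_root_.infChart z i0) (swapHom i0 c.totalDegree c) =
      (z i0)⁻¹ ^ c.totalDegree * evalAt K z c := h1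
    rw [h3, h4]
    conv_lhs => rw [hk]
    ring
  have h3 : X i0 ∣ p * swapHom i0 c.totalDegree c := by
    rw [h2, pow_succ, mul_comm (X i0 ^ k), mul_assoc]; exact dvd_mul_right _ _
  rcases (MvPolynomial.X_prime (i := i0) (R := K)).dvd_or_dvd h3 with h | h
  · exact hp h
  · exact not_X_dvd_swapHom i0 hc h

end

end

section
open MvPolynomial

theorem Set.Finite.exists_pow_mul_mem {M : Type*} [Field M] {V : Set (ValuationSubring M)}
    (hV : V.Finite) {w : M} (hw : ∀ v ∈ V, w ∈ v) (harch : ∀ v ∈ V, ∀ u, ∃ m : ℕ, w ^ m * u ∈ v)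
    (u : ValuationSubring M → M) : ∃ m : ℕ, ∀ v ∈ V, w ^ m * u v ∈ v := by
  induction V, hV using Set.Finite.induction_on with
  | empty => exact ⟨0, by simp⟩
  | @insert v V _ _ ih =>
    obtain ⟨m, hm⟩ := ih (fun v' h => hw v' (Set.mem_insert_of_mem _ h))
      (fun v' h => harch v' (Set.mem_insert_of_mem _ h))
    obtain ⟨k, hk⟩ := harch v (Set.mem_insert _ _) (u v)
    refine ⟨m + k, ?_⟩
    rintro v' (rfl | h)
    · rw [pow_add, mul_assoc]
      exact mul_mem (pow_mem (hw _ (Set.mem_insert _ _)) _) hk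
    · rw [add_comm, pow_add, mul_assoc]
      exact mul_mem (pow_mem (hw _ (Set.mem_insert_of_mem _ h)) _) (hm _ h)

theorem valOver_eq_of_associated {A M : Type*} [CommRing A] [Field M] {φ : A →+* M} {ρ ρ' : A}
    (h : Associated ρ ρ') : ValOver φ ρ = ValOver φ ρ' := by
  ext v
  simp only [ValOver, Set.mem_ofPred_eq, h.dvd_iff_dvd_left]

theorem finite_valOver_dvd {A M : Type*} [CommRing A] [Field M] {φ : A →+* M} [IsDomain A]
    [IsNoetherianRing A] [UniqueFactorizationMonoid A] (h : FinSepOver φ) {H : A} (hH : H ≠ 0) :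
    {v | ∃ ρ, Prime ρ ∧ ρ ∣ H ∧ v ∈ ValOver φ ρ}.Finite := by
  classical
  have : {v | ∃ ρ, Prime ρ ∧ ρ ∣ H ∧ v ∈ ValOver φ ρ} ⊆
      ⋃ ρ ∈ (UniqueFactorizationMonoid.factors H).toFinset, ValOver φ ρ := by
    rintro v ⟨ρ, hρ, hd, hv⟩
    obtain ⟨ρ', h1, h2⟩ :=
      UniqueFactorizationMonoid.exists_mem_factors_of_dvd hH hρ.irreducible hd
    simp only [Set.mem_iUnion]
    exact ⟨ρ', by simpa using h1, by rwa [← valOver_eq_of_associated h2]⟩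
  refine Set.Finite.subset (Set.Finite.biUnion (Finset.finite_toSet _) fun ρ hρ => ?_) this
  exact valOver_finite h (UniqueFactorizationMonoid.prime_of_factor ρ (by simpa using hρ))

section
variable {K ι M : Type*} [Field K] [Fintype ι] [DecidableEq ι] [Field M] [Algebra K M]

theorem exists_finiteDimensional_of_bounded {z : ι → M} (h : FinSepOver (evalAt K z)) (i0 : ι)
    {H : MvPolynomial ι K} (hH : H ≠ 0) {a : ValuationSubring M → M} (ha : ∀ v, a v ≠ 0) :
    ∃ W : Submodule K M, FiniteDimensional K W ∧ ∀ u,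
      (∀ ρ, Prime ρ → ∀ v ∈ ValOver (evalAt K z) ρ, (¬ ρ ∣ H → u ∈ v) ∧ (ρ ∣ H → a v * u ∈ v)) →
      (∀ v ∈ ValOver (evalAt K (infChart z i0)) (X i0), a v * u ∈ v) → u ∈ W := by
  obtain ⟨h0, hcl, h'⟩ := h.infChart i0
  set φ := evalAt K z with hφ
  set φ' := evalAt K (infChart z i0) with hφ'
  have hXp : Prime (X i0 : MvPolynomial ι K) := MvPolynomial.X_prime
  have hX : φ' (X i0) = (z i0)⁻¹ := by simp [hφ', infChart]
  obtain ⟨m, hm⟩ := (finite_valOver_dvd h hH).exists_pow_mul_mem (w := φ H)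
    (by rintro v ⟨ρ, -, -, hv⟩; exact hv.1 H)
    (by
      rintro v ⟨ρ, hρ, hd, hv⟩ u
      exact valOver_archimedean h hρ hv ((hv.2 H).2 hd) u) (fun v => (a v)⁻¹)
  -- the trace
  generalize hEdef : Subfield.closure (Set.range φ) = E at hcl
  have hEfin : Module.Finite E M := hEdef ▸ h.fin
  have hEsep : Algebra.IsSeparable E M := hEdef ▸ h.sep
  have hφE : ∀ p, φ p ∈ E := fun p => hEdef ▸ Subfield.subset_closure ⟨p, rfl⟩
  obtain ⟨s, b, hb⟩ : ∃ (s : Finset M) (b : Module.Basis s E M), ∀ i, φ.IsIntegralElem (b i) := by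
    letI : Algebra (MvPolynomial ι K) E := (φ.codRestrict E hφE).toAlgebra
    letI : Algebra (MvPolynomial ι K) M := φ.toAlgebra
    haveI : IsScalarTower (MvPolynomial ι K) E M := IsScalarTower.of_algebraMap_eq fun a => rfl
    haveI : IsFractionRing (MvPolynomial ι K) E := by
      subst hEdef
      exact isFractionRing_toClosure φ h.inj
    obtain ⟨s, b, hb⟩ := FiniteDimensional.exists_is_basis_integral (MvPolynomial ι K) E M
    exact ⟨s, b, hb⟩
  have hsm : ∀ (e : M) (he : e ∈ E) (u : M),
      (Algebra.trace E M (e * u) : M) = e * (Algebra.trace E M u : M) := by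
    intro e he u
    have : e * u = (⟨e, he⟩ : E) • u := rfl
    rw [this, map_smul]; rfl
  let T : M →ₗ[K] (s → M) :=
    { toFun := fun u i => (Algebra.trace E M (φ H ^ m * u * b i) : M)
      map_add' := fun u u' => by
        funext i
        simp only [mul_add, add_mul, map_add, Pi.add_apply]; push_cast; rfl
      map_smul' := fun k u => by
        funext i
        have : φ H ^ m * (k • u) * b i = algebraMap K M k * (φ H ^ m * u * b i) := by
          rw [Algebra.smul_def]; ring
        rw [this, hsm _ (by simpa [hφ] using hφE (C k)), Pi.smul_apply, RingHom.id_apply,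
          Algebra.smul_def] }
  have hHne : φ H ≠ 0 := fun h1 => hH (h.inj (by rw [h1, map_zero]))
  have hTinj : Function.Injective T := by
    rw [injective_iff_map_eq_zero]
    intro u hu
    by_contra hu0
    have h1 : ∀ y, Algebra.traceForm E M (φ H ^ m * u) y = 0 := by
      intro y
      have : Algebra.traceForm E M (φ H ^ m * u) = 0 := by
        apply b.ext
        intro i
        rw [Algebra.traceForm_apply]
        exact Subtype.ext (congrFun hu i)
      rw [this]; rfl
    have h2 := (traceForm_nondegenerate E M).1 _ h1
    exact (mul_ne_zero (pow_ne_zero _ hHne) hu0) h2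
  obtain ⟨N, hN⟩ : ∃ N : ℕ, ∀ i, ∀ v ∈ ValOver φ' (X i0),
      (z i0)⁻¹ ^ N * ((a v)⁻¹ * (φ H ^ m * b i)) ∈ v := by
    have key : ∀ i, ∃ N : ℕ, ∀ v ∈ ValOver φ' (X i0),
      (z i0)⁻¹ ^ N * ((a v)⁻¹ * (φ H ^ m * b i)) ∈ v := fun i =>
      (valOver_finite h' hXp).exists_pow_mul_mem (w := (z i0)⁻¹)
        (fun v hv => by rw [← hX]; exact hv.1 _)
        (fun v hv u => valOver_archimedean h' hXp hv
          (by rw [← hX]; exact (hv.2 _).2 dvd_rfl) u) _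
    choose N hN using key
    classical
    refine ⟨∑ i, N i, fun i v hv => ?_⟩
    rw [← Finset.add_sum_erase _ _ (Finset.mem_univ i), add_comm, pow_add, mul_assoc]
    refine mul_mem (pow_mem ?_ _) (hN i v hv)
    rw [← hX]; exact hv.1 _
  let B : Submodule K (s → M) :=
    Submodule.pi Set.univ fun _ => (restrictTotalDegree ι K N).map (aeval z).toLinearMap
  haveI hBfin : FiniteDimensional K B := by
    have hr : B = LinearMap.range (LinearMap.pi fun i : s =>
        ((aeval z).toLinearMap.domRestrict (restrictTotalDegree ι K N)) ∘ₗ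
          LinearMap.proj (R := K) (φ := fun _ : s => restrictTotalDegree ι K N) i) := by
      ext w
      simp only [B, Submodule.mem_pi, LinearMap.mem_range]
      constructor
      · intro hw
        choose p hp hpw using fun i => Submodule.mem_map.1 (hw i (Set.mem_univ i))
        exact ⟨fun i => ⟨p i, hp i⟩, funext fun i => hpw i⟩
      · rintro ⟨p, rfl⟩ i -
        exact Submodule.mem_map.2 ⟨(p i).1, (p i).2, rfl⟩
    rw [hr]
    infer_instance
  refine ⟨B.comap T, ?_, ?_⟩
  · exact Module.Finite.of_injective (T.restrict (p := B.comap T) (q := B) fun x hx => hx)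
      (fun x y hxy => Subtype.ext (hTinj (congrArg Subtype.val hxy)))
  · intro u hu hu'
    rw [Submodule.mem_comap, Submodule.mem_pi]
    intro i _
    have hc : ∃ c, φ c = (Algebra.trace E M (φ H ^ m * u * b i) : M) := by
      refine exists_eq_of_forall_prime h.inj (by rw [hEdef]; exact Subtype.prop _)
        fun ρ hρ => ?_
      refine exists_trace_mul_eq h hEdef hρ (fun v hv => ?_) (hb i)
      by_cases hd : ρ ∣ H
      · have h1 := mul_mem (hm v ⟨ρ, hρ, hd, hv⟩) ((hu ρ hρ v hv).2 hd)
        have h2 : φ H ^ m * u = φ H ^ m * (a v)⁻¹ * (a v * u) := by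
          field_simp [ha v]
        rwa [h2]
      · exact mul_mem (pow_mem (hv.1 H) _) ((hu ρ hρ v hv).1 hd)
    obtain ⟨c, hc⟩ := hc
    refine Submodule.mem_map.2 ⟨c, ?_, hc⟩
    rw [mem_restrictTotalDegree]
    obtain ⟨p, hp, r, hr⟩ := exists_trace_mul_eq (u := (z i0)⁻¹ ^ N * (φ H ^ m * u * b i)) (b := 1)
      h' hcl hXp
      (fun v hv => by
        have h1 := mul_mem (hN i v hv) (hu' v hv)
        have h2 : (z i0)⁻¹ ^ N * (φ H ^ m * u * b i) =
          (z i0)⁻¹ ^ N * ((a v)⁻¹ * (φ H ^ m * b i)) * (a v * u) := by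
          have := ha v
          rw [show (z i0)⁻¹ ^ N * ((a v)⁻¹ * (φ H ^ m * b i)) * (a v * u) =
            (z i0)⁻¹ ^ N * (φ H ^ m * u * b i) * ((a v)⁻¹ * a v) by ring, inv_mul_cancel₀ this,
            mul_one]
        rwa [h2]) (by simpa using RingHom.isIntegralElem_map φ' (x := 1))
    rw [mul_one, hsm _ (pow_mem (by rw [← hX, ← hcl]; exact Subfield.subset_closure ⟨_, rfl⟩) _),
      ← hc] at hr
    exact totalDegree_le_of_infChart h i0 hp hr

end

end

section
open Polynomial Pointwise

theorem derivative_mul_mem_adjoin {A K L : Type*} [CommRing A] [IsDomain A] [IsIntegrallyClosed A]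
    [Field K] [Field L] [Algebra A K] [IsFractionRing A K] [Algebra K L] [Algebra A L]
    [IsScalarTower A K L] {x : L} (hx : Algebra.adjoin K {x} = ⊤) {Q : A[X]} (hQm : Q.Monic)
    (hQ : aeval x Q = 0) {e : L} (he : IsIntegral A e) :
    aeval x (derivative Q) * e ∈ Algebra.adjoin A {x} := by
  have hAx : IsIntegral A x := ⟨Q, hQm, hQ⟩
  have hKx : IsIntegral K x := hAx.tower_top
  haveI : FaithfulSMul A L := by
    rw [faithfulSMul_iff_algebraMap_injective, IsScalarTower.algebraMap_eq A K L]
    exact (algebraMap K L).injective.comp (IsFractionRing.injective A K)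
  obtain ⟨H, rfl⟩ := minpoly.isIntegrallyClosed_dvd hAx hQ
  have hHx : aeval x H ∈ Algebra.adjoin A {x} := by
    rw [Algebra.adjoin_singleton_eq_range_aeval]; exact ⟨H, rfl⟩
  have hG : aeval x (derivative (minpoly A x)) = aeval x (derivative (minpoly K x)) := by
    rw [minpoly.isIntegrallyClosed_eq_field_fractions' K hAx, derivative_map,
      aeval_map_algebraMap]
  rw [derivative_mul, map_add, map_mul, map_mul, minpoly.aeval, zero_mul, add_zero,
    mul_right_comm]
  refine mul_mem ?_ hHx
  rw [hG]
  by_cases h0 : aeval x (derivative (minpoly K x)) = 0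
  · rw [h0, zero_mul]; exact zero_mem _
  have hsepx : IsSeparable K x := by
    rw [IsSeparable, Polynomial.separable_iff_derivative_ne_zero (minpoly.irreducible hKx)]
    intro h; rw [h, map_zero] at h0; exact h0 rfl
  haveI : FiniteDimensional K L := by
    have := hKx.fg_adjoin_singleton
    rw [hx] at this
    exact ⟨this⟩
  haveI : Algebra.IsSeparable K L := by
    have h1 : IntermediateField.adjoin K {x} = ⊤ := by
      rw [eq_top_iff]
      intro y _
      have : y ∈ Algebra.adjoin K {x} := hx ▸ Algebra.mem_top
      exact IntermediateField.algebra_adjoin_le_adjoin K _ this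
    have h2 := (IntermediateField.isSeparable_adjoin_simple_iff_isSeparable (F := K) (E := L)
      (x := x)).2 hsepx
    rw [h1] at h2
    exact Algebra.IsSeparable.of_algHom K (⊤ : IntermediateField K L)
      (IntermediateField.topEquiv (F := K) (E := L)).symm.toAlgHom
  have h3 := traceForm_dualSubmodule_adjoin A K hx hAx
  have h4 : e ∈ (Algebra.traceForm K L).dualSubmodule
      (Subalgebra.toSubmodule (Algebra.adjoin A {x})) := by
    rw [LinearMap.BilinForm.mem_dualSubmodule]
    intro y hy
    rw [Algebra.traceForm_apply, Submodule.mem_one]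
    have hy' : IsIntegral A y := by
      have : Algebra.adjoin A {x} ≤ integralClosure A L :=
        Algebra.adjoin_le (Set.singleton_subset_iff.2 hAx)
      exact this hy
    obtain ⟨c, hc⟩ := IsIntegrallyClosed.isIntegral_iff.1
      (Algebra.isIntegral_trace (L := K) (F := L) (he.mul hy'))
    exact ⟨c, hc⟩
  rw [h3, Submodule.mem_smul_pointwise_iff_exists] at h4
  obtain ⟨y, hy, rfl⟩ := h4
  rw [smul_eq_mul, mul_inv_cancel_left₀ h0]
  exact hy

end

section
open Polynomial

section
variable {K ι κ : Type*} [Field K] [Fintype ι] [DecidableEq ι] [Field κ] [Algebra K κ]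

/-- the Rees algebra of the degree filtration on the image of `K[X]` in `κ` -/
noncomputable def reesAlg (K : Type*) {ι κ : Type*} [Field K] [Field κ] [Algebra K κ] (x : ι → κ) :
    Subring κ[X] where
  carrier := {f | ∀ k, ∃ p : MvPolynomial ι K, p.totalDegree ≤ k ∧ MvPolynomial.aeval x p = f.coeff k}
  mul_mem' := by
    intro f g hf hg k
    choose p hp hpf using hf
    choose r hr hrg using hg
    refine ⟨∑ ij ∈ Finset.HasAntidiagonal.antidiagonal k, p ij.1 * r ij.2, ?_, ?_⟩
    · refine MvPolynomial.totalDegree_finsetSum_le fun ij hij => ?_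
      refine (MvPolynomial.totalDegree_mul _ _).trans ?_
      rw [← Finset.HasAntidiagonal.mem_antidiagonal.1 hij]
      exact add_le_add (hp _) (hr _)
    · rw [coeff_mul, map_sum]
      exact Finset.sum_congr rfl fun ij _ => by rw [map_mul, hpf, hrg]
  one_mem' := by
    intro k
    rw [coeff_one]
    split_ifs
    · exact ⟨1, by simp, by simp⟩
    · exact ⟨0, by simp, by simp⟩
  add_mem' := by
    intro f g hf hg k
    obtain ⟨p, hp, hpf⟩ := hf k
    obtain ⟨r, hr, hrg⟩ := hg k
    exact ⟨p + r, (MvPolynomial.totalDegree_add _ _).trans (max_le hp hr), by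
      rw [map_add, hpf, hrg, coeff_add]⟩
  zero_mem' := fun k => ⟨0, by simp, by simp⟩
  neg_mem' := by
    intro f hf k
    obtain ⟨p, hp, hpf⟩ := hf k
    exact ⟨-p, by rwa [MvPolynomial.totalDegree_neg], by rw [map_neg, hpf, coeff_neg]⟩

theorem monomial_mem_reesAlg {x : ι → κ} {p : MvPolynomial ι K} {k : ℕ} (hp : p.totalDegree ≤ k) :
    monomial k (MvPolynomial.aeval x p) ∈ reesAlg K x := by
  intro l
  rw [coeff_monomial]
  split_ifs with h
  · subst h; exact ⟨p, hp, rfl⟩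
  · exact ⟨0, by simp, by simp⟩

/-- the graded polynomial ring over which the Rees algebra is integral -/
noncomputable def reesBase (K : Type*) {ι κ : Type*} [Field K] [DecidableEq ι] [Field κ]
    [Algebra K κ] (x : ι → κ) (i0 : ι) : MvPolynomial ι K →ₐ[K] κ[X] :=
  MvPolynomial.aeval fun j => if j = i0 then X else C (x j) * X

theorem reesBase_monomial (x : ι → κ) (i0 : ι) (m : ι →₀ ℕ) (c : K) :
    reesBase K x i0 (MvPolynomial.monomial m c) =
      monomial m.degree (MvPolynomial.aeval x (MvPolynomial.monomial (m.erase i0) c)) := by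
  rw [reesBase, MvPolynomial.aeval_monomial, MvPolynomial.aeval_monomial,
    Finsupp.prod_fintype _ _ (by simp), Finsupp.prod_fintype _ _ (by simp), Finsupp.degree_eq_sum,
    ← C_mul_X_pow_eq_monomial]
  have h1 : ∀ j, (if j = i0 then (X : κ[X]) else C (x j) * X) ^ m j =
      C (x j ^ (m.erase i0) j) * X ^ m j := by
    intro j
    split_ifs with h
    · subst h; simp
    · rw [Finsupp.erase_ne h, mul_pow, C_pow]
  simp_rw [h1]
  rw [Finset.prod_mul_distrib, Finset.prod_pow_eq_pow_sum, ← map_prod, map_mul, mul_assoc]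
  rfl

theorem reesBase_mem (x : ι → κ) (i0 : ι) (p : MvPolynomial ι K) :
    reesBase K x i0 p ∈ reesAlg K x := by
  induction p using MvPolynomial.induction_on' with
  | monomial m c =>
    rw [reesBase_monomial]
    apply monomial_mem_reesAlg
    refine (MvPolynomial.totalDegree_monomial_le _ _).trans ?_
    exact Finsupp.degree_mono (Finsupp.le_def.2 fun i => by
      rw [Finsupp.erase_apply]; split_ifs <;> simp)
  | add p r hp hr => rw [map_add]; exact add_mem hp hr

theorem reesBase_injective {x : ι → κ} {q : MvPolynomial ι K}
    (hq : ∀ p : MvPolynomial ι K, MvPolynomial.aeval x p = 0 → q ∣ p) {i0 : ι} {D : ℕ} (hD : 0 < D)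
    (hc : q.coeff (Finsupp.single i0 D) ≠ 0) : Function.Injective (reesBase K x i0) := by
  rw [injective_iff_map_eq_zero]
  intro p hp
  ext m
  rw [MvPolynomial.coeff_zero]
  set k := m.degree with hk
  let P : MvPolynomial ι K := ∑ m' ∈ p.support.filter (fun m' => m'.degree = k),
    MvPolynomial.monomial (m'.erase i0) (p.coeff m')
  have hP : MvPolynomial.aeval x P = 0 := by
    have h1 : (reesBase K x i0 p).coeff k = MvPolynomial.aeval x P := by
      conv_lhs => rw [p.as_sum]
      rw [map_sum, finsetSum_coeff, map_sum, Finset.sum_filter]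
      refine Finset.sum_congr rfl fun m' _ => ?_
      rw [reesBase_monomial, coeff_monomial]
    rw [← h1, hp, coeff_zero]
  have hP0 : P = 0 := by
    by_contra h0
    obtain ⟨r, hr⟩ := hq P hP
    have hq0 : q ≠ 0 := by rintro rfl; simp at hc
    have hr0 : r ≠ 0 := by rintro rfl; rw [mul_zero] at hr; exact h0 hr
    have h1 := MvPolynomial.degreeOf_mul_eq (n := i0) hq0 hr0
    have h2 := MvPolynomial.monomial_le_degreeOf i0 (MvPolynomial.mem_support_iff.2 hc)
    rw [Finsupp.single_eq_same] at h2
    have h3 : P.degreeOf i0 = 0 := by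
      rw [← Nat.le_zero, MvPolynomial.degreeOf_le_iff]
      intro m' hm'
      obtain ⟨b, _, hb⟩ := Finset.mem_biUnion.1 (MvPolynomial.support_sum hm')
      have := MvPolynomial.support_monomial_subset hb
      rw [Finset.mem_singleton] at this
      rw [this]; simp
    rw [← hr, h3] at h1
    omega
  have hinj : ∀ m' : ι →₀ ℕ, m'.degree = k → m'.erase i0 = m.erase i0 → m' = m := by
    intro m' h1 h2
    have h3 : ∀ f : ι →₀ ℕ, f.degree = f i0 + (f.erase i0).degree := by
      intro f
      conv_lhs => rw [← Finsupp.single_add_erase i0 f]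
      rw [map_add, Finsupp.degree_single]
    have h4 := h3 m'
    have h5 := h3 m
    rw [h1, h2] at h4
    have h6 : m' i0 = m i0 := by omega
    rw [← Finsupp.single_add_erase i0 m', ← Finsupp.single_add_erase i0 m, h2, h6]
  have : MvPolynomial.coeff (m.erase i0) P = p.coeff m := by
    rw [MvPolynomial.coeff_sum]
    simp only [MvPolynomial.coeff_monomial]
    rw [Finset.sum_eq_single m]
    · simp
    · intro b hb hbm
      rw [if_neg]
      exact fun h => hbm (hinj b (Finset.mem_filter.1 hb).2 h)
    · intro h
      simp only [if_true]
      by_contra h0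
      exact h (Finset.mem_filter.2 ⟨MvPolynomial.mem_support_iff.2 h0, rfl⟩)
  rw [← this, hP0, MvPolynomial.coeff_zero]
end

end

section
open Polynomial

section
variable {K ι κ : Type*} [Field K] [Fintype ι] [DecidableEq ι] [Field κ] [Algebra K κ]

/-- a polynomial, made homogeneous of degree `D` and viewed as a polynomial in the variable `i0` -/
noncomputable def shearPoly (q : MvPolynomial ι K) (i0 : ι) (D : ℕ) : (MvPolynomial ι K)[X] :=
  ∑ m ∈ q.support, monomial (m i0) (MvPolynomial.monomial (m.update i0 (D - m.degree)) (q.coeff m))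

theorem degree_eq_add_erase (f : ι →₀ ℕ) (i0 : ι) : f.degree = f i0 + (f.erase i0).degree := by
  conv_lhs => rw [← Finsupp.single_add_erase i0 f]
  rw [map_add, Finsupp.degree_single]

theorem reesBase_shear_term (x : ι → κ) (i0 : ι) (m : ι →₀ ℕ) (c : K) {D : ℕ} (hm : m.degree ≤ D) :
    reesBase K x i0 (MvPolynomial.monomial (m.update i0 (D - m.degree)) c) =
      monomial (D - m i0) (MvPolynomial.aeval x (MvPolynomial.monomial (m.erase i0) c)) := by
  rw [reesBase_monomial]
  have h1 : (m.update i0 (D - m.degree)).erase i0 = m.erase i0 := by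
    ext j
    by_cases hj : j = i0
    · subst hj; simp
    · rw [Finsupp.erase_ne hj, Finsupp.erase_ne hj, Finsupp.update_apply, if_neg hj]
  have h2 := degree_eq_add_erase (m.update i0 (D - m.degree)) i0
  have h3 := degree_eq_add_erase m i0
  rw [h1, Finsupp.update_apply, if_pos rfl] at h2
  have h4 : D - m.degree + (m.erase i0).degree = D - m i0 := by omega
  rw [h1, h2, h4]

theorem aeval_monomial_erase (x : ι → κ) (i0 : ι) (m : ι →₀ ℕ) (c : K) :
    MvPolynomial.aeval x (MvPolynomial.monomial (m.erase i0) c) * x i0 ^ (m i0) =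
      MvPolynomial.aeval x (MvPolynomial.monomial m c) := by
  conv_rhs => rw [← Finsupp.single_add_erase i0 m]
  have h : MvPolynomial.monomial (Finsupp.single i0 (m i0) + m.erase i0) c =
      MvPolynomial.X i0 ^ m i0 * MvPolynomial.monomial (m.erase i0) c := by
    rw [MvPolynomial.X_pow_eq_monomial, MvPolynomial.monomial_mul, one_mul]
  rw [h, map_mul, map_pow, MvPolynomial.aeval_X, mul_comm]

theorem eval₂_shearPoly (x : ι → κ) (i0 : ι) {q : MvPolynomial ι K} {D : ℕ}
    (hD : q.totalDegree ≤ D) :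
    eval₂ (reesBase K x i0 : MvPolynomial ι K →+* κ[X]) (C (x i0) * X) (shearPoly q i0 D) =
      monomial D (MvPolynomial.aeval x q) := by
  conv_rhs => rw [q.as_sum]
  rw [shearPoly, eval₂_finsetSum, map_sum, map_sum]
  refine Finset.sum_congr rfl fun m hm => ?_
  have hmD : m.degree ≤ D := (MvPolynomial.le_totalDegree hm).trans hD
  have h3 := degree_eq_add_erase m i0
  rw [eval₂_monomial, AlgHom.coe_toRingHom, reesBase_shear_term _ _ _ _ hmD, mul_pow, ← C_pow,
    ← mul_assoc, monomial_mul_C, ← C_mul_X_pow_eq_monomial, mul_assoc, ← pow_add,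
    aeval_monomial_erase, C_mul_X_pow_eq_monomial, Nat.sub_add_cancel (by omega)]

theorem eval₂_derivative_shearPoly (x : ι → κ) (i0 : ι) {q : MvPolynomial ι K} {D : ℕ}
    (hD : q.totalDegree ≤ D) :
    eval₂ (reesBase K x i0 : MvPolynomial ι K →+* κ[X]) (C (x i0) * X)
      (derivative (shearPoly q i0 D)) =
      monomial (D - 1) (MvPolynomial.aeval x (MvPolynomial.pderiv i0 q)) := by
  conv_rhs => rw [q.as_sum]
  rw [shearPoly, derivative_sum, eval₂_finsetSum, map_sum, map_sum, map_sum]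
  refine Finset.sum_congr rfl fun m hm => ?_
  have hmD : m.degree ≤ D := (MvPolynomial.le_totalDegree hm).trans hD
  have h3 := degree_eq_add_erase m i0
  rw [derivative_monomial, eval₂_monomial, AlgHom.coe_toRingHom, map_mul,
    reesBase_shear_term _ _ _ _ hmD, MvPolynomial.pderiv_monomial]
  rcases Nat.eq_zero_or_pos (m i0) with h0 | h0
  · simp [h0]
  have h4 : (m - Finsupp.single i0 1 : ι →₀ ℕ) i0 = m i0 - 1 := by simp
  have h5 : (m - Finsupp.single i0 1 : ι →₀ ℕ).erase i0 = m.erase i0 := by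
    ext j
    by_cases hj : j = i0
    · subst hj; simp
    · rw [Finsupp.erase_ne hj, Finsupp.erase_ne hj]; simp [Finsupp.single_apply, Ne.symm hj]
  have h6 := aeval_monomial_erase x i0 (m - Finsupp.single i0 1) (q.coeff m * (m i0 : K))
  rw [h4, h5] at h6
  rw [← h6, mul_pow, ← C_pow, ← mul_assoc, mul_right_comm _ _ (C _), monomial_mul_C,
    ← C_mul_X_pow_eq_monomial, ← C_mul_X_pow_eq_monomial]
  have h7 : (MvPolynomial.aeval x) (MvPolynomial.monomial (m.erase i0) (q.coeff m * (m i0 : K))) =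
      MvPolynomial.aeval x (MvPolynomial.monomial (m.erase i0) (q.coeff m)) * (m i0 : κ) := by
    rw [mul_comm, ← MvPolynomial.C_mul_monomial, map_mul]; simp [mul_comm]
  rw [h7]
  have h8 : D - m i0 + (m i0 - 1) = D - 1 := by omega
  rw [← h8, pow_add]
  simp only [map_mul, map_pow, map_natCast]
  ring

theorem natDegree_shearPoly_le (q : MvPolynomial ι K) (i0 : ι) {D : ℕ} (hD : q.totalDegree ≤ D) :
    (shearPoly q i0 D).natDegree ≤ D := by
  refine natDegree_sum_le_of_forall_le _ _ fun m hm => (natDegree_monomial_le _).trans ?_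
  exact (Finsupp.le_degree i0 m).trans ((MvPolynomial.le_totalDegree hm).trans hD)

theorem coeff_shearPoly (q : MvPolynomial ι K) (i0 : ι) {D : ℕ} (hD : q.totalDegree ≤ D) :
    (shearPoly q i0 D).coeff D = MvPolynomial.C (q.coeff (Finsupp.single i0 D)) := by
  rw [shearPoly, finsetSum_coeff]
  simp only [coeff_monomial]
  have key : ∀ m ∈ q.support, m i0 = D → m = Finsupp.single i0 D := by
    intro m hm h
    have hmD : m.degree ≤ D := (MvPolynomial.le_totalDegree hm).trans hD
    have h3 := degree_eq_add_erase m i0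
    have h4 : (m.erase i0).degree = 0 := by omega
    rw [Finsupp.degree_eq_zero_iff] at h4
    rw [← Finsupp.single_add_erase i0 m, h4, h, add_zero]
  have h0 : (Finsupp.single i0 D).update i0 (D - (Finsupp.single i0 D).degree) = (0 : ι →₀ ℕ) := by
    ext j
    rw [Finsupp.update_apply]; split_ifs with h
    · simp
    · simp [Finsupp.single_apply, Ne.symm h]
  rw [Finset.sum_eq_single (Finsupp.single i0 D)]
  · rw [if_pos (by simp), h0]; rfl
  · intro m hm hne
    rw [if_neg fun h => hne (key m hm h)]
  · intro h
    rw [MvPolynomial.notMem_support_iff.1 h]; simp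

theorem exists_monic_shearPoly {q : MvPolynomial ι K} {i0 : ι} {D : ℕ} (hD : q.totalDegree ≤ D)
    (hc : q.coeff (Finsupp.single i0 D) ≠ 0) :
    (C (MvPolynomial.C (q.coeff (Finsupp.single i0 D))⁻¹) * shearPoly q i0 D).Monic := by
  apply monic_of_natDegree_le_of_coeff_eq_one D
  · exact (natDegree_C_mul_le _ _).trans (natDegree_shearPoly_le q i0 hD)
  · rw [coeff_C_mul, coeff_shearPoly q i0 hD, ← map_mul, inv_mul_cancel₀ hc, map_one]

end

end

section
open Polynomial

section
variable {K ι κ : Type*} [Field K] [Fintype ι] [DecidableEq ι] [Field κ] [Algebra K κ]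

theorem exists_eval₂_eq_of_mem_reesAlg {x : ι → κ} (i0 : ι) {f : κ[X]} (hf : f ∈ reesAlg K x) :
    ∃ P : (MvPolynomial ι K)[X],
      eval₂ (reesBase K x i0 : MvPolynomial ι K →+* κ[X]) (C (x i0) * X) P = f := by
  let T : Subring κ[X] :=
    (eval₂RingHom (reesBase K x i0 : MvPolynomial ι K →+* κ[X]) (C (x i0) * X)).range
  have hC : ∀ p, reesBase K x i0 p ∈ T := fun p => ⟨C p, by simp⟩
  have hK : ∀ c : K, C (algebraMap K κ c) ∈ T := fun c => by
    have := hC (MvPolynomial.C c)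
    rw [reesBase, MvPolynomial.aeval_C] at this
    exact this
  have hX : (X : κ[X]) ∈ T := by
    have := hC (MvPolynomial.X i0)
    rw [reesBase, MvPolynomial.aeval_X, if_pos rfl] at this
    exact this
  have hx : ∀ j, C (x j) * X ∈ T := by
    intro j
    by_cases hj : j = i0
    · subst hj; exact ⟨X, by simp⟩
    · have := hC (MvPolynomial.X j)
      rw [reesBase, MvPolynomial.aeval_X, if_neg hj] at this
      exact this
  suffices f ∈ T from this
  rw [f.as_sum_support]
  refine sum_mem fun k _ => ?_
  obtain ⟨p, hp, hpf⟩ := hf k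
  rw [← hpf, p.as_sum, map_sum, map_sum]
  refine sum_mem fun m hm => ?_
  have hmk : m.degree ≤ k := (MvPolynomial.le_totalDegree hm).trans hp
  have : monomial k (MvPolynomial.aeval x (MvPolynomial.monomial m (p.coeff m))) =
      C (algebraMap K κ (p.coeff m)) * (∏ j, (C (x j) * X) ^ m j) * X ^ (k - m.degree) := by
    rw [MvPolynomial.aeval_monomial, Finsupp.prod_fintype _ _ (by simp)]
    simp_rw [mul_pow]
    rw [Finset.prod_mul_distrib, Finset.prod_pow_eq_pow_sum, ← Finsupp.degree_eq_sum,
      ← C_mul_X_pow_eq_monomial, mul_assoc, mul_assoc, ← pow_add, Nat.add_sub_cancel' hmk]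
    simp only [map_mul, map_prod, map_pow, mul_assoc]
  rw [this]
  exact mul_mem (mul_mem (hK _) (prod_mem fun j _ => pow_mem (hx j) _)) (pow_mem hX _)

theorem eval₂_reesBase_mem (x : ι → κ) (i0 : ι) (P : (MvPolynomial ι K)[X]) :
    eval₂ (reesBase K x i0 : MvPolynomial ι K →+* κ[X]) (C (x i0) * X) P ∈ reesAlg K x := by
  rw [eval₂_eq_sum_range]
  refine sum_mem fun k _ => mul_mem (reesBase_mem x i0 _) (pow_mem ?_ _)
  have := monomial_mem_reesAlg (x := x) (p := (MvPolynomial.X i0 : MvPolynomial ι K)) (k := 1)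
    (by simp)
  rwa [MvPolynomial.aeval_X, ← C_mul_X_eq_monomial] at this

theorem exists_pderiv_mul_eq_of_isIntegral {x : ι → κ} {q : MvPolynomial ι K}
    (hq : ∀ p : MvPolynomial ι K, MvPolynomial.aeval x p = 0 ↔ q ∣ p)
    (hfrac : ∀ e : κ, ∃ p r : MvPolynomial ι K, MvPolynomial.aeval x r ≠ 0 ∧
      e * MvPolynomial.aeval x r = MvPolynomial.aeval x p) {i0 : ι} {D : ℕ} (hD : 0 < D)
    (hqD : q.totalDegree ≤ D) (hc : q.coeff (Finsupp.single i0 D) ≠ 0) {w : ℕ} {e : κ}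
    (he : IsIntegral (reesAlg K x) (monomial w e : κ[X])) :
    ∃ p : MvPolynomial ι K, p.totalDegree ≤ D - 1 + w ∧
      MvPolynomial.aeval x p = e * MvPolynomial.aeval x (MvPolynomial.pderiv i0 q) := by
  let A := MvPolynomial ι K
  let Λ := FractionRing κ[X]
  letI a1 : Algebra A κ[X] := (reesBase K x i0 : MvPolynomial ι K →+* κ[X]).toAlgebra
  have hmap : ∀ p : A, algebraMap A κ[X] p = reesBase K x i0 p := fun _ => rfl
  haveI : FaithfulSMul A Λ := by
    rw [faithfulSMul_iff_algebraMap_injective, IsScalarTower.algebraMap_eq A κ[X] Λ]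
    exact (IsFractionRing.injective κ[X] Λ).comp (reesBase_injective (fun p hp => (hq p).1 hp) hD hc)
  letI a3 : Algebra (FractionRing A) Λ := FractionRing.liftAlgebra A Λ
  haveI : IsScalarTower A (FractionRing A) Λ := FractionRing.isScalarTower_liftAlgebra A Λ
  set θ : κ[X] := C (x i0) * X with hθ
  set c := q.coeff (Finsupp.single i0 D) with hcdef
  set Q : A[X] := C (MvPolynomial.C c⁻¹) * shearPoly q i0 D with hQdef
  have hQm : Q.Monic := exists_monic_shearPoly hqD hc
  have hQθ : aeval θ Q = 0 := by
    have h1 := eval₂_shearPoly x i0 hqD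
    rw [(hq q).2 dvd_rfl, map_zero] at h1
    rw [hQdef, aeval_def, eval₂_mul]
    erw [h1, mul_zero]
  have hQ'θ : aeval θ (derivative Q) = C (algebraMap K κ c⁻¹) *
      monomial (D - 1) (MvPolynomial.aeval x (MvPolynomial.pderiv i0 q)) := by
    have h1 := eval₂_derivative_shearPoly x i0 hqD
    rw [hQdef, derivative_C_mul, aeval_def, eval₂_mul, eval₂_C, hmap, reesBase, MvPolynomial.aeval_C]
    erw [h1]
    rfl
  have hθint : IsIntegral A θ := ⟨Q, hQm, hQθ⟩
  -- integrality over the polynomial ring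
  have hrees : ∀ f ∈ reesAlg K x, IsIntegral A f := by
    intro f hf
    obtain ⟨P, rfl⟩ := exists_eval₂_eq_of_mem_reesAlg i0 hf
    have : aeval θ P ∈ integralClosure A κ[X] :=
      (Algebra.adjoin_le (Set.singleton_subset_iff.2 hθint))
        (Polynomial.aeval_mem_adjoin_singleton A θ)
    exact this
  have hint : IsIntegral A (monomial w e : κ[X]) := by
    let ψ : reesAlg K x →+* integralClosure A κ[X] :=
      { toFun := fun f => ⟨f.1, hrees f.1 f.2⟩
        map_one' := rfl
        map_mul' := fun _ _ => rfl
        map_zero' := rfl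
        map_add' := fun _ _ => rfl }
    obtain ⟨Q1, hQ1, hQ1e⟩ := he
    have : IsIntegral (integralClosure A κ[X]) (monomial w e : κ[X]) := by
      refine ⟨Q1.map ψ, hQ1.map _, ?_⟩
      rw [eval₂_map]
      exact hQ1e
    exact isIntegral_trans _ this
  -- the field generated
  have htop : Algebra.adjoin (FractionRing A) {algebraMap κ[X] Λ θ} = ⊤ := by
    have hθ' : IsIntegral (FractionRing A) (algebraMap κ[X] Λ θ) :=
      (hθint.map (IsScalarTower.toAlgHom A κ[X] Λ)).tower_top
    rw [eq_top_iff]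
    set E := IntermediateField.adjoin (FractionRing A) {algebraMap κ[X] Λ θ} with hE
    rw [← IntermediateField.adjoin_simple_toSubalgebra_of_isAlgebraic hθ'.isAlgebraic]
    intro u _
    change u ∈ E
    have hA : ∀ p : A, algebraMap κ[X] Λ (reesBase K x i0 p) ∈ E := by
      intro p
      have : algebraMap κ[X] Λ (reesBase K x i0 p) =
          algebraMap (FractionRing A) Λ (algebraMap A (FractionRing A) p) := by
        rw [← IsScalarTower.algebraMap_apply A (FractionRing A) Λ]; rfl
      rw [this]
      exact E.algebraMap_mem _
    have hX : algebraMap κ[X] Λ X ∈ E := by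
      have := hA (MvPolynomial.X i0)
      rwa [reesBase, MvPolynomial.aeval_X, if_pos rfl] at this
    have hX0 : algebraMap κ[X] Λ X ≠ 0 := by
      rw [Ne, FaithfulSMul.algebraMap_eq_zero_iff]; exact X_ne_zero
    have hx' : ∀ j, algebraMap κ[X] Λ (C (x j)) ∈ E := by
      intro j
      have h1 : algebraMap κ[X] Λ (C (x j) * X) ∈ E := by
        by_cases hj : j = i0
        · subst hj
          exact IntermediateField.mem_adjoin_simple_self _ _
        · have := hA (MvPolynomial.X j)
          rwa [reesBase, MvPolynomial.aeval_X, if_neg hj] at this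
      rw [map_mul] at h1
      have := div_mem h1 hX
      rwa [mul_div_cancel_right₀ _ hX0] at this
    have hp' : ∀ p : A, algebraMap κ[X] Λ (C (MvPolynomial.aeval x p)) ∈ E := by
      intro p
      induction p using MvPolynomial.induction_on with
      | C c =>
        rw [MvPolynomial.aeval_C]
        have := hA (MvPolynomial.C c)
        rwa [reesBase, MvPolynomial.aeval_C] at this
      | add p r hp hr => rw [map_add, map_add, map_add]; exact add_mem hp hr
      | mul_X p j hp =>
        rw [map_mul, map_mul, map_mul, MvPolynomial.aeval_X]; exact mul_mem hp (hx' j)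
    have hκ : ∀ e : κ, algebraMap κ[X] Λ (C e) ∈ E := by
      intro e
      obtain ⟨p, r, hr, hpr⟩ := hfrac e
      have h0 : algebraMap κ[X] Λ (C (MvPolynomial.aeval x r)) ≠ 0 := by
        rw [Ne, FaithfulSMul.algebraMap_eq_zero_iff, C_eq_zero]; exact hr
      have := div_mem (hp' p) (hp' r)
      rwa [← hpr, map_mul, map_mul, mul_div_cancel_right₀ _ h0] at this
    have hκX : ∀ f : κ[X], algebraMap κ[X] Λ f ∈ E := by
      intro f
      induction f using Polynomial.induction_on' with
      | add f g hf hg => rw [map_add]; exact add_mem hf hg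
      | monomial n a =>
        rw [← C_mul_X_pow_eq_monomial, map_mul, map_pow]
        exact mul_mem (hκ a) (pow_mem hX n)
    obtain ⟨f, g, -, rfl⟩ := IsFractionRing.div_surjective (A := κ[X]) u
    exact div_mem (hκX f) (hκX g)
  have key := derivative_mul_mem_adjoin (A := A) (K := FractionRing A) (L := Λ) htop hQm
    (by rw [aeval_algebraMap_apply, hQθ, map_zero])
    (hint.map (IsScalarTower.toAlgHom A κ[X] Λ))
  rw [Algebra.adjoin_singleton_eq_range_aeval] at key
  obtain ⟨P, hP⟩ := key
  have hP' : aeval θ P = aeval θ (derivative Q) * monomial w e := by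
    apply IsFractionRing.injective κ[X] Λ
    rw [map_mul, ← aeval_algebraMap_apply, ← aeval_algebraMap_apply]
    exact hP
  have hPm : aeval θ P ∈ reesAlg K x := eval₂_reesBase_mem x i0 P
  rw [hP', hQ'θ, mul_assoc, monomial_mul_monomial] at hPm
  obtain ⟨p, hp, hpe⟩ := hPm (D - 1 + w)
  rw [coeff_C_mul, coeff_monomial, if_pos rfl] at hpe
  refine ⟨MvPolynomial.C c * p, ?_, ?_⟩
  · refine (MvPolynomial.totalDegree_mul _ _).trans ?_
    simpa using hp
  · rw [map_mul, hpe, MvPolynomial.aeval_C, ← mul_assoc, ← map_mul, mul_inv_cancel₀ hc, map_one,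
      one_mul, mul_comm]
end

end

section
open MvPolynomial

section
variable {K ι κ : Type*} [Field K] [Fintype ι] [DecidableEq ι] [Field κ] [Algebra K κ]

theorem totalDegree_aeval_le {l : ι → MvPolynomial ι K} (hl : ∀ i, (l i).totalDegree ≤ 1)
    (p : MvPolynomial ι K) : (aeval l p).totalDegree ≤ p.totalDegree := by
  conv_lhs => rw [p.as_sum, map_sum]
  refine totalDegree_finsetSum_le fun m hm => ?_
  rw [aeval_monomial]
  refine (totalDegree_mul _ _).trans ?_
  rw [algebraMap_eq, totalDegree_C, zero_add]
  refine (totalDegree_finsetProd _ _).trans (le_trans ?_ (le_totalDegree hm))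
  refine Finset.sum_le_sum fun i _ => (totalDegree_pow _ _).trans ?_
  simpa using Nat.mul_le_mul_left (m i) (hl i)

theorem coeff_single_eq (i0 : ι) (D : ℕ) (p : MvPolynomial ι K) :
    p.coeff (Finsupp.single i0 D) =
      (aeval (fun j => if j = i0 then (Polynomial.X : Polynomial K) else 0) p).coeff D := by
  conv_rhs => rw [p.as_sum]
  rw [map_sum, Polynomial.finsetSum_coeff]
  have h : ∀ m ∈ p.support, (aeval (fun j => if j = i0 then (Polynomial.X : Polynomial K) else 0)
      (monomial m (p.coeff m))).coeff D = if m = Finsupp.single i0 D then p.coeff m else 0 := by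
    intro m _
    rw [aeval_monomial, Finsupp.prod_fintype _ _ (by simp), Polynomial.algebraMap_eq,
      Polynomial.coeff_C_mul]
    rw [← Finset.mul_prod_erase _ _ (Finset.mem_univ i0), if_pos rfl]
    split_ifs with hm
    · subst hm
      rw [Finset.prod_eq_one]
      · simp
      · intro j hj
        rw [Finsupp.single_eq_of_ne (Finset.ne_of_mem_erase hj), pow_zero]
    · by_cases h0 : ∃ j, j ≠ i0 ∧ m j ≠ 0
      · obtain ⟨j, hj, hmj⟩ := h0
        rw [Finset.prod_eq_zero (i := j) (Finset.mem_erase.2 ⟨hj, Finset.mem_univ _⟩)]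
        · simp
        · rw [if_neg hj, zero_pow hmj]
      · push Not at h0
        rw [Finset.prod_eq_one]
        · rw [mul_one, Polynomial.coeff_X_pow, if_neg, mul_zero]
          intro h
          apply hm
          ext j
          by_cases hj : j = i0
          · subst hj; simp [h]
          · rw [h0 j hj, Finsupp.single_eq_of_ne hj]
        · intro j hj
          rw [h0 j (Finset.ne_of_mem_erase hj), pow_zero]
  rw [Finset.sum_congr rfl h, Finset.sum_ite_eq']
  split_ifs with h
  · rfl
  · exact notMem_support_iff.1 h

theorem coeff_aeval_C_mul_X (v : ι → K) (D : ℕ) (p : MvPolynomial ι K) :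
    (aeval (fun j => Polynomial.C (v j) * Polynomial.X) p).coeff D =
      eval v (homogeneousComponent D p) := by
  conv_lhs => rw [p.as_sum]
  rw [map_sum, Polynomial.finsetSum_coeff, homogeneousComponent_apply, map_sum, Finset.sum_filter]
  refine Finset.sum_congr rfl fun m _ => ?_
  rw [aeval_monomial, Finsupp.prod_fintype _ _ (by simp), Polynomial.algebraMap_eq,
    Polynomial.coeff_C_mul]
  simp_rw [mul_pow]
  rw [Finset.prod_mul_distrib, Finset.prod_pow_eq_pow_sum, ← Finsupp.degree_eq_sum]
  simp_rw [← Polynomial.C_pow]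
  rw [← map_prod, Polynomial.coeff_C_mul, Polynomial.coeff_X_pow, eval_monomial,
    Finsupp.prod_fintype _ _ (by simp)]
  split_ifs with h1 h2 h2
  · simp
  · exact absurd h1.symm h2
  · exact absurd h2.symm h1
  · simp

/-- the linear substitution sending the `i0` direction to `v` -/
noncomputable def shearHom (v : ι → K) (i0 : ι) : MvPolynomial ι K →ₐ[K] MvPolynomial ι K :=
  aeval fun j => if j = i0 then C (v i0) * X i0 else X j + C (v j) * X i0

/-- the inverse of `shearHom` -/
noncomputable def shearInv (v : ι → K) (i0 : ι) : MvPolynomial ι K →ₐ[K] MvPolynomial ι K :=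
  aeval fun j => if j = i0 then C (v i0)⁻¹ * X i0 else X j - C (v j * (v i0)⁻¹) * X i0

theorem shearHom_shearInv {v : ι → K} {i0 : ι} (h : v i0 ≠ 0) (p : MvPolynomial ι K) :
    shearHom v i0 (shearInv v i0 p) = p := by
  suffices (shearHom v i0).comp (shearInv v i0) = AlgHom.id K _ from DFunLike.congr_fun this p
  refine algHom_ext fun j => ?_
  rw [AlgHom.comp_apply, shearInv, aeval_X]
  split_ifs with hj
  · subst hj
    rw [map_mul, shearHom, aeval_X, if_pos rfl, ← algebraMap_eq, AlgHom.commutes, algebraMap_eq,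
      ← mul_assoc, ← C_mul, inv_mul_cancel₀ h]
    simp
  · rw [map_sub, map_mul, shearHom, aeval_X, aeval_X, if_pos rfl, if_neg hj, ← algebraMap_eq,
      AlgHom.commutes, algebraMap_eq, ← mul_assoc, ← C_mul, inv_mul_cancel_right₀ h]
    simp

theorem shearInv_shearHom {v : ι → K} {i0 : ι} (h : v i0 ≠ 0) (p : MvPolynomial ι K) :
    shearInv v i0 (shearHom v i0 p) = p := by
  suffices (shearInv v i0).comp (shearHom v i0) = AlgHom.id K _ from DFunLike.congr_fun this p
  refine algHom_ext fun j => ?_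
  rw [AlgHom.comp_apply, shearHom, aeval_X]
  split_ifs with hj
  · subst hj
    rw [map_mul, shearInv, aeval_X, if_pos rfl, ← algebraMap_eq, AlgHom.commutes, algebraMap_eq,
      ← mul_assoc, ← C_mul, mul_inv_cancel₀ h]
    simp
  · rw [map_add, map_mul, shearInv, aeval_X, aeval_X, if_pos rfl, if_neg hj, ← algebraMap_eq,
      AlgHom.commutes, algebraMap_eq, ← mul_assoc, ← C_mul]
    simp

theorem totalDegree_shearHom_le (v : ι → K) (i0 : ι) (p : MvPolynomial ι K) :
    (shearHom v i0 p).totalDegree ≤ p.totalDegree := by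
  refine totalDegree_aeval_le (fun j => ?_) p
  have h : ∀ c : K, (C c * X i0 : MvPolynomial ι K).totalDegree ≤ 1 := fun c =>
    (totalDegree_mul _ _).trans (by simp)
  split_ifs
  · exact h _
  · exact (totalDegree_add _ _).trans (max_le (by simp) (h _))

theorem totalDegree_shearInv_le (v : ι → K) (i0 : ι) (p : MvPolynomial ι K) :
    (shearInv v i0 p).totalDegree ≤ p.totalDegree := by
  refine totalDegree_aeval_le (fun j => ?_) p
  have h : ∀ c : K, (C c * X i0 : MvPolynomial ι K).totalDegree ≤ 1 := fun c =>
    (totalDegree_mul _ _).trans (by simp)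
  split_ifs
  · exact h _
  · exact (totalDegree_sub _ _).trans (max_le (by simp) (h _))

theorem coeff_single_shearHom (v : ι → K) (i0 : ι) (D : ℕ) (p : MvPolynomial ι K) :
    (shearHom v i0 p).coeff (Finsupp.single i0 D) = eval v (homogeneousComponent D p) := by
  rw [coeff_single_eq, ← coeff_aeval_C_mul_X]
  congr 1
  suffices (aeval (fun j => if j = i0 then (Polynomial.X : Polynomial K) else 0)).comp
      (shearHom v i0) = aeval (fun j => Polynomial.C (v j) * Polynomial.X) from
    DFunLike.congr_fun this p
  refine algHom_ext fun j => ?_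
  rw [AlgHom.comp_apply, shearHom, aeval_X, aeval_X]
  split_ifs with hj
  · subst hj; simp
  · simp [hj]

theorem pderiv_shearHom (v : ι → K) (i0 : ι) (p : MvPolynomial ι K) :
    pderiv i0 (shearHom v i0 p) = ∑ j, C (v j) * shearHom v i0 (pderiv j p) := by
  induction p using MvPolynomial.induction_on with
  | C c => rw [← algebraMap_eq, AlgHom.commutes, algebraMap_eq]; simp
  | add p r hp hr =>
    simp only [map_add, hp, hr, mul_add, Finset.sum_add_distrib]
  | mul_X p k hp =>
    rw [map_mul, pderiv_mul, hp]
    simp_rw [pderiv_mul, map_add, map_mul, mul_add, Finset.sum_add_distrib]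
    have h1 : pderiv i0 (shearHom v i0 (X k)) = C (v k) := by
      rw [shearHom, aeval_X]
      split_ifs with hk
      · subst hk; simp
      · rw [map_add, pderiv_C_mul, pderiv_X_self, pderiv_X_of_ne hk]; simp
    rw [h1, Finset.sum_mul]
    congr 1
    · exact Finset.sum_congr rfl fun j _ => by ring
    · rw [Finset.sum_eq_single k]
      · rw [pderiv_X_self, map_one]; ring
      · intro j _ hj
        rw [pderiv_X_of_ne hj.symm]; simp
      · simp

/-- the generators of the sheared presentation -/
noncomputable def shearGen (v : ι → K) (i0 : ι) (x : ι → κ) : ι → κ :=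
  fun j => aeval x (shearInv v i0 (X j))

theorem aeval_shearGen (v : ι → K) (i0 : ι) (x : ι → κ) (p : MvPolynomial ι K) :
    aeval (shearGen v i0 x) p = aeval x (shearInv v i0 p) := by
  suffices aeval (shearGen v i0 x) = (aeval x).comp (shearInv v i0) from
    DFunLike.congr_fun this p
  exact algHom_ext fun j => by rw [aeval_X]; rfl

theorem reesAlg_shearGen {v : ι → K} {i0 : ι} (h : v i0 ≠ 0) (x : ι → κ) :
    reesAlg K x ≤ reesAlg K (shearGen v i0 x) := by
  intro f hf k
  obtain ⟨p, hp, hpf⟩ := hf k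
  exact ⟨shearHom v i0 p, (totalDegree_shearHom_le v i0 p).trans hp, by
    rw [aeval_shearGen, shearInv_shearHom h, hpf]⟩

theorem exists_sum_pderiv_mul_eq_of_isIntegral {x : ι → κ} {q : MvPolynomial ι K}
    (hq : ∀ p : MvPolynomial ι K, aeval x p = 0 ↔ q ∣ p)
    (hfrac : ∀ e : κ, ∃ p r : MvPolynomial ι K, aeval x r ≠ 0 ∧ e * aeval x r = aeval x p)
    {D : ℕ} (hD : 0 < D) (hqD : q.totalDegree ≤ D) {v : ι → K}
    (hv : eval v (homogeneousComponent D q) ≠ 0) {w : ℕ} {e : κ}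
    (he : IsIntegral (reesAlg K x) (Polynomial.monomial w e)) :
    ∃ p : MvPolynomial ι K, p.totalDegree ≤ D - 1 + w ∧
      aeval x p = e * ∑ j, algebraMap K κ (v j) * aeval x (pderiv j q) := by
  obtain ⟨i0, h0⟩ : ∃ i0, v i0 ≠ 0 := by
    by_contra! h
    apply hv
    have : v = 0 := funext h
    rw [this, ← coeff_aeval_C_mul_X]
    have h2 : (fun j : ι => Polynomial.C ((0 : ι → K) j) * Polynomial.X) = 0 := by
      ext; simp
    rw [h2, aeval_zero, Polynomial.algebraMap_eq, Polynomial.coeff_C, if_neg hD.ne']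
  have hint : IsIntegral (reesAlg K (shearGen v i0 x)) (Polynomial.monomial w e) := by
    obtain ⟨Q, hQ, hQe⟩ := he
    refine ⟨Q.map (Subring.inclusion (reesAlg_shearGen h0 x)), hQ.map _, ?_⟩
    rw [Polynomial.eval₂_map]; exact hQe
  have h1 : ∀ p : MvPolynomial ι K, aeval (shearGen v i0 x) p = 0 ↔ shearHom v i0 q ∣ p := by
    intro p
    rw [aeval_shearGen, hq]
    constructor
    · intro h
      have := map_dvd (shearHom v i0) h
      rwa [shearHom_shearInv h0] at this
    · intro h
      have := map_dvd (shearInv v i0) h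
      rwa [shearInv_shearHom h0] at this
  have h2 : ∀ e : κ, ∃ p r : MvPolynomial ι K, aeval (shearGen v i0 x) r ≠ 0 ∧
      e * aeval (shearGen v i0 x) r = aeval (shearGen v i0 x) p := by
    intro e
    obtain ⟨p, r, hr, hpr⟩ := hfrac e
    refine ⟨shearHom v i0 p, shearHom v i0 r, ?_, ?_⟩
    · rwa [aeval_shearGen, shearInv_shearHom h0]
    · rwa [aeval_shearGen, shearInv_shearHom h0, aeval_shearGen, shearInv_shearHom h0]
  obtain ⟨p, hp, hpe⟩ := exists_pderiv_mul_eq_of_isIntegral h1 h2 hD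
    ((totalDegree_shearHom_le v i0 q).trans hqD) (by rwa [coeff_single_shearHom]) hint
  refine ⟨shearInv v i0 p, (totalDegree_shearInv_le v i0 p).trans hp, ?_⟩
  rw [← aeval_shearGen, hpe, aeval_shearGen, pderiv_shearHom, map_sum, map_sum]
  congr 1
  refine Finset.sum_congr rfl fun j _ => ?_
  rw [map_mul, map_mul, shearInv_shearHom h0, ← algebraMap_eq, AlgHom.commutes, AlgHom.commutes]

theorem exists_pderiv_mul_eq [Infinite K] {x : ι → κ} {q : MvPolynomial ι K}
    (hq : ∀ p : MvPolynomial ι K, aeval x p = 0 ↔ q ∣ p)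
    (hfrac : ∀ e : κ, ∃ p r : MvPolynomial ι K, aeval x r ≠ 0 ∧ e * aeval x r = aeval x p)
    (hD : 0 < q.totalDegree) {w : ℕ} {e : κ}
    (he : IsIntegral (reesAlg K x) (Polynomial.monomial w e)) (j : ι) :
    ∃ p : MvPolynomial ι K, p.totalDegree ≤ q.totalDegree - 1 + w ∧
      aeval x p = e * aeval x (pderiv j q) := by
  set D := q.totalDegree with hDdef
  have hH : homogeneousComponent D q ≠ 0 := by
    intro h
    have hq0 : q ≠ 0 := by rintro rfl; simp at hDdef; omega
    obtain ⟨m, hm, hmD⟩ := Finset.exists_mem_eq_sup q.support (by simpa using hq0)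
      (fun m => m.sum fun _ e => e)
    have h1 : coeff m (homogeneousComponent D q) = coeff m q := by
      rw [coeff_homogeneousComponent, if_pos]
      exact hmD.symm
    rw [h, coeff_zero] at h1
    exact (mem_support_iff.1 hm) h1.symm
  obtain ⟨v, hv⟩ : ∃ v, eval v (homogeneousComponent D q) ≠ 0 := by
    by_contra! h
    exact hH (funext fun v => by rw [h v, map_zero])
  obtain ⟨t, ht0, ht⟩ : ∃ t : K, t ≠ 0 ∧
      eval (v + t • Pi.single j 1) (homogeneousComponent D q) ≠ 0 := by
    let f : Polynomial K := aeval (fun i => Polynomial.C (v i) +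
      Polynomial.X * Polynomial.C ((Pi.single j 1 : ι → K) i)) (homogeneousComponent D q)
    have hf : ∀ t, f.eval t = eval (v + t • Pi.single j 1) (homogeneousComponent D q) := by
      intro t
      have : (Polynomial.aeval t).comp (aeval (fun i => Polynomial.C (v i) +
        Polynomial.X * Polynomial.C ((Pi.single j 1 : ι → K) i))) =
        aeval (v + t • Pi.single j 1) := algHom_ext fun i => by simp; ring
      exact DFunLike.congr_fun this (homogeneousComponent D q)
    have hf0 : f ≠ 0 := by
      intro h
      have := hf 0
      rw [h, Polynomial.eval_zero, zero_smul, add_zero] at this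
      exact hv this.symm
    obtain ⟨t, ht⟩ := (Polynomial.X * f).exists_eval_ne_zero_of_natDegree_lt_card
      (mul_ne_zero Polynomial.X_ne_zero hf0)
      ((Cardinal.natCast_lt_aleph0).trans_le (Cardinal.aleph0_le_mk K))
    rw [Polynomial.eval_mul, Polynomial.eval_X, hf] at ht
    exact ⟨t, left_ne_zero_of_mul ht, right_ne_zero_of_mul ht⟩
  obtain ⟨p1, hp1, he1⟩ := exists_sum_pderiv_mul_eq_of_isIntegral hq hfrac hD le_rfl hv he
  obtain ⟨p2, hp2, he2⟩ := exists_sum_pderiv_mul_eq_of_isIntegral hq hfrac hD le_rfl ht he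
  refine ⟨C t⁻¹ * (p2 - p1), ?_, ?_⟩
  · refine (totalDegree_mul _ _).trans ?_
    rw [totalDegree_C, zero_add]
    exact (totalDegree_sub _ _).trans (max_le hp2 hp1)
  · rw [map_mul, map_sub, he1, he2, ← mul_sub, ← Finset.sum_sub_distrib, ← algebraMap_eq,
      AlgHom.commutes, Finset.sum_eq_single j]
    · have : algebraMap K κ t ≠ 0 := by simpa using ht0
      simp only [Pi.add_apply, Pi.smul_apply, Pi.single_eq_same, smul_eq_mul, mul_one, map_add,
        map_inv₀]
      field_simp
      ring
    · intro i _ hi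
      simp [hi]
    · simp
end

end

section
open Polynomial

section
variable {K ι κ : Type*} [Field K] [Fintype ι] [DecidableEq ι] [Field κ] [Algebra K κ]

theorem isIntegral_monomial_mono {x : ι → κ} {w w' : ℕ} (h : w ≤ w') {e : κ}
    (he : IsIntegral (reesAlg K x) (monomial w e)) :
    IsIntegral (reesAlg K x) (monomial w' e) := by
  have h1 : monomial w' e = monomial (w' - w) 1 * monomial w e := by
    rw [monomial_mul_monomial, one_mul, Nat.sub_add_cancel h]
  have h2 : (monomial (w' - w) 1 : κ[X]) ∈ reesAlg K x := by
    have := monomial_mem_reesAlg (x := x) (p := (1 : MvPolynomial ι K)) (k := w' - w) (by simp)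
    rwa [map_one] at this
  rw [h1]
  exact (isIntegral_algebraMap (R := reesAlg K x) (A := κ[X]) (x := ⟨_, h2⟩)).mul he

theorem isIntegral_monomial_coeff_of_dvd {x : ι → κ} {F A : κ[X]} (hF : F.Monic) (hA : A.Monic)
    (hAF : A ∣ F) {c : ℕ} (hFc : ∀ i, ∃ p : MvPolynomial ι K,
      p.totalDegree ≤ c * (F.natDegree - i) ∧ MvPolynomial.aeval x p = F.coeff i) (i : ℕ) :
    IsIntegral (reesAlg K x) (monomial (c * F.natDegree) (A.coeff i)) := by
  have hCinj : Function.Injective (C : κ →+* κ[X]) := C_injective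
  have hdeg : ∀ G : κ[X], (G.map C).natDegree = G.natDegree :=
    fun G => natDegree_map_eq_of_injective hCinj G
  have hcoeff : ∀ (G : κ[X]) i, ((G.map C).scaleRoots (X ^ c)).coeff i =
      monomial (c * (G.natDegree - i)) (G.coeff i) := by
    intro G i
    rw [coeff_scaleRoots, coeff_map, hdeg, ← pow_mul, C_mul_X_pow_eq_monomial]
  set F1 := (F.map C).scaleRoots (X ^ c) with hF1
  have hF1m : F1.Monic := (monic_scaleRoots_iff _).2 (hF.map _)
  have hlift : F1 ∈ lifts (algebraMap (reesAlg K x) κ[X]) := by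
    rw [lifts_iff_coeff_lifts]
    intro i
    rw [hF1, hcoeff]
    obtain ⟨p, hp, hpe⟩ := hFc i
    rw [← hpe]
    exact ⟨⟨_, monomial_mem_reesAlg hp⟩, rfl⟩
  obtain ⟨F2, hF2, -, hF2m⟩ := lifts_and_natDegree_eq_and_monic hlift hF1m
  have h := isIntegral_coeff_of_dvd F2 ((A.map C).scaleRoots (X ^ c)) hF2m
    ((monic_scaleRoots_iff _).2 (hA.map _)) (by
      rw [hF2, hF1]; exact scaleRoots_dvd _ _ (Polynomial.map_dvd _ hAF)) i
  rw [hcoeff] at h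
  refine isIntegral_monomial_mono (Nat.mul_le_mul_left c ?_) h
  exact (Nat.sub_le _ _).trans (natDegree_le_of_dvd hAF hF.ne_zero)

theorem isIntegral_monomial_coeff_mul {x : ι → κ} {w w' : ℕ} {F G : κ[X]}
    (hF : ∀ i, IsIntegral (reesAlg K x) (monomial w (F.coeff i)))
    (hG : ∀ i, IsIntegral (reesAlg K x) (monomial w' (G.coeff i))) (i : ℕ) :
    IsIntegral (reesAlg K x) (monomial (w + w') ((F * G).coeff i)) := by
  rw [coeff_mul, map_sum]
  refine IsIntegral.sum _ fun ij _ => ?_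
  rw [← monomial_mul_monomial]
  exact (hF _).mul (hG _)

theorem isIntegral_monomial_coeff_derivative {x : ι → κ} {w : ℕ} {F : κ[X]}
    (hF : ∀ i, IsIntegral (reesAlg K x) (monomial w (F.coeff i))) (i : ℕ) :
    IsIntegral (reesAlg K x) (monomial w ((derivative F).coeff i)) := by
  rw [coeff_derivative]
  have h1 : monomial w (F.coeff (i + 1) * ((i : κ) + 1)) =
      monomial w (F.coeff (i + 1)) * algebraMap (reesAlg K x) κ[X] ((i + 1 : ℕ) : reesAlg K x) := by
    rw [← C_mul_X_pow_eq_monomial, ← C_mul_X_pow_eq_monomial]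
    simp only [map_mul, map_add, map_natCast, map_one, Nat.cast_add, Nat.cast_one]
    ring
  rw [h1]
  exact (hF _).mul (isIntegral_algebraMap (R := reesAlg K x) (A := κ[X]))

/-- a prime of `A[Y]` containing a monic polynomial is determined by a monic irreducible polynomial
over the residue field of its contraction -/
theorem exists_irreducible_mem_iff {A κ : Type*} [CommRing A] [Field κ] [Algebra A κ]
    (hfrac : ∀ e : κ, ∃ p r : A, algebraMap A κ r ≠ 0 ∧ e * algebraMap A κ r = algebraMap A κ p)
    {P : Ideal A[X]} (hP : P.IsPrime) (hPc : P.comap C = RingHom.ker (algebraMap A κ))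
    {F : A[X]} (hF : F.Monic) (hFP : F ∈ P) :
    ∃ m : κ[X], m.Monic ∧ Irreducible m ∧ ∀ G : A[X], G ∈ P ↔ m ∣ G.map (algebraMap A κ) := by
  -- `κ` is the fraction field of the image of `A`
  let κ' := FractionRing (A[X] ⧸ P)
  let ψ : A →+* κ' := (algebraMap (A[X] ⧸ P) κ').comp ((Ideal.Quotient.mk P).comp C)
  have hψ : RingHom.ker ψ = RingHom.ker (algebraMap A κ) := by
    rw [← hPc]
    ext a
    rw [RingHom.mem_ker, Ideal.mem_comap, ← Ideal.Quotient.eq_zero_iff_mem]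
    exact FaithfulSMul.algebraMap_eq_zero_iff (A[X] ⧸ P) κ'
  let B := (algebraMap A κ).range
  haveI : IsFractionRing B κ := by
    refine (isLocalization_iff _ _).2 ⟨?_, ?_, ?_⟩
    · intro y
      exact isUnit_iff_ne_zero.2 fun h => nonZeroDivisors.ne_zero y.2 (Subtype.ext h)
    · intro e
      obtain ⟨p, r, hr, h⟩ := hfrac e
      refine ⟨⟨⟨_, p, rfl⟩, ⟨⟨_, r, rfl⟩, ?_⟩⟩, h⟩
      exact mem_nonZeroDivisors_of_ne_zero fun h => hr (congrArg Subtype.val h)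
    · intro a b h
      exact ⟨1, by rw [show a = b from Subtype.ext h]⟩
  let ψB : B →+* κ' := (algebraMap A κ).rangeRestrict.liftOfSurjective
    (RingHom.rangeRestrict_surjective _) ⟨ψ, by rw [hψ]; exact fun a ha => Subtype.ext_iff.1 ha⟩
  have hψB : ∀ a, ψB ((algebraMap A κ).rangeRestrict a) = ψ a := fun a => 
    RingHom.liftOfRightInverse_comp_apply _ _ _ _ _
  have hψBi : Function.Injective ψB := by
    rw [injective_iff_map_eq_zero]
    rintro ⟨_, a, rfl⟩ h
    have : ψ a = 0 := by rw [← hψB]; exact h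
    rw [← RingHom.mem_ker, hψ] at this
    exact Subtype.ext this
  let χ : κ →+* κ' := IsFractionRing.lift (A := B) hψBi
  have hχ : χ.comp (algebraMap A κ) = ψ := by
    ext a
    have := IsFractionRing.lift_algebraMap (A := B) (K := κ) hψBi ((algebraMap A κ).rangeRestrict a)
    rw [hψB] at this
    exact this
  letI : Algebra κ κ' := χ.toAlgebra
  let y0 : κ' := algebraMap (A[X] ⧸ P) κ' (Ideal.Quotient.mk P X)
  have key : ∀ G : A[X], aeval y0 (G.map (algebraMap A κ)) =
      algebraMap (A[X] ⧸ P) κ' (Ideal.Quotient.mk P G) := by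
    intro G
    rw [aeval_def, eval₂_map]
    change eval₂ (χ.comp (algebraMap A κ)) y0 G = _
    rw [hχ]
    have : eval₂RingHom ψ y0 = (algebraMap (A[X] ⧸ P) κ').comp (Ideal.Quotient.mk P) := by
      refine Polynomial.ringHom_ext (fun a => ?_) ?_
      · simp; rfl
      · simp; rfl
    exact DFunLike.congr_fun this G
  have hy0 : IsIntegral κ y0 := by
    refine ⟨F.map (algebraMap A κ), hF.map _, ?_⟩
    have := key F
    rwa [Ideal.Quotient.eq_zero_iff_mem.2 hFP, map_zero] at this
  refine ⟨minpoly κ y0, minpoly.monic hy0, minpoly.irreducible hy0, fun G => ?_⟩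
  rw [minpoly.dvd_iff, key, FaithfulSMul.algebraMap_eq_zero_iff, Ideal.Quotient.eq_zero_iff_mem]
end

end

section
open Polynomial

section
variable {K ι : Type*} [Field K] [Infinite K] [Fintype ι] [DecidableEq ι]

/-- LemB -/
theorem exists_derivative_mul_mem {F : (MvPolynomial ι K)[X]} (hF : F.Monic) {c : ℕ}
    (hFc : ∀ i, (F.coeff i).totalDegree ≤ c * (F.natDegree - i))
    {q : MvPolynomial ι K} (hq : Prime q) {P : Ideal (MvPolynomial ι K)[X]} (hP : P.IsPrime)
    (hFP : F ∈ P) (hPq : P.comap C = Ideal.span {q}) (j : ι) :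
    ∃ N : (MvPolynomial ι K)[X], N.natDegree ≤ F.natDegree ∧
      (∀ i, (N.coeff i).totalDegree ≤ q.totalDegree + 2 * c * F.natDegree) ∧
      N - derivative F * C (MvPolynomial.pderiv j q) ∈ P ∧
      ∀ P' : Ideal (MvPolynomial ι K)[X], P'.IsPrime → F ∈ P' → P'.comap C = Ideal.span {q} →
        P' ≠ P → N ∈ P' := by
  let A := MvPolynomial ι K
  haveI : (Ideal.span {q}).IsPrime := (Ideal.span_singleton_prime hq.ne_zero).2 hq
  let κ := FractionRing (A ⧸ Ideal.span {q})
  let x : ι → κ := fun j => algebraMap A κ (MvPolynomial.X j)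
  have hx : ∀ p : A, MvPolynomial.aeval x p = algebraMap A κ p := by
    intro p
    have : MvPolynomial.aeval x = IsScalarTower.toAlgHom K A κ :=
      MvPolynomial.algHom_ext fun j => by simp only [x, MvPolynomial.aeval_X]; rfl
    rw [this]; rfl
  have hker : ∀ p : A, algebraMap A κ p = 0 ↔ q ∣ p := by
    intro p
    rw [← Ideal.mem_span_singleton, ← Ideal.Quotient.eq_zero_iff_mem]
    exact FaithfulSMul.algebraMap_eq_zero_iff (A ⧸ Ideal.span {q}) κ
  have hfrac : ∀ e : κ, ∃ p r : A, algebraMap A κ r ≠ 0 ∧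
      e * algebraMap A κ r = algebraMap A κ p := by
    intro e
    obtain ⟨p, r, hr, rfl⟩ := IsFractionRing.div_surjective (A := A ⧸ Ideal.span {q}) e
    obtain ⟨p, rfl⟩ := Ideal.Quotient.mk_surjective p
    obtain ⟨r, rfl⟩ := Ideal.Quotient.mk_surjective r
    have h : algebraMap (A ⧸ Ideal.span {q}) κ (Ideal.Quotient.mk _ r) ≠ 0 := by
      rw [Ne, FaithfulSMul.algebraMap_eq_zero_iff]; exact nonZeroDivisors.ne_zero hr
    exact ⟨p, r, h, div_mul_cancel₀ _ h⟩
  have hqK : Ideal.span {q} = RingHom.ker (algebraMap A κ) := by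
    ext p
    rw [Ideal.mem_span_singleton, RingHom.mem_ker, hker]
  obtain ⟨m, hmm, hmi, hm⟩ := exists_irreducible_mem_iff hfrac hP (hPq.trans hqK) hF hFP
  obtain ⟨B, hB⟩ := (hm F).1 hFP
  set Fκ := F.map (algebraMap A κ) with hFκ
  have hFκm : Fκ.Monic := hF.map _
  have hdeg : Fκ.natDegree = F.natDegree := hF.natDegree_map _
  have hBm : B.Monic := hmm.of_mul_monic_left (hB ▸ hFκm)
  have hcoef : ∀ i, ∃ p : A, p.totalDegree ≤ c * (Fκ.natDegree - i) ∧
      MvPolynomial.aeval x p = Fκ.coeff i := fun i =>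
    ⟨F.coeff i, by rw [hdeg]; exact hFc i, by rw [hx, hFκ, coeff_map]⟩
  have hint : ∀ i, IsIntegral (reesAlg K x)
      (monomial (2 * c * F.natDegree) ((derivative m * B).coeff i)) := by
    intro i
    have := isIntegral_monomial_coeff_mul (isIntegral_monomial_coeff_derivative
      (isIntegral_monomial_coeff_of_dvd hFκm hmm ⟨B, hB⟩ hcoef))
      (isIntegral_monomial_coeff_of_dvd hFκm hBm ⟨m, by rw [hB, mul_comm]⟩ hcoef) i
    rwa [hdeg, ← two_mul, ← mul_assoc] at this
  have hD : 0 < q.totalDegree := by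
    rw [Nat.pos_iff_ne_zero]
    intro h
    rw [MvPolynomial.totalDegree_eq_zero_iff_eq_C] at h
    apply hq.not_isUnit
    rw [h]
    refine (IsUnit.mk0 _ fun h0 => hq.ne_zero ?_).map MvPolynomial.C
    rw [h, h0, map_zero]
  have hE := fun i => exists_pderiv_mul_eq (x := x) (q := q) (fun p => by rw [hx, hker])
    (fun e => by
      obtain ⟨p, r, h1, h2⟩ := hfrac e
      exact ⟨p, r, by rwa [hx], by rwa [hx, hx]⟩) hD (hint i) j
  choose p hp hpe using hE
  have hNdeg : (derivative m * B).natDegree ≤ F.natDegree := by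
    rw [← hdeg, hB, hmm.natDegree_mul hBm]
    exact natDegree_mul_le.trans (add_le_add_left
      ((natDegree_derivative_le _).trans (Nat.sub_le _ _)) _)
  refine ⟨∑ i ∈ Finset.range (F.natDegree + 1), monomial i (p i), ?_, ?_, ?_, ?_⟩
  · refine natDegree_sum_le_of_forall_le _ _ fun i hi => (natDegree_monomial_le _).trans ?_
    exact Nat.lt_succ_iff.1 (Finset.mem_range.1 hi)
  · intro i
    rw [finsetSum_coeff]
    refine MvPolynomial.totalDegree_finsetSum_le fun k _ => ?_
    rw [coeff_monomial]
    split_ifs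
    · exact (hp k).trans (by omega)
    · simp
  all_goals
    have hN : (∑ i ∈ Finset.range (F.natDegree + 1), monomial i (p i)).map (algebraMap A κ) =
        derivative m * B * C (algebraMap A κ (MvPolynomial.pderiv j q)) := by
      ext i
      rw [coeff_map, finsetSum_coeff, coeff_mul_C]
      simp only [coeff_monomial]
      rw [Finset.sum_ite_eq']
      split_ifs with h
      · rw [← hx, ← hx, hpe]
      · rw [coeff_eq_zero_of_natDegree_lt (p := derivative m * B), map_zero, zero_mul]
        rw [Finset.mem_range] at h
        omega
  · rw [hm, Polynomial.map_sub, hN, Polynomial.map_mul, map_C, ← sub_mul, ← derivative_map, ← hFκ,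
      hB, derivative_mul, sub_add_cancel_left]
    exact ⟨-(derivative B * C (algebraMap A κ (MvPolynomial.pderiv j q))), by ring⟩
  · intro P' hP' hFP' hPq' hne
    obtain ⟨m', hmm', hmi', hm'⟩ := exists_irreducible_mem_iff hfrac hP' (hPq'.trans hqK) hF hFP'
    rw [hm', hN]
    have h1 : m' ∣ m * B := hB ▸ (hm' F).1 hFP'
    rcases hmi'.prime.dvd_or_dvd h1 with h | h
    · exfalso
      apply hne
      have : m' = m := eq_of_monic_of_associated hmm' hmm
        (hmi'.associated_of_dvd hmi h)
      ext G
      rw [hm', hm, this]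
    · exact (h.mul_left _).mul_right _
end

end

section
open Polynomial

section
variable {A M : Type*} [CommRing A] [Field M] {φ : A →+* M}

theorem FinSepOver.isAlgebraic [IsDomain A] (h : FinSepOver φ) (u : M) :
    letI := φ.toAlgebra
    IsAlgebraic A u := by
  let E := Subfield.closure (Set.range φ)
  letI : Algebra A E := (toClosure φ).toAlgebra
  letI : Algebra A M := φ.toAlgebra
  haveI : IsScalarTower A E M := IsScalarTower.of_algebraMap_eq fun a => rfl
  haveI := h.fin
  haveI hfr : IsFractionRing A E := isFractionRing_toClosure φ h.inj
  exact (IsFractionRing.isAlgebraic_iff A E M).2 (Algebra.IsAlgebraic.isAlgebraic u)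

theorem FinSepOver.exists_isIntegralElem [IsDomain A] (h : FinSepOver φ) (u : M) :
    ∃ b : A, b ≠ 0 ∧ φ.IsIntegralElem (φ b * u) := by
  letI : Algebra A M := φ.toAlgebra
  obtain ⟨b, hb, hu⟩ := (h.isAlgebraic u).exists_integral_multiple
  refine ⟨b, hb, ?_⟩
  rw [Algebra.smul_def] at hu
  exact hu

theorem mem_of_valOver_of_isIntegralElem {ρ b : A} (hb : ¬ ρ ∣ b) {u : M}
    (hu : φ.IsIntegralElem (φ b * u)) {v : ValuationSubring M} (hv : v ∈ ValOver φ ρ) : u ∈ v := by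
  letI : Algebra A M := φ.toAlgebra
  have h1 : φ b * u ∈ v := v.mem_of_isIntegral (A := A) hv.1 hu
  have h2 : φ b ∉ v.nonunits := fun h => hb ((hv.2 b).1 h)
  have h0 : φ b ≠ 0 := fun h => h2 (v.mem_nonunits_iff_or.2 (Or.inl h))
  have := v.mul_mem _ _ (v.inv_mem_of_not_nonunit h2) h1
  rwa [inv_mul_cancel_left₀ h0] at this

theorem FinSepOver.exists_forall_mem [IsDomain A] (h : FinSepOver φ) {U : Set M} (hU : U.Finite) :
    ∃ b : A, b ≠ 0 ∧ ∀ ρ, ¬ ρ ∣ b → ∀ v ∈ ValOver φ ρ, ∀ u ∈ U, u ∈ v := by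
  choose b hb hbu using h.exists_isIntegralElem
  refine ⟨∏ u ∈ hU.toFinset, b u, Finset.prod_ne_zero_iff.2 fun u _ => hb u, ?_⟩
  intro ρ hρ v hv u hu
  refine mem_of_valOver_of_isIntegralElem (b := b u) (fun hd => hρ ?_) (hbu u) hv
  exact hd.trans (Finset.dvd_prod_of_mem b (hU.mem_toFinset.2 hu))

theorem FinSepOver.exists_primitive [IsDomain A] [IsIntegrallyClosed A] (h : FinSepOver φ) :
    ∃ (w : M) (G : A[X]), G.Monic ∧ (∀ p : A[X], p.eval₂ φ w = 0 ↔ G ∣ p) ∧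
      (derivative G).eval₂ φ w ≠ 0 ∧
      ∀ u : M, ∃ b : A, b ≠ 0 ∧ ∃ p : A[X], φ b * u = p.eval₂ φ w := by
  let E := Subfield.closure (Set.range φ)
  letI : Algebra A E := (toClosure φ).toAlgebra
  letI : Algebra A M := φ.toAlgebra
  haveI : IsScalarTower A E M := IsScalarTower.of_algebraMap_eq fun a => rfl
  haveI : FiniteDimensional E M := h.fin
  haveI : Algebra.IsSeparable E M := h.sep
  haveI hfr : IsFractionRing A E := isFractionRing_toClosure φ h.inj
  obtain ⟨w0, hw0⟩ := Field.exists_primitive_element E M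
  obtain ⟨b, hb, hbw⟩ := h.exists_isIntegralElem w0
  let w := φ b * w0
  have hw : IsIntegral A w := hbw
  have hφb : φ b ≠ 0 := (map_ne_zero_iff φ h.inj).2 hb
  have htop : IntermediateField.adjoin E {w} = ⊤ := by
    rw [eq_top_iff, ← hw0, IntermediateField.adjoin_simple_le_iff]
    have h1 : w ∈ IntermediateField.adjoin E {w} := IntermediateField.mem_adjoin_simple_self E w
    have h2 : algebraMap E M (algebraMap A E b) ∈ IntermediateField.adjoin E {w} :=
      IntermediateField.algebraMap_mem _ _
    have h3 : algebraMap E M (algebraMap A E b) = φ b := rfl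
    rw [h3] at h2
    have := mul_mem (inv_mem h2) h1
    rwa [inv_mul_cancel_left₀ hφb] at this
  have hfs : FaithfulSMul A M := (faithfulSMul_iff_algebraMap_injective A M).2 h.inj
  haveI : Module.IsTorsionFree A M := inferInstance
  have hmin : minpoly E w = (minpoly A w).map (algebraMap A E) :=
    minpoly.isIntegrallyClosed_eq_field_fractions' E hw
  refine ⟨w, minpoly A w, minpoly.monic hw, ?_, ?_, ?_⟩
  · intro p
    exact minpoly.isIntegrallyClosed_dvd_iff hw p
  · have hs : (minpoly E w).Separable := Algebra.IsSeparable.isSeparable E w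
    have := hs.aeval_derivative_ne_zero (minpoly.aeval E w)
    rw [hmin, derivative_map, aeval_map_algebraMap] at this
    exact this
  · intro u
    have hu : u ∈ Algebra.adjoin E {w} := by
      have := IntermediateField.adjoin_simple_toSubalgebra_of_isAlgebraic
        (F := E) (α := w) (Algebra.IsAlgebraic.isAlgebraic w)
      rw [← this, htop]; trivial
    obtain ⟨p, rfl⟩ := Algebra.adjoin_singleton_eq_range_aeval E w ▸ hu
    obtain ⟨c, hc, hcp⟩ := IsLocalization.integerNormalization_spec (nonZeroDivisors A) p
    refine ⟨c, nonZeroDivisors.ne_zero hc,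
      IsLocalization.integerNormalization (nonZeroDivisors A) p, ?_⟩
    have h1 := congrArg (aeval w) hcp
    rw [aeval_map_algebraMap, ← IsScalarTower.algebraMap_smul E c p, map_smul, IsScalarTower.algebraMap_smul,
      Algebra.smul_def] at h1
    exact h1.symm

/-- At a simple root the maximal ideal is generated by `ρ` after localisation. -/
theorem exists_mul_mem_of_monic {A : Type*} [CommRing A] [IsDomain A] {ρ : A} (hρ : Prime ρ) {P : Ideal A[X]}
    (hP : P.IsPrime) (hPρ : P.comap C = Ideal.span {ρ}) {G : A[X]} (hG : G.Monic) (hGP : G ∈ P)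
    (hG' : derivative G ∉ P) :
    ∃ c ∉ P, ∀ a ∈ P, ∃ s t : A[X], c * a = C ρ * s + G * t := by
  haveI hI : (Ideal.span {ρ}).IsPrime := (Ideal.span_singleton_prime hρ.ne_zero).2 hρ
  let D := A ⧸ Ideal.span {ρ}
  let κ := FractionRing D
  have hker : RingHom.ker (algebraMap A κ) = Ideal.span {ρ} := by
    ext a
    rw [RingHom.mem_ker, IsScalarTower.algebraMap_apply A D κ,
      FaithfulSMul.algebraMap_eq_zero_iff D κ]
    exact Ideal.Quotient.eq_zero_iff_mem
  have hfrac : ∀ e : κ, ∃ p r : A, algebraMap A κ r ≠ 0 ∧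
      e * algebraMap A κ r = algebraMap A κ p := by
    intro e
    obtain ⟨a, b, hb, rfl⟩ := IsFractionRing.div_surjective (A := D) e
    obtain ⟨p, rfl⟩ := Ideal.Quotient.mk_surjective a
    obtain ⟨r, rfl⟩ := Ideal.Quotient.mk_surjective b
    have hr : algebraMap D κ (Ideal.Quotient.mk _ r) ≠ 0 :=
      IsFractionRing.to_map_ne_zero_of_mem_nonZeroDivisors hb
    refine ⟨p, r, hr, ?_⟩
    rw [IsScalarTower.algebraMap_apply A D κ r, IsScalarTower.algebraMap_apply A D κ p]
    exact div_mul_cancel₀ _ hr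
  obtain ⟨m, hm, hmi, hmem⟩ := exists_irreducible_mem_iff hfrac hP (hPρ.trans hker.symm) hG hGP
  obtain ⟨B, hB⟩ := (hmem G).1 hGP
  have hmB : ¬ m ∣ B := by
    intro h
    apply hG'
    rw [hmem, ← derivative_map, hB, derivative_mul]
    exact dvd_add (h.mul_left _) (dvd_mul_right _ _)
  -- lift `B`
  have hlift : ∃ (r : A) (c : A[X]), algebraMap A κ r ≠ 0 ∧
      c.map (algebraMap A κ) = C (algebraMap A κ r) * B := by
    obtain ⟨b, hb⟩ := IsLocalization.integerNormalization_spec (nonZeroDivisors D) B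
    obtain ⟨r, rfl⟩ := Ideal.Quotient.mk_surjective b
    obtain ⟨c, hc⟩ := Polynomial.map_surjective (Ideal.Quotient.mk (Ideal.span {ρ}))
      Ideal.Quotient.mk_surjective (IsLocalization.integerNormalization (nonZeroDivisors D) B)
    refine ⟨r, c, IsFractionRing.to_map_ne_zero_of_mem_nonZeroDivisors (R := D) (K := κ) hb.1, ?_⟩
    rw [IsScalarTower.algebraMap_eq A D κ, ← Polynomial.map_map]
    change Polynomial.map _ (c.map (Ideal.Quotient.mk _)) = _
    rw [hc, hb.2, ← IsScalarTower.algebraMap_smul κ, smul_eq_C_mul]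
    rfl
  obtain ⟨r, c, hr, hc⟩ := hlift
  refine ⟨c, ?_, ?_⟩
  · rw [hmem, hc]
    rwa [IsUnit.dvd_mul_left (isUnit_C.2 (isUnit_iff_ne_zero.2 hr))]
  · intro a ha
    rw [hmem] at ha
    have h1 : G.map (algebraMap A κ) ∣ (c * a).map (algebraMap A κ) := by
      rw [Polynomial.map_mul, hc, hB, mul_assoc, mul_comm m B]
      exact (mul_dvd_mul_left B ha).mul_left _
    have h2 : ((c * a) %ₘ G).map (algebraMap A κ) = 0 := by
      rw [map_modByMonic _ hG]
      exact (modByMonic_eq_zero_iff_dvd (hG.map _)).2 h1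
    have h3 : C ρ ∣ (c * a) %ₘ G := by
      rw [C_dvd_iff_dvd_coeff]
      intro i
      rw [← Ideal.mem_span_singleton, ← hker, RingHom.mem_ker, ← coeff_map, h2, coeff_zero]
    obtain ⟨s, hs⟩ := h3
    exact ⟨s, (c * a) /ₘ G, by rw [← hs, modByMonic_add_div]⟩

theorem exists_eval₂_mul_eq_of_mem [IsDomain A] (hφ : Function.Injective φ) {ρ : A} (hρ : Prime ρ)
    {w : M} {G : A[X]} (hG : G.Monic) (hGw : G.eval₂ φ w = 0)
    (hgen : ∀ u : M, ∃ b : A, b ≠ 0 ∧ ∃ p : A[X], φ b * u = p.eval₂ φ w)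
    [IsNoetherianRing A]
    {v : ValuationSubring M} (hv : v ∈ ValOver φ ρ) (hw : w ∈ v)
    (hG' : (derivative G).eval₂ φ w ∉ v.nonunits) {u : M} (hu : u ∈ v) :
    ∃ c a : A[X], c.eval₂ φ w ∉ v.nonunits ∧ c.eval₂ φ w * u = a.eval₂ φ w := by
  let E : A[X] →+* M := eval₂RingHom φ w
  have hE : ∀ p, E p ∈ v := by
    intro p
    change p.eval₂ φ w ∈ v
    rw [eval₂_eq_sum_range]
    exact sum_mem fun i _ => mul_mem (hv.1 _) (pow_mem hw _)
  let P := v.centre E hE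
  have hPmem : ∀ p, p ∈ P ↔ E p ∈ v.nonunits := v.mem_centre E hE
  have hPρ : P.comap C = Ideal.span {ρ} := by
    ext a
    rw [Ideal.mem_comap, hPmem, Ideal.mem_span_singleton, ← hv.2]
    simp [E]
  have h0 : (0 : M) ∈ v.nonunits := v.mem_nonunits_iff_or.2 (Or.inl rfl)
  obtain ⟨c, hc, hcP⟩ := exists_mul_mem_of_monic hρ (v.centre_isPrime E hE) hPρ hG
    ((hPmem G).2 (by change G.eval₂ φ w ∈ _; rw [hGw]; exact h0)) (fun h => hG' ((hPmem _).1 h))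
  have hρ0 : φ ρ ≠ 0 := (map_ne_zero_iff φ hφ).2 hρ.ne_zero
  obtain ⟨b, hb, p, hbp⟩ := hgen u
  obtain ⟨b', hbb', hb'⟩ :=
    (FiniteMultiplicity.of_not_isUnit hρ.not_isUnit hb).exists_eq_pow_mul_and_not_dvd
  generalize multiplicity ρ b = n at hbb'
  have key : ∀ (k : ℕ) (d : A[X]) (a : A[X]), d ∉ P → φ ρ ^ k * E d * u = E a →
      ∃ c a : A[X], c ∉ P ∧ E c * u = E a := by
    intro k
    induction k with
    | zero => intro d a hd h; exact ⟨d, a, hd, by simpa using h⟩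
    | succ k ih =>
      intro d a hd h
      have haP : a ∈ P := by
        rw [hPmem, ← h, mul_assoc, mul_comm]
        refine v.nonunits_mul_left (mul_mem (hE _) hu) ?_
        rw [pow_succ]
        refine v.nonunits_mul_left (pow_mem (hv.1 _) _) ((hv.2 _).2 dvd_rfl)
      obtain ⟨s, t, hst⟩ := hcP a haP
      refine ih (c * d) s (fun h => ?_) ?_
      · exact ((v.centre_isPrime E hE).mem_or_mem h).elim hc hd
      · have h1 := congrArg E hst
        have hEG : E G = 0 := hGw
        have hEC : E (C ρ) = φ ρ := by simp [E]
        rw [map_mul, map_add, map_mul, map_mul, hEG, zero_mul, add_zero, ← h, hEC] at h1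
        apply mul_left_cancel₀ hρ0
        rw [← h1, map_mul]
        ring
  have hbP : C b' ∉ P := fun h => by
    have : b' ∈ P.comap C := h
    rw [hPρ, Ideal.mem_span_singleton] at this
    exact hb' this
  obtain ⟨c', a', h1, h2⟩ := key n (C b') p hbP
    (by change _ = p.eval₂ φ w; rw [← hbp, hbb', map_mul, map_pow]; simp [E])
  exact ⟨c', a', fun h => h1 ((hPmem _).2 h), h2⟩
end

end

section
open MvPolynomial

section
variable {K M ι : Type*} [Field K] [Field M] [Algebra K M] 

theorem FinSepOver.formallyEtale {A : Type*} [CommRing A] [IsDomain A] [Algebra A M]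
    (h : FinSepOver (algebraMap A M)) : Algebra.FormallyEtale A M := by
  let E := Subfield.closure (Set.range (algebraMap A M))
  letI : Algebra A E := (toClosure (algebraMap A M)).toAlgebra
  haveI : IsScalarTower A E M := IsScalarTower.of_algebraMap_eq fun a => rfl
  haveI : FiniteDimensional E M := h.fin
  haveI : Algebra.IsSeparable E M := h.sep
  haveI hfr : IsFractionRing A E := isFractionRing_toClosure (algebraMap A M) h.inj
  haveI := Algebra.FormallyEtale.of_isLocalization (Rₘ := E) (nonZeroDivisors A)
  haveI : Algebra.FormallyEtale E M := Algebra.FormallyEtale.of_isSeparable E M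
  exact Algebra.FormallyEtale.comp A E M

theorem FinSepOver.exists_basis {z : ι → M} (h : FinSepOver (evalAt K z)) :
    ∃ b : Module.Basis ι M (Ω[M⁄K]), ∀ i, b i = KaehlerDifferential.D K M (z i) := by
  classical
  let A := MvPolynomial ι K
  letI : Algebra A M := (evalAt K z).toAlgebra
  haveI : IsScalarTower K A M := IsScalarTower.of_algebraMap_eq fun a => by
    change _ = evalAt K z (C a); simp
  haveI : Algebra.FormallyEtale A M := FinSepOver.formallyEtale h
  let e := KaehlerDifferential.tensorKaehlerEquivOfFormallyEtale K A M
  refine ⟨((KaehlerDifferential.mvPolynomialBasis K ι).baseChange M).map e, fun i => ?_⟩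
  rw [Module.Basis.map_apply, Module.Basis.baseChange_apply, KaehlerDifferential.mvPolynomialBasis_apply]
  rw [← KaehlerDifferential.tensorKaehlerEquivOfFormallyEtale_symm_D_algebraMap,
    LinearEquiv.apply_symm_apply]
  congr 1
  change evalAt K z (X i) = _
  simp

/-- The partial derivative with respect to the `k`-th member of a separating transcendence basis. -/
noncomputable def FinSepOver.pd {z : ι → M} (h : FinSepOver (evalAt K z)) (k : ι) :
    Derivation K M M :=
  (h.exists_basis.choose.coord k).compDer (KaehlerDifferential.D K M)

theorem FinSepOver.pd_self [DecidableEq ι] {z : ι → M} (h : FinSepOver (evalAt K z)) (k i : ι) :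
    h.pd k (z i) = if i = k then 1 else 0 := by
  have h1 : h.pd k (z i) =
      h.exists_basis.choose.repr (KaehlerDifferential.D K M (z i)) k := rfl
  rw [h1, ← h.exists_basis.choose_spec i, Module.Basis.repr_self, Finsupp.single_apply]

theorem FinSepOver.derivation_apply [Fintype ι] {z : ι → M} (h : FinSepOver (evalAt K z)) {N : Type*}
    [AddCommGroup N] [Module M N] [Module K N] [IsScalarTower K M N] (D : Derivation K M N) (u : M) :
    D u = ∑ k, h.pd k u • D (z k) := by
  have h1 : D.liftKaehlerDifferential (KaehlerDifferential.D K M u) = D u :=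
    D.liftKaehlerDifferential_comp_D u
  rw [← h1, ← h.exists_basis.choose.sum_repr (KaehlerDifferential.D K M u), map_sum]
  refine Finset.sum_congr rfl fun k _ => ?_
  rw [map_smul, h.exists_basis.choose_spec, D.liftKaehlerDifferential_comp_D]
  rfl

theorem FinSepOver.pd_evalAt {z : ι → M} (h : FinSepOver (evalAt K z)) (k : ι)
    (p : MvPolynomial ι K) : h.pd k (evalAt K z p) = evalAt K z (pderiv k p) := by
  classical
  induction p using MvPolynomial.induction_on with
  | C a => simp
  | add p q hp hq => simp only [map_add, hp, hq]
  | mul_X p i hp =>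
    rw [map_mul, Derivation.leibniz, hp, Derivation.leibniz, map_add]
    simp only [smul_eq_mul, map_mul, pderiv_X]
    have : evalAt K z (X i) = z i := by simp
    rw [this, h.pd_self, Pi.single_apply]
    split_ifs <;> simp

end

end

section
open MvPolynomial

section
variable {K M ι : Type*} [Field K] [Field M] [Algebra K M] 

theorem Derivation.eval₂_mem {A : Type*} [CommRing A] (φ : A →+* M) (D : Derivation K M M)
    {v : ValuationSubring M} (hφ : ∀ a, φ a ∈ v) (hD : ∀ a, D (φ a) ∈ v) {w : M} (hw : w ∈ v)
    (hDw : D w ∈ v) (p : Polynomial A) : p.eval₂ φ w ∈ v ∧ D (p.eval₂ φ w) ∈ v := by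
  induction p using Polynomial.induction_on' with
  | add p q hp hq =>
    rw [Polynomial.eval₂_add, map_add]
    exact ⟨v.add_mem _ _ hp.1 hq.1, v.add_mem _ _ hp.2 hq.2⟩
  | monomial n a =>
    rw [Polynomial.eval₂_monomial, Derivation.leibniz, Derivation.leibniz_pow]
    simp only [smul_eq_mul]
    have hpow := fun n => v.toSubring.pow_mem hw n
    refine ⟨v.mul_mem _ _ (hφ a) (hpow n), v.add_mem _ _ (v.mul_mem _ _ (hφ a) ?_)
      (v.mul_mem _ _ (hpow n) (hD a))⟩
    exact v.toSubring.nsmul_mem (v.mul_mem _ _ (hpow _) hDw) n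

theorem FinSepOver.exists_pd_mem [Finite ι] {z : ι → M} (h : FinSepOver (evalAt K z)) :
    ∃ b : MvPolynomial ι K, b ≠ 0 ∧ ∀ ρ, Prime ρ → ¬ ρ ∣ b → ∀ v ∈ ValOver (evalAt K z) ρ,
      ∀ k, ∀ u ∈ v, h.pd k u ∈ v := by
  classical
  haveI := Fintype.ofFinite ι
  obtain ⟨w, G, hG, hGw, hG', hgen⟩ := h.exists_primitive
  obtain ⟨b, hb, hU⟩ := h.exists_forall_mem
    (U := {w, ((Polynomial.derivative G).eval₂ (evalAt K z) w)⁻¹} ∪ Set.range (fun k => h.pd k w))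
    ((Set.toFinite _).union (Set.finite_range _))
  refine ⟨b, hb, fun ρ hρ hρb v hv k u hu => ?_⟩
  have hU' := hU ρ hρb v hv
  have hw : w ∈ v := hU' w (by simp)
  have hDw : h.pd k w ∈ v := hU' _ (Or.inr ⟨k, rfl⟩)
  have hGn : (Polynomial.derivative G).eval₂ (evalAt K z) w ∉ v.nonunits := by
    rw [ValuationSubring.mem_nonunits_iff_or]
    push Not
    exact ⟨hG', hU' _ (by simp)⟩
  obtain ⟨c, a, hc, hca⟩ := exists_eval₂_mul_eq_of_mem h.inj hρ hG ((hGw G).2 dvd_rfl) hgen hv hw hGn hu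
  have hφ : ∀ a, evalAt K z a ∈ v := hv.1
  have hD : ∀ a, h.pd k (evalAt K z a) ∈ v := fun a => by rw [h.pd_evalAt]; exact hφ _
  have h1 := (Derivation.eval₂_mem (evalAt K z) (h.pd k) hφ hD hw hDw a)
  have h2 := (Derivation.eval₂_mem (evalAt K z) (h.pd k) hφ hD hw hDw c)
  set cw := c.eval₂ (evalAt K z) w
  set aw := a.eval₂ (evalAt K z) w
  have hc0 : cw ≠ 0 := fun h0 => hc (v.mem_nonunits_iff_or.2 (Or.inl h0))
  have h3 : cw * h.pd k u = h.pd k aw - u * h.pd k cw := by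
    rw [← hca, Derivation.leibniz]; simp
  have h4 : h.pd k u = cw⁻¹ * (h.pd k aw - u * h.pd k cw) := by
    rw [← h3, inv_mul_cancel_left₀ hc0]
  rw [h4]
  exact v.mul_mem _ _ (v.inv_mem_of_not_nonunit hc) (v.toSubring.sub_mem h1.2 (v.mul_mem _ _ hu h2.2))

end

end

section
open MvPolynomial

section
variable (K : Type*) {M : Type*} [Field K] [Field M] [Algebra K M]

/-- The residue of an element of `M` at the valuation ring `v`, with value `0` outside `v`. -/
noncomputable def ValuationSubring.res (v : ValuationSubring M) (u : M) :
    IsLocalRing.ResidueField v :=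
  open Classical in if h : u ∈ v then IsLocalRing.residue v ⟨u, h⟩ else 0

section res
variable {K} {v : ValuationSubring M} {u w : M}

theorem ValuationSubring.res_of_mem (h : u ∈ v) : v.res u = IsLocalRing.residue v ⟨u, h⟩ := by
  simp [ValuationSubring.res, h]

theorem ValuationSubring.res_add (hu : u ∈ v) (hw : w ∈ v) : v.res (u + w) = v.res u + v.res w := by
  rw [res_of_mem hu, res_of_mem hw, res_of_mem (v.add_mem _ _ hu hw), ← map_add]; rfl

theorem ValuationSubring.res_mul (hu : u ∈ v) (hw : w ∈ v) : v.res (u * w) = v.res u * v.res w := by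
  rw [res_of_mem hu, res_of_mem hw, res_of_mem (v.mul_mem _ _ hu hw), ← map_mul]; rfl

theorem ValuationSubring.res_eq_zero_iff (hu : u ∈ v) : v.res u = 0 ↔ u ∈ v.nonunits := by
  rw [res_of_mem hu, IsLocalRing.residue_eq_zero_iff]
  exact ValuationSubring.coe_mem_nonunits_iff.symm

end res

/-- The scalars in `K` lie in `v`. -/
def ValuationSubring.Constants (v : ValuationSubring M) : Prop := ∀ c : K, algebraMap K M c ∈ v

variable {K}

/-- The algebra structure over the constants. -/
@[reducible]
def ValuationSubring.Constants.algebra {v : ValuationSubring M} (hv : v.Constants K) : Algebra K v :=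
  ((algebraMap K M).codRestrict v.toSubring hv).toAlgebra

/-- The transcendence degree of the algebra generated by the residues of `U`. -/
noncomputable def ValuationSubring.Constants.resRank {v : ValuationSubring M}
    (hv : v.Constants K) (U : Set M) : ℕ∞ :=
  letI := hv.algebra
  (AlgebraicIndependent.matroid K (IsLocalRing.ResidueField v)).eRk (v.res '' U)

/-- The residues of the family `t` are algebraically independent. -/
def ResIndep (K : Type*) {M : Type*} [Field K] [Field M] [Algebra K M]
    (v : ValuationSubring M) {ι : Type*} (t : ι → M) : Prop :=
  (∀ i, t i ∈ v) ∧ ∀ p, evalAt K t p ∈ v.nonunits → p = 0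

namespace ValuationSubring.Constants
variable {v : ValuationSubring M} (hv : v.Constants K)

theorem evalAt_mem (hv : v.Constants K) {ι : Type*} {t : ι → M} (ht : ∀ i, t i ∈ v) (p : MvPolynomial ι K) :
    evalAt K t p ∈ v := by
  induction p using MvPolynomial.induction_on with
  | C a => simpa using hv a
  | add p q hp hq => rw [map_add]; exact v.add_mem _ _ hp hq
  | mul_X p i hp => rw [map_mul]; exact v.mul_mem _ _ hp (by simpa using ht i)

theorem res_algebraMap (c : K) : letI := hv.algebra
    v.res (algebraMap K M c) = algebraMap K (IsLocalRing.ResidueField v) c := by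
  letI := hv.algebra
  rw [res_of_mem (hv c)]; rfl

theorem res_evalAt {ι : Type*} {t : ι → M} (ht : ∀ i, t i ∈ v) (p : MvPolynomial ι K) :
    letI := hv.algebra
    v.res (evalAt K t p) = aeval (fun i => v.res (t i)) p := by
  letI := hv.algebra
  induction p using MvPolynomial.induction_on with
  | C a => simpa using hv.res_algebraMap a
  | add p q hp hq => rw [map_add, res_add (hv.evalAt_mem ht p) (hv.evalAt_mem ht q), hp, hq, map_add]
  | mul_X p i hp =>
    rw [map_mul, res_mul (hv.evalAt_mem ht p) (hv.evalAt_mem ht _), hp, map_mul]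
    simp

theorem resIndep_iff {ι : Type*} {t : ι → M} (ht : ∀ i, t i ∈ v) : letI := hv.algebra
    ResIndep K v t ↔ AlgebraicIndependent K fun i => v.res (t i) := by
  letI := hv.algebra
  rw [algebraicIndependent_iff]
  refine ⟨fun h p hp => h.2 p ?_, fun h => ⟨ht, fun p hp => h p ?_⟩⟩
  · rwa [← res_eq_zero_iff (hv.evalAt_mem ht p), hv.res_evalAt ht]
  · rwa [← res_eq_zero_iff (hv.evalAt_mem ht p), hv.res_evalAt ht] at hp

theorem resRank_mono {U U' : Set M} (h : U ⊆ U') : hv.resRank U ≤ hv.resRank U' := by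
  letI := hv.algebra
  exact Matroid.eRk_mono _ (Set.image_mono h)

theorem resRank_union_le (U : Set M) {T : Set M} : hv.resRank (U ∪ T) ≤ hv.resRank U + T.encard := by
  letI := hv.algebra
  unfold resRank
  rw [Set.image_union]
  refine (Matroid.eRk_union_le_eRk_add_encard _ _ _).trans ?_
  gcongr
  exact Set.encard_image_le _ _

theorem le_resRank {ι : Type*} [Fintype ι] {t : ι → M} (ht : ResIndep K v t) {U : Set M}
    (hU : ∀ i, t i ∈ U) : (Fintype.card ι : ℕ∞) ≤ hv.resRank U := by
  letI := hv.algebra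
  have h := (hv.resIndep_iff ht.1).1 ht
  have h1 : (AlgebraicIndependent.matroid K (IsLocalRing.ResidueField v)).Indep
      (Set.range fun i => v.res (t i)) := by
    rw [AlgebraicIndependent.matroid_indep_iff]
    exact AlgebraicIndependent.to_subtype_range h
  have h2 := h1.encard_le_eRk_of_subset (X := v.res '' U) (by rintro _ ⟨i, rfl⟩; exact ⟨_, hU i, rfl⟩)
  refine le_trans (le_of_eq ?_) h2
  rw [← Set.image_univ, h.injective.encard_image, Set.encard_univ]
  simp

theorem exists_resIndep {n : ℕ} {U : Set M} (hU : U ⊆ v) (h : (n : ℕ∞) ≤ hv.resRank U) :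
    ∃ t : Fin n → M, (∀ i, t i ∈ U) ∧ ResIndep K v t := by
  letI := hv.algebra
  obtain ⟨I, hIU, hI, hn⟩ := Matroid.le_eRk_iff.1 h
  have hfin : I.Finite := Set.finite_of_encard_eq_coe hn
  haveI := hfin.fintype
  have hcard : Fintype.card I = n := by
    have := Set.encard_eq_coe_toFinset_card I
    rw [hn] at this
    rw [← Set.toFinset_card]
    exact_mod_cast this.symm
  let e : Fin n ≃ I := (Fintype.equivFinOfCardEq hcard).symm
  choose g hgU hg using fun i : I => hIU i.2
  have ht : ∀ i, g (e i) ∈ v := fun i => hU (hgU _)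
  refine ⟨fun i => g (e i), fun i => hgU _, (hv.resIndep_iff ht).2 ?_⟩
  rw [AlgebraicIndependent.matroid_indep_iff] at hI
  have h3 : (fun i => v.res (g (e i))) = (fun i : I => (i : IsLocalRing.ResidueField v)) ∘ e :=
    funext fun i => hg _
  rw [h3]
  exact AlgebraicIndependent.comp hI e e.injective

theorem adjoin_mem {U : Set M} (hU : U ⊆ v) {u : M} (hu : u ∈ Algebra.adjoin K U) :
    letI := hv.algebra
    u ∈ v ∧ v.res u ∈ Algebra.adjoin K (v.res '' U) := by
  letI := hv.algebra
  induction hu using Algebra.adjoin_induction with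
  | mem x hx => exact ⟨hU hx, Algebra.subset_adjoin ⟨x, hx, rfl⟩⟩
  | algebraMap c => exact ⟨hv c, by rw [hv.res_algebraMap]; exact Subalgebra.algebraMap_mem _ c⟩
  | add x y _ _ hx hy =>
    exact ⟨v.add_mem _ _ hx.1 hy.1, by rw [res_add hx.1 hy.1]; exact Subalgebra.add_mem _ hx.2 hy.2⟩
  | mul x y _ _ hx hy =>
    exact ⟨v.mul_mem _ _ hx.1 hy.1, by rw [res_mul hx.1 hy.1]; exact Subalgebra.mul_mem _ hx.2 hy.2⟩

theorem isAlgebraic_res {U : Set M} (hU : U ⊆ v) {u : M} (hu : u ∈ v) {p : Polynomial M}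
    (hp : ∀ i, p.coeff i ∈ Algebra.adjoin K U) {k : ℕ} (hk : p.coeff k ∉ v.nonunits)
    (hpu : p.eval u ∈ v.nonunits) : letI := hv.algebra
    IsAlgebraic (Algebra.adjoin K (v.res '' U)) (v.res u) := by
  letI := hv.algebra
  let B := Algebra.adjoin K (v.res '' U)
  let c : ℕ → B := fun i => ⟨v.res (p.coeff i), (hv.adjoin_mem hU (hp i)).2⟩
  have hc : ∀ i, p.coeff i ∈ v := fun i => (hv.adjoin_mem hU (hp i)).1
  refine ⟨∑ i ∈ p.support, Polynomial.monomial i (c i), fun h => hk ?_, ?_⟩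
  · have h1 := congrArg (fun q => Polynomial.coeff q k) h
    simp only [Polynomial.finsetSum_coeff, Polynomial.coeff_monomial, Finset.sum_ite_eq',
      Polynomial.coeff_zero] at h1
    rw [← res_eq_zero_iff (hc k)]
    split_ifs at h1 with h2
    · exact congrArg Subtype.val h1
    · rw [Polynomial.notMem_support_iff.1 h2, res_of_mem v.zero_mem]; exact map_zero _
  · rw [map_sum, ← (res_eq_zero_iff (v := v) (u := p.eval u) (by
      exact v.nonunits_le hpu)).2 hpu, Polynomial.eval_eq_sum, Polynomial.sum]
    have : ∀ s : Finset ℕ, (∑ i ∈ s, p.coeff i * u ^ i) ∈ v ∧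
        v.res (∑ i ∈ s, p.coeff i * u ^ i) =
          ∑ i ∈ s, Polynomial.aeval (v.res u) (Polynomial.monomial i (c i)) := by
      intro s
      classical
      have hpow : ∀ n : ℕ, u ^ n ∈ v ∧ v.res (u ^ n) = v.res u ^ n := by
        intro n
        induction n with
        | zero => exact ⟨by simp, by rw [pow_zero, pow_zero, res_of_mem v.one_mem]; exact map_one _⟩
        | succ n ih => 
          rw [pow_succ, pow_succ, res_mul ih.1 hu, ih.2]
          exact ⟨v.mul_mem _ _ ih.1 hu, rfl⟩
      induction s using Finset.induction_on with
      | empty => exact ⟨by simp, by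
          rw [Finset.sum_empty, Finset.sum_empty, res_of_mem v.zero_mem]; exact map_zero _⟩
      | insert a s ha ih =>
        have h1 := v.mul_mem _ _ (hc a) (hpow a).1
        rw [Finset.sum_insert ha, Finset.sum_insert ha, res_add h1 ih.1, ih.2,
          res_mul (hc a) (hpow a).1, (hpow a).2, Polynomial.aeval_monomial]
        exact ⟨v.add_mem _ _ h1 ih.1, rfl⟩
    exact (this _).2.symm

theorem resRank_le_of_isAlgebraic {U U' : Set M}
    (h : letI := hv.algebra
      ∀ u ∈ U', IsAlgebraic (Algebra.adjoin K (v.res '' U)) (v.res u)) :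
    hv.resRank U' ≤ hv.resRank U := by
  letI := hv.algebra
  unfold resRank
  rw [← Matroid.eRk_closure_eq _ (v.res '' U)]
  refine Matroid.eRk_mono _ ?_
  rintro _ ⟨u, hu, rfl⟩
  rw [AlgebraicIndependent.matroid_closure_eq]
  exact h u hu

end ValuationSubring.Constants
end

end

section
open MvPolynomial

section
variable {K M ι : Type*} [Field K] [Field M] [Algebra K M]

theorem aeval_option_elim {D : Type*} [CommRing D] [Algebra K D] (t : ι → D) (x : D)
    (p : MvPolynomial (Option ι) K) : aeval (fun o : Option ι => o.elim x t) p =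
      (optionEquivLeft K ι p).eval₂ (aeval t : MvPolynomial ι K →ₐ[K] D).toRingHom x := by
  induction p using MvPolynomial.induction_on with
  | C a => simp [optionEquivLeft_C]
  | add p q hp hq => simp [Polynomial.eval₂_add, hp, hq]
  | mul_X p i hp =>
    rw [map_mul, hp, map_mul, Polynomial.eval₂_mul]
    congr 1
    cases i <;> simp [optionEquivLeft_X_none, optionEquivLeft_X_some]

/-- Elements independent modulo a prime `P`, together with an element of `P` outside a smaller
prime `Q`, are independent modulo `Q`. -/
theorem independent_mod_of_lt {D : Type*} [CommRing D] [Algebra K D] {P Q : Ideal D}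
    [Q.IsPrime] (hQP : Q ≤ P) {t : ι → D} (ht : ∀ p : MvPolynomial ι K, aeval t p ∈ P → p = 0)
    {x : D} (hxP : x ∈ P) (hxQ : x ∉ Q) (p : MvPolynomial (Option ι) K)
    (hp : aeval (fun o : Option ι => o.elim x t) p ∈ Q) : p = 0 := by
  rw [aeval_option_elim] at hp
  have key : ∀ q : Polynomial (MvPolynomial ι K),
      q.eval₂ (aeval t : MvPolynomial ι K →ₐ[K] D).toRingHom x ∈ Q → q = 0 := by
    intro q hq
    by_contra h0
    obtain ⟨k, r, hr, hqr⟩ : ∃ k r, r.coeff 0 ≠ 0 ∧ q = Polynomial.X ^ k * r := by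
      obtain ⟨r, hr, h⟩ := Polynomial.exists_eq_pow_rootMultiplicity_mul_and_not_dvd q h0 0
      rw [Polynomial.C_0, sub_zero, Polynomial.X_dvd_iff] at h
      rw [Polynomial.C_0, sub_zero] at hr
      exact ⟨_, r, h, hr⟩
    rw [hqr, Polynomial.eval₂_mul, Polynomial.eval₂_pow, Polynomial.eval₂_X] at hq
    rcases Ideal.IsPrime.mem_or_mem ‹_› hq with h1 | h1
    · exact hxQ (Ideal.IsPrime.mem_of_pow_mem ‹_› _ h1)
    · apply hr
      apply ht
      rw [← Polynomial.divX_mul_X_add r, Polynomial.eval₂_add, Polynomial.eval₂_mul, Polynomial.eval₂_X,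
        Polynomial.eval₂_C] at h1
      exact (Ideal.add_mem_iff_right _ (Ideal.mul_mem_left _ _ hxP)).1 (hQP h1)
  exact (map_eq_zero_iff _ (optionEquivLeft K ι).injective).1 (key _ hp)

theorem exists_degreeOf_pos {ρ : MvPolynomial ι K} (hρ : Prime ρ) : ∃ i, 0 < degreeOf i ρ := by
  classical
  by_contra! h
  have h1 : ρ.totalDegree = 0 := by
    rw [totalDegree_eq_zero_iff]
    intro m hm x
    have := monomial_le_degreeOf x hm
    have := h x
    omega
  rw [totalDegree_eq_zero_iff_eq_C] at h1
  have h2 : ρ.coeff 0 ≠ 0 := fun h2 => hρ.ne_zero (by rw [h1, h2, C_0])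
  exact hρ.not_isUnit (by rw [h1]; exact (isUnit_iff_ne_zero.2 h2).map C)

theorem constants_of_valOver {z : ι → M} {ρ : MvPolynomial ι K} {v : ValuationSubring M}
    (hv : v ∈ ValOver (evalAt K z) ρ) : v.Constants K := fun c => by
  simpa using hv.1 (C c)

theorem card_le_resRank_range [Fintype ι] {z : ι → M} {ρ : MvPolynomial ι K} (hρ : Prime ρ)
    {v : ValuationSubring M} (hv : v ∈ ValOver (evalAt K z) ρ) :
    (Fintype.card ι : ℕ∞) ≤ (constants_of_valOver hv).resRank (Set.range z) + 1 := by
  classical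
  obtain ⟨i, hi⟩ := exists_degreeOf_pos hρ
  have ht : ResIndep K v (fun j : {j // j ≠ i} => z j) := by
    refine ⟨fun j => by simpa using hv.1 (X j.1), fun p hp => ?_⟩
    have h1 : evalAt K (fun j : {j // j ≠ i} => z j) p = evalAt K z (rename Subtype.val p) := by
      simp only [RingHom.coe_coe, AlgHom.toRingHom_eq_coe, aeval_rename]; rfl
    rw [h1, hv.2] at hp
    obtain ⟨q, hq⟩ := hp
    by_contra hp0
    have hr0 : rename (Subtype.val : {j // j ≠ i} → ι) p ≠ 0 := fun h =>
      hp0 ((map_eq_zero_iff _ (rename_injective _ Subtype.val_injective)).1 h)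
    have h2 : degreeOf i (rename (Subtype.val : {j // j ≠ i} → ι) p) = 0 := by
      have := vars_rename (Subtype.val : {j // j ≠ i} → ι) p
      by_contra h3
      have h4 : i ∈ vars (rename (Subtype.val : {j // j ≠ i} → ι) p) := by
        rw [vars_def, Multiset.mem_toFinset, ← Multiset.count_pos]
        exact Nat.pos_of_ne_zero h3
      obtain ⟨j, -, hj⟩ := Finset.mem_image.1 (this h4)
      exact j.2 hj
    have hq0 : q ≠ 0 := by rintro rfl; exact hr0 (by rw [hq, mul_zero])
    rw [hq, degreeOf_mul_eq (n := i) hρ.ne_zero hq0] at h2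
    omega
  have h3 := (constants_of_valOver hv).le_resRank ht (U := Set.range z) fun j => ⟨_, rfl⟩
  have h4 : Fintype.card ι = Fintype.card {j // j ≠ i} + 1 := by
    rw [Fintype.card_subtype_compl, Fintype.card_subtype_eq]
    have : 0 < Fintype.card ι := Fintype.card_pos_iff.2 ⟨i⟩
    omega
  rw [h4]
  push_cast
  gcongr

theorem FinSepOver.exists_le_resRank [Fintype ι] {z : ι → M} (h : FinSepOver (evalAt K z))
    {U : Set M} (hU : U.Finite) (hz : ∀ i, IsAlgebraic (Algebra.adjoin K U) (z i)) :
    ∃ b ≠ 0, ∀ ρ, Prime ρ → ¬ ρ ∣ b → ∀ v (hv : v ∈ ValOver (evalAt K z) ρ), U ⊆ v ∧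
      (Fintype.card ι : ℕ∞) ≤ (constants_of_valOver hv).resRank U + 1 := by
  choose p hp0 hp using hz
  obtain ⟨b, hb, hbU⟩ := h.exists_forall_mem
    (U := U ∪ Set.range fun i => ((p i).leadingCoeff : M)⁻¹) (hU.union (Set.finite_range _))
  refine ⟨b, hb, fun ρ hρ hρb v hv => ?_⟩
  have h1 := hbU ρ hρb v hv
  have hUv : U ⊆ v := fun u hu => h1 u (Or.inl hu)
  refine ⟨hUv, (card_le_resRank_range hρ hv).trans ?_⟩
  gcongr
  apply ValuationSubring.Constants.resRank_le_of_isAlgebraic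
  rintro _ ⟨i, rfl⟩
  refine ValuationSubring.Constants.isAlgebraic_res _ hUv (by simpa using hv.1 (X i))
    (p := (p i).map (algebraMap _ M)) (k := (p i).natDegree) ?_ ?_ ?_
  · intro k; rw [Polynomial.coeff_map]; exact ((p i).coeff k).2
  · rw [Polynomial.coeff_map, Polynomial.coeff_natDegree, ValuationSubring.mem_nonunits_iff_or]
    push Not
    refine ⟨?_, h1 _ (Or.inr ⟨i, rfl⟩)⟩
    intro h2
    exact hp0 i (Polynomial.leadingCoeff_eq_zero.1 (Subtype.ext h2))
  · rw [Polynomial.eval_map_algebraMap, hp i]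
    exact v.mem_nonunits_iff_or.2 (Or.inl rfl)

end

end

section
open MvPolynomial

section
variable {K M ι : Type*} [Field K] [Field M] [Algebra K M]

theorem FinSepOver.isTranscendenceBasis {z : ι → M} (h : FinSepOver (evalAt K z)) :
    IsTranscendenceBasis K z := by
  have hind : AlgebraicIndependent K z := h.inj
  rw [isTranscendenceBasis_iff_algebraicIndependent_isAlgebraic]
  refine ⟨hind, ⟨fun u => ?_⟩⟩
  letI := (evalAt K z).toAlgebra
  obtain ⟨p, hp0, hp⟩ := h.isAlgebraic u
  let f : MvPolynomial ι K →+* Algebra.adjoin K (Set.range z) :=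
    (evalAt K z).codRestrict (Algebra.adjoin K (Set.range z)).toSubring fun p => by
      change aeval z p ∈ Algebra.adjoin K (Set.range z)
      rw [Algebra.adjoin_range_eq_range_aeval]; exact ⟨p, rfl⟩
  have hf : Function.Injective f := fun a b hab => h.inj (congrArg Subtype.val hab)
  refine ⟨p.map f, (Polynomial.map_ne_zero_iff hf).2 hp0, ?_⟩
  rw [Polynomial.aeval_def, Polynomial.eval₂_map]
  exact hp

theorem FinSepOver.isAlgebraic_adjoin {z : ι → M} (h : FinSepOver (evalAt K z)) (u : M) {U : Set M}
    (hU : Set.range z ⊆ U) : IsAlgebraic (Algebra.adjoin K U) u :=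
  (h.isTranscendenceBasis.isAlgebraic.isAlgebraic u).adjoin_of_forall_isAlgebraic
    fun x hx => (hx.2 (hU hx.1)).elim

theorem FinSepOver.card_le [Fintype ι] {z : ι → M} (h : FinSepOver (evalAt K z)) {κ : Type*}
    [Fintype κ] {s : κ → M} (hs : AlgebraicIndependent K s) : Fintype.card κ ≤ Fintype.card ι := by
  have h1 := h.isTranscendenceBasis.lift_cardinalMk_eq_trdeg
  have h2 := hs.lift_cardinalMk_le_trdeg
  simp only [Cardinal.mk_fintype, Cardinal.lift_natCast] at h1 h2
  have h3 : Cardinal.lift.{_, _} (Algebra.trdeg K M) = ((Fintype.card ι : ℕ) : Cardinal) := h1.symm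
  have h4 : Algebra.trdeg K M = Fintype.card ι := by
    have := h1.symm
    rw [Cardinal.lift_eq_nat_iff] at this
    exact this
  rw [h4] at h2
  simpa using h2

theorem FinSepOver.exists_centre_heightOne [Fintype ι] {z : ι → M} (h : FinSepOver (evalAt K z))
    {S : Type*} [CommRing S] [IsDomain S] [Algebra K S] [Algebra.FiniteType K S] [Algebra S M]
    [IsScalarTower K S M] [IsFractionRing S M] :
    ∃ b : MvPolynomial ι K, b ≠ 0 ∧ ∀ ρ, Prime ρ → ¬ ρ ∣ b → ∀ v ∈ ValOver (evalAt K z) ρ,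
      ∃ hS : ∀ s, algebraMap S M s ∈ v, HeightOnePrime (v.centre (algebraMap S M) hS) := by
  classical
  obtain ⟨G, hG⟩ := (inferInstance : Algebra.FiniteType K S)
  let f : S →ₐ[K] M := IsScalarTower.toAlgHom K S M
  have hadj : Algebra.adjoin K (f '' (G : Set S)) = f.range := by
    rw [← AlgHom.map_adjoin, hG, Algebra.map_top]
  have halg : ∀ u : M, IsAlgebraic (Algebra.adjoin K (f '' (G : Set S))) u := by
    intro u
    obtain ⟨a, s, hs, rfl⟩ := IsFractionRing.div_surjective (A := S) u
    have hs0 : algebraMap S M s ≠ 0 := IsFractionRing.to_map_ne_zero_of_mem_nonZeroDivisors hs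
    have hm : ∀ a : S, algebraMap S M a ∈ Algebra.adjoin K (f '' (G : Set S)) := fun a => by
      rw [hadj]; exact ⟨a, rfl⟩
    have h1 : ∀ a : S, IsAlgebraic (Algebra.adjoin K (f '' (G : Set S))) (algebraMap S M a) :=
      fun a => isAlgebraic_algebraMap (⟨_, hm a⟩ : Algebra.adjoin K (f '' (G : Set S)))
    rw [div_eq_mul_inv]
    exact (h1 a).mul (h1 s).inv
  obtain ⟨b, hb, hU⟩ := h.exists_le_resRank (G.finite_toSet.image f) (fun i => halg (z i))
  obtain ⟨s, hs⟩ := IsLocalization.exist_integer_multiples_of_finite (nonZeroDivisors S) z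
  obtain ⟨b', hb', hU'⟩ := h.exists_forall_mem (U := {(algebraMap S M s)⁻¹}) (Set.finite_singleton _)
  refine ⟨b * b', mul_ne_zero hb hb', fun ρ hρ hρb v hv => ?_⟩
  have hρ1 : ¬ ρ ∣ b := fun h => hρb (h.mul_right _)
  have hρ2 : ¬ ρ ∣ b' := fun h => hρb (h.mul_left _)
  obtain ⟨hUv, hrk⟩ := hU ρ hρ hρ1 v hv
  have hcon := constants_of_valOver hv
  have hS : ∀ s, algebraMap S M s ∈ v := fun s => by
    refine (hcon.adjoin_mem hUv (u := algebraMap S M s) ?_).1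
    rw [hadj]; exact ⟨s, rfl⟩
  refine ⟨hS, inferInstance, ?_, ?_⟩
  · have hs1 := hU' ρ hρ2 v hv _ rfl
    have h1 : ∀ p : MvPolynomial ι K, ∃ (N : ℕ) (r : S), 
        algebraMap S M r = evalAt K z p * algebraMap S M s ^ N := by
      intro p
      induction p using MvPolynomial.induction_on with
      | C a => exact ⟨0, algebraMap K S a, by simp [← IsScalarTower.algebraMap_apply]⟩
      | add p q hp hq =>
        obtain ⟨N, r, hr⟩ := hp
        obtain ⟨N', r', hr'⟩ := hq
        refine ⟨N + N', r * s ^ N' + r' * s ^ N, ?_⟩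
        simp only [map_add, map_mul, map_pow, hr, hr']
        ring
      | mul_X p i hp =>
        obtain ⟨N, r, hr⟩ := hp
        obtain ⟨y, hy⟩ := hs i
        refine ⟨N + 1, r * y, ?_⟩
        rw [map_mul, hr, hy, map_mul, Algebra.smul_def]
        simp only [RingHom.coe_coe, aeval_X]
        change _ * (algebraMap S M s * _) = _
        ring
    obtain ⟨N, r, hr⟩ := h1 ρ
    intro h0
    have hs0 : algebraMap S M s ≠ 0 := IsFractionRing.to_map_ne_zero_of_mem_nonZeroDivisors s.2
    have hr' : r ∈ v.centre (algebraMap S M) hS := by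
      rw [ValuationSubring.mem_centre, hr, mul_comm]
      exact ValuationSubring.nonunits_mul_left (v.toSubring.pow_mem (hS s) N) ((hv.2 ρ).2 dvd_rfl)
    rw [h0, Ideal.mem_bot] at hr'
    rw [hr', map_zero] at hr
    have h2 : evalAt K z ρ ≠ 0 := fun h2 => hρ.ne_zero (h.inj (by rw [h2, map_zero]))
    exact mul_ne_zero h2 (pow_ne_zero N hs0) hr.symm
  · intro Q hQ hQP
    by_contra hQ0
    obtain ⟨x, hxP, hxQ⟩ := Set.exists_of_ssubset hQP
    obtain ⟨y, hyQ, hy0⟩ := Submodule.exists_mem_ne_zero_of_ne_bot hQ0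
    obtain ⟨t, htU, ht⟩ := hcon.exists_resIndep (n := Fintype.card ι - 1) hUv (by
      rw [ENat.natCast_sub]; exact tsub_le_iff_right.2 hrk)
    choose g hgG hg using htU
    have h1 : ∀ p : MvPolynomial (Fin (Fintype.card ι - 1)) K,
        aeval g p ∈ v.centre (algebraMap S M) hS → p = 0 := by
      intro p hp
      rw [ValuationSubring.mem_centre] at hp
      refine ht.2 p ?_
      convert hp using 1
      rw [← show f ∘ g = t from funext hg]
      change aeval (f ∘ g) p = f (aeval g p)
      exact (comp_aeval_apply g f p).symm
    have h2 := independent_mod_of_lt (Q := Q) hQP.le h1 hxP hxQ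
    have h3 := independent_mod_of_lt (Q := (⊥ : Ideal S)) bot_le h2 hyQ (fun h => hy0 h)
    have h4 : AlgebraicIndependent K fun o : Option (Option (Fin (Fintype.card ι - 1))) =>
        f (o.elim y fun o => o.elim x g) := by
      have h5 : AlgebraicIndependent K (fun o : Option (Option (Fin (Fintype.card ι - 1))) =>
        (o.elim y fun o => o.elim x g)) := (injective_iff_map_eq_zero _).2 fun p hp => h3 p hp
      exact h5.map' (IsFractionRing.injective S M)
    have h5 := h.card_le h4
    simp only [Fintype.card_option, Fintype.card_fin] at h5
    omega

end

end

section
open MvPolynomial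

section
variable {K L M ι : Type*} [Field K] [Field L] [Field M] [Algebra K L] [Algebra K M]

theorem IsSeparable.of_forall_mem {A B : Type*} [Field A] [Field B] [Algebra A M] [Algebra B M]
    (h : ∀ a : A, algebraMap A M a ∈ Set.range (algebraMap B M)) {u : M}
    (hu : IsSeparable A u) : IsSeparable B u := by
  choose g hg using h
  have hinj := (algebraMap B M).injective
  let f : A →+* B :=
    { toFun := g
      map_one' := hinj (by rw [hg, map_one, map_one])
      map_mul' := fun a b => hinj (by rw [hg, map_mul, map_mul, hg, hg])
      map_zero' := hinj (by rw [hg, map_zero, map_zero])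
      map_add' := fun a b => hinj (by rw [hg, map_add, map_add, hg, hg]) }
  letI := f.toAlgebra
  haveI : IsScalarTower A B M := IsScalarTower.of_algebraMap_eq fun a => (hg a).symm
  exact hu.tower_top B

theorem FinSepOver.of_isSeparable [Algebra.EssFiniteType K M] {z : ι → M}
    (hz : AlgebraicIndependent K z)
    (hsep : Algebra.IsSeparable (Subfield.closure (Set.range (evalAt K z))) M) :
    FinSepOver (evalAt K z) := by
  refine ⟨hz, ?_, hsep⟩
  let E := Subfield.closure (Set.range (evalAt K z))
  letI : Algebra K E := ((algebraMap K M).codRestrict E fun c =>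
    Subfield.subset_closure ⟨C c, by simp⟩).toAlgebra
  haveI : IsScalarTower K E M := IsScalarTower.of_algebraMap_eq fun c => rfl
  haveI : Algebra.EssFiniteType E M := .of_comp K E M
  exact Algebra.finite_of_essFiniteType_of_isAlgebraic

theorem exists_finSepOver (K M : Type*) [Field K] [Field M] [Algebra K M] [PerfectField K]
    [Algebra.EssFiniteType K M] : ∃ (n : ℕ) (z : Fin n → M), FinSepOver (evalAt K z) := by
  obtain ⟨s, hs, hsep⟩ := exists_isTranscendenceBasis_and_isSeparable_of_perfectField K M
  let e : Fin s.card ≃ s := s.equivFin.symm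
  refine ⟨s.card, fun i => (e i : M), .of_isSeparable (hs.1.comp e e.injective) ⟨fun u => ?_⟩⟩
  refine (hsep.isSeparable' u).of_forall_mem fun a => ⟨⟨a, ?_⟩, rfl⟩
  have h1 : (IntermediateField.adjoin K (s : Set M)).toSubfield =
      Subfield.closure (Set.range (algebraMap K M) ∪ s) := rfl
  rw [closure_evalAt_eq]
  have h2 : Set.range (fun i => (e i : M)) = s := by
    have : (fun i => (e i : M)) = Subtype.val ∘ e := rfl
    rw [this, Set.range_comp, e.range_eq_univ, Set.image_univ, Subtype.range_coe]
  rw [h2, ← h1]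
  exact a.2

theorem FinSepOver.exists_extend [Algebra.EssFiniteType K M] {x : ι → L}
    (h : FinSepOver (evalAt K x)) {F : L →ₐ[K] M} (hF : SeparablyGeneratedVia (F : L →+* M)) :
    ∃ (r : ℕ) (t : Fin r → M), FinSepOver (evalAt K (Sum.elim (F ∘ x) t)) := by
  obtain ⟨r, t, ht, hsep⟩ := hF
  refine ⟨r, t, ?_⟩
  let F' : L →+* (F : L →+* M).fieldRange := (F : L →+* M).rangeRestrictField
  letI : Algebra K (F : L →+* M).fieldRange := (F'.comp (algebraMap K L)).toAlgebra
  haveI : IsScalarTower K (F : L →+* M).fieldRange M := IsScalarTower.of_algebraMap_eq fun c =>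
    (F.commutes c).symm
  have hx : AlgebraicIndependent K x := h.inj
  have hx' : AlgebraicIndependent K (F' ∘ x) := by
    let F'' : L →ₐ[K] (F : L →+* M).fieldRange := { F' with commutes' := fun _ => rfl }
    exact hx.map' (f := F'') F''.toRingHom.injective
  have hind : AlgebraicIndependent K (Sum.elim (F ∘ x) t) := by
    have h0 := (hx'.sumElim_comp ht).comp Sum.swap Sum.swap_leftInverse.injective
    convert h0 using 1
    funext i
    cases i <;> rfl
  refine .of_isSeparable hind ?_
  set E := Subfield.closure (Set.range (evalAt K (Sum.elim (F ∘ x) t))) with hE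
  have hLS : ∀ u : L, IsSeparable E (F u) := by
    intro u
    have h1 := h.sep.isSeparable' u
    have hmem : ∀ a ∈ Subfield.closure (Set.range (evalAt K x)), F a ∈ E := by
      have : Subfield.closure (Set.range (evalAt K x)) ≤ E.comap (F : L →+* M) := by
        rw [Subfield.closure_le]
        rintro _ ⟨p, rfl⟩
        refine Subfield.subset_closure ⟨rename Sum.inl p, ?_⟩
        simp only [RingHom.coe_coe, aeval_rename, Sum.elim_comp_inl]
        exact (comp_aeval_apply x F p).symm
      exact this
    let g : Subfield.closure (Set.range (evalAt K x)) →+* E :=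
      ((F : L →+* M).comp (Subfield.subtype _)).codRestrict E fun a => hmem a a.2
    have h2 : (minpoly (Subfield.closure (Set.range (evalAt K x))) u).Separable := h1
    have h3 := h2.map (f := g)
    refine h3.of_dvd (minpoly.dvd _ _ ?_)
    rw [Polynomial.aeval_def, Polynomial.eval₂_map]
    have h4 := Polynomial.hom_eval₂ (minpoly (Subfield.closure (Set.range (evalAt K x))) u)
      (algebraMap _ L) (F : L →+* M) u
    rw [← Polynomial.aeval_def, minpoly.aeval, map_zero] at h4
    exact h4.symm
  let T := separableClosure E M
  haveI : Algebra.IsSeparable T M := ⟨fun u => by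
    refine (hsep.isSeparable' u).of_forall_mem fun a => ⟨⟨a, ?_⟩, rfl⟩
    have h5 : (IntermediateField.adjoin (F : L →+* M).fieldRange (Set.range t)).toSubfield ≤
        T.toSubfield := by
      change Subfield.closure _ ≤ _
      rw [Subfield.closure_le]
      rintro _ (⟨⟨_, u, rfl⟩, rfl⟩ | ⟨i, rfl⟩)
      · exact mem_separableClosure_iff.2 (hLS u)
      · refine mem_separableClosure_iff.2 ?_
        exact isSeparable_algebraMap (F := E) (⟨t i, Subfield.subset_closure ⟨X (Sum.inr i), by simp⟩⟩ : E)
    exact h5 a.2⟩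
  exact Algebra.IsSeparable.trans E T M

end

end

section
open MvPolynomial

section
variable {K L M ι κ : Type*} [Field K] [Field L] [Field M] [Algebra K L] [Algebra K M]

theorem algebraicIndependent_sdiff_of_subset_closure {k : Type*} [Field k] [Algebra K k]
    {I J A : Set k} (hIJ : I ⊆ J) (hJ : (AlgebraicIndependent.matroid K k).Indep J)
    (hA : A ⊆ (AlgebraicIndependent.matroid K k).closure I) {σ : Type*} {w : σ → k}
    (hw : Function.Injective w) (hwJ : ∀ i, w i ∈ J \ I) {p : MvPolynomial σ k}
    (hp : ∀ m, p.coeff m ∈ A) (hpw : eval w p = 0) : p = 0 := by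
  rw [AlgebraicIndependent.matroid_indep_iff] at hJ
  have h1 := ((AlgebraicIndependent.iff_adjoin_image (x := fun j : J => (j : k))
    (Subtype.val ⁻¹' I)).1 hJ).2
  rw [Subtype.image_preimage_coe, Set.inter_eq_right.2 hIJ] at h1
  let e : σ → ↥((Subtype.val ⁻¹' I : Set J)ᶜ) := fun i => ⟨⟨w i, (hwJ i).1⟩, (hwJ i).2⟩
  have he : Function.Injective e := fun i j hij => hw (congrArg (fun x => (x.1.1 : k)) hij)
  have h2 : AlgebraicIndependent (Algebra.adjoin K I) w :=
    AlgebraicIndependent.comp h1 e he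
  have h3 := h2.subalgebraAlgebraicClosure
  rw [AlgebraicIndependent.matroid_closure_eq] at hA
  let B := Subalgebra.algebraicClosure (Algebra.adjoin K I) k
  have h4 : p ∈ Set.range (map (algebraMap B k)) := by
    refine ⟨∑ m ∈ p.support, monomial m ⟨p.coeff m, hA (hp m)⟩, ?_⟩
    rw [map_sum]
    conv_rhs => rw [p.as_sum]
    refine Finset.sum_congr rfl fun m _ => ?_
    rw [map_monomial]
    rfl
  obtain ⟨q, rfl⟩ := h4
  rw [eval_map] at hpw
  have h5 : aeval w q = 0 := hpw
  rw [(injective_iff_map_eq_zero _).1 h3 q h5, map_zero]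

theorem ValuationSubring.exists_forall_div_mem {α : Type*} (v : ValuationSubring M) {s : Finset α}
    (hs : s.Nonempty) (f : α → M) (h0 : ∀ i ∈ s, f i ≠ 0) : ∃ i ∈ s, ∀ j ∈ s, f j / f i ∈ v := by
  obtain ⟨i, hi, h⟩ := s.exists_max_image (fun i => v.valuation (f i)) hs
  refine ⟨i, hi, fun j hj => ?_⟩
  rw [← v.valuation_le_one_iff, map_div₀]
  have h1 : v.valuation (f i) ≠ 0 := (Valuation.ne_zero_iff _).2 (h0 i hi)
  exact (div_le_one₀ (zero_lt_iff.2 h1)).2 (h j hj)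

theorem FinSepOver.le_resRank_range [Fintype ι] [Fintype κ] {z : κ → M}
    (h : FinSepOver (evalAt K z)) {x : ι → L} (hx : AlgebraicIndependent K x) (F : L →ₐ[K] M)
    {v : ValuationSubring M} (hv : v.Constants K) (hzv : ∀ i, z i ∈ v)
    (hz : (Fintype.card κ : ℕ∞) ≤ hv.resRank (Set.range z) + 1) :
    (Fintype.card ι : ℕ∞) ≤ hv.resRank {u | u ∈ v ∧ ∃ l, F l = u} + 1 := by
  classical
  letI := hv.algebra
  set U : Set M := {u | u ∈ v ∧ ∃ l, F l = u}
  let 𝓜 := AlgebraicIndependent.matroid K (IsLocalRing.ResidueField v)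
  obtain ⟨I, hI⟩ := 𝓜.exists_isBasis (v.res '' U) (Set.subset_univ _)
  obtain ⟨J, hJ, hIJ⟩ := hI.indep.subset_isBasis_of_subset
    (X := I ∪ v.res '' Set.range z) Set.subset_union_left (Set.subset_univ _)
  have hrI : hv.resRank U = I.encard := hI.eRk_eq_encard
  have hrJ : hv.resRank (Set.range z) ≤ J.encard := by
    rw [← hJ.eRk_eq_encard]
    exact Matroid.eRk_mono _ Set.subset_union_right
  have hJI : J \ I ⊆ v.res '' Set.range z := fun a ha => (hJ.subset ha.1).resolve_left ha.2
  have hfin : (J \ I).Finite := ((Set.finite_range z).image _).subset hJI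
  haveI := hfin.fintype
  have hlift : ∀ a : ↥(J \ I), ∃ u ∈ v, v.res u = a := fun a => by
    obtain ⟨_, ⟨i, rfl⟩, hu⟩ := hJI a.2
    exact ⟨z i, hzv i, hu⟩
  choose w hwv hw using hlift
  have hwind : ∀ p : MvPolynomial ↥(J \ I) L, eval₂ (F : L →+* M) w p = 0 → p = 0 := by
    intro p hp
    by_contra hp0
    obtain ⟨m0, hm0, hmax⟩ := v.exists_forall_div_mem (s := p.support)
      (support_nonempty.2 hp0) (fun m => F (p.coeff m)) (fun m hm => by
        rw [Ne, map_eq_zero]; exact mem_support_iff.1 hm)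
    set a := p.coeff m0 with ha
    have ha0 : a ≠ 0 := mem_support_iff.1 hm0
    let q := C a⁻¹ * p
    have hqc : ∀ m, F (q.coeff m) ∈ v := fun m => by
      rw [coeff_C_mul, mul_comm, ← div_eq_mul_inv, map_div₀]
      by_cases hm : m ∈ p.support
      · exact hmax m hm
      · rw [notMem_support_iff.1 hm]; simp
    have hqU : ∀ m, F (q.coeff m) ∈ U := fun m => ⟨hqc m, _, rfl⟩
    have hq : eval₂ (F : L →+* M) w q = 0 := by rw [eval₂_mul, hp, mul_zero]
    let qb : MvPolynomial ↥(J \ I) (IsLocalRing.ResidueField v) :=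
      ∑ m ∈ p.support, monomial m (v.res (F (q.coeff m)))
    have hres0 : v.res 0 = 0 := by rw [ValuationSubring.res_of_mem v.zero_mem]; exact map_zero _
    have hqb : ∀ m, qb.coeff m = v.res (F (q.coeff m)) := fun m => by
      rw [coeff_sum]
      simp only [coeff_monomial, Finset.sum_ite_eq']
      split_ifs with hm
      · rfl
      · rw [coeff_C_mul, notMem_support_iff.1 hm, mul_zero, map_zero, hres0]
    have h1 : qb = 0 := by
      refine algebraicIndependent_sdiff_of_subset_closure (A := v.res '' U) (w := Subtype.val) hIJ
        hJ.indep hI.subset_closure Subtype.val_injective (fun i => i.2) (fun m => ?_) ?_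
      · rw [hqb]; exact ⟨_, hqU m, rfl⟩
      · have hsum : ∀ s : Finset (↥(J \ I) →₀ ℕ),
            (∑ m ∈ s, F (q.coeff m) * m.prod fun i k => w i ^ k) ∈ v ∧
            v.res (∑ m ∈ s, F (q.coeff m) * m.prod fun i k => w i ^ k) =
            ∑ m ∈ s, eval Subtype.val (monomial m (v.res (F (q.coeff m)))) := by
          intro s
          have hmon : ∀ m : ↥(J \ I) →₀ ℕ, (m.prod fun i k => w i ^ k) ∈ v ∧
              v.res (m.prod fun i k => w i ^ k) = m.prod fun i k => (i : IsLocalRing.ResidueField v) ^ k := by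
            intro m
            have h2 := hv.res_evalAt hwv (monomial m (1 : K))
            have h3 := hv.evalAt_mem hwv (monomial m (1 : K))
            simp only [RingHom.coe_coe, aeval_monomial, map_one, one_mul] at h2 h3
            simp only [hw] at h2
            exact ⟨h3, h2⟩
          induction s using Finset.induction_on with
          | empty => simp [hres0]
          | insert m s hm ih =>
            have h1 := v.mul_mem _ _ (hqc m) (hmon m).1
            rw [Finset.sum_insert hm, Finset.sum_insert hm, ValuationSubring.res_add h1 ih.1, ih.2,
              ValuationSubring.res_mul (hqc m) (hmon m).1, (hmon m).2, eval_monomial]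
            exact ⟨v.add_mem _ _ h1 ih.1, rfl⟩
        have h2 : eval₂ (F : L →+* M) w q =
            ∑ m ∈ p.support, F (q.coeff m) * m.prod fun i k => w i ^ k := by
          rw [eval₂_eq]
          exact Finset.sum_subset (s₂ := p.support) (fun m hm => by
            rw [mem_support_iff, coeff_C_mul] at hm
            exact mem_support_iff.2 (right_ne_zero_of_mul hm)) fun m _ hm => by
              rw [notMem_support_iff.1 hm, map_zero, zero_mul]
        rw [map_sum, ← (hsum _).2, ← h2, hq, hres0]
    have h2 := hqb m0
    have h3 : q.coeff m0 = 1 := by rw [coeff_C_mul]; exact inv_mul_cancel₀ ha0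
    rw [h1, coeff_zero, h3, map_one, ValuationSubring.res_of_mem v.one_mem] at h2
    exact zero_ne_one (h2.trans (map_one _))
  letI : Algebra L M := (F : L →+* M).toAlgebra
  haveI : IsScalarTower K L M := IsScalarTower.of_algebraMap_eq fun c => (F.commutes c).symm
  have hw' : AlgebraicIndependent L w := (injective_iff_map_eq_zero _).2 hwind
  have h2 := h.card_le (hx.sumElim_comp hw')
  rw [Fintype.card_sum] at h2
  have h3 : J.encard = I.encard + (Fintype.card ↥(J \ I) : ℕ) := by
    have := Set.encard_sdiff_add_encard_of_subset hIJ
    rw [← this, add_comm]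
    congr 1
    rw [Set.encard_eq_coe_toFinset_card, Set.toFinset_card]
  rw [hrI]
  have h4 : (Fintype.card κ : ℕ∞) ≤ I.encard + (Fintype.card ↥(J \ I) : ℕ) + 1 := by
    rw [← h3]; exact hz.trans (by gcongr)
  rcases eq_or_ne I.encard ⊤ with h5 | h5
  · rw [h5]; simp
  · obtain ⟨c, hc⟩ := ENat.ne_top_iff_exists.1 h5
    rw [← hc] at h4 ⊢
    norm_cast at h4 ⊢
    omega

end

end

section
open MvPolynomial

section
variable {K L M ι κ : Type*} [Field K] [Field L] [Field M] [Algebra K L] [Algebra K M]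

/-- The discrete valuation rings lying over the prime divisors of projective space with affine
coordinates `z`. -/
def Places (K : Type*) {M κ : Type*} [Field K] [Field M] [Algebra K M] [DecidableEq κ] (z : κ → M)
    (i0 : κ) : Set (ValuationSubring M) :=
  {v | ∃ ρ, Prime ρ ∧ v ∈ ValOver (evalAt K z) ρ} ∪ ValOver (evalAt K (infChart z i0)) (X i0)

/-- The family `V` defines a rational map to projective space that maps the centre of `v` onto
a subvariety of dimension at least `n - 1`. -/
def GoodFam (F : L →ₐ[K] M) (n : ℕ) (v : ValuationSubring M) (V : Finset L) : Prop :=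
  ∃ hv : v.Constants K, ∃ a ∈ V, a ≠ 0 ∧ (∀ b ∈ V, F (b / a) ∈ v) ∧
    (n : ℕ∞) ≤ hv.resRank {u | ∃ b ∈ V, F (b / a) = u} + 1

open scoped Classical Pointwise in
theorem GoodFam.mul {F : L →ₐ[K] M} {n : ℕ} {v : ValuationSubring M} {V : Finset L}
    (hV : GoodFam F n v V) {T : Finset L} (hT : 1 ∈ T) : GoodFam F n v (V * T) := by
  obtain ⟨hv, a, ha, ha0, hav, hr⟩ := hV
  obtain ⟨t, ht, hmax⟩ := v.exists_forall_div_mem (s := T.erase 0)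
    ⟨1, Finset.mem_erase.2 ⟨one_ne_zero, hT⟩⟩ (fun l => F l) (fun i hi => by
      rw [Ne, map_eq_zero]; exact (Finset.mem_erase.1 hi).1)
  have ht0 := (Finset.mem_erase.1 ht).1
  have htT := (Finset.mem_erase.1 ht).2
  refine ⟨hv, a * t, Finset.mul_mem_mul ha htT, mul_ne_zero ha0 ht0, fun b hb => ?_, ?_⟩
  · obtain ⟨b', hb', s, hs, rfl⟩ := Finset.mem_mul.1 hb
    rw [mul_div_mul_comm, map_mul]
    refine v.mul_mem _ _ (hav b' hb') ?_
    by_cases hs0 : s = 0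
    · simp [hs0]
    · rw [map_div₀]; exact hmax s (Finset.mem_erase.2 ⟨hs0, hs⟩)
  · refine hr.trans ?_
    gcongr
    refine hv.resRank_mono ?_
    rintro _ ⟨b, hb, rfl⟩
    exact ⟨b * t, Finset.mul_mem_mul hb htT, by rw [mul_div_mul_right _ _ ht0]⟩

open scoped Classical Pointwise in
theorem Set.Finite.exists_goodFam {S : Set ((L →ₐ[K] M) × ValuationSubring M)} (hS : S.Finite)
    {n : ℕ} (h : ∀ p ∈ S, ∃ T : Finset L, 1 ∈ T ∧ GoodFam p.1 n p.2 T) :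
    ∃ T : Finset L, 1 ∈ T ∧ ∀ p ∈ S, GoodFam p.1 n p.2 T := by
  induction S, hS using Set.Finite.induction_on with
  | empty => exact ⟨{1}, by simp⟩
  | @insert p S _ _ ih =>
    obtain ⟨T, hT, hTS⟩ := ih fun q hq => h q (Set.mem_insert_of_mem _ hq)
    obtain ⟨T', hT', hTp⟩ := h p (Set.mem_insert _ _)
    refine ⟨T * T', Finset.mem_mul.2 ⟨1, hT, 1, hT', one_mul 1⟩, ?_⟩
    rintro q (rfl | hq)
    · rw [mul_comm]; exact hTp.mul hT
    · exact (hTS q hq).mul hT'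

open scoped Classical in
theorem goodFam_of_range [Fintype ι] {F : L →ₐ[K] M} {n : ℕ} {v : ValuationSubring M}
    (hv : v.Constants K) {x : ι → L} (hx : ∀ i, F (x i) ∈ v)
    (hr : (n : ℕ∞) ≤ hv.resRank (Set.range fun i => F (x i)) + 1) :
    GoodFam F n v (insert 1 (Finset.univ.image x)) := by
  refine ⟨hv, 1, by simp, one_ne_zero, fun b hb => ?_, hr.trans ?_⟩
  · rw [div_one]
    rcases Finset.mem_insert.1 hb with rfl | hb
    · simp
    · obtain ⟨i, -, rfl⟩ := Finset.mem_image.1 hb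
      exact hx i
  · gcongr
    refine hv.resRank_mono ?_
    rintro _ ⟨i, rfl⟩
    exact ⟨x i, by simp, by rw [div_one]⟩

theorem FinSepOver.exists_le_resRank_comp [Algebra.EssFiniteType K M] [Fintype ι] [Fintype κ]
    {x : ι → L} (hx : FinSepOver (evalAt K x)) {z : κ → M} (hz : FinSepOver (evalAt K z))
    {F : L →ₐ[K] M} (hF : SeparablyGeneratedVia (F : L →+* M)) :
    ∃ b ≠ 0, ∀ ρ, Prime ρ → ¬ ρ ∣ b → ∀ v (hv : v ∈ ValOver (evalAt K z) ρ),
      (∀ i, F (x i) ∈ v) ∧ (Fintype.card ι : ℕ∞) ≤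
        (constants_of_valOver hv).resRank (Set.range fun i => F (x i)) + 1 := by
  obtain ⟨r, t, ht⟩ := hx.exists_extend hF
  obtain ⟨b, hb, h⟩ := hz.exists_le_resRank (U := (Set.range fun i => F (x i)) ∪ Set.range t)
    ((Set.finite_range _).union (Set.finite_range _))
    fun i => ht.isAlgebraic_adjoin (z i) (by rw [Set.Sum.elim_range]; rfl)
  refine ⟨b, hb, fun ρ hρ hρb v hv => ?_⟩
  obtain ⟨h1, h2⟩ := h ρ hρ hρb v hv
  refine ⟨fun i => h1 (Or.inl ⟨i, rfl⟩), ?_⟩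
  have h3 := h2.trans (add_le_add_left ((constants_of_valOver hv).resRank_union_le _) 1)
  have h4 : (Set.range t).encard ≤ (r : ℕ) := by
    rw [← Set.image_univ]
    refine (Set.encard_image_le _ _).trans ?_
    simp
  have h5 := hz.card_le ht.isTranscendenceBasis.1
  rw [Fintype.card_sum, Fintype.card_fin] at h5
  have h6 : ((Fintype.card ι + r : ℕ) : ℕ∞) ≤
      (constants_of_valOver hv).resRank (Set.range fun i => F (x i)) + r + 1 :=
    (Nat.cast_le.2 h5).trans (h3.trans (by gcongr))
  generalize (constants_of_valOver hv).resRank (Set.range fun i => F (x i)) = c at h6 ⊢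
  induction c using ENat.recTopCoe with
  | top => simp
  | coe c => norm_cast at h6 ⊢; omega

open scoped Classical in
theorem FinSepOver.exists_goodFam_of_valOver [Fintype ι] [Fintype κ] {z : κ → M}
    (h : FinSepOver (evalAt K z)) {x : ι → L} (hx : AlgebraicIndependent K x) (F : L →ₐ[K] M)
    {ρ : MvPolynomial κ K} (hρ : Prime ρ) {v : ValuationSubring M}
    (hv : v ∈ ValOver (evalAt K z) ρ) :
    ∃ T : Finset L, 1 ∈ T ∧ GoodFam F (Fintype.card ι) v T := by
  have h1 := h.le_resRank_range hx F (constants_of_valOver hv)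
    (fun i => by simpa using hv.1 (X i)) (card_le_resRank_range hρ hv)
  obtain ⟨t, ht, hti⟩ := (constants_of_valOver hv).exists_resIndep (n := Fintype.card ι - 1)
    (U := {u | u ∈ v ∧ ∃ l, F l = u}) (fun u hu => hu.1) (by
      rw [ENat.natCast_sub]; exact tsub_le_iff_right.2 h1)
  choose l hl using fun i => (ht i).2
  refine ⟨insert 1 (Finset.univ.image l), by simp, goodFam_of_range (constants_of_valOver hv)
    (fun i => by rw [hl]; exact hti.1 i) ?_⟩
  have h2 := (constants_of_valOver hv).le_resRank hti (U := Set.range fun i => F (l i))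
    fun i => ⟨i, hl i⟩
  rw [Fintype.card_fin] at h2
  calc ((Fintype.card ι : ℕ) : ℕ∞) ≤ ((Fintype.card ι - 1 + 1 : ℕ) : ℕ∞) := by
        exact_mod_cast by omega
    _ ≤ _ := by push_cast; gcongr; simpa using h2

open scoped Classical Pointwise in
theorem FinSepOver.exists_goodFam [Algebra.EssFiniteType K M] [Fintype ι] [Fintype κ] [DecidableEq κ]
    {x : ι → L} (hx : FinSepOver (evalAt K x)) {z : κ → M} (hz : FinSepOver (evalAt K z)) (i0 : κ)
    {S : Set (L →ₐ[K] M)} (hS : S.Finite)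
    (hF : ∀ F ∈ S, SeparablyGeneratedVia (F : L →+* M)) :
    ∃ V : Finset L, 1 ∈ V ∧ (∀ i, x i ∈ V) ∧
      ∀ F ∈ S, ∀ v ∈ Places K z i0, GoodFam F (Fintype.card ι) v V := by
  choose! b hb0 hb using fun F hFS => hx.exists_le_resRank_comp hz (hF F hFS)
  let H := ∏ F ∈ hS.toFinset, b F
  have hH : H ≠ 0 := Finset.prod_ne_zero_iff.2 fun F hF => hb0 F (hS.mem_toFinset.1 hF)
  obtain ⟨hi0, -, hz'⟩ := hz.infChart i0
  obtain ⟨T, hT, hTS⟩ := Set.Finite.exists_goodFam (n := Fintype.card ι)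
    (S := S ×ˢ ({v | ∃ ρ, Prime ρ ∧ ρ ∣ H ∧ v ∈ ValOver (evalAt K z) ρ} ∪
      ValOver (evalAt K (_root_.infChart z i0)) (X i0)))
    (hS.prod ((finite_valOver_dvd hz hH).union (valOver_finite hz' (X_prime (i := i0))))) (by
      rintro ⟨F, v⟩ ⟨-, ⟨ρ, hρ, -, hv⟩ | hv⟩
      · exact hz.exists_goodFam_of_valOver hx.isTranscendenceBasis.1 F hρ hv
      · exact hz'.exists_goodFam_of_valOver hx.isTranscendenceBasis.1 F X_prime hv)
  let V0 : Finset L := insert 1 (Finset.univ.image x)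
  have h1 : 1 ∈ V0 := by simp [V0]
  refine ⟨V0 * T, Finset.mem_mul.2 ⟨1, h1, 1, hT, one_mul 1⟩, fun i =>
    Finset.mem_mul.2 ⟨x i, by simp [V0], 1, hT, mul_one _⟩, fun F hFS v hv => ?_⟩
  by_cases hbad : v ∈ {v | ∃ ρ, Prime ρ ∧ ρ ∣ H ∧ v ∈ ValOver (evalAt K z) ρ} ∪
      ValOver (evalAt K (_root_.infChart z i0)) (X i0)
  · rw [mul_comm]
    exact (hTS (F, v) ⟨hFS, hbad⟩).mul h1
  · rcases hv with ⟨ρ, hρ, hv⟩ | hv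
    · have hρb : ¬ ρ ∣ b F := fun hd => hbad <| Or.inl
        ⟨ρ, hρ, hd.trans (Finset.dvd_prod_of_mem _ (hS.mem_toFinset.2 hFS)), hv⟩
      have := hb F hFS ρ hρ hρb v hv
      exact (goodFam_of_range _ this.1 this.2).mul hT
    · exact absurd (Or.inr hv) hbad

end

end

section
open MvPolynomial

section
variable {K L : Type*} [Field K] [Field L] [Algebra K L]

theorem IsIntegral.of_forall_adjoin {R A : Type*} [CommRing R] [CommRing A] [Algebra R A]
    {U U' : Set A} (h : ∀ u ∈ U, IsIntegral (Algebra.adjoin R U') u) {x : A}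
    (hx : IsIntegral (Algebra.adjoin R U) x) : IsIntegral (Algebra.adjoin R U') x := by
  let C := integralClosure (Algebra.adjoin R U') A
  have hle : Algebra.adjoin R U ≤ C.restrictScalars R := Algebra.adjoin_le fun u hu => h u hu
  have hx' : IsIntegral C x := by
    obtain ⟨p, hp, hpx⟩ := hx
    let j : Algebra.adjoin R U →+* C :=
      (algebraMap (Algebra.adjoin R U) A).codRestrict C.toSubring fun a => hle a.2
    refine ⟨p.map j, hp.map _, ?_⟩
    rw [Polynomial.eval₂_map]
    exact hpx
  exact isIntegral_trans (A := C) x hx'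

/-- A nonhomogeneous relation with nonzero constant term yields an integral equation after
homogenization. -/
theorem isIntegral_mul_of_aeval_div_eq_zero {σ : Type*} {p : MvPolynomial σ K}
    (h0 : p.coeff 0 ≠ 0) {y : σ → L} {w : L} (hw : w ≠ 0)
    (hp : aeval (fun i => y i / w) p = 0) (u : L) :
    IsIntegral (Algebra.adjoin K (Set.range fun i => y i * u)) (w * u) := by
  classical
  set A := Algebra.adjoin K (Set.range fun i => y i * u)
  set d := p.totalDegree
  let a : σ → A := fun i => ⟨y i * u, Algebra.subset_adjoin ⟨i, rfl⟩⟩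
  let q : Polynomial A := ∑ m ∈ p.support.erase 0, Polynomial.monomial (d - m.degree)
    (algebraMap K A ((p.coeff 0)⁻¹ * p.coeff m) * m.prod fun i k => a i ^ k)
  have hdeg : ∀ m ∈ p.support, m.degree ≤ d := fun m hm => by
    exact le_totalDegree hm
  have hmon : ∀ m ∈ p.support, (w * u) ^ (d - m.degree) * (m.prod fun i k => (y i * u) ^ k) =
      (w * u) ^ d * m.prod fun i k => (y i / w) ^ k := by
    intro m hm
    have h1 : (m.prod fun i k => (y i * u) ^ k) =
        (w * u) ^ m.degree * m.prod fun i k => (y i / w) ^ k := by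
      rw [Finsupp.degree_apply, Finsupp.prod, Finsupp.prod, ← Finset.prod_pow_eq_pow_sum,
        ← Finset.prod_mul_distrib]
      refine Finset.prod_congr rfl fun i _ => ?_
      rw [← mul_pow]
      congr 1
      field_simp
    rw [h1, ← mul_assoc, ← pow_add, Nat.sub_add_cancel (hdeg m hm)]
  refine ⟨Polynomial.X ^ d + q, Polynomial.monic_X_pow_add ?_, ?_⟩
  · refine (Polynomial.degree_sum_le _ _).trans_lt ((Finset.sup_lt_iff (WithBot.bot_lt_coe d)).2
      fun m hm => ?_)
    refine (Polynomial.degree_monomial_le _ _).trans_lt ?_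
    have h1 : m.degree ≠ 0 := fun h => (Finset.mem_erase.1 hm).1 ((Finsupp.degree_eq_zero_iff m).1 h)
    have h2 := hdeg m (Finset.mem_erase.1 hm).2
    exact WithBot.coe_lt_coe.2 (by omega : d - m.degree < d)
  · have h1 : (p.coeff 0)⁻¹ • aeval (fun i => y i / w) p = 0 := by rw [hp, smul_zero]
    have h2 : (0 : σ →₀ ℕ) ∈ p.support := mem_support_iff.2 h0
    rw [aeval_def, eval₂_eq, ← Finset.add_sum_erase _ _ h2, smul_add, Finset.smul_sum] at h1
    rw [Polynomial.eval₂_add, Polynomial.eval₂_X_pow, Polynomial.eval₂_finsetSum]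
    have h3 : ∀ m ∈ p.support.erase 0, Polynomial.eval₂ (algebraMap A L) (w * u)
        (Polynomial.monomial (d - m.degree)
          (algebraMap K A ((p.coeff 0)⁻¹ * p.coeff m) * m.prod fun i k => a i ^ k)) =
        (w * u) ^ d * ((p.coeff 0)⁻¹ • (algebraMap K L (p.coeff m) *
          ∏ i ∈ m.support, (y i / w) ^ m i)) := by
      intro m hm
      have h4 := hmon m (Finset.mem_erase.1 hm).2
      rw [Polynomial.eval₂_monomial, map_mul, ← IsScalarTower.algebraMap_apply, map_mul,
        Algebra.smul_def]
      have h5 : algebraMap A L (m.prod fun i k => a i ^ k) = m.prod fun i k => (y i * u) ^ k := by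
        rw [map_finsuppProd]
        simp only [map_pow]
        rfl
      rw [h5]
      have h6 : (m.prod fun i k => (y i / w) ^ k) = ∏ i ∈ m.support, (y i / w) ^ m i := rfl
      rw [h6] at h4
      linear_combination (algebraMap K L (p.coeff 0)⁻¹ * algebraMap K L (p.coeff m)) * h4
    rw [Finset.sum_congr rfl h3, ← Finset.mul_sum]
    have h7 : (p.coeff 0)⁻¹ • (algebraMap K L (p.coeff 0) *
        ∏ i ∈ (0 : σ →₀ ℕ).support, (y i / w) ^ (0 : σ →₀ ℕ) i) = 1 := by
      simp [Algebra.smul_def, ← map_mul, h0]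
    rw [h7] at h1
    linear_combination (w * u) ^ d * h1

/-- Homogeneous linear Noether normalization, preserving spanning under a linear map. -/
theorem exists_integral_family [Infinite K] {E : Type*} [AddCommGroup E] [Module L E] [Module K E]
    [IsScalarTower K L E] [FiniteDimensional L E] (T : L →ₗ[K] E) {d : ℕ}
    (hd : Module.finrank L E = d) (hd0 : 0 < d)
    (htr : ∀ y : Fin d → L, ¬ AlgebraicIndependent K y) {N : ℕ}
    (h : Fin N → L) (hspan : Submodule.span L (Set.range (T ∘ h)) = ⊤) :
    ∃ l : Fin d → L, Submodule.span L (Set.range (T ∘ l)) = ⊤ ∧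
      (∀ j, l j ∈ Submodule.span K (Set.range h)) ∧
      ∀ i u, IsIntegral (Algebra.adjoin K (Set.range fun j => l j * u)) (h i * u) := by
  classical
  have hdN : d ≤ N := by
    rw [← hd, ← finrank_top L E, ← hspan]
    refine (finrank_range_le_card (R := L) (T ∘ h)).trans ?_
    rw [Fintype.card_fin]
  induction N with
  | zero => omega
  | succ N ih =>
    rcases hdN.eq_or_lt with rfl | hlt
    · exact ⟨h, hspan, fun j => Submodule.subset_span ⟨j, rfl⟩, fun i u =>
        isIntegral_algebraMap (R := Algebra.adjoin K (Set.range fun j => h j * u))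
          (x := ⟨h i * u, Algebra.subset_adjoin ⟨i, rfl⟩⟩)⟩
    have hdN' : d ≤ N := by omega
    obtain ⟨p, hp⟩ : ∃ p, h p ≠ 0 := by
      by_contra! h0
      have h1 : Set.range (T ∘ h) ⊆ {0} := by
        rintro _ ⟨i, rfl⟩
        simp [h0]
      have h2 := (Submodule.span_mono (R := L) h1)
      rw [hspan, Submodule.span_zero_singleton] at h2
      have h3 : Module.finrank L E = 0 := by
        rw [← finrank_top L E, le_bot_iff.1 h2, finrank_bot]
      omega
    obtain ⟨a, ha, ha0⟩ : ∃ a : Fin (N + 1) → L, ∑ i, a i • T (h i) = 0 ∧ ∃ i, a i ≠ 0 := by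
      have h1 : ¬ LinearIndependent L (T ∘ h) := fun h1 => by
        have := h1.fintype_card_le_finrank
        rw [hd, Fintype.card_fin] at this
        omega
      exact Fintype.not_linearIndependent_iff.1 h1
    obtain ⟨P, hP, hP0⟩ : ∃ P : MvPolynomial (Fin N) K,
        aeval (fun j => h (p.succAbove j) / h p) P = 0 ∧ P ≠ 0 := by
      by_contra! h1
      refine htr ((fun j => h (p.succAbove j) / h p) ∘ Fin.castLE hdN') ?_
      exact AlgebraicIndependent.comp ((injective_iff_map_eq_zero _).2 h1) _
        (Fin.castLE_injective hdN')
    let Q : MvPolynomial (Fin N) L := map (algebraMap K L) P *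
      (C (a p) + ∑ j, C (a (p.succAbove j)) * X j)
    have hQ : Q ≠ 0 := by
      refine mul_ne_zero (fun h1 => hP0 ?_) fun h1 => ?_
      · exact map_injective _ (algebraMap K L).injective (by rw [h1, map_zero])
      · obtain ⟨i, hi⟩ := ha0
        have hlin : ∀ j, a (p.succAbove j) = 0 := fun j => by
          have := congrArg (coeff (Finsupp.single j 1)) h1
          simpa [coeff_C, coeff_sum, coeff_C_mul, coeff_X, Finsupp.single_left_inj, eq_comm] using this
        rcases Fin.eq_self_or_eq_succAbove p i with rfl | ⟨j, rfl⟩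
        · simp only [hlin, map_zero, zero_mul, Finset.sum_const_zero, add_zero] at h1
          exact hi (by simpa using h1)
        · exact hi (hlin j)
    obtain ⟨c, hc⟩ : ∃ c : Fin N → K, eval (fun j => algebraMap K L (c j)) Q ≠ 0 := by
      by_contra! h1
      refine hQ (funext_set (fun _ => Set.range (algebraMap K L))
        (fun _ => Set.infinite_range_of_injective (algebraMap K L).injective) fun y hy => ?_)
      choose c hc using fun j => hy j (Set.mem_univ j)
      rw [map_zero, ← h1 c]
      congr 2
      exact _root_.funext fun j => (hc j).symm
    rw [map_mul] at hc
    have hc1 : eval c P ≠ 0 := fun h1 => left_ne_zero_of_mul hc (by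
      rw [eval_map, ← aeval_def]
      have := aeval_algebraMap_apply L c P
      rw [Function.comp_def] at *
      rw [this, aeval_eq_eval, h1, map_zero])
    have hc2 : a p + ∑ j, a (p.succAbove j) * algebraMap K L (c j) ≠ 0 := by
      simpa using right_ne_zero_of_mul hc
    let h' : Fin N → L := fun j => h (p.succAbove j) - c j • h p
    have hTp : T (h p) ∈ Submodule.span L (Set.range (T ∘ h')) := by
      have h1 : (a p + ∑ j, a (p.succAbove j) * algebraMap K L (c j)) • T (h p) =
          -∑ j, a (p.succAbove j) • T (h' j) := by
        rw [Fin.sum_univ_succAbove _ p] at ha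
        rw [eq_neg_iff_add_eq_zero, ← ha, add_smul, Finset.sum_smul, add_assoc,
          ← Finset.sum_add_distrib]
        congr 1
        refine Finset.sum_congr rfl fun j _ => ?_
        simp only [h', map_sub, map_smul, smul_sub, mul_smul, algebraMap_smul]
        abel
      have h2 : T (h p) = (a p + ∑ j, a (p.succAbove j) * algebraMap K L (c j))⁻¹ •
          -∑ j, a (p.succAbove j) • T (h' j) := by
        rw [← h1, smul_smul, inv_mul_cancel₀ hc2, one_smul]
      rw [h2]
      exact Submodule.smul_mem _ _ (Submodule.neg_mem _ (Submodule.sum_mem _ fun j _ =>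
        Submodule.smul_mem _ _ (Submodule.subset_span ⟨j, rfl⟩)))
    have hspan' : Submodule.span L (Set.range (T ∘ h')) = ⊤ := by
      rw [eq_top_iff, ← hspan, Submodule.span_le]
      rintro _ ⟨i, rfl⟩
      rcases Fin.eq_self_or_eq_succAbove p i with rfl | ⟨j, rfl⟩
      · exact hTp
      · have h1 : T (h (p.succAbove j)) = T (h' j) + algebraMap K L (c j) • T (h p) := by
          simp [h', algebraMap_smul]
        simp only [Function.comp_apply, h1]
        exact Submodule.add_mem _ (Submodule.subset_span ⟨j, rfl⟩) (Submodule.smul_mem _ _ hTp)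
    obtain ⟨l, hl1, hl2, hl3⟩ := ih h' hspan' hdN'
    refine ⟨l, hl1, fun j => ?_, fun i u => ?_⟩
    · refine Submodule.span_le.2 ?_ (hl2 j)
      rintro _ ⟨k, rfl⟩
      exact Submodule.sub_mem _ (Submodule.subset_span ⟨_, rfl⟩)
        (Submodule.smul_mem _ _ (Submodule.subset_span ⟨p, rfl⟩))
    · have hpi : IsIntegral (Algebra.adjoin K (Set.range fun j => l j * u)) (h p * u) := by
        refine IsIntegral.of_forall_adjoin (U := Set.range fun j => h' j * u)
          (by rintro _ ⟨j, rfl⟩; exact hl3 j u)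
          (isIntegral_mul_of_aeval_div_eq_zero (p := aeval (fun j => X j + C (c j)) P) ?_ hp ?_ u)
        · have h2 : (constantCoeff (R := K) (σ := Fin N)).comp
              (aeval (fun j => X j + C (c j)) : MvPolynomial (Fin N) K →ₐ[K] _).toRingHom =
              eval c := by
            refine ringHom_ext (fun r => ?_) fun j => ?_ <;> simp
          have h3 := RingHom.congr_fun h2 P
          rw [← constantCoeff_eq]
          exact fun h4 => hc1 (h3.symm.trans h4)
        · rw [← hP, comp_aeval_apply]
          congr 2
          refine _root_.funext fun j => ?_
          simp [h', sub_div, Algebra.smul_def, hp]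
      rcases Fin.eq_self_or_eq_succAbove p i with rfl | ⟨j, rfl⟩
      · exact hpi
      · have h1 : h (p.succAbove j) * u = h' j * u + c j • (h p * u) := by
          simp only [h', Algebra.smul_def]; ring
        rw [h1]
        exact (hl3 j u).add (hpi.smul (c j))

end

end

section
open MvPolynomial

section
variable {K L M ι κ : Type*} [Field K] [Field L] [Field M] [Algebra K L] [Algebra K M]

open scoped IntermediateField.algebraAdjoinAdjoin in
theorem FinSepOver.of_span_D [Algebra.EssFiniteType K L] [Fintype ι] [Fintype κ] {x : ι → L}
    (hspan : Submodule.span L (Set.range fun i => KaehlerDifferential.D K L (x i)) = ⊤)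
    {y : κ → L} (hy : FinSepOver (evalAt K y)) (hcard : Fintype.card ι = Fintype.card κ) :
    FinSepOver (evalAt K x) := by
  classical
  let E := IntermediateField.adjoin K (Set.range x)
  haveI : Algebra.EssFiniteType E L := .of_comp K E L
  let φ : Ω[L⁄K] →ₗ[L] Ω[L⁄E] :=
    ((KaehlerDifferential.D E L).restrictScalars K).liftKaehlerDifferential
  have hφ : ∀ u, φ (KaehlerDifferential.D K L u) = KaehlerDifferential.D E L u := fun u =>
    Derivation.liftKaehlerDifferential_comp_D _ u
  have hφ0 : φ = 0 := by
    refine LinearMap.ext_on hspan ?_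
    rintro _ ⟨i, rfl⟩
    simp only [hφ, LinearMap.zero_apply]
    exact Derivation.map_algebraMap (KaehlerDifferential.D E L)
      (⟨x i, IntermediateField.subset_adjoin _ _ ⟨i, rfl⟩⟩ : E)
  haveI : Algebra.FormallyUnramified E L := by
    refine ⟨subsingleton_of_forall_eq 0 fun ω => ?_⟩
    have h1 : ω ∈ Submodule.span L (Set.range (KaehlerDifferential.D E L)) := by
      rw [KaehlerDifferential.span_range_derivation]; trivial
    have h2 : Set.range (KaehlerDifferential.D E L) ⊆ {0} := by
      rintro _ ⟨u, rfl⟩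
      rw [← hφ, hφ0]; rfl
    simpa using Submodule.span_mono h2 h1
  have hsep : Algebra.IsSeparable E L := Algebra.FormallyUnramified.isSeparable E L
  have halg : Algebra.IsAlgebraic (Algebra.adjoin K (Set.range x)) L := by
    constructor
    intro u
    exact (IsFractionRing.isAlgebraic_iff (Algebra.adjoin K (Set.range x)) E L).2
      (hsep.isAlgebraic.isAlgebraic u)
  have hx : IsTranscendenceBasis K x := by
    refine Algebra.IsAlgebraic.isTranscendenceBasis_of_lift_le_trdeg_of_finite K x ?_
    have h1 := hy.isTranscendenceBasis.lift_cardinalMk_eq_trdeg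
    simp only [Cardinal.mk_fintype, Cardinal.lift_natCast] at h1 ⊢
    rw [Cardinal.lift_eq_nat_iff.1 h1.symm, Cardinal.lift_natCast, hcard]
  refine .of_isSeparable hx.1 ⟨fun u => ?_⟩
  refine (hsep.isSeparable' u).of_forall_mem fun a => ⟨⟨a, ?_⟩, rfl⟩
  rw [closure_evalAt_eq]
  exact a.2

theorem add_two_le_card_of_prime [Fintype ι] [Fintype κ] {P : Ideal (MvPolynomial ι K)}
    {t : κ → MvPolynomial ι K} (ht : ∀ p : MvPolynomial κ K, aeval t p ∈ P → p = 0)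
    {q a : MvPolynomial ι K} (hq : Prime q) (hqP : q ∈ P) (ha : a ∈ P) (hqa : ¬ q ∣ a) :
    Fintype.card κ + 2 ≤ Fintype.card ι := by
  haveI : (Ideal.span {q}).IsPrime := (Ideal.span_singleton_prime hq.ne_zero).2 hq
  have h1 := independent_mod_of_lt (P := P) (Q := Ideal.span {q})
    ((Ideal.span_singleton_le_iff_mem _).2 hqP) ht ha
    (fun h => hqa (Ideal.mem_span_singleton.1 h))
  have h2 := independent_mod_of_lt (P := Ideal.span {q}) (Q := ⊥) bot_le h1
    (Ideal.mem_span_singleton_self q) (fun h => hq.ne_zero h)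
  have h3 := AlgebraicIndependent.lift_cardinalMk_le_trdeg
    ((injective_iff_map_eq_zero _).2 fun p hp => h2 p (by rw [hp]; exact Ideal.zero_mem _))
  rw [MvPolynomial.trdeg_of_isDomain] at h3
  simp only [Cardinal.mk_fintype, Cardinal.lift_natCast, Fintype.card_option, Nat.cast_le] at h3
  exact_mod_cast h3

end

end

section
open MvPolynomial

section
variable {K L M ι κ : Type*} [Field K] [Field L] [Field M] [Algebra K L] [Algebra K M]

theorem GoodFam.le_resRank {F : L →ₐ[K] M} {n : ℕ} {v : ValuationSubring M} {V : Finset L}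
    (h : GoodFam F n v V) {J : Type*} {l : J → L}
    (hl : ∀ b ∈ V, ∀ u, IsIntegral (Algebra.adjoin K (Set.range fun j => l j * u)) (b * u))
    {e : L} (he0 : e ≠ 0) (he : e ∈ Submodule.span K (V : Set L)) (hle : ∀ j, F (l j / e) ∈ v) :
    ∃ hv : v.Constants K, (n : ℕ∞) ≤ hv.resRank (Set.range fun j => F (l j / e)) + 1 := by
  obtain ⟨hv, a, haV, ha0, haV', hr⟩ := h
  refine ⟨hv, hr.trans ?_⟩
  letI := hv.algebra
  set U := Set.range fun j => F (l j / e)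
  have hU : U ⊆ v := by rintro _ ⟨j, rfl⟩; exact hle j
  have hpoly : ∀ b ∈ V, ∃ p : Polynomial M, p.Monic ∧ (∀ i, p.coeff i ∈ Algebra.adjoin K U) ∧
      p.eval (F (b / e)) = 0 := by
    intro b hb
    obtain ⟨p, hp, hpb⟩ := hl b hb e⁻¹
    refine ⟨p.map ((F : L →+* M).comp (algebraMap _ L)), hp.map _, fun i => ?_, ?_⟩
    · rw [Polynomial.coeff_map]
      have h1 := (Algebra.adjoin K (Set.range fun j => l j * e⁻¹)).mem_map (f := F)
        |>.2 ⟨_, (p.coeff i).2, rfl⟩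
      have h3 : U = F '' Set.range fun j => l j * e⁻¹ := by
        simp only [U, div_eq_mul_inv, ← Set.range_comp]; rfl
      rw [h3, ← AlgHom.map_adjoin]
      exact h1
    · rw [Polynomial.eval_map, div_eq_mul_inv]
      have h2 := Polynomial.hom_eval₂ p (algebraMap _ L) (F : L →+* M) (b * e⁻¹)
      rw [hpb, map_zero] at h2
      exact h2.symm
  have hmem : ∀ b ∈ V, F (b / e) ∈ v := by
    intro b hb
    obtain ⟨p, hp, hpU, hpb⟩ := hpoly b hb
    have hv' : ∀ i, p.coeff i ∈ v.toSubring := fun i => (hv.adjoin_mem hU (hpU i)).1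
    have hc : (↑p.coeffs : Set M) ⊆ v.toSubring := by
      intro c hc
      obtain ⟨i, -, rfl⟩ := Polynomial.mem_coeffs_iff.1 hc
      exact hv' i
    refine v.mem_of_isIntegral (A := v.toSubring) (fun a => a.2)
      ⟨p.toSubring v.toSubring hc, (Polynomial.monic_toSubring p v.toSubring hc).2 hp, ?_⟩
    have hm : (p.toSubring v.toSubring hc).map (algebraMap v.toSubring M) = p :=
      Polynomial.ext fun i => by
        rw [Polynomial.coeff_map]; exact Polynomial.coeff_toSubring p v.toSubring hc
    rw [← Polynomial.eval_map, hm]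
    exact hpb
  have halg : ∀ b ∈ V, IsAlgebraic (Algebra.adjoin K (v.res '' U)) (v.res (F (b / e))) := by
    intro b hb
    obtain ⟨p, hp, hpU, hpb⟩ := hpoly b hb
    refine hv.isAlgebraic_res hU (hmem b hb) hpU (k := p.natDegree) ?_ ?_
    · rw [hp.coeff_natDegree]; exact v.one_notMem_nonunits
    · rw [hpb]; exact v.mem_nonunits_iff_or.2 (Or.inl rfl)
  have hspan : ∀ e ∈ Submodule.span K (V : Set L), F (e / a) ∈ v := by
    intro e he
    induction he using Submodule.span_induction with
    | mem x hx => exact haV' x hx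
    | zero => simp
    | add x y _ _ hx hy => rw [add_div, map_add]; exact v.add_mem _ _ hx hy
    | smul c x _ hx =>
      rw [smul_div_assoc, map_smul, Algebra.smul_def]
      exact v.mul_mem _ _ (hv c) hx
  have hea := hspan e he
  have h1 : v.res (F (e / a)) = (v.res (F (a / e)))⁻¹ := by
    refine eq_inv_of_mul_eq_one_left ?_
    rw [← ValuationSubring.res_mul hea (hmem a haV), ← map_mul, div_mul_div_cancel₀ ha0, div_self he0,
      map_one, ValuationSubring.res_of_mem v.one_mem]
    exact map_one _
  gcongr
  refine hv.resRank_le_of_isAlgebraic ?_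
  rintro _ ⟨b, hb, rfl⟩
  rw [← div_mul_div_cancel₀ (a := b) (b := e) (c := a) he0, map_mul, ValuationSubring.res_mul (hmem b hb) hea, h1]
  exact (halg b hb).mul (halg a haV).inv

end

end

section
open MvPolynomial

section
variable {K L M ι κ : Type*} [Field K] [Field L] [Field M] [Algebra K L] [Algebra K M]

/-- The centre of `v` on the affine space with coordinates `y` is a prime divisor or the generic
point. -/
def DivCentre (K : Type*) {M ι : Type*} [Field K] [Field M] [Algebra K M] (y : ι → M)
    (v : ValuationSubring M) : Prop :=
  (∀ p, evalAt K y p ∈ v) ∧ ∀ q a, Prime q → evalAt K y q ∈ v.nonunits →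
    evalAt K y a ∈ v.nonunits → q ∣ a

theorem DivCentre.of_le_resRank [Fintype ι] {y : ι → M} {v : ValuationSubring M}
    (hv : v.Constants K) {U : Set M} (hU : U ⊆ insert 1 (Set.range y)) (hy : ∀ i, y i ∈ v)
    (hr : (Fintype.card ι : ℕ∞) ≤ hv.resRank U + 1) : DivCentre K y v := by
  have hyv := hv.evalAt_mem hy
  refine ⟨hyv, fun q a hq hqv hav => ?_⟩
  by_contra hqa
  have hUv : U ⊆ v := fun u hu => by
    rcases hU hu with rfl | ⟨i, rfl⟩
    exacts [v.one_mem, hy i]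
  obtain ⟨t, ht, hti⟩ := hv.exists_resIndep (n := Fintype.card ι - 1) hUv
    (by rw [ENat.natCast_sub]; exact tsub_le_iff_right.2 hr)
  have h1 : ∀ i, ∃ p : MvPolynomial ι K, evalAt K y p = t i := fun i => by
    rcases hU (ht i) with h | ⟨j, h⟩
    · exact ⟨1, by rw [map_one, h]⟩
    · exact ⟨X j, by rw [← h]; simp⟩
  choose τ hτ using h1
  have h2 := add_two_le_card_of_prime (P := v.centre (evalAt K y) hyv) (t := τ) (q := q) (a := a)
    (fun p hp => hti.2 p (by
      rw [ValuationSubring.mem_centre] at hp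
      have h3 : evalAt K y (aeval τ p) = evalAt K t p := by
        have h4 := comp_aeval_apply (aeval y : MvPolynomial ι K →ₐ[K] M) (f := τ) p
        have h5 : (fun i => aeval y (τ i)) = t := _root_.funext hτ
        rw [h5] at h4
        exact h4
      rwa [h3] at hp)) hq ((ValuationSubring.mem_centre ..).2 hqv)
    ((ValuationSubring.mem_centre ..).2 hav) hqa
  rw [Fintype.card_fin] at h2
  omega

theorem DivCentre.mem_valOver {y : ι → M} {v : ValuationSubring M} (h : DivCentre K y v)
    {q : MvPolynomial ι K} (hq : Prime q) (hqv : evalAt K y q ∈ v.nonunits) :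
    v ∈ ValOver (evalAt K y) q := by
  refine ⟨h.1, fun a => ⟨h.2 q a hq hqv, ?_⟩⟩
  rintro ⟨c, rfl⟩
  rw [map_mul, mul_comm]
  exact ValuationSubring.nonunits_mul_left (h.1 c) hqv

theorem exists_span_D_eq_top [Algebra.EssFiniteType K L] [Fintype ι] {x : ι → L}
    (hx : FinSepOver (evalAt K x)) [Infinite K] {V : Finset L} (h1 : 1 ∈ V) (hV : ∀ i, x i ∈ V) :
    ∃ (l : Option ι → L), l none ≠ 0 ∧ (∀ j, l j ∈ Submodule.span K (V : Set L)) ∧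
      (∀ b ∈ V, ∀ u, IsIntegral (Algebra.adjoin K (Set.range fun j => l j * u)) (b * u)) ∧
      Submodule.span L (Set.range fun i : ι => KaehlerDifferential.D K L (l (some i) / l none)) =
        ⊤ := by
  classical
  obtain ⟨β, hβ⟩ := hx.exists_basis
  haveI : Module.Finite L Ω[L⁄K] := Module.Finite.of_basis β
  let D := KaehlerDifferential.D K L
  let T : L →ₗ[K] L × Ω[L⁄K] := LinearMap.prod LinearMap.id D.toLinearMap
  have hT : ∀ u, T u = (u, D u) := fun u => rfl
  let h : Fin V.card → L := fun i => V.equivFin.symm i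
  have hrange : Set.range h = V := by
    ext b
    refine ⟨?_, fun hb => ⟨V.equivFin ⟨b, hb⟩, by simp [h]⟩⟩
    rintro ⟨i, rfl⟩
    exact (V.equivFin.symm i).2
  obtain ⟨l, hspan, hl, hint⟩ := exists_integral_family (d := Fintype.card ι + 1) T
    (by rw [Module.finrank_prod, Module.finrank_self, Module.finrank_eq_card_basis β, add_comm])
    (by omega)
    (fun y hy => by have := hx.card_le hy; simp at this) h (by
      rw [Set.range_comp, hrange, eq_top_iff]
      have e1 : ((1 : L), (0 : Ω[L⁄K])) ∈ Submodule.span L (T '' (V : Set L)) :=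
        Submodule.subset_span ⟨1, h1, by rw [hT, Derivation.map_one_eq_zero]⟩
      have e2 : ∀ ω : Ω[L⁄K], ((0 : L), ω) ∈ Submodule.span L (T '' (V : Set L)) := by
        intro ω
        have h3 : ω ∈ Submodule.span L (Set.range β) := by rw [β.span_eq]; trivial
        induction h3 using Submodule.span_induction with
        | mem w hw =>
          obtain ⟨i, rfl⟩ := hw
          have h4 := Submodule.sub_mem _
            (Submodule.subset_span (R := L) (s := T '' (V : Set L)) ⟨x i, hV i, rfl⟩)
            (Submodule.smul_mem _ (x i) e1)
          rw [hT] at h4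
          rw [hβ]
          simpa using h4
        | zero => exact Submodule.zero_mem _
        | add a b _ _ ha hb => simpa using Submodule.add_mem _ ha hb
        | smul c a _ ha => simpa using Submodule.smul_mem _ c ha
      rintro ⟨a, ω⟩ -
      simpa using Submodule.add_mem _ (Submodule.smul_mem _ a e1) (e2 ω))
  have hne : ∃ j, l j ≠ 0 := by
    by_contra! hl0
    have h5 : T ∘ l = 0 := by ext1 j; simp [hl0]
    rw [h5] at hspan
    have h6 : ((1 : L), (0 : Ω[L⁄K])) ∈ Submodule.span L (Set.range (0 : Fin (Fintype.card ι + 1) →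
      L × Ω[L⁄K])) := by rw [hspan]; trivial
    have h7 : Submodule.span L (Set.range (0 : Fin (Fintype.card ι + 1) → L × Ω[L⁄K])) = ⊥ := by
      rw [Submodule.span_eq_bot]
      rintro _ ⟨i, rfl⟩
      rfl
    rw [h7, Submodule.mem_bot] at h6
    exact one_ne_zero (congrArg Prod.fst h6)
  obtain ⟨j0, hj0⟩ := hne
  let e0 : Option ι ≃ Fin (Fintype.card ι + 1) := Fintype.equivOfCardEq (by simp)
  let e : Option ι ≃ Fin (Fintype.card ι + 1) := e0.trans (Equiv.swap (e0 none) j0)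
  have he : e none = j0 := by simp [e]
  refine ⟨l ∘ e, by simpa [he] using hj0, fun j => hrange ▸ hl _, fun b hb u => ?_, ?_⟩
  · rw [← Finset.mem_coe, ← hrange] at hb
    obtain ⟨i, rfl⟩ := hb
    have h8 : (Set.range fun j => (l ∘ e) j * u) = Set.range fun j => l j * u :=
      e.surjective.range_comp fun j => l j * u
    rw [h8]
    exact hint i u
  · set l0 := l (e none) with hl0
    have hl0' : l0 ≠ 0 := by rw [hl0, he]; exact hj0
    let ψ : L × Ω[L⁄K] →ₗ[L] Ω[L⁄K] :=
      LinearMap.snd L L _ - (LinearMap.toSpanSingleton L _ (l0⁻¹ • D l0)).comp (LinearMap.fst L L _)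
    have hψ : ∀ a ω, ψ (a, ω) = ω - a • l0⁻¹ • D l0 := fun a ω => rfl
    have h9 : Submodule.map ψ ⊤ = ⊤ := by
      rw [eq_top_iff]
      intro ω _
      exact ⟨(0, ω), trivial, by rw [hψ]; simp⟩
    rw [← hspan, Submodule.map_span, ← Set.range_comp] at h9
    rw [eq_top_iff, ← h9, Submodule.span_le]
    rintro _ ⟨j, rfl⟩
    obtain ⟨b, rfl⟩ := e.surjective j
    have h10 : ∀ u, ψ (T (u * l0)) = l0 • D u := by
      intro u
      rw [hT, hψ, D.leibniz, smul_smul, mul_assoc, mul_inv_cancel₀ hl0', mul_one]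
      abel
    have h11 : (ψ ∘ T ∘ l) (e b) = l0 • D (l (e b) / l0) := by
      rw [← h10, div_mul_cancel₀ _ hl0']; rfl
    rw [h11]
    cases b with
    | none => rw [div_self hl0', D.map_one_eq_zero, smul_zero]; exact Submodule.zero_mem _
    | some i => exact Submodule.smul_mem _ _ (Submodule.subset_span ⟨i, rfl⟩)

/-- **Adapted coordinates.** -/
theorem FinSepOver.exists_adapted [Infinite K] [Algebra.EssFiniteType K L]
    [Algebra.EssFiniteType K M] [Fintype ι] [DecidableEq ι]
    [Fintype κ] [DecidableEq κ]
    {x : ι → L} (hx : FinSepOver (evalAt K x)) {z : κ → M} (hz : FinSepOver (evalAt K z)) (i0 : κ)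
    {S : Set (L →ₐ[K] M)} (hS : S.Finite)
    (hF : ∀ F ∈ S, SeparablyGeneratedVia (F : L →+* M)) :
    ∃ x' : ι → L, FinSepOver (evalAt K x') ∧ ∀ F ∈ S, ∀ v ∈ Places K z i0,
      DivCentre K (F ∘ x') v ∨ ∃ i, v ∈ ValOver (evalAt K (_root_.infChart (F ∘ x') i)) (X i) := by
  classical
  obtain ⟨V, h1, hV, hgood⟩ := hx.exists_goodFam hz i0 hS hF
  obtain ⟨l, hl0, hl, hint, hspan⟩ := exists_span_D_eq_top hx h1 hV
  refine ⟨fun i => l (some i) / l none, .of_span_D hspan hx rfl, fun F hFS v hv => ?_⟩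
  have hg := hgood F hFS v hv
  by_cases haff : ∀ i, F (l i / l none) ∈ v
  · left
    obtain ⟨hv, hr⟩ := hg.le_resRank hint hl0 (hl _) haff
    refine .of_le_resRank hv ?_ (fun i => haff _) hr
    rintro _ ⟨_ | i, rfl⟩
    · left; simp [div_self hl0]
    · right; exact ⟨i, rfl⟩
  · right
    obtain ⟨j, hj, hmax⟩ := v.exists_forall_div_mem (s := {j | l j ≠ 0}) ⟨none, by simpa using hl0⟩
      (fun j => F (l j)) (fun j hj => by simpa using hj)
    have hj0 : l j ≠ 0 := by simpa using hj
    have hmem : ∀ i, F (l i / l j) ∈ v := by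
      intro i
      by_cases hi : l i = 0
      · simp [hi]
      · rw [map_div₀]; exact hmax i (by simpa using hi)
    have hinf : F (l none / l j) ∈ v.nonunits := by
      by_contra hn
      refine haff fun i => ?_
      have := v.mul_mem _ _ (hmem i) (v.inv_mem_of_not_nonunit hn)
      rwa [← map_inv₀, inv_div, ← map_mul, div_mul_div_cancel₀ hj0] at this
    obtain _ | i := j
    · rw [div_self hl0, map_one] at hinf
      exact absurd hinf v.one_notMem_nonunits
    refine ⟨i, ?_⟩
    obtain ⟨hv, hr⟩ := hg.le_resRank hint hj0 (hl _) hmem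
    set y := _root_.infChart (F ∘ fun i => l (some i) / l none) i with hy
    have hyi : y i = F (l none / l (some i)) := by simp [hy, _root_.infChart]
    have hyk : ∀ k, k ≠ i → y k = F (l (some k) / l (some i)) := fun k hk => by
      simp only [hy, _root_.infChart, if_neg hk, Function.comp, ← map_div₀]
      rw [div_div_div_cancel_right₀ hl0]
    have hyv : ∀ k, y k ∈ v := fun k => by
      by_cases hk : k = i
      · rw [hk, hyi]; exact hmem _
      · rw [hyk k hk]; exact hmem _
    refine (DivCentre.of_le_resRank hv ?_ hyv hr).mem_valOver X_prime (by simpa [hyi] using hinf)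
    rintro _ ⟨_ | k, rfl⟩
    · right; exact ⟨i, hyi⟩
    · by_cases hk : k = i
      · left; simp [hk, div_self hj0]
      · right; exact ⟨k, hyk k hk⟩

end

end

section
open MvPolynomial

section
variable {K L M ι κ : Type*} [Field K] [Field L] [Field M] [Algebra K L] [Algebra K M]

theorem derivation_evalAt [Fintype ι] (D : Derivation K M M) (y : ι → M) (p : MvPolynomial ι K) :
    D (evalAt K y p) = ∑ j, evalAt K y (pderiv j p) * D (y j) := by
  classical
  induction p using MvPolynomial.induction_on with
  | C a => simp
  | add p q hp hq => simp only [map_add, hp, hq, add_mul, Finset.sum_add_distrib]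
  | mul_X p i hp =>
    have h1 : evalAt K y (X i) = y i := by simp
    simp only [map_mul, Derivation.leibniz, hp, h1, map_add, smul_eq_mul, add_mul,
      Finset.sum_add_distrib, Finset.mul_sum]
    congr 1
    · rw [Finset.sum_eq_single i]
      · simp
      · intro j _ hj
        rw [pderiv_X_of_ne (Ne.symm hj)]
        simp
      · simp
    · exact Finset.sum_congr rfl fun j _ => by ring

theorem exists_pow_eq_of_forall_pderiv_eq_zero [PerfectField K] {q : MvPolynomial ι K}
    (h : ∀ i, pderiv i q = 0) : (∃ c, q = C c) ∨ ∃ p : ℕ, 1 < p ∧ ∃ r, q = r ^ p := by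
  classical
  have h1 : ∀ m ∈ q.support, ∀ i, ((m i : ℕ) : K) = 0 := by
    intro m hm i
    by_contra hmi
    have hmi0 : m i ≠ 0 := fun h0 => hmi (by simp [h0])
    have h2 : coeff (m - Finsupp.single i 1) (pderiv i q) = 0 := by rw [h i, coeff_zero]
    have h3 : m - Finsupp.single i 1 + Finsupp.single i 1 = m :=
      tsub_add_cancel_of_le (Finsupp.single_le_iff.2 (by omega))
    rw [coeff_pderiv, h3] at h2
    rcases mul_eq_zero.1 h2 with h2 | h2
    · exact (mem_support_iff.1 hm) h2
    · apply hmi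
      rw [Finsupp.tsub_apply, Finsupp.single_eq_same, ← Nat.cast_succ] at h2
      rwa [show (m i - 1).succ = m i by omega] at h2
  obtain ⟨p, hp⟩ := ExpChar.exists K
  rcases hp with _ | hpp
  · left
    refine ⟨coeff 0 q, ?_⟩
    ext m
    by_cases hm : m = 0
    · simp [hm]
    · rw [coeff_C, if_neg (Ne.symm hm)]
      by_contra hq
      refine hm (Finsupp.ext fun i => ?_)
      exact_mod_cast h1 m (mem_support_iff.2 hq) i
  · right
    haveI : Fact p.Prime := ⟨hpp⟩
    refine ⟨p, hpp.one_lt, ∑ m ∈ q.support,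
      monomial (m.mapRange (· / p) (Nat.zero_div p)) ((frobeniusEquiv K p).symm (coeff m q)), ?_⟩
    haveI : CharP (MvPolynomial ι K) p := inferInstance
    rw [← frobenius_def, map_sum]
    conv_lhs => rw [q.as_sum]
    refine Finset.sum_congr rfl fun m hm => ?_
    rw [frobenius_def, monomial_pow, frobeniusEquiv_symm_pow_p]
    congr 2
    refine Finsupp.ext fun i => ?_
    have := (CharP.cast_eq_zero_iff K p (m i)).1 (h1 m hm i)
    simp [Nat.mul_div_cancel' this]

/-- A prime polynomial over a perfect field has a derivative that it does not divide. -/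
theorem Prime.exists_not_dvd_pderiv [PerfectField K] {q : MvPolynomial ι K} (hq : Prime q) :
    ∃ i, ¬ q ∣ pderiv i q := by
  by_contra! h
  have h0 : ∀ i, pderiv i q = 0 := by
    intro i
    by_contra hi
    obtain ⟨c, hc⟩ := h i
    have hc0 : c ≠ 0 := by rintro rfl; exact hi (by rw [hc, mul_zero])
    have h1 : degreeOf i q ≤ degreeOf i (pderiv i q) := by
      rw [hc, degreeOf_mul_eq hq.ne_zero hc0]; omega
    obtain ⟨m, hm, hmd⟩ : ∃ m ∈ (pderiv i q).support, degreeOf i (pderiv i q) = m i := by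
      rw [degreeOf_eq_sup]
      exact Finset.exists_mem_eq_sup _ (support_nonempty.2 hi) _
    have h3 : coeff (m + Finsupp.single i 1) q ≠ 0 := by
      intro h3
      rw [mem_support_iff, coeff_pderiv, h3, zero_mul] at hm
      exact hm rfl
    have h4 := monomial_le_degreeOf i (mem_support_iff.2 h3)
    simp at h4
    omega
  rcases exists_pow_eq_of_forall_pderiv_eq_zero h0 with ⟨c, rfl⟩ | ⟨p, hp, r, rfl⟩
  · have hc : c ≠ 0 := by rintro rfl; exact hq.ne_zero (map_zero _)
    exact hq.not_isUnit ((isUnit_iff_ne_zero.2 hc).map C)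
  · exact not_prime_pow (by omega) hq

theorem FinSepOver.exists_jacobian_inverse [Algebra.EssFiniteType K M] [Fintype κ] [DecidableEq ι]
    {x : ι → L} (hx : FinSepOver (evalAt K x)) {z : κ → M} (hz : FinSepOver (evalAt K z))
    {F : L →ₐ[K] M} (hF : SeparablyGeneratedVia (F : L →+* M)) :
    ∃ J : ι → κ → M, ∀ i j, ∑ k, J i k * hz.pd k (F (x j)) = if i = j then 1 else 0 := by
  classical
  obtain ⟨r, t, ht⟩ := hx.exists_extend hF
  refine ⟨fun i k => ht.pd (Sum.inl i) (z k), fun i j => ?_⟩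
  have h1 := hz.derivation_apply (ht.pd (Sum.inl i)) (F (x j))
  have h2 := ht.pd_self (Sum.inl i) (Sum.inl j)
  rw [Sum.elim_inl, Function.comp_apply] at h2
  rw [h2] at h1
  simp only [smul_eq_mul, Sum.inl.injEq] at h1
  rw [Finset.sum_congr rfl fun k _ => mul_comm _ _, ← h1]
  simp only [eq_comm]

end

end

section
open MvPolynomial

section
variable {K L M ι κ : Type*} [Field K] [Field L] [Field M] [Algebra K L] [Algebra K M]

/-- Evaluation of a polynomial in `Y` over `K[X]` at `X = x`, `Y = y`. -/
noncomputable abbrev evalPair (K : Type*) {M ι : Type*} [Field K] [Field M] [Algebra K M]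
    (x : ι → M) (y : M) : Polynomial (MvPolynomial ι K) →+* M :=
  Polynomial.eval₂RingHom (evalAt K x) y

theorem evalPair_C (x : ι → M) (y : M) (p : MvPolynomial ι K) :
    evalPair K x y (Polynomial.C p) = evalAt K x p := by
  simp [evalPair]

theorem map_evalPair (F : L →ₐ[K] M) (x : ι → L) (y : L) (p : Polynomial (MvPolynomial ι K)) :
    F (evalPair K x y p) = evalPair K (F ∘ x) (F y) p := by
  have h1 : (F : L →+* M).comp (evalAt K x) = evalAt K (F ∘ x) := by
    ext <;> simp
  have := Polynomial.hom_eval₂ p (evalAt K x) (F : L →+* M) y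
  rw [h1] at this
  exact this

theorem map_evalAt (F : L →ₐ[K] M) (x : ι → L) (p : MvPolynomial ι K) :
    F (evalAt K x p) = evalAt K (F ∘ x) p := by
  simpa using map_evalPair F x 0 (Polynomial.C p)

/-- The prime divisors of the hypersurface `G = 0` that are not contained in the branch locus. -/
def PrimeDivisors (G : Polynomial (MvPolynomial ι K)) : Set (Ideal (Polynomial (MvPolynomial ι K))) :=
  {P | P.IsPrime ∧ G ∈ P ∧ Polynomial.derivative G ∉ P ∧
    ∃ q, Prime q ∧ P.comap Polynomial.C = Ideal.span {q}}

open scoped Classical in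
/-- A prime generator of a principal prime ideal. -/
noncomputable def primeGen (J : Ideal (MvPolynomial ι K)) : MvPolynomial ι K :=
  if h : ∃ q, Prime q ∧ J = Ideal.span {q} then h.choose else 1

theorem primeGen_ne_zero (J : Ideal (MvPolynomial ι K)) : primeGen J ≠ 0 := by
  unfold primeGen
  split_ifs with h
  exacts [h.choose_spec.1.ne_zero, one_ne_zero]

/-- The polynomial generating the contraction of `P`. -/
noncomputable abbrev contractionGen (P : Ideal (Polynomial (MvPolynomial ι K))) :
    MvPolynomial ι K := primeGen (P.comap Polynomial.C)

theorem contractionGen_spec {G : Polynomial (MvPolynomial ι K)} {P} (hP : P ∈ PrimeDivisors G) :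
    Prime (contractionGen P) ∧ P.comap Polynomial.C = Ideal.span {contractionGen P} := by
  have h := hP.2.2.2
  unfold contractionGen primeGen
  rw [dif_pos h]
  exact h.choose_spec

/-- `N` is the numerator of a differential form with logarithmic pole along `P` only. -/
def IsLogNumerator (G : Polynomial (MvPolynomial ι K)) (c : ℕ)
    (P : Ideal (Polynomial (MvPolynomial ι K))) (j : ι) (N : Polynomial (MvPolynomial ι K)) : Prop :=
  N.natDegree ≤ G.natDegree ∧
    (∀ i, (N.coeff i).totalDegree ≤ (contractionGen P).totalDegree + 2 * c * G.natDegree) ∧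
    N - Polynomial.derivative G * Polynomial.C (pderiv j (contractionGen P)) ∈ P ∧
    ∀ P', P'.IsPrime → G ∈ P' → P'.comap Polynomial.C = Ideal.span {contractionGen P} →
      P' ≠ P → N ∈ P'

open scoped Classical in
/-- A choice of numerator. -/
noncomputable def logNumerator (G : Polynomial (MvPolynomial ι K)) (c : ℕ)
    (P : Ideal (Polynomial (MvPolynomial ι K))) (j : ι) : Polynomial (MvPolynomial ι K) :=
  if h : ∃ N, IsLogNumerator G c P j N then h.choose else 0

theorem logNumerator_spec [Infinite K] [Fintype ι] {G : Polynomial (MvPolynomial ι K)} (hG : G.Monic)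
    {c : ℕ} (hc : ∀ i, (G.coeff i).totalDegree ≤ c * (G.natDegree - i)) {P}
    (hP : P ∈ PrimeDivisors G) (j : ι) : IsLogNumerator G c P j (logNumerator G c P j) := by
  classical
  have h1 := contractionGen_spec hP
  have h : ∃ N, IsLogNumerator G c P j N := exists_derivative_mul_mem hG hc h1.1 hP.1 hP.2.1 h1.2 j
  unfold logNumerator
  rw [dif_pos h]
  exact h.choose_spec

/-- The coefficients of a differential form with logarithmic pole along `P` only. -/
noncomputable def logForm (x : ι → M) (y : M) (G : Polynomial (MvPolynomial ι K)) (c : ℕ)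
    (P : Ideal (Polynomial (MvPolynomial ι K))) (j : ι) : M :=
  evalPair K x y (logNumerator G c P j) /
    (evalAt K x (contractionGen P) * evalPair K x y (Polynomial.derivative G))

theorem map_logForm (F : L →ₐ[K] M) (x : ι → L) (y : L) (G : Polynomial (MvPolynomial ι K)) (c : ℕ)
    (P : Ideal (Polynomial (MvPolynomial ι K))) (j : ι) :
    F (logForm x y G c P j) = logForm (F ∘ x) (F y) G c P j := by
  unfold logForm
  rw [map_div₀, map_mul, map_evalPair, map_evalPair, map_evalAt]

/-- The conditions on a place at which the forms behave well. -/
structure GoodPlace (D : κ → Derivation K M M) (J : ι → κ → M) (x : ι → M) (y : M)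
    (G : Polynomial (MvPolynomial ι K)) (v : ValuationSubring M) : Prop where
  mem : ∀ p, evalPair K x y p ∈ v
  div : DivCentre K x v
  deriv_inv : (evalPair K x y (Polynomial.derivative G))⁻¹ ∈ v
  D_mem : ∀ k, ∀ u ∈ v, D k u ∈ v
  J_mem : ∀ i k, J i k ∈ v

variable [Fintype ι] [Fintype κ] [DecidableEq ι] {D : κ → Derivation K M M} {J : ι → κ → M} {x : ι → M} {y : M}
  {G : Polynomial (MvPolynomial ι K)} {v : ValuationSubring M}

theorem GoodPlace.div_mem [PerfectField K] (h : GoodPlace D J x y G v)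
    (hJ : ∀ i j, ∑ k, J i k * D k (x j) = if i = j then 1 else 0)
    {q : MvPolynomial ι K} (hq : Prime q)
    (hqv : evalAt K x q ∈ v.nonunits) {u : M} (hu : u ∈ v.nonunits) : u / evalAt K x q ∈ v := by
  by_contra hn
  have hu0 : u ≠ 0 := by rintro rfl; simp at hn
  set w := evalAt K x q / u with hw
  have hwv : w ∈ v.nonunits := by
    rw [ValuationSubring.mem_nonunits_iff_or, hw, inv_div]
    exact Or.inr hn
  have hqw : evalAt K x q = u * w := by rw [hw, mul_div_cancel₀ _ hu0]
  have h1 : ∀ k, D k (evalAt K x q) ∈ v.nonunits := by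
    intro k
    rw [hqw, Derivation.leibniz, smul_eq_mul, smul_eq_mul, mul_comm u, mul_comm w]
    exact ValuationSubring.nonunits_add
      (ValuationSubring.nonunits_mul_left (h.D_mem k w (v.nonunits_le hwv)) hu)
      (ValuationSubring.nonunits_mul_left (h.D_mem k u (v.nonunits_le hu)) hwv)
  obtain ⟨i, hi⟩ := hq.exists_not_dvd_pderiv
  refine hi (h.div.2 q _ hq hqv ?_)
  have h2 : ∑ k, J i k * D k (evalAt K x q) = evalAt K x (pderiv i q) := by
    simp_rw [derivation_evalAt, Finset.mul_sum]
    rw [Finset.sum_comm]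
    have h4 : ∀ l, ∑ k, J i k * (evalAt K x (pderiv l q) * D k (x l)) =
        evalAt K x (pderiv l q) * if i = l then 1 else 0 := fun l => by
      rw [← hJ, Finset.mul_sum]
      exact Finset.sum_congr rfl fun k _ => mul_left_comm _ _ _
    rw [Finset.sum_congr rfl fun l _ => h4 l]
    simp
  rw [← h2]
  have h3 : ∀ s : Finset κ, ∑ k ∈ s, J i k * D k (evalAt K x q) ∈ v.nonunits := by
    intro s
    induction s using Finset.cons_induction with
    | empty => simp [ValuationSubring.mem_nonunits_iff_or]
    | cons a s ha hs =>
      rw [Finset.sum_cons]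
      exact ValuationSubring.nonunits_add
        (ValuationSubring.nonunits_mul_left (h.J_mem i a) (h1 a)) hs
  exact h3 _

variable [PerfectField K] [Infinite K]

theorem GoodPlace.logForm_mem (h : GoodPlace D J x y G v)
    (hJ : ∀ i j, ∑ k, J i k * D k (x j) = if i = j then 1 else 0)
    (hG : G.Monic) {c : ℕ} (hc : ∀ i, (G.coeff i).totalDegree ≤ c * (G.natDegree - i))
    (hy : evalPair K x y G = 0) {P} (hP : P ∈ PrimeDivisors G)
    (hne : P ≠ v.centre (evalPair K x y) h.mem) (j : ι) : logForm x y G c P j ∈ v := by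
  obtain ⟨hq, hPq⟩ := contractionGen_spec hP
  obtain ⟨-, -, -, hN⟩ := logNumerator_spec hG hc hP j
  unfold logForm
  rw [div_mul_eq_div_div, div_eq_mul_inv _ (evalPair K x y _)]
  refine v.mul_mem _ _ ?_ h.deriv_inv
  by_cases hqv : evalAt K x (contractionGen P) ∈ v.nonunits
  · refine h.div_mem hJ hq hqv ?_
    rw [← ValuationSubring.mem_centre v _ h.mem]
    refine hN _ inferInstance ?_ ?_ hne.symm
    · rw [ValuationSubring.mem_centre, hy, ValuationSubring.mem_nonunits_iff_or]
      exact Or.inl rfl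
    · ext a
      rw [Ideal.mem_comap, ValuationSubring.mem_centre, evalPair_C, Ideal.mem_span_singleton]
      exact (h.div.mem_valOver hq hqv).2 a
  · rw [div_eq_mul_inv]
    exact v.mul_mem _ _ (h.mem _) (v.inv_mem_of_not_nonunit hqv)

theorem GoodPlace.exists_logForm_sub_mem (h : GoodPlace D J x y G v)
    (hJ : ∀ i j, ∑ k, J i k * D k (x j) = if i = j then 1 else 0)
    (hG : G.Monic) {c : ℕ} (hc : ∀ i, (G.coeff i).totalDegree ≤ c * (G.natDegree - i))
    (hx : Function.Injective (evalAt K x))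
    (hG' : evalPair K x y (Polynomial.derivative G) ≠ 0)
    {P} (hP : P ∈ PrimeDivisors G)
    (he : P = v.centre (evalPair K x y) h.mem) :
    ∃ ε ∈ v.nonunits, ε ≠ 0 ∧ (∀ u ∈ v.nonunits, u / ε ∈ v) ∧
      ∀ k, ∑ j, logForm x y G c P j * D k (x j) - D k ε / ε ∈ v := by
  obtain ⟨hq, hPq⟩ := contractionGen_spec hP
  set q := contractionGen P with hqdef
  have hqv : evalAt K x q ∈ v.nonunits := by
    rw [← evalPair_C (y := y), ← ValuationSubring.mem_centre v _ h.mem, ← he, ← Ideal.mem_comap,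
      hPq]
    exact Ideal.mem_span_singleton_self _
  have hq0 : evalAt K x q ≠ 0 := (map_ne_zero_iff _ hx).2 hq.ne_zero
  refine ⟨evalAt K x q, hqv, hq0, fun u hu => h.div_mem hJ hq hqv hu, fun k => ?_⟩
  rw [derivation_evalAt, Finset.sum_div, ← Finset.sum_sub_distrib]
  refine sum_mem fun j _ => ?_
  obtain ⟨-, -, hN, -⟩ := logNumerator_spec hG hc hP j
  have hj : x j ∈ v := by simpa using h.div.1 (X j)
  have h1 : logForm x y G c P j * D k (x j) - evalAt K x (pderiv j q) * D k (x j) / evalAt K x q =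
      (evalPair K x y (logNumerator G c P j -
        Polynomial.derivative G * Polynomial.C (pderiv j q)) / evalAt K x q) *
      (evalPair K x y (Polynomial.derivative G))⁻¹ * D k (x j) := by
    unfold logForm
    rw [map_sub, map_mul, evalPair_C, ← hqdef]
    field_simp
  rw [h1]
  refine v.mul_mem _ _ (v.mul_mem _ _ (h.div_mem hJ hq hqv ?_) h.deriv_inv) (h.D_mem _ _ hj)
  rw [← ValuationSubring.mem_centre v _ h.mem, ← he]
  exact hN

theorem GoodPlace.sum_logForm (h : GoodPlace D J x y G v)
    (hJ : ∀ i j, ∑ k, J i k * D k (x j) = if i = j then 1 else 0)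
    (hG : G.Monic) {c : ℕ} (hc : ∀ i, (G.coeff i).totalDegree ≤ c * (G.natDegree - i))
    (hx : Function.Injective (evalAt K x)) (hy : evalPair K x y G = 0)
    (hG' : evalPair K x y (Polynomial.derivative G) ≠ 0)
    {I : Finset (Ideal (Polynomial (MvPolynomial ι K)))} (hI : ↑I ⊆ PrimeDivisors G) :
    (v.centre (evalPair K x y) h.mem ∉ I → ∀ k, ∑ j, (∑ P ∈ I, logForm x y G c P j) * D k (x j) ∈ v) ∧
    (v.centre (evalPair K x y) h.mem ∈ I → ∃ ε ∈ v.nonunits, ε ≠ 0 ∧ (∀ u ∈ v.nonunits, u / ε ∈ v) ∧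
      ∀ k, ∑ j, (∑ P ∈ I, logForm x y G c P j) * D k (x j) - D k ε / ε ∈ v) := by
  classical
  have hxv : ∀ j, x j ∈ v := fun j => by simpa using h.div.1 (X j)
  have h1 : ∀ P ∈ PrimeDivisors G, P ≠ v.centre (evalPair K x y) h.mem → ∀ k,
      ∑ j, logForm x y G c P j * D k (x j) ∈ v := fun P hP hne k => sum_mem fun j _ =>
    v.mul_mem _ _ (h.logForm_mem hJ hG hc hy hP hne j) (h.D_mem _ _ (hxv j))
  have h2 : ∀ s : Finset (Ideal (Polynomial (MvPolynomial ι K))), ∀ k,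
      ∑ j, (∑ P ∈ s, logForm x y G c P j) * D k (x j) =
      ∑ P ∈ s, ∑ j, logForm x y G c P j * D k (x j) := by
    intro s k
    simp_rw [Finset.sum_mul]
    rw [Finset.sum_comm]
  refine ⟨fun hn k => ?_, fun hn => ?_⟩
  · rw [h2]
    exact sum_mem fun P hP => h1 P (hI hP) (fun he => hn (he ▸ hP)) k
  · obtain ⟨ε, h3, h4, h5, h6⟩ := h.exists_logForm_sub_mem hJ hG hc hx hG' (hI hn) rfl
    refine ⟨ε, h3, h4, h5, fun k => ?_⟩
    rw [h2, ← Finset.sum_erase_add _ _ hn, add_sub_assoc]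
    refine v.add_mem _ _ (sum_mem fun P hP => ?_) (h6 k)
    exact h1 P (hI (Finset.mem_of_mem_erase hP)) (Finset.ne_of_mem_erase hP) k

end

end

section
open MvPolynomial

section
variable {K L M ι κ : Type*} [Field K] [Field L] [Field M] [Algebra K L] [Algebra K M]

theorem evalPair_mem {x : ι → M} {y : M} {v : ValuationSubring M} (hv : v.Constants K)
    (hx : ∀ i, x i ∈ v) (hy : y ∈ v) (p : Polynomial (MvPolynomial ι K)) : evalPair K x y p ∈ v := by
  rw [evalPair, Polynomial.coe_eval₂RingHom, Polynomial.eval₂_eq_sum_range]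
  exact sum_mem fun i _ => v.mul_mem _ _ (hv.evalAt_mem hx _) (pow_mem hy i)

theorem contractionGen_eq_of_dvd {G : Polynomial (MvPolynomial ι K)} {P P'}
    (hP : P ∈ PrimeDivisors G) (hP' : P' ∈ PrimeDivisors G)
    (h : contractionGen P ∣ contractionGen P') : contractionGen P = contractionGen P' := by
  have h1 := contractionGen_spec hP
  have h2 := contractionGen_spec hP'
  have h3 := (h1.1.irreducible.dvd_irreducible_iff_associated h2.1.irreducible).1 h
  unfold contractionGen
  rw [h1.2, h2.2, Ideal.span_singleton_eq_span_singleton.2 h3]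

theorem pow_mul_evalAt_mem [Fintype ι] [DecidableEq ι] {x : ι → M} {v : ValuationSubring M} {i : ι}
    (hxi : x i ≠ 0) (h : v ∈ ValOver (evalAt K (infChart x i)) (X i)) {p : MvPolynomial ι K} {d : ℕ}
    (hd : p.totalDegree ≤ d) : (x i)⁻¹ ^ d * evalAt K x p ∈ v := by
  have := aeval_swapHom x i hxi p hd
  change _ = (x i)⁻¹ ^ d * evalAt K x p at this
  rw [← this]
  exact h.1 _

theorem inv_pow_mul_evalAt_mem [Fintype ι] [DecidableEq ι] {x : ι → M} {v : ValuationSubring M} {i : ι}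
    (hxi : x i ≠ 0) (h : v ∈ ValOver (evalAt K (infChart x i)) (X i)) {p : MvPolynomial ι K}
    (hp : p ≠ 0) : ((x i)⁻¹ ^ p.totalDegree * evalAt K x p)⁻¹ ∈ v := by
  have := aeval_swapHom x i hxi p le_rfl
  change _ = (x i)⁻¹ ^ _ * evalAt K x p at this
  rw [← this]
  exact v.inv_mem_of_not_nonunit fun hn => not_X_dvd_swapHom i hp ((h.2 _).1 hn)

theorem exists_mul_pow_mem (v : ValuationSubring M) (y : M) (d : ℕ) :
    ∃ b ≠ 0, ∀ m ≤ d, b * y ^ m ∈ v := by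
  by_cases hy : y ∈ v
  · exact ⟨1, one_ne_zero, fun m _ => by rw [one_mul]; exact pow_mem hy m⟩
  · have hy0 : y ≠ 0 := by rintro rfl; exact hy v.zero_mem
    have hi : y⁻¹ ∈ v := (v.mem_or_inv_mem y).resolve_left hy
    refine ⟨y⁻¹ ^ d, pow_ne_zero _ (inv_ne_zero hy0), fun m hm => ?_⟩
    rw [← Nat.sub_add_cancel hm, pow_add, mul_assoc, ← mul_pow, inv_mul_cancel₀ hy0, one_pow, mul_one]
    exact pow_mem hi _

variable [Infinite K] [Fintype ι] [DecidableEq ι]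

theorem exists_mul_logForm_mem {v : ValuationSubring M} (hv : v.Constants K) {x : ι → M} {y : M}
    (hdc : DivCentre K x v ∨ ∃ i, v ∈ ValOver (evalAt K (infChart x i)) (X i))
    (hx : Function.Injective (evalAt K x)) {G : Polynomial (MvPolynomial ι K)} (hG : G.Monic)
    {c : ℕ} (hc : ∀ i, (G.coeff i).totalDegree ≤ c * (G.natDegree - i))
    (hy : evalPair K x y G = 0) (hG' : evalPair K x y (Polynomial.derivative G) ≠ 0) :
    ∃ a ≠ 0, ∀ P ∈ PrimeDivisors G, ∀ j, a * logForm x y G c P j ∈ v := by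
  have hq0 : ∀ P : Ideal (Polynomial (MvPolynomial ι K)), evalAt K x (contractionGen P) ≠ 0 :=
    fun P => (map_ne_zero_iff _ hx).2 (primeGen_ne_zero _)
  rcases hdc with hdc | ⟨i, hi⟩
  · have hxv : ∀ j, x j ∈ v := fun j => by simpa using hdc.1 (X j)
    have hyv : y ∈ v := by
      letI := (evalAt K x).toAlgebra
      exact v.mem_of_isIntegral (A := MvPolynomial ι K) hdc.1 ⟨G, hG, hy⟩
    have hmem := evalPair_mem hv hxv hyv
    have h1 : ∃ a ≠ 0, ∀ P ∈ PrimeDivisors G, a * (evalAt K x (contractionGen P))⁻¹ ∈ v := by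
      by_cases hex : ∃ P0 ∈ PrimeDivisors G, evalAt K x (contractionGen P0) ∈ v.nonunits
      · obtain ⟨P0, hP0, h0⟩ := hex
        refine ⟨_, hq0 P0, fun P hP => ?_⟩
        by_cases hn : evalAt K x (contractionGen P) ∈ v.nonunits
        · rw [contractionGen_eq_of_dvd hP0 hP
            (hdc.2 _ _ (contractionGen_spec hP0).1 h0 hn), mul_inv_cancel₀ (hq0 P)]
          exact v.one_mem
        · exact v.mul_mem _ _ (hdc.1 _) (v.inv_mem_of_not_nonunit hn)
      · push Not at hex
        exact ⟨1, one_ne_zero, fun P hP => by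
          rw [one_mul]; exact v.inv_mem_of_not_nonunit (hex P hP)⟩
    obtain ⟨a, ha, haP⟩ := h1
    refine ⟨a * evalPair K x y (Polynomial.derivative G), mul_ne_zero ha hG', fun P hP j => ?_⟩
    have := v.mul_mem _ _ (haP P hP) (hmem (logNumerator G c P j))
    convert this using 1
    unfold logForm
    have := hq0 P
    field_simp
  · have hxi : x i ≠ 0 := by
      intro h0
      exact X_ne_zero i (hx (show evalAt K x (X i) = evalAt K x 0 by simp [h0]))
    have ht : (x i)⁻¹ ≠ 0 := inv_ne_zero hxi
    obtain ⟨b, hb, hby⟩ := exists_mul_pow_mem v y G.natDegree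
    refine ⟨(x i)⁻¹ ^ (2 * c * G.natDegree) * b * evalPair K x y (Polynomial.derivative G),
      mul_ne_zero (mul_ne_zero (pow_ne_zero _ ht) hb) hG', fun P hP j => ?_⟩
    obtain ⟨hNd, hNt, -, -⟩ := logNumerator_spec hG hc hP j
    have h1 : (x i)⁻¹ ^ ((contractionGen P).totalDegree + 2 * c * G.natDegree) * b *
        evalPair K x y (logNumerator G c P j) ∈ v := by
      rw [evalPair, Polynomial.coe_eval₂RingHom,
        Polynomial.eval₂_eq_sum_range' _ (Nat.lt_succ_of_le hNd), Finset.mul_sum]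
      refine sum_mem fun m hm => ?_
      have h2 := v.mul_mem _ _ (pow_mul_evalAt_mem hxi hi (hNt m))
        (hby m (Nat.lt_succ_iff.1 (Finset.mem_range.1 hm)))
      convert h2 using 1
      ring
    have h3 := v.mul_mem _ _ h1 (inv_pow_mul_evalAt_mem hxi hi (primeGen_ne_zero (P.comap Polynomial.C)))
    convert h3 using 1
    unfold logForm
    have := hq0 P
    rw [pow_add]
    field_simp

theorem FinSepOver.exists_goodPlace [Fintype κ] {z : κ → M}
    (hz : FinSepOver (evalAt K z)) (J : ι → κ → M) {x : ι → M}
    (hx : Function.Injective (evalAt K x)) (y : M)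
    (G : Polynomial (MvPolynomial ι K)) :
    ∃ b : MvPolynomial κ K, b ≠ 0 ∧ ∀ ρ, Prime ρ → ¬ ρ ∣ b → ∀ v ∈ ValOver (evalAt K z) ρ,
      (DivCentre K x v ∨ ∃ i, v ∈ ValOver (evalAt K (_root_.infChart x i)) (X i)) →
      GoodPlace hz.pd J x y G v := by
  classical
  obtain ⟨b1, hb1, h1⟩ := hz.exists_pd_mem
  let U : Set M := (Set.range x ∪ {y, (evalPair K x y (Polynomial.derivative G))⁻¹}) ∪
    Set.range fun s : ι × κ => J s.1 s.2
  obtain ⟨b2, hb2, h2⟩ := hz.exists_forall_mem (U := U)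
    (((Set.finite_range x).union (by simp)).union (Set.finite_range _))
  refine ⟨b1 * b2, mul_ne_zero hb1 hb2, fun ρ hρ hρb v hv hdc => ?_⟩
  have hd1 := h1 ρ hρ (fun h => hρb (h.mul_right b2)) v hv
  have hd2 := h2 ρ (fun h => hρb (h.mul_left b1)) v hv
  have hxv : ∀ i, x i ∈ v := fun i => hd2 _ (Or.inl (Or.inl ⟨i, rfl⟩))
  refine ⟨evalPair_mem (constants_of_valOver hv) hxv (hd2 _ (Or.inl (Or.inr (by simp)))), ?_,
    hd2 _ (Or.inl (Or.inr (by simp))), hd1, fun i k => hd2 _ (Or.inr ⟨(i, k), rfl⟩)⟩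
  rcases hdc with hdc | ⟨i, hi⟩
  · exact hdc
  · have h3 : (x i)⁻¹ ∈ v.nonunits := by
      have := (hi.2 (X i)).2 dvd_rfl
      simpa [_root_.infChart] using this
    rcases (v.mem_nonunits_iff_or).1 h3 with h4 | h4
    · refine absurd (hx (show evalAt K x (X i) = evalAt K x 0 from ?_)) (X_ne_zero i)
      rw [map_zero]
      simpa using h4
    · exact absurd (by simpa using hxv i) h4

end

end

section
open MvPolynomial

section
variable {K L M ι κ : Type*} [Field K] [Field L] [Field M] [Algebra K L] [Algebra K M]

theorem ValuationSubring.exists_mem_of_mul_mem (v : ValuationSubring M) {a : M} (ha : a ≠ 0) :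
    ∃ b ≠ 0, b ∈ v ∧ ∀ u, a * u ∈ v → b * u ∈ v := by
  by_cases hav : a ∈ v
  · exact ⟨a, ha, hav, fun u hu => hu⟩
  · refine ⟨1, one_ne_zero, v.one_mem, fun u hu => ?_⟩
    have := v.mul_mem _ _ ((v.mem_or_inv_mem a).resolve_left hav) hu
    rwa [inv_mul_cancel_left₀ ha, ← one_mul u] at this

theorem ValuationSubring.exists_forall_mul_mem (v : ValuationSubring M) (s : Finset M) :
    ∃ b ≠ 0, b ∈ v ∧ ∀ w ∈ s, b * w ∈ v := by
  classical
  induction s using Finset.induction_on with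
  | empty => exact ⟨1, one_ne_zero, v.one_mem, by simp⟩
  | insert w s _ ih =>
    obtain ⟨b, hb0, hb, hs⟩ := ih
    obtain ⟨a, ha0, ha⟩ : ∃ a ≠ 0, a * w ∈ v := by
      by_cases hw : w = 0
      · exact ⟨1, one_ne_zero, by simp [hw]⟩
      · exact ⟨w⁻¹, inv_ne_zero hw, by rw [inv_mul_cancel₀ hw]; exact v.one_mem⟩
    obtain ⟨a', ha0', hav, ha'⟩ := v.exists_mem_of_mul_mem ha0
    refine ⟨a' * b, mul_ne_zero ha0' hb0, v.mul_mem _ _ hav hb, fun u hu => ?_⟩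
    rcases Finset.mem_insert.1 hu with rfl | hu
    · rw [mul_right_comm]; exact v.mul_mem _ _ (ha' _ ha) hb
    · rw [mul_assoc]; exact v.mul_mem _ _ hav (hs u hu)

/-- Pull back of differential forms along a morphism, in coordinates. -/
noncomputable def pullForm [Fintype ι] (D : κ → Derivation K M M) (F : L →ₐ[K] M) (x : ι → L) :
    (ι → L) →ₗ[K] (κ → M) where
  toFun η k := ∑ j, F (η j) * D k (F (x j))
  map_add' η η' := by
    ext k
    simp [add_mul, Finset.sum_add_distrib]
  map_smul' c η := by
    ext k
    simp [Finset.smul_sum]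

theorem pullForm_apply [Fintype ι] (D : κ → Derivation K M M) (F : L →ₐ[K] M) (x : ι → L)
    (η : ι → L) (k : κ) : pullForm D F x η k = ∑ j, F (η j) * D k (F (x j)) := rfl

theorem pullForm_sum_logForm [Fintype ι] (D : κ → Derivation K M M) (F : L →ₐ[K] M) (x : ι → L)
    (y : L) (G : Polynomial (MvPolynomial ι K)) (c : ℕ)
    (I : Finset (Ideal (Polynomial (MvPolynomial ι K)))) (k : κ) :
    pullForm D F x (∑ P ∈ I, logForm x y G c P) k =
      ∑ j, (∑ P ∈ I, logForm (F ∘ x) (F y) G c P j) * D k ((F ∘ x) j) := by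
  rw [pullForm_apply]
  refine Finset.sum_congr rfl fun j _ => ?_
  rw [Finset.sum_apply, map_sum]
  simp_rw [map_logForm]
  rfl

theorem dlog_sub_dlog_mem {D : Derivation K M M} {v : ValuationSubring M} (hD : ∀ u ∈ v, D u ∈ v)
    {a b : M} (ha : a ≠ 0) (hb : b ≠ 0) (hab : a / b ∈ v) (hba : b / a ∈ v) :
    D a / a - D b / b ∈ v := by
  have h1 : D a = a / b * D b + b * D (a / b) := by
    have := D.leibniz (a / b) b
    rwa [div_mul_cancel₀ _ hb] at this
  have h2 : D a / a - D b / b = D (a / b) * (b / a) := by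
    rw [h1]; field_simp; ring
  rw [h2]
  exact v.mul_mem _ _ (hD _ hab) hba

theorem FinSepOver.exists_finiteDimensional_logForm [Infinite K] [PerfectField K]
    [Fintype ι] [DecidableEq ι] [Fintype κ] [DecidableEq κ] {z : κ → M}
    (hz : FinSepOver (evalAt K z)) (i0 : κ) {x : ι → L} (hx : Function.Injective (evalAt K x))
    {y : L} {G : Polynomial (MvPolynomial ι K)} (hG : G.Monic) {c : ℕ}
    (hc : ∀ i, (G.coeff i).totalDegree ≤ c * (G.natDegree - i))
    (hy : evalPair K x y G = 0) (hG' : evalPair K x y (Polynomial.derivative G) ≠ 0)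
    {F : Fin 2 → L →ₐ[K] M}
    (hJ : ∀ s, ∃ J : ι → κ → M, ∀ i j, ∑ k, J i k * hz.pd k (F s (x j)) = if i = j then 1 else 0)
    (hadapt : ∀ s, ∀ v ∈ Places K z i0, DivCentre K (F s ∘ x) v ∨
      ∃ i, v ∈ ValOver (evalAt K (_root_.infChart (F s ∘ x) i)) (X i))
    {𝓘 : Set (Finset (Ideal (Polynomial (MvPolynomial ι K))))}
    (h𝓘 : ∀ I ∈ 𝓘, (I : Set (Ideal (Polynomial (MvPolynomial ι K)))) ⊆ PrimeDivisors G)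
    {H : MvPolynomial κ K} (hH : H ≠ 0)
    (hcomp : ∀ ρ, Prime ρ → ¬ ρ ∣ H → ∀ v ∈ ValOver (evalAt K z) ρ,
      ∀ h : ∀ s p, evalPair K (F s ∘ x) (F s y) p ∈ v, ∀ I ∈ 𝓘,
        v.centre _ (h 0) ∈ I ↔ v.centre _ (h 1) ∈ I) :
    ∃ W : Submodule K M, FiniteDimensional K W ∧ ∀ I ∈ 𝓘, ∀ k,
      pullForm hz.pd (F 0) x (∑ P ∈ I, logForm x y G c P) k -
      pullForm hz.pd (F 1) x (∑ P ∈ I, logForm x y G c P) k ∈ W := by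
  classical
  choose J hJ using hJ
  have hxF : ∀ s, Function.Injective (evalAt K (F s ∘ x)) := fun s p q h => by
    rw [← map_evalAt, ← map_evalAt] at h
    exact hx ((F s).injective h)
  have hyF : ∀ s, evalPair K (F s ∘ x) (F s y) G = 0 := fun s => by
    rw [← map_evalPair, hy, map_zero]
  have hGF : ∀ s, evalPair K (F s ∘ x) (F s y) (Polynomial.derivative G) ≠ 0 := fun s => by
    rw [← map_evalPair]
    exact (map_ne_zero_iff _ (F s).injective).2 hG'
  choose b hb0 hb using fun s => hz.exists_goodPlace (J s) (hxF s) (F s y) G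
  have hconst : ∀ v ∈ Places K z i0, v.Constants K := by
    rintro v (⟨ρ, -, hv⟩ | hv)
    exacts [constants_of_valOver hv, constants_of_valOver hv]
  have hbd : ∀ v : ValuationSubring M, ∃ a ≠ 0, v ∈ Places K z i0 → ∀ I ∈ 𝓘, ∀ k,
      a * (pullForm hz.pd (F 0) x (∑ P ∈ I, logForm x y G c P) k -
      pullForm hz.pd (F 1) x (∑ P ∈ I, logForm x y G c P) k) ∈ v := by
    intro v
    by_cases hv : v ∈ Places K z i0
    · have h1 : ∀ s, ∃ a ≠ 0, a ∈ v ∧ ∀ I ∈ 𝓘, ∀ k,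
          a * pullForm hz.pd (F s) x (∑ P ∈ I, logForm x y G c P) k ∈ v := by
        intro s
        obtain ⟨a, ha, haP⟩ := exists_mul_logForm_mem (hconst v hv) (hadapt s v hv) (hxF s) hG hc
          (hyF s) (hGF s)
        obtain ⟨a', ha0', hav, ha'⟩ := v.exists_mem_of_mul_mem ha
        obtain ⟨d, hd0, hdv, hd⟩ := v.exists_forall_mul_mem
          (Finset.univ.image fun s' : ι × κ => hz.pd s'.2 ((F s ∘ x) s'.1))
        refine ⟨a' * d, mul_ne_zero ha0' hd0, v.mul_mem _ _ hav hdv, fun I hI k => ?_⟩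
        rw [pullForm_sum_logForm, Finset.mul_sum]
        refine sum_mem fun j _ => ?_
        rw [mul_mul_mul_comm, Finset.mul_sum]
        refine v.mul_mem _ _ (sum_mem fun P hP => ha' _ (haP P (h𝓘 I hI hP) j)) (hd _ ?_)
        exact Finset.mem_image.2 ⟨(j, k), Finset.mem_univ _, rfl⟩
      choose a ha0 hav ha using h1
      refine ⟨a 0 * a 1, mul_ne_zero (ha0 0) (ha0 1), fun _ I hI k => ?_⟩
      rw [mul_sub]
      refine sub_mem ?_ ?_
      · rw [mul_right_comm]; exact v.mul_mem _ _ (ha 0 I hI k) (hav 1)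
      · rw [mul_assoc]; exact v.mul_mem _ _ (hav 0) (ha 1 I hI k)
    · exact ⟨1, one_ne_zero, fun h => absurd h hv⟩
  choose a ha0 ha using hbd
  have hB : H * (b 0 * b 1) ≠ 0 := mul_ne_zero hH (mul_ne_zero (hb0 0) (hb0 1))
  obtain ⟨W, hW, hWu⟩ := exists_finiteDimensional_of_bounded hz i0 hB ha0
  refine ⟨W, hW, fun I hI k => hWu _ (fun ρ hρ v hv => ⟨fun hρB => ?_, fun _ => ?_⟩) fun v hv =>
    ha v (Or.inr hv) I hI k⟩
  · have hpl : v ∈ Places K z i0 := Or.inl ⟨ρ, hρ, hv⟩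
    have hgood : ∀ s, GoodPlace hz.pd (J s) (F s ∘ x) (F s y) G v := fun s =>
      hb s ρ hρ (fun h => hρB (by
        refine Dvd.dvd.mul_left ?_ _
        fin_cases s
        exacts [h.mul_right _, h.mul_left _])) v hv (hadapt s v hpl)
    have hiff := hcomp ρ hρ (fun h => hρB (h.mul_right _)) v hv (fun s => (hgood s).mem) I hI
    have hs := fun s => (hgood s).sum_logForm (hJ s) hG hc (hxF s) (hyF s) (hGF s) (h𝓘 I hI)
    rw [pullForm_sum_logForm, pullForm_sum_logForm]
    by_cases h0 : v.centre _ (hgood 0).mem ∈ I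
    · obtain ⟨ε, h1, h2, h3, h4⟩ := (hs 0).2 h0
      obtain ⟨ε', h1', h2', h3', h4'⟩ := (hs 1).2 (hiff.1 h0)
      have h5 := dlog_sub_dlog_mem ((hgood 0).D_mem k) h2 h2' (h3' _ h1) (h3 _ h1')
      have h6 := v.add_mem _ _ (sub_mem (h4 k) (h4' k)) h5
      convert h6 using 1
      ring
    · exact sub_mem ((hs 0).1 h0 k) ((hs 1).1 (fun h => h0 (hiff.2 h)) k)
  · exact ha v (Or.inl ⟨ρ, hρ, hv⟩) I hI k

end

end

section
open MvPolynomial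

section
variable {K L ι : Type*} [Field K] [Field L] [Algebra K L]

theorem finite_primeDivisors_dvd [Finite ι] {G : Polynomial (MvPolynomial ι K)} (hG : G.Monic)
    {Q : MvPolynomial ι K} (hQ : Q ≠ 0) :
    {P | P ∈ PrimeDivisors G ∧ contractionGen P ∣ Q}.Finite := by
  have hfin := Ideal.finite_minimalPrimes_of_isNoetherianRing (Polynomial (MvPolynomial ι K))
    (Ideal.span {G, Polynomial.C Q})
  refine hfin.subset ?_
  rintro P ⟨hP, hPQ⟩
  obtain ⟨hq, hPq⟩ := contractionGen_spec hP
  haveI := hP.1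
  have hQP : Polynomial.C Q ∈ P := by
    have : Q ∈ P.comap Polynomial.C := by rwa [hPq, Ideal.mem_span_singleton]
    exact this
  refine ⟨⟨hP.1, ?_⟩, ?_⟩
  · rw [Ideal.span_le]
    rintro _ (rfl | rfl)
    exacts [hP.2.1, hQP]
  · rintro P' ⟨hP', hle⟩ hP'P
    haveI := hP'
    by_contra hcon
    have hlt : P' < P := lt_of_le_not_ge hP'P hcon
    obtain ⟨r, hrP, hrP'⟩ := Set.exists_of_ssubset hlt
    have hGP' : G ∈ P' := hle (Ideal.subset_span (by simp))
    have hQP' : Polynomial.C Q ∈ P' := hle (Ideal.subset_span (by simp))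
    have hlt' : P'.comap (Polynomial.C : MvPolynomial ι K →+* _) < P.comap Polynomial.C := by
      haveI : Module.Finite (MvPolynomial ι K) (AdjoinRoot G) := hG.finite_adjoinRoot
      obtain ⟨g, hgm, hg⟩ := Algebra.IsIntegral.isIntegral (R := MvPolynomial ι K) (AdjoinRoot.mk G r)
      refine Ideal.comap_lt_comap_of_root_mem_sdiff (p := g) hP'P ⟨hrP, hrP'⟩
        (Polynomial.map_monic_ne_zero hgm) (P'.mem_of_dvd ?_ hGP')
      rw [← AdjoinRoot.mk_eq_zero, Polynomial.hom_eval₂, ← hg]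
      rfl
    obtain ⟨q', hq'1, hq'2⟩ : ∃ q', Prime q' ∧ q' ∈ P'.comap (Polynomial.C : MvPolynomial ι K →+* _) := by
      have := Ideal.IsPrime.exists_mem_prime_of_ne_bot (I := P'.comap (Polynomial.C : MvPolynomial ι K →+* _)) inferInstance
        (fun h => hQ (by rw [← Ideal.mem_bot, ← h]; exact hQP'))
      obtain ⟨q', h1, h2⟩ := this
      exact ⟨q', h2, h1⟩
    have h3 : contractionGen P ∣ q' := by
      rw [← Ideal.mem_span_singleton, ← hPq]
      exact hlt'.le hq'2
    have h4 := (hq.irreducible.dvd_irreducible_iff_associated hq'1.irreducible).1 h3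
    refine hlt'.not_ge ?_
    rw [hPq, Ideal.span_singleton_eq_span_singleton.2 h4, Ideal.span_le]
    simpa using hq'2

theorem exists_common_denominator {x : ι → L} {y : L}
    (hx : Function.Injective (evalAt K x))
    (hden : ∀ u : L, ∃ b : MvPolynomial ι K, b ≠ 0 ∧ ∃ p, evalAt K x b * u = evalPair K x y p)
    {σ : Type*} [Finite σ] {W : Submodule K (σ → L)} (hW : W.FG) :
    ∃ Q : MvPolynomial ι K, Q ≠ 0 ∧ ∀ η ∈ W, ∀ j, ∃ p, evalAt K x Q * η j = evalPair K x y p := by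
  classical
  cases nonempty_fintype σ
  choose b hb p hp using hden
  induction W, hW using Submodule.fg_induction with
  | singleton η =>
    refine ⟨∏ j, b (η j), Finset.prod_ne_zero_iff.2 fun j _ => hb _, fun η' hη' j => ?_⟩
    obtain ⟨a, rfl⟩ := Submodule.mem_span_singleton.1 hη'
    refine ⟨Polynomial.C (C a * ∏ i ∈ Finset.univ.erase j, b (η i)) * p (η j), ?_⟩
    rw [map_mul, ← hp, evalPair_C, ← Finset.mul_prod_erase _ _ (Finset.mem_univ j), map_mul, map_mul,
      Pi.smul_apply, Algebra.smul_def]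
    have : evalAt K x (C a) = algebraMap K L a := by simp
    rw [this]
    ring
  | sup W₁ W₂ _ _ h₁ h₂ =>
    obtain ⟨Q₁, hQ₁, h₁⟩ := h₁
    obtain ⟨Q₂, hQ₂, h₂⟩ := h₂
    refine ⟨Q₁ * Q₂, mul_ne_zero hQ₁ hQ₂, fun η hη j => ?_⟩
    obtain ⟨η₁, hη₁, η₂, hη₂, rfl⟩ := Submodule.mem_sup.1 hη
    obtain ⟨p₁, hp₁⟩ := h₁ η₁ hη₁ j
    obtain ⟨p₂, hp₂⟩ := h₂ η₂ hη₂ j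
    refine ⟨Polynomial.C Q₂ * p₁ + Polynomial.C Q₁ * p₂, ?_⟩
    rw [map_add, map_mul (evalPair K x y), map_mul (evalPair K x y), ← hp₁, ← hp₂, evalPair_C,
      evalPair_C, map_mul, Pi.add_apply]
    ring

theorem infinite_of_logForm [Infinite K] [PerfectField K] [Fintype ι] {x : ι → L} {y : L}
    (hx : Function.Injective (evalAt K x))
    {G : Polynomial (MvPolynomial ι K)} (hG : G.Monic) {c : ℕ}
    (hc : ∀ i, (G.coeff i).totalDegree ≤ c * (G.natDegree - i))
    (hker : ∀ p, evalPair K x y p = 0 ↔ G ∣ p)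
    (hG' : evalPair K x y (Polynomial.derivative G) ≠ 0)
    (hden : ∀ u : L, ∃ b : MvPolynomial ι K, b ≠ 0 ∧ ∃ p, evalAt K x b * u = evalPair K x y p)
    {𝓘 : Set (Finset (Ideal (Polynomial (MvPolynomial ι K))))}
    (h𝓘 : ∀ I ∈ 𝓘, (I : Set (Ideal (Polynomial (MvPolynomial ι K)))) ⊆ PrimeDivisors G)
    (hinf : {P | ∃ I ∈ 𝓘, P ∈ I}.Infinite) {W : Submodule K (ι → L)}
    (hW : ∀ I ∈ 𝓘, ∑ P ∈ I, logForm x y G c P ∈ W) : ¬ W.FG := by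
  classical
  intro hfg
  obtain ⟨Q, hQ0, hQ⟩ := exists_common_denominator hx hden hfg
  obtain ⟨P₁, ⟨I, hI, hP₁I⟩, hP₁⟩ := hinf.exists_notMem_finite (finite_primeDivisors_dvd hG hQ0)
  have hPD := h𝓘 I hI
  have hP₁D := hPD hP₁I
  have hq₁Q : ¬ contractionGen P₁ ∣ Q := fun h => hP₁ ⟨hP₁D, h⟩
  obtain ⟨hq₁, hPq₁⟩ := contractionGen_spec hP₁D
  haveI := hP₁D.1
  set q₁ := contractionGen P₁ with hq₁def
  have hmemP₁ : ∀ a, Polynomial.C a ∈ P₁ ↔ q₁ ∣ a := fun a => by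
    rw [← Ideal.mem_span_singleton, ← hPq₁, Ideal.mem_comap]
  set T := (I.image contractionGen).erase q₁ with hT
  set cof : Ideal (Polynomial (MvPolynomial ι K)) → MvPolynomial ι K := fun P =>
    if contractionGen P = q₁ then ∏ q ∈ T, q else q₁ * ∏ q ∈ T.erase (contractionGen P), q with hcof
  have hcofmul : ∀ P ∈ I, cof P * contractionGen P = q₁ * ∏ q ∈ T, q := by
    intro P hP
    simp only [hcof]
    split_ifs with h
    · rw [h, mul_comm]
    · rw [mul_assoc, mul_comm (∏ q ∈ _, q), Finset.mul_prod_erase (f := fun q => q) T]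
      exact Finset.mem_erase.2 ⟨h, Finset.mem_image_of_mem _ hP⟩
  have hTq : ¬ q₁ ∣ ∏ q ∈ T, q := by
    intro h
    obtain ⟨q, hqT, hq⟩ := (hq₁.dvd_finsetProd_iff _).1 h
    obtain ⟨hne, hqI⟩ := Finset.mem_erase.1 hqT
    obtain ⟨P, hP, rfl⟩ := Finset.mem_image.1 hqI
    exact hne (contractionGen_eq_of_dvd hP₁D (hPD hP) hq).symm
  obtain ⟨j, hj⟩ := hq₁.exists_not_dvd_pderiv
  obtain ⟨p, hp⟩ := hQ _ (hW I hI) j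
  have hspec := fun P (hP : P ∈ I) => logNumerator_spec hG hc (hPD hP) j
  -- polynomial identity modulo `G`
  have hid : G ∣ Polynomial.C (q₁ * ∏ q ∈ T, q) * Polynomial.derivative G * p -
      ∑ P ∈ I, Polynomial.C (Q * cof P) * logNumerator G c P j := by
    rw [← hker, map_sub, sub_eq_zero, map_mul, ← hp, map_sum, Finset.sum_apply, Finset.mul_sum,
      Finset.mul_sum]
    refine Finset.sum_congr rfl fun P hP => ?_
    have h0 : evalAt K x (contractionGen P) ≠ 0 := by
      rw [Ne, map_eq_zero_iff _ hx]
      exact primeGen_ne_zero _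
    rw [map_mul (evalPair K x y), map_mul (evalPair K x y), evalPair_C, evalPair_C, ← hcofmul P hP,
      logForm, map_mul, map_mul]
    field_simp
  have hGP : G ∈ P₁ := hP₁D.2.1
  have h1 := P₁.mem_of_dvd hid hGP
  have h2 : ∑ P ∈ I, Polynomial.C (Q * cof P) * logNumerator G c P j ∈ P₁ := by
    rw [← Ideal.neg_mem_iff, ← Ideal.add_mem_iff_right (a := _) P₁ (?_), ← sub_eq_add_neg]
    · exact h1
    · exact Ideal.mul_mem_right _ _ (Ideal.mul_mem_right _ _ ((hmemP₁ _).2 (dvd_mul_right _ _)))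
  rw [← Finset.add_sum_erase _ _ hP₁I] at h2
  have h3 := (Ideal.add_mem_iff_left _ (Ideal.sum_mem _ fun P hP => ?_)).1 h2
  · rcases ‹P₁.IsPrime›.mem_or_mem h3 with h | h
    · rw [hmemP₁] at h
      have hc1 : cof P₁ = ∏ q ∈ T, q := by simp [hcof, ← hq₁def]
      rw [hc1] at h
      exact (hq₁.dvd_or_dvd h).elim hq₁Q hTq
    · have h4 := P₁.sub_mem h (hspec P₁ hP₁I).2.2.1
      rw [sub_sub_cancel] at h4
      rcases ‹P₁.IsPrime›.mem_or_mem h4 with h | h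
      · exact hP₁D.2.2.1 h
      · exact hj ((hmemP₁ _).1 h)
  · obtain ⟨hne, hPI⟩ := Finset.mem_erase.1 hP
    by_cases hc : contractionGen P = q₁
    · refine Ideal.mul_mem_left _ _ ((hspec P hPI).2.2.2 P₁ hP₁D.1 hGP ?_ hne.symm)
      rw [hc, hPq₁]
    · refine Ideal.mul_mem_right _ _ ((hmemP₁ _).2 (Dvd.dvd.mul_left ?_ _))
      simp only [hcof, if_neg hc]
      exact dvd_mul_right _ _
end

end

section
open MvPolynomial

section
variable {K L M ι κ : Type*} [Field K] [Field L] [Field M] [Algebra K L] [Algebra K M]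

open scoped Classical in
theorem LinearIndependent.exists_dual [Fintype ι] {b : Set (ι → L)}
    (hb : LinearIndependent L ((↑) : b → ι → L)) (i : b) :
    ∃ e : ι → L, ∀ i' : b, ∑ l, e l * (i' : ι → L) l = if i' = i then 1 else 0 := by
  obtain ⟨g, hg⟩ := LinearMap.exists_leftInverse_of_injective (Finsupp.linearCombination L ((↑) : b → ι → L))
    (LinearMap.ker_eq_bot.2 hb)
  refine ⟨fun l => g (Pi.single l 1) i, fun i' => ?_⟩
  have h1 : g (i' : ι → L) = Finsupp.single i' 1 := by
    have := LinearMap.congr_fun hg (Finsupp.single i' 1)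
    simpa using this
  have h2 : (i' : ι → L) = ∑ l, (i' : ι → L) l • Pi.single l (1 : L) := by
    ext m
    simp [Finset.sum_apply, Pi.single_apply]
  have h3 := congrArg (fun f => f i) h1
  rw [h2] at h3
  simp only [map_sum, map_smul, Finsupp.coe_finsetSum, Finset.sum_apply, Finsupp.smul_apply, smul_eq_mul,
    Finsupp.single_apply] at h3
  rw [← h3]
  exact Finset.sum_congr rfl fun _ _ => mul_comm _ _

theorem exists_map_eq_of_pullForm_eq [Fintype ι] [DecidableEq ι] [Fintype κ]
    {D : κ → Derivation K M M} {F₀ F₁ : L →ₐ[K] M} {x : ι → L} {J : ι → κ → M}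
    (hJ : ∀ i j, ∑ k, J i k * D k (F₀ (x j)) = if i = j then 1 else 0)
    {U : Submodule K (ι → L)} (hU : ¬ U.FG)
    (h : ∀ η ∈ U, pullForm D F₀ x η = pullForm D F₁ x η) :
    ∃ g : L, g ∉ Set.range (algebraMap K L) ∧ F₀ g = F₁ g := by
  classical
  obtain ⟨b, hbU, hspan, hb⟩ := exists_linearIndependent L (U : Set (ι → L))
  have hbfin : b.Finite := by
    haveI := hb.finite
    exact Set.toFinite b
  haveI : Fintype b := hbfin.fintype
  obtain ⟨u₀, hu₀U, hu₀⟩ : ∃ u ∈ U, u ∉ Submodule.span K b := by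
    by_contra! hcon
    refine hU ?_
    have : U = Submodule.span K b := le_antisymm hcon (Submodule.span_le.2 hbU)
    rw [this]
    exact Submodule.fg_span hbfin
  have hu₀s : u₀ ∈ Submodule.span L (Set.range ((↑) : b → ι → L)) := by
    rw [Subtype.range_coe, hspan]
    exact Submodule.subset_span hu₀U
  obtain ⟨c, hc⟩ := (Submodule.mem_span_range_iff_exists_fun L).1 hu₀s
  have key : ∀ i, F₀ (c i) = F₁ (c i) := by
    intro i
    have hpull : ∀ F : L →ₐ[K] M, ∀ k, pullForm D F x u₀ k =
        ∑ i', F (c i') * pullForm D F x (i' : ι → L) k := by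
      intro F k
      simp_rw [pullForm_apply, ← hc, Finset.sum_apply, Pi.smul_apply, smul_eq_mul, map_sum, map_mul,
        Finset.sum_mul, Finset.mul_sum]
      rw [Finset.sum_comm]
      exact Finset.sum_congr rfl fun _ _ => Finset.sum_congr rfl fun _ _ => mul_assoc _ _ _
    have h1 : ∀ k, ∑ i', (F₀ (c i') - F₁ (c i')) * pullForm D F₀ x (i' : ι → L) k = 0 := by
      intro k
      simp_rw [sub_mul, Finset.sum_sub_distrib]
      rw [sub_eq_zero, ← hpull, h u₀ hu₀U, hpull]
      exact Finset.sum_congr rfl fun i' _ => by rw [h _ (hbU i'.2)]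
    have hinv : ∀ (η : ι → L) l, ∑ k, J l k * pullForm D F₀ x η k = F₀ (η l) := by
      intro η l
      simp_rw [pullForm_apply, Finset.mul_sum]
      rw [Finset.sum_comm]
      have : ∀ j, ∑ k, J l k * (F₀ (η j) * D k (F₀ (x j))) = F₀ (η j) * if l = j then 1 else 0 := by
        intro j
        rw [← hJ, Finset.mul_sum]
        exact Finset.sum_congr rfl fun _ _ => mul_left_comm _ _ _
      rw [Finset.sum_congr rfl fun j _ => this j]
      simp
    have h2 : ∀ l, ∑ i', (F₀ (c i') - F₁ (c i')) * F₀ ((i' : ι → L) l) = 0 := by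
      intro l
      simp_rw [← hinv, Finset.mul_sum]
      rw [Finset.sum_comm]
      refine Finset.sum_eq_zero fun k _ => ?_
      rw [← mul_zero (J l k), ← h1 k, Finset.mul_sum]
      exact Finset.sum_congr rfl fun _ _ => mul_left_comm _ _ _
    obtain ⟨e, he⟩ := hb.exists_dual i
    have h3 : ∑ i', (F₀ (c i') - F₁ (c i')) * F₀ (∑ l, e l * (i' : ι → L) l) = 0 := by
      simp_rw [map_sum, map_mul, Finset.mul_sum]
      rw [Finset.sum_comm]
      refine Finset.sum_eq_zero fun l _ => ?_
      rw [← mul_zero (F₀ (e l)), ← h2 l, Finset.mul_sum]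
      exact Finset.sum_congr rfl fun _ _ => mul_left_comm _ _ _
    simp_rw [he] at h3
    simpa [sub_eq_zero] using h3
  by_contra! hcon
  have hcK : ∀ i, ∃ a, algebraMap K L a = c i := fun i => by
    by_contra h
    exact hcon (c i) h (key i)
  choose a ha using hcK
  refine hu₀ ?_
  rw [← hc]
  refine Submodule.sum_mem _ fun i _ => ?_
  rw [← ha, algebraMap_smul]
  exact Submodule.smul_mem _ _ (Submodule.subset_span i.2)

theorem Polynomial.exists_totalDegree_coeff_le (G : Polynomial (MvPolynomial ι K)) (hG : G.Monic) :
    ∃ c, ∀ i, (G.coeff i).totalDegree ≤ c * (G.natDegree - i) := by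
  classical
  refine ⟨∑ i ∈ Finset.range G.natDegree, (G.coeff i).totalDegree, fun i => ?_⟩
  rcases lt_trichotomy i G.natDegree with h | h | h
  · calc _ ≤ ∑ i ∈ Finset.range G.natDegree, (G.coeff i).totalDegree :=
          Finset.single_le_sum (f := fun i => (G.coeff i).totalDegree) (fun _ _ => zero_le)
            (Finset.mem_range.2 h)
      _ ≤ _ := Nat.le_mul_of_pos_right _ (by lia)
  · rw [h, hG.coeff_natDegree]; simp
  · rw [Polynomial.coeff_eq_zero_of_natDegree_lt h]; simp

/-- If two morphisms pull back infinitely many prime divisors compatibly then they agree on a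
nonconstant function. -/
theorem FinSepOver.exists_map_eq_of_adapted [Infinite K] [PerfectField K]
    [Fintype ι] [DecidableEq ι] [Fintype κ] [DecidableEq κ] {z : κ → M}
    (hz : FinSepOver (evalAt K z)) (i0 : κ) {x : ι → L} (hx : Function.Injective (evalAt K x))
    {y : L} {G : Polynomial (MvPolynomial ι K)} (hG : G.Monic)
    (hker : ∀ p, evalPair K x y p = 0 ↔ G ∣ p)
    (hG' : evalPair K x y (Polynomial.derivative G) ≠ 0)
    (hden : ∀ u : L, ∃ b : MvPolynomial ι K, b ≠ 0 ∧ ∃ p, evalAt K x b * u = evalPair K x y p)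
    {F : Fin 2 → L →ₐ[K] M}
    (hJ : ∀ s, ∃ J : ι → κ → M, ∀ i j, ∑ k, J i k * hz.pd k (F s (x j)) = if i = j then 1 else 0)
    (hadapt : ∀ s, ∀ v ∈ Places K z i0, DivCentre K (F s ∘ x) v ∨
      ∃ i, v ∈ ValOver (evalAt K (_root_.infChart (F s ∘ x) i)) (X i))
    {𝓘 : Set (Finset (Ideal (Polynomial (MvPolynomial ι K))))}
    (h𝓘 : ∀ I ∈ 𝓘, (I : Set (Ideal (Polynomial (MvPolynomial ι K)))) ⊆ PrimeDivisors G)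
    (hinf : {P | ∃ I ∈ 𝓘, P ∈ I}.Infinite)
    {H : MvPolynomial κ K} (hH : H ≠ 0)
    (hcomp : ∀ ρ, Prime ρ → ¬ ρ ∣ H → ∀ v ∈ ValOver (evalAt K z) ρ,
      ∀ h : ∀ s p, evalPair K (F s ∘ x) (F s y) p ∈ v, ∀ I ∈ 𝓘,
        v.centre _ (h 0) ∈ I ↔ v.centre _ (h 1) ∈ I) :
    ∃ g : L, g ∉ Set.range (algebraMap K L) ∧ F 0 g = F 1 g := by
  obtain ⟨c, hc⟩ := G.exists_totalDegree_coeff_le hG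
  obtain ⟨W, hWfin, hW⟩ := hz.exists_finiteDimensional_logForm i0 hx hG hc ((hker G).2 dvd_rfl) hG'
    hJ hadapt h𝓘 hH hcomp
  set E := Submodule.span K {η | ∃ I ∈ 𝓘, ∑ P ∈ I, logForm x y G c P = η} with hE
  have hEfg : ¬ E.FG := infinite_of_logForm hx hG hc hker hG' hden h𝓘 hinf fun I hI =>
    Submodule.subset_span ⟨I, hI, rfl⟩
  set Δ := pullForm hz.pd (F 0) x - pullForm hz.pd (F 1) x with hΔ
  have hmap : (E.map Δ).FG := by
    have hle : E.map Δ ≤ Submodule.pi Set.univ fun _ => W := by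
      rw [Submodule.map_le_iff_le_comap, hE, Submodule.span_le]
      rintro _ ⟨I, hI, rfl⟩
      exact fun k _ => hW I hI k
    haveI : FiniteDimensional K (Submodule.pi Set.univ fun _ : κ => W) := by
      have : (Submodule.pi Set.univ fun _ : κ => W) ≤
          LinearMap.range (LinearMap.pi fun k => W.subtype ∘ₗ LinearMap.proj k :
            (κ → W) →ₗ[K] (κ → M)) := fun w hw =>
        ⟨fun k => ⟨w k, hw k trivial⟩, rfl⟩
      exact Submodule.finiteDimensional_of_le this
    haveI := Submodule.finiteDimensional_of_le hle
    exact (Submodule.fg_top _).1 (Module.finite_def.1 this)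
  obtain ⟨J, hJ0⟩ := hJ 0
  refine exists_map_eq_of_pullForm_eq hJ0 (U := E ⊓ LinearMap.ker Δ) (fun hfg => hEfg ?_) ?_
  · exact Submodule.fg_of_fg_map_of_fg_inf_ker Δ hmap hfg
  · rintro η ⟨-, hη⟩
    rw [SetLike.mem_coe, LinearMap.mem_ker, hΔ, LinearMap.sub_apply, sub_eq_zero] at hη
    exact hη
end

end

section
variable {L : Type*} [Field L]

theorem exists_centre_eq {B : Type*} [CommRing B] (φ : B →+* L) (hφ : Function.Injective φ)
    (P : Ideal B) [P.IsPrime] :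
    ∃ (V : ValuationSubring L) (h : ∀ b, φ b ∈ V), V.centre φ h = P := by
  have hu : ∀ s : P.primeCompl, IsUnit (φ s) := fun s => by
    rw [isUnit_iff_ne_zero, Ne, map_eq_zero_iff _ hφ]
    rintro h
    exact s.2 (h ▸ P.zero_mem)
  obtain ⟨V, h, hloc⟩ := IsLocalRing.exists_factor_valuationRing
    (IsLocalization.lift (S := Localization.AtPrime P) hu)
  have hV : ∀ b, φ b ∈ V := fun b => by
    have := h (algebraMap B _ b)
    rwa [IsLocalization.lift_eq] at this
  refine ⟨V, hV, ?_⟩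
  ext b
  have h1 : IsUnit (algebraMap B (Localization.AtPrime P) b) ↔
      IsUnit (⟨φ b, hV b⟩ : V) := by
    have h2 := isUnit_map_iff ((IsLocalization.lift (S := Localization.AtPrime P) hu).codRestrict
      V.toSubring h) (algebraMap B (Localization.AtPrime P) b)
    rw [← h2]
    have h3 : ((IsLocalization.lift (S := Localization.AtPrime P) hu).codRestrict
      V.toSubring h) (algebraMap B (Localization.AtPrime P) b) = (⟨φ b, hV b⟩ : V) :=
      Subtype.ext (IsLocalization.lift_eq hu b)
    rw [h3]
  rw [IsLocalization.AtPrime.isUnit_to_map_iff (Localization.AtPrime P) P] at h1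
  have h2 : φ b ∈ V.nonunits ↔ ¬ IsUnit (⟨φ b, hV b⟩ : V) :=
    V.coe_mem_nonunits_iff (a := ⟨φ b, hV b⟩)
  rw [V.mem_centre, h2, ← h1]
  exact not_not

/-- If every element of `B'` becomes an element of `B` after multiplication by a power of `t`,
a valuation ring containing `B` in which `t` is a unit contains `B'`. -/
theorem ValuationSubring.mem_of_den {B B' : Type*} [CommRing B] [CommRing B'] {φ : B →+* L}
    {ψ : B' →+* L} {t : B} (h : ∀ u, ∃ (N : ℕ) (r : B), φ t ^ N * ψ u = φ r)
    {V : ValuationSubring L} (hφ : ∀ b, φ b ∈ V) (ht : t ∉ V.centre φ hφ) (u : B') : ψ u ∈ V := by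
  obtain ⟨N, r, hr⟩ := h u
  rw [V.mem_centre] at ht
  have ht' := V.inv_mem_of_not_nonunit ht
  have h0 : φ t ≠ 0 := fun h0 => ht (by rw [h0]; simp [V.mem_nonunits_iff_or])
  have : ψ u = (φ t)⁻¹ ^ N * φ r := by rw [← hr, ← mul_assoc, ← mul_pow, inv_mul_cancel₀ h0, one_pow, one_mul]
  rw [this]
  exact V.mul_mem _ _ (V.pow_mem ht' N) (hφ r)

theorem ValuationSubring.centre_le_of_den {B B' : Type*} [CommRing B] [CommRing B'] {φ : B →+* L}
    {ψ : B' →+* L} {t : B} (h : ∀ u, ∃ (N : ℕ) (r : B), φ t ^ N * ψ u = φ r)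
    {V V' : ValuationSubring L} {hφ : ∀ b, φ b ∈ V} {hφ' : ∀ b, φ b ∈ V'}
    {hψ : ∀ b, ψ b ∈ V} {hψ' : ∀ b, ψ b ∈ V'} (hle : V.centre φ hφ ≤ V'.centre φ hφ')
    (ht : t ∉ V'.centre φ hφ') : V.centre ψ hψ ≤ V'.centre ψ hψ' := by
  intro u hu
  rw [V.mem_centre] at hu
  rw [V'.mem_centre]
  obtain ⟨N, r, hr⟩ := h u
  have h1 : r ∈ V.centre φ hφ := by
    rw [V.mem_centre, ← hr, ← map_pow]
    exact ValuationSubring.nonunits_mul_left (hφ _) hu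
  have h2 := hle h1
  rw [V'.mem_centre] at ht h2
  have ht' := V'.inv_mem_of_not_nonunit ht
  have h0 : φ t ≠ 0 := fun h0 => ht (by rw [h0]; simp [V'.mem_nonunits_iff_or])
  have : ψ u = (φ t)⁻¹ ^ N * φ r := by rw [← hr, ← mul_assoc, ← mul_pow, inv_mul_cancel₀ h0, one_pow, one_mul]
  rw [this]
  exact ValuationSubring.nonunits_mul_left (V'.pow_mem ht' N) h2

/-- Elements that become elements of the subalgebra `T` after multiplication by a power of `t`. -/
def Subalgebra.den {K : Type*} [Field K] [Algebra K L] (T : Subalgebra K L) {t : L} (ht : t ∈ T) :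
    Subalgebra K L where
  carrier := {u | ∃ N : ℕ, t ^ N * u ∈ T}
  mul_mem' := by
    rintro a b ⟨N, hN⟩ ⟨N', hN'⟩
    refine ⟨N + N', ?_⟩
    rw [show t ^ (N + N') * (a * b) = (t ^ N * a) * (t ^ N' * b) by ring]
    exact T.mul_mem hN hN'
  add_mem' := by
    rintro a b ⟨N, hN⟩ ⟨N', hN'⟩
    refine ⟨N + N', ?_⟩
    rw [show t ^ (N + N') * (a + b) = t ^ N' * (t ^ N * a) + t ^ N * (t ^ N' * b) by ring]
    exact T.add_mem (T.mul_mem (T.pow_mem ht _) hN) (T.mul_mem (T.pow_mem ht _) hN')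
  algebraMap_mem' r := ⟨0, by simp⟩
end

section
open MvPolynomial

section
variable {K L ι : Type*} [Field K] [Field L] [Algebra K L]

theorem evalPair_mem_subalgebra {x : ι → L} {y : L} {T : Subalgebra K L} (hx : ∀ i, x i ∈ T) (hy : y ∈ T)
    (p : Polynomial (MvPolynomial ι K)) : evalPair K x y p ∈ T := by
  have h1 : ∀ a : MvPolynomial ι K, evalAt K x a ∈ T := fun a => by
    induction a using MvPolynomial.induction_on with
    | C a => simpa using T.algebraMap_mem a
    | add p q hp hq => rw [map_add]; exact T.add_mem hp hq
    | mul_X p i hp => rw [map_mul]; exact T.mul_mem hp (by simpa using hx i)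
  induction p using Polynomial.induction_on' with
  | add p q hp hq => rw [map_add]; exact T.add_mem hp hq
  | monomial n a =>
    rw [← Polynomial.C_mul_X_pow_eq_monomial, map_mul, map_pow, evalPair_C]
    exact T.mul_mem (h1 a) (T.pow_mem (by simpa [evalPair] using hy) n)

/-- The subalgebra `K[x, y]`. -/
noncomputable def evalPairRange (K : Type*) {L ι : Type*} [Field K] [Field L] [Algebra K L]
    (x : ι → L) (y : L) : Subalgebra K L :=
  { (evalPair K x y).range with
    algebraMap_mem' := fun r => ⟨Polynomial.C (C r), by rw [evalPair_C]; simp⟩ }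

/-- `Spec R` and `Spec K[x, y]` have isomorphic basic open subsets `b ≠ 0` and `a ≠ 0`. -/
structure CommonChart {R : Type*} [CommRing R] [Algebra R L] (x : ι → L) (y : L) (b : R)
    (a : Polynomial (MvPolynomial ι K)) : Prop where
  ne_zero : b ≠ 0
  num : ∀ p, ∃ (N : ℕ) (r : R), algebraMap R L b ^ N * evalPair K x y p = algebraMap R L r
  den : ∀ r : R, ∃ (N : ℕ) (p : Polynomial (MvPolynomial ι K)),
    evalPair K x y a ^ N * algebraMap R L r = evalPair K x y p
  inv : ∃ r, evalPair K x y a * algebraMap R L r = algebraMap R L b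

variable {R : Type*} [CommRing R] [IsDomain R] [Algebra K R] [Algebra R L]
    [IsScalarTower K R L] [IsFractionRing R L]

theorem exists_commonChart [Algebra.FiniteType K R] [Finite ι] {x : ι → L} {y : L}
    (hx : Function.Injective (evalAt K x))
    (hden : ∀ u : L, ∃ b : MvPolynomial ι K, b ≠ 0 ∧ ∃ p, evalAt K x b * u = evalPair K x y p)
    {g : Polynomial (MvPolynomial ι K)} (hg : evalPair K x y g ≠ 0) :
    ∃ (b : R) (a : Polynomial (MvPolynomial ι K)), g ∣ a ∧ CommonChart x y b a := by
  classical
  set f : R →ₐ[K] L := IsScalarTower.toAlgHom K R L with hf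
  have hinj : Function.Injective (algebraMap R L) := IsFractionRing.injective R L
  obtain ⟨d, hd⟩ := IsLocalization.exist_integer_multiples_of_finite (nonZeroDivisors R)
    (fun o : Option ι => o.elim y x)
  have hd0 : (d : R) ≠ 0 := nonZeroDivisors.ne_zero d.2
  have hdT : algebraMap R L d ∈ f.range := ⟨d, rfl⟩
  have hnum : ∀ p, ∃ (N : ℕ) (r : R), algebraMap R L d ^ N * evalPair K x y p = algebraMap R L r := by
    have hmem : ∀ o : Option ι, o.elim y x ∈ f.range.den hdT := fun o => by
      obtain ⟨r, hr⟩ := hd o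
      exact ⟨1, r, by rw [pow_one, ← Algebra.smul_def]; exact hr⟩
    intro p
    obtain ⟨N, r, hr⟩ := evalPair_mem_subalgebra (fun i => hmem (some i)) (hmem none) p
    exact ⟨N, r, hr.symm⟩
  obtain ⟨s, hs⟩ := (inferInstance : Algebra.FiniteType K R)
  choose b hb p hp using hden
  set a₀ := ∏ r ∈ s, b (algebraMap R L r) with ha₀
  set a := Polynomial.C a₀ * g with ha
  have ha₀0 : a₀ ≠ 0 := Finset.prod_ne_zero_iff.2 fun _ _ => hb _
  have ha0 : evalPair K x y a ≠ 0 := by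
    rw [ha, map_mul, evalPair_C]
    exact mul_ne_zero (by rwa [Ne, map_eq_zero_iff _ hx]) hg
  have haT : evalPair K x y a ∈ evalPairRange K x y := ⟨a, rfl⟩
  obtain ⟨N, ra, hra⟩ := hnum a
  refine ⟨d * ra, a, dvd_mul_left _ _, ?_, fun q => ?_, fun r => ?_, (d : R) ^ (N + 1), ?_⟩
  · refine mul_ne_zero hd0 ?_
    rintro rfl
    rw [map_zero, mul_eq_zero] at hra
    refine hra.elim (pow_ne_zero _ ?_) ha0
    rwa [Ne, map_eq_zero_iff _ hinj]
  · obtain ⟨n, r, hr⟩ := hnum q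
    refine ⟨n, ra ^ n * r, ?_⟩
    rw [map_mul, mul_pow, map_mul, ← hr, map_pow]
    ring
  · have htop : Algebra.adjoin K (s : Set R) ≤ ((evalPairRange K x y).den haT).comap f := by
      refine Algebra.adjoin_le fun r hr => ⟨1, ?_⟩
      refine ⟨p (algebraMap R L r) * (Polynomial.C (∏ r ∈ s.erase r, b (algebraMap R L r)) * g), ?_⟩
      rw [map_mul, ← hp, pow_one, ha, ha₀, ← Finset.mul_prod_erase _ _ hr]
      simp only [map_mul, evalPair_C]
      change _ = _ * algebraMap R L r
      ring
    rw [hs] at htop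
    obtain ⟨n, q, hq⟩ := htop (Algebra.mem_top (x := r))
    exact ⟨n, q, hq.symm⟩
  · rw [map_pow, map_mul (algebraMap R L), ← hra]
    ring

end

end

section
open MvPolynomial

section
variable {K L ι : Type*} [Field K] [Field L] [Algebra K L]
variable {R : Type*} [CommRing R] [Algebra R L] {x : ι → L} {y : L} {b : R}
  {a : Polynomial (MvPolynomial ι K)}

/-- `P` and `P'` are the centres of a common valuation ring. -/
def SameCentre (x : ι → L) (y : L) (P : Ideal R) (P' : Ideal (Polynomial (MvPolynomial ι K))) : Prop :=
  ∃ (V : ValuationSubring L) (h : ∀ r, algebraMap R L r ∈ V) (h' : ∀ p, evalPair K x y p ∈ V),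
    V.centre (algebraMap R L) h = P ∧ V.centre (evalPair K x y) h' = P'

namespace CommonChart

theorem notMem (hc : CommonChart x y b a) {P : Ideal R}
    {P' : Ideal (Polynomial (MvPolynomial ι K))} (h : SameCentre x y P P')
    (hb : b ∉ P) : a ∉ P' := by
  obtain ⟨V, h, h', rfl, rfl⟩ := h
  obtain ⟨r, hr⟩ := hc.inv
  rw [V.mem_centre] at hb ⊢
  intro ha
  rw [← hr, mul_comm] at hb
  exact hb (ValuationSubring.nonunits_mul_left (h r) ha)

theorem exists_sameCentre (hc : CommonChart x y b a) [IsDomain R] [IsFractionRing R L] {P : Ideal R}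
    (hP : P.IsPrime) (hb : b ∉ P) :
    ∃ P' : Ideal (Polynomial (MvPolynomial ι K)), SameCentre x y P P' := by
  obtain ⟨V, h, rfl⟩ := exists_centre_eq (algebraMap R L) (IsFractionRing.injective R L) P
  exact ⟨_, V, h, ValuationSubring.mem_of_den hc.num h hb, rfl, rfl⟩

theorem le_iff (hc : CommonChart x y b a) {P Q : Ideal R}
    {P' Q' : Ideal (Polynomial (MvPolynomial ι K))} (hP : SameCentre x y P P')
    (hQ : SameCentre x y Q Q') (hb : b ∉ Q) : P ≤ Q ↔ P' ≤ Q' := by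
  have ha := hc.notMem hQ hb
  obtain ⟨V, h, h', rfl, rfl⟩ := hP
  obtain ⟨V', _, _, rfl, rfl⟩ := hQ
  exact ⟨fun hle => ValuationSubring.centre_le_of_den hc.num hle hb,
    fun hle => ValuationSubring.centre_le_of_den hc.den hle ha⟩

theorem eq_iff (hc : CommonChart x y b a) {P Q : Ideal R}
    {P' Q' : Ideal (Polynomial (MvPolynomial ι K))} (hP : SameCentre x y P P')
    (hQ : SameCentre x y Q Q') (hbP : b ∉ P) (hbQ : b ∉ Q) : P = Q ↔ P' = Q' := by
  rw [le_antisymm_iff, le_antisymm_iff, hc.le_iff hP hQ hbQ, hc.le_iff hQ hP hbP]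

theorem mem_primeDivisors (hc : CommonChart x y b a) [IsDomain R] [IsFractionRing R L]
    (hx : Function.Injective (evalAt K x))
    {G : Polynomial (MvPolynomial ι K)} (hG : G.Monic) (hy : evalPair K x y G = 0)
    (hGa : Polynomial.derivative G ∣ a) {P : Ideal R}
    {P' : Ideal (Polynomial (MvPolynomial ι K))} (hP : HeightOnePrime P)
    (h : SameCentre x y P P') (hb : b ∉ P) : P' ∈ PrimeDivisors G := by
  have ha := hc.notMem h hb
  have hPP' := h
  obtain ⟨V, h, h', rfl, rfl⟩ := h
  refine ⟨inferInstance, ?_, fun hG' => ha (Ideal.mem_of_dvd _ hGa hG'), ?_⟩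
  · rw [V.mem_centre, hy]
    simp [V.mem_nonunits_iff_or]
  set T := (evalPair K x y).range with hT
  letI : Algebra (MvPolynomial ι K) T :=
    ((evalPair K x y).rangeRestrict.comp Polynomial.C).toAlgebra
  have hmap : ∀ p, ((algebraMap (MvPolynomial ι K) T p : T) : L) = evalAt K x p := fun p =>
    evalPair_C x y p
  haveI : FaithfulSMul (MvPolynomial ι K) T := (faithfulSMul_iff_algebraMap_injective _ _).2
    fun p q hpq => hx (by rw [← hmap, ← hmap, hpq])
  have hint : ∀ t : T, IsIntegral (MvPolynomial ι K) t := by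
    have hyi : IsIntegral (MvPolynomial ι K) ((evalPair K x y).rangeRestrict Polynomial.X) := by
      refine ⟨G, hG, ?_⟩
      have h1 := Polynomial.hom_eval₂ G Polynomial.C (evalPair K x y).rangeRestrict Polynomial.X
      rw [Polynomial.eval₂_C_X] at h1
      rw [RingHom.algebraMap_toAlgebra, ← h1]
      exact Subtype.ext hy
    intro t
    obtain ⟨p, rfl⟩ := (evalPair K x y).rangeRestrict_surjective t
    induction p using Polynomial.induction_on' with
    | add p q hp hq =>
      rw [map_add]
      exact hp.add hq
    | monomial n c =>
      rw [← Polynomial.C_mul_X_pow_eq_monomial, map_mul, map_pow]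
      exact (isIntegral_algebraMap (R := MvPolynomial ι K) (A := T) (x := c)).mul (hyi.pow n)
  haveI : Algebra.IsIntegral (MvPolynomial ι K) T := ⟨hint⟩
  have hTV : ∀ t : T, T.subtype t ∈ V := by
    rintro ⟨_, p, rfl⟩
    exact h' p
  set PT := V.centre T.subtype hTV with hPT
  have hinj : Function.Injective (algebraMap R L) := IsFractionRing.injective R L
  obtain ⟨r, hrP, hr0⟩ := Submodule.exists_mem_ne_zero_of_ne_bot hP.2.1
  have hPT0 : PT.comap (algebraMap (MvPolynomial ι K) T) ≠ ⊥ := by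
    obtain ⟨N, p, hp⟩ := hc.den r
    have ha0 : evalPair K x y a ≠ 0 := fun h0 => ha (by
      rw [V.mem_centre, h0]
      simp [V.mem_nonunits_iff_or])
    have hp0 : (⟨_, p, rfl⟩ : T) ≠ 0 := fun h0 => by
      have h1 : evalPair K x y p = 0 := congrArg Subtype.val h0
      rw [← hp] at h1
      refine mul_ne_zero (pow_ne_zero _ ha0) ?_ h1
      rwa [Ne, map_eq_zero_iff _ hinj]
    refine Ideal.comap_ne_bot_of_integral_mem hp0 ?_ (hint _)
    rw [hPT, V.mem_centre]
    change evalPair K x y p ∈ _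
    rw [← hp, ← map_pow]
    exact ValuationSubring.nonunits_mul_left (h' _) ((V.mem_centre _ _ _).1 hrP)
  obtain ⟨q, hqPT, hq⟩ := Ideal.IsPrime.exists_mem_prime_of_ne_bot
    (I := PT.comap (algebraMap (MvPolynomial ι K) T)) inferInstance hPT0
  haveI : (Ideal.span {q}).IsPrime := (Ideal.span_singleton_prime hq.ne_zero).2 hq
  haveI : PT.LiesOver (PT.comap (algebraMap (MvPolynomial ι K) T)) := ⟨rfl⟩
  obtain ⟨QT, hQPT, hQT, hQTq⟩ := Ideal.exists_ideal_le_liesOver_of_le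
    (p := Ideal.span {q}) (q := PT.comap (algebraMap (MvPolynomial ι K) T)) PT
    (by rw [Ideal.span_le]; simpa using hqPT)
  obtain ⟨V', hV', hV'c⟩ := exists_centre_eq T.subtype T.subtype_injective QT
  have hA' : ∀ p, evalPair K x y p ∈ V' := fun p => hV' ⟨_, p, rfl⟩
  have hmem' : ∀ p, p ∈ V'.centre (evalPair K x y) hA' ↔ (⟨_, p, rfl⟩ : T) ∈ QT := fun p => by
    rw [← hV'c, V'.mem_centre, V'.mem_centre]
    rfl
  have hmem : ∀ p, p ∈ V.centre (evalPair K x y) h' ↔ (⟨_, p, rfl⟩ : T) ∈ PT := fun p => by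
    rw [hPT, V.mem_centre, V.mem_centre]
    rfl
  have hle : V'.centre (evalPair K x y) hA' ≤ V.centre (evalPair K x y) h' := fun p hp =>
    (hmem p).2 (hQPT ((hmem' p).1 hp))
  have hR' : ∀ r, algebraMap R L r ∈ V' := ValuationSubring.mem_of_den hc.den hA' fun h => ha (hle h)
  have hQP : V'.centre (algebraMap R L) hR' ≤ V.centre (algebraMap R L) h :=
    ValuationSubring.centre_le_of_den hc.den hle ha
  have hqQ : Polynomial.C q ∈ V'.centre (evalPair K x y) hA' := by
    rw [hmem']
    have h1 : q ∈ QT.under (MvPolynomial ι K) := by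
      rw [← hQTq.over]
      exact Ideal.mem_span_singleton_self q
    exact h1
  have hQ0 : V'.centre (algebraMap R L) hR' ≠ ⊥ := by
    obtain ⟨N, r, hr⟩ := hc.num (Polynomial.C q)
    have hr0 : r ≠ 0 := by
      rintro rfl
      rw [map_zero] at hr
      refine mul_ne_zero (pow_ne_zero _ ?_) ?_ hr
      · rw [Ne, map_eq_zero_iff _ hinj]
        exact hc.ne_zero
      · rw [evalPair_C, Ne, map_eq_zero_iff _ hx]
        exact hq.ne_zero
    refine (Submodule.ne_bot_iff _).2 ⟨r, ?_, hr0⟩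
    rw [V'.mem_centre, ← hr, ← map_pow]
    exact ValuationSubring.nonunits_mul_left (hR' _) ((V'.mem_centre _ _ _).1 hqQ)
  have hQeq : V'.centre (algebraMap R L) hR' = V.centre (algebraMap R L) h := by
    by_contra hne
    exact hQ0 (hP.2.2 _ inferInstance (lt_of_le_of_ne hQP hne))
  have hge : V.centre (evalPair K x y) h' ≤ V'.centre (evalPair K x y) hA' :=
    ValuationSubring.centre_le_of_den hc.num hQeq.ge (by rwa [hQeq])
  refine ⟨q, hq, le_antisymm (fun p hp => ?_) ?_⟩
  · rw [hQTq.over]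
    exact (hmem' _).1 (hge hp)
  · rw [Ideal.span_le, Set.singleton_subset_iff]
    exact hle hqQ

end CommonChart
end

end

section
open MvPolynomial

section
variable {R S : Type*} [CommRing R] [CommRing S]

theorem HeightOnePrime.comap_mem_minimalPrimes [IsDomain R] [IsNoetherianRing S]
    {f g : R →+* S} (hf : Function.Injective f) (hg : Function.Injective g) {I : Ideal R}
    (hI : IsHypersurfaceIdeal I) (h : properTransform f I = properTransform g I) {W : Ideal S}
    (hW : HeightOnePrime W) (hWI : W.comap f ∈ I.minimalPrimes) : W.comap g ∈ I.minimalPrimes := by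
  haveI := hW.1
  have hle : I.map f ≤ W := Ideal.map_le_iff_le_comap.2 hWI.1.2
  obtain ⟨Q, hQ, hQW⟩ := Ideal.exists_minimalPrimes_le hle
  have hI0 : I ≠ ⊥ := by
    rintro rfl
    have h1 := hI.2.2 _ hWI
    have h2 : (⊥ : Ideal R).IsPrime := Ideal.isPrime_bot
    exact h1.2.1 (le_bot_iff.1 (hWI.2 ⟨h2, le_rfl⟩ bot_le))
  have hQ0 : Q ≠ ⊥ := by
    rintro rfl
    exact hI0 ((Ideal.map_eq_bot_iff_of_injective hf).1 (le_bot_iff.1 hQ.1.2))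
  have hQeq : Q = W := by
    by_contra hne
    exact hQ0 (hW.2.2 Q hQ.1.1 (lt_of_le_of_ne hQW hne))
  have hmem : properTransform g I ≤ W := by
    rw [← h]
    exact sInf_le ⟨hQeq ▸ hQ, hWI⟩
  unfold properTransform at hmem
  have hfin : {Q : Ideal S | Q ∈ (I.map g).minimalPrimes ∧ Q.comap g ∈ I.minimalPrimes}.Finite :=
    (Ideal.finite_minimalPrimes_of_isNoetherianRing S _).subset fun _ h => h.1
  rw [sInf_eq_iInf, ← hfin.coe_toFinset] at hmem
  obtain ⟨Q', hQ', hQ'W⟩ := (Ideal.IsPrime.inf_le' (s := hfin.toFinset) (f := id) hW.1).1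
    (by rw [Finset.inf_eq_iInf]; exact hmem)
  obtain ⟨hQ'1, hQ'2⟩ := hfin.mem_toFinset.1 hQ'
  have : Q' = W := by
    by_contra hne
    have h0 := hW.2.2 Q' hQ'1.1.1 (lt_of_le_of_ne hQ'W hne)
    refine (hI.2.2 _ hQ'2).2.1 ?_
    rw [h0]
    exact Ideal.comap_bot_of_injective g hg
  exact this ▸ hQ'2

theorem infinite_minimalPrimes [IsNoetherianRing R] {𝓢 : Set (Ideal R)} (h𝓢 : 𝓢.Infinite)
    (hrad : ∀ I ∈ 𝓢, I.IsRadical) : {P | ∃ I ∈ 𝓢, P ∈ I.minimalPrimes}.Infinite := by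
  intro hfin
  refine h𝓢 (Set.Finite.of_finite_image (f := Ideal.minimalPrimes)
    (hfin.finite_subsets.subset ?_) fun I hI J hJ hIJ => ?_)
  · rintro _ ⟨I, hI, rfl⟩ P hP
    exact ⟨I, hI, hP⟩
  · rw [← (hrad I hI).radical, ← (hrad J hJ).radical, ← Ideal.sInf_minimalPrimes, hIJ,
      Ideal.sInf_minimalPrimes]

theorem finite_heightOnePrime_mem [IsNoetherianRing R] [IsDomain R] {b : R} (hb : b ≠ 0) :
    {P | HeightOnePrime P ∧ b ∈ P}.Finite := by
  refine (Ideal.finite_minimalPrimes_of_isNoetherianRing R (Ideal.span {b})).subset ?_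
  rintro P ⟨hP, hbP⟩
  refine ⟨⟨hP.1, by simpa [Ideal.span_le] using hbP⟩, ?_⟩
  rintro Q ⟨hQ, hbQ⟩ hle
  by_contra hcon
  have := hP.2.2 Q hQ (lt_of_le_not_ge hle hcon)
  rw [this] at hbQ
  exact hb (by simpa using hbQ)

section
variable {K R S L M : Type*} [Field K] [IsAlgClosed K] [CommRing R] [IsDomain R] [Algebra K R]
  [Algebra.FiniteType K R] [CommRing S] [IsDomain S] [Algebra K S] [Algebra.FiniteType K S]
  [Field L] [Algebra K L] [Algebra R L] [IsScalarTower K R L] [IsFractionRing R L]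
  [Field M] [Algebra K M] [Algebra S M] [IsScalarTower K S M] [IsFractionRing S M]

theorem FinSepOver.nonempty_of_heightOnePrime {κ : Type*} [Fintype κ] {z : κ → M}
    (hz : FinSepOver (evalAt K z)) (F : L →ₐ[K] M) {P : Ideal R} (hP : HeightOnePrime P) :
    Nonempty κ := by
  obtain ⟨r, hrP, hr0⟩ := Submodule.exists_mem_ne_zero_of_ne_bot hP.2.1
  have hinj : Function.Injective (algebraMap R L) := IsFractionRing.injective R L
  have htr : Transcendental K (algebraMap R L r) := by
    intro halg
    obtain ⟨c, hc⟩ := minpoly.mem_range_of_degree_eq_one K (algebraMap R L r)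
      (IsAlgClosed.degree_eq_one_of_irreducible K (minpoly.irreducible halg.isIntegral))
    rw [IsScalarTower.algebraMap_apply K R L] at hc
    have hrc := hinj hc
    have hc0 : c ≠ 0 := by
      rintro rfl
      exact hr0 (by rw [← hrc, map_zero])
    refine hP.1.ne_top (Ideal.eq_top_of_isUnit_mem _ hrP ?_)
    rw [← hrc]
    exact (isUnit_iff_ne_zero.2 hc0).map _
  have h1 : AlgebraicIndependent K fun _ : Unit => F (algebraMap R L r) := by
    rw [algebraicIndependent_unique_type_iff]
    exact fun h => htr ((isAlgebraic_algHom_iff F F.injective).1 h)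
  have := hz.card_le h1
  rw [Fintype.card_unit] at this
  exact Fintype.card_pos_iff.1 (by lia)

theorem exists_map_eq_of_properTransform {f : Fin 2 → R →ₐ[K] S} (hf : ∀ s, Function.Injective (f s))
    {F : Fin 2 → L →ₐ[K] M} (hF : ∀ s r, F s (algebraMap R L r) = algebraMap S M (f s r))
    (hsep : ∀ s, SeparablyGeneratedVia (F s : L →+* M)) {𝓢 : Set (Ideal R)} (h𝓢 : 𝓢.Infinite)
    (hI : ∀ I ∈ 𝓢, IsHypersurfaceIdeal I)
    (hpt : ∀ I ∈ 𝓢, properTransform (f 0 : R →+* S) I = properTransform (f 1 : R →+* S) I) :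
    ∃ g : L, g ∉ Set.range (algebraMap K L) ∧ F 0 g = F 1 g := by
  classical
  haveI : IsNoetherianRing R := Algebra.FiniteType.isNoetherianRing K R
  haveI : IsNoetherianRing S := Algebra.FiniteType.isNoetherianRing K S
  haveI : Algebra.EssFiniteType R L := .of_isLocalization _ (nonZeroDivisors R)
  haveI : Algebra.EssFiniteType S M := .of_isLocalization _ (nonZeroDivisors S)
  haveI : Algebra.EssFiniteType K L := .comp K R L
  haveI : Algebra.EssFiniteType K M := .comp K S M
  have hinf := infinite_minimalPrimes h𝓢 fun I h => (hI I h).1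
  obtain ⟨P₀, I₀, hI₀, hP₀⟩ := hinf.nonempty
  obtain ⟨n, x₀, hx₀⟩ := exists_finSepOver K L
  obtain ⟨m, z, hz⟩ := exists_finSepOver K M
  obtain ⟨i0⟩ := hz.nonempty_of_heightOnePrime (F 0) ((hI _ hI₀).2.2 _ hP₀)
  obtain ⟨x, hx, hadapt⟩ := hx₀.exists_adapted hz i0 (Set.finite_range F)
    (by rintro _ ⟨s, rfl⟩; exact hsep s)
  obtain ⟨y, G, hG, hker, hG', hden⟩ := hx.exists_primitive
  obtain ⟨b, a, hGa, hc⟩ := exists_commonChart (R := R) hx.inj hden hG'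
  -- the prime divisors determined by the hypersurfaces
  have hex := fun P (hP : HeightOnePrime P ∧ b ∉ P) => hc.exists_sameCentre hP.1.1 hP.2
  choose! t ht using hex
  have hgood : ∀ P, HeightOnePrime P ∧ b ∉ P → t P ∈ PrimeDivisors G := fun P hP =>
    hc.mem_primeDivisors hx.inj hG ((hker G).2 dvd_rfl) hGa hP.1 (ht P hP) hP.2
  have hminfin := fun I : Ideal R => Ideal.finite_minimalPrimes_of_isNoetherianRing R I
  set J : Ideal R → Finset (Ideal (Polynomial (MvPolynomial (Fin n) K))) := fun I =>
    ((hminfin I).toFinset.filter fun P => b ∉ P).image t with hJdef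
  have hmemJ : ∀ I T, T ∈ J I ↔ ∃ P, (P ∈ I.minimalPrimes ∧ b ∉ P) ∧ t P = T := fun I T => by
    simp only [hJdef, Finset.mem_image, Finset.mem_filter, Set.Finite.mem_toFinset]
  obtain ⟨H₁, hH₁, hHmem⟩ := hz.exists_forall_mem
    (Set.finite_range fun s => (F s (algebraMap R L b))⁻¹)
  obtain ⟨H₂, hH₂, hHht⟩ := hz.exists_centre_heightOne (S := S)
  refine hz.exists_map_eq_of_adapted i0 hx.inj hG hker hG' hden
    (fun s => hx.exists_jacobian_inverse hz (hsep s)) (fun s v hv => hadapt _ ⟨s, rfl⟩ v hv)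
    (𝓘 := J '' 𝓢) ?_ ?_ (mul_ne_zero hH₁ hH₂) ?_
  · rintro _ ⟨I, hIS, rfl⟩ T hT
    obtain ⟨P, ⟨hP, hbP⟩, rfl⟩ := (hmemJ _ _).1 hT
    exact hgood P ⟨(hI I hIS).2.2 P hP, hbP⟩
  · have h1 := hinf.sdiff (finite_heightOnePrime_mem hc.ne_zero)
    refine (h1.image (f := t) ?_).mono ?_
    · rintro P ⟨⟨I, hIS, hP⟩, hbP⟩ Q ⟨⟨I', hIS', hQ⟩, hbQ⟩ hPQ
      have hP1 := (hI I hIS).2.2 P hP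
      have hQ1 := (hI I' hIS').2.2 Q hQ
      have hbP' : b ∉ P := fun h => hbP ⟨hP1, h⟩
      have hbQ' : b ∉ Q := fun h => hbQ ⟨hQ1, h⟩
      exact (hc.eq_iff (ht P ⟨hP1, hbP'⟩) (ht Q ⟨hQ1, hbQ'⟩) hbP' hbQ').2 hPQ
    · rintro _ ⟨P, ⟨⟨I, hIS, hP⟩, hbP⟩, rfl⟩
      have hP1 := (hI I hIS).2.2 P hP
      exact ⟨J I, ⟨I, hIS, rfl⟩, (hmemJ _ _).2 ⟨P, ⟨hP, fun h => hbP ⟨hP1, h⟩⟩, rfl⟩⟩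
  · rintro ρ hρ hρH v hv h _ ⟨I, hIS, rfl⟩
    obtain ⟨hSv, hW⟩ := hHht ρ hρ (fun hd => hρH (hd.mul_left _)) v hv
    set W := v.centre (algebraMap S M) hSv with hWdef
    have hbv := hHmem ρ (fun hd => hρH (hd.mul_right _)) v hv
    have key : ∀ s, b ∉ W.comap (f s : R →+* S) ∧
        SameCentre x y (W.comap (f s : R →+* S)) (v.centre _ (h s)) := by
      intro s
      have hcom : ∀ r, r ∈ W.comap (f s : R →+* S) ↔ F s (algebraMap R L r) ∈ v.nonunits := fun r => by
        rw [Ideal.mem_comap, hWdef, v.mem_centre, hF]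
        rfl
      refine ⟨fun hb => ?_, ?_⟩
      · rw [hcom, v.mem_nonunits_iff_or] at hb
        refine hb.elim (fun h0 => ?_) fun h1 => h1 (hbv _ ⟨s, rfl⟩)
        rw [map_eq_zero, map_eq_zero_iff _ (IsFractionRing.injective R L)] at h0
        exact hc.ne_zero h0
      · have hnon : ∀ u, u ∈ (v.comap (F s : L →+* M)).nonunits ↔ F s u ∈ v.nonunits := fun u => by
          rw [ValuationSubring.mem_nonunits_iff_or, ValuationSubring.mem_nonunits_iff_or,
            ValuationSubring.mem_comap, map_eq_zero, ← map_inv₀]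
          rfl
        refine ⟨v.comap (F s : L →+* M), fun r => ?_, fun p => ?_, ?_, ?_⟩
        · change F s (algebraMap R L r) ∈ v
          rw [hF]
          exact hSv _
        · change F s (evalPair K x y p) ∈ v
          rw [map_evalPair]
          exact h s p
        · ext r
          rw [ValuationSubring.mem_centre, hnon, hcom]
        · ext p
          rw [ValuationSubring.mem_centre, hnon, map_evalPair, v.mem_centre]
    have hiff : ∀ s, v.centre _ (h s) ∈ J I ↔ W.comap (f s : R →+* S) ∈ I.minimalPrimes := by
      intro s
      rw [hmemJ]
      constructor
      · rintro ⟨P, ⟨hP, hbP⟩, htP⟩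
        have := (hc.eq_iff (ht P ⟨(hI I hIS).2.2 P hP, hbP⟩) (key s).2 hbP (key s).1).2 htP
        exact this ▸ hP
      · intro hmin
        refine ⟨_, ⟨hmin, (key s).1⟩, ?_⟩
        exact (hc.eq_iff (ht _ ⟨(hI I hIS).2.2 _ hmin, (key s).1⟩) (key s).2 (key s).1 (key s).1).1 rfl
    rw [hiff, hiff]
    exact ⟨hW.comap_mem_minimalPrimes (hf 0) (hf 1) (hI I hIS) (hpt I hIS),
      hW.comap_mem_minimalPrimes (hf 1) (hf 0) (hI I hIS) (hpt I hIS).symm⟩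
end
end

end

section
theorem exists_mul_eq_mul_of_properTransform
    {K : Type*} [Field K] [IsAlgClosed K]
    {R : Type*} [CommRing R] [IsDomain R] [Algebra K R] [Algebra.FiniteType K R]
    {S : Type*} [CommRing S] [IsDomain S] [Algebra K S] [Algebra.FiniteType K S]
    {f₁ f₂ : R →ₐ[K] S} (hdom₁ : Function.Injective f₁) (hdom₂ : Function.Injective f₂)
    {FR : Type*} [Field FR] [Algebra R FR] [IsFractionRing R FR]
    {FS : Type*} [Field FS] [Algebra S FS] [IsFractionRing S FS] {F₁ F₂ : FR →+* FS}
    (hF₁ : F₁.comp (algebraMap R FR) = (algebraMap S FS).comp (f₁ : R →+* S))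
    (hF₂ : F₂.comp (algebraMap R FR) = (algebraMap S FS).comp (f₂ : R →+* S))
    (hsep₁ : SeparablyGeneratedVia F₁) (hsep₂ : SeparablyGeneratedVia F₂)
    {𝓢 : Set (Ideal R)} (h𝓢 : 𝓢.Infinite) (hI : ∀ I ∈ 𝓢, IsHypersurfaceIdeal I)
    (hpt : ∀ I ∈ 𝓢, properTransform (f₁ : R →+* S) I = properTransform (f₂ : R →+* S) I) :
    ∃ a b : R, b ≠ 0 ∧ (∀ c : K, a ≠ algebraMap K R c * b) ∧ f₁ a * f₂ b = f₂ a * f₁ b := by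
  letI : Algebra K FR := ((algebraMap R FR).comp (algebraMap K R)).toAlgebra
  letI : Algebra K FS := ((algebraMap S FS).comp (algebraMap K S)).toAlgebra
  haveI : IsScalarTower K R FR := .of_algebraMap_eq fun _ => rfl
  haveI : IsScalarTower K S FS := .of_algebraMap_eq fun _ => rfl
  have e₁ : ∀ r, F₁ (algebraMap R FR r) = algebraMap S FS (f₁ r) := fun r => RingHom.congr_fun hF₁ r
  have e₂ : ∀ r, F₂ (algebraMap R FR r) = algebraMap S FS (f₂ r) := fun r => RingHom.congr_fun hF₂ r
  let G₁ : FR →ₐ[K] FS := ⟨F₁, fun c => by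
    change F₁ (algebraMap K FR c) = _
    rw [IsScalarTower.algebraMap_apply K R FR, e₁, AlgHom.commutes,
      ← IsScalarTower.algebraMap_apply K S FS]⟩
  let G₂ : FR →ₐ[K] FS := ⟨F₂, fun c => by
    change F₂ (algebraMap K FR c) = _
    rw [IsScalarTower.algebraMap_apply K R FR, e₂, AlgHom.commutes,
      ← IsScalarTower.algebraMap_apply K S FS]⟩
  obtain ⟨g, hg, hgg⟩ := exists_map_eq_of_properTransform (f := ![f₁, f₂]) (F := ![G₁, G₂])
    (Fin.forall_fin_two.2 ⟨hdom₁, hdom₂⟩) (Fin.forall_fin_two.2 ⟨e₁, e₂⟩)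
    (Fin.forall_fin_two.2 ⟨hsep₁, hsep₂⟩) h𝓢 hI hpt
  obtain ⟨a, b, hb, rfl⟩ := IsFractionRing.div_surjective (A := R) g
  have hb0 : b ≠ 0 := nonZeroDivisors.ne_zero hb
  have hR := IsFractionRing.injective R FR
  have hS := IsFractionRing.injective S FS
  refine ⟨a, b, hb0, ?_, ?_⟩
  · rintro c rfl
    refine hg ⟨c, ?_⟩
    rw [map_mul, mul_div_assoc, div_self ((map_ne_zero_iff _ hR).2 hb0), mul_one,
      ← IsScalarTower.algebraMap_apply]
  · have h1 : F₁ (algebraMap R FR a / algebraMap R FR b) =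
      F₂ (algebraMap R FR a / algebraMap R FR b) := hgg
    rw [map_div₀, map_div₀, e₁, e₁, e₂, e₂, div_eq_div_iff] at h1
    · exact hS (by rw [map_mul, map_mul]; exact h1)
    · rw [map_ne_zero_iff _ hS, map_ne_zero_iff _ hdom₁]; exact hb0
    · rw [map_ne_zero_iff _ hS, map_ne_zero_iff _ hdom₂]; exact hb0
end

section
open IntermediateField

section
variable {K L : Type*} [Field K] [Field L] [Algebra K L]

/-- A root-closed intermediate field of a function field in characteristic `p` that is not
algebraic over the constants contains an element that is not a `p`-th power. -/
theorem exists_mem_forall_pow_ne [PerfectField K] [Algebra.EssFiniteType K L] (p : ℕ) [Fact p.Prime]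
    [CharP L p] {L₀ : IntermediateField K L} (hroot : ∀ u : L, u ^ p ∈ L₀ → u ∈ L₀) {g₀ : L}
    (hg₀ : g₀ ∈ L₀) (htr : Transcendental K g₀) : ∃ g ∈ L₀, ∀ v : L, v ^ p ≠ g := by
  by_contra! hcon
  have hp : p.Prime := Fact.out
  haveI : CharP L₀ p := (algebraMap L₀ L).charP (algebraMap L₀ L).injective p
  haveI : ExpChar L₀ p := .prime hp
  haveI : PerfectRing L₀ p := .ofSurjective L₀ p fun u => by
    obtain ⟨v, hv⟩ := hcon u u.2
    exact ⟨⟨v, hroot v (hv ▸ u.2)⟩, Subtype.ext hv⟩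
  haveI : PerfectField L₀ := PerfectRing.toPerfectField L₀ p
  haveI : Algebra.EssFiniteType L₀ L := .of_comp K L₀ L
  obtain ⟨n, x, hx⟩ := exists_finSepOver K L
  obtain ⟨m, z, hz⟩ := exists_finSepOver L₀ L
  obtain ⟨bx, -⟩ := hx.exists_basis
  obtain ⟨bz, -⟩ := hz.exists_basis
  let D : Derivation L₀ L (Ω[L⁄K]) :=
    Derivation.mk' 
      { toFun := KaehlerDifferential.D K L
        map_add' := map_add _
        map_smul' := fun c u => by
          obtain ⟨v, hv⟩ := hcon c c.2
          have h1 : KaehlerDifferential.D K L (c : L) = 0 := by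
            rw [← hv, Derivation.leibniz_pow, ← Nat.cast_smul_eq_nsmul L, CharP.cast_eq_zero,
              zero_smul]
          rw [Algebra.smul_def, Derivation.leibniz]
          change (c : L) • _ + u • KaehlerDifferential.D K L (c : L) = _
          rw [h1, smul_zero, add_zero]
          rfl }
      fun a b => Derivation.leibniz _ a b
  have hsurj : Function.Surjective D.liftKaehlerDifferential := by
    rw [← LinearMap.range_eq_top, eq_top_iff, ← KaehlerDifferential.span_range_derivation K L,
      Submodule.span_le]
    rintro _ ⟨u, rfl⟩
    exact ⟨KaehlerDifferential.D L₀ L u, D.liftKaehlerDifferential_comp_D u⟩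
  haveI : Module.Finite L (Ω[L⁄L₀]) := .of_basis bz
  have h1 := LinearMap.finrank_le_finrank_of_surjective hsurj
  rw [Module.finrank_eq_card_basis bx, Module.finrank_eq_card_basis bz, Fintype.card_fin,
    Fintype.card_fin] at h1
  have h2 : AlgebraicIndependent K (fun _ : Unit => (⟨g₀, hg₀⟩ : L₀)) := by
    rw [algebraicIndependent_unique_type_iff]
    exact fun h => htr (IsAlgebraic.algHom (IsScalarTower.toAlgHom K L₀ L) h)
  have h3 := hx.card_le (h2.sumElim_comp hz.inj)
  simp at h3
  omega

theorem SeparablyGeneratedVia.of_finset {F : K →+* L} {s : Finset L}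
    (hs : IsTranscendenceBasis F.fieldRange ((↑) : s → L))
    (hsep : Algebra.IsSeparable (IntermediateField.adjoin F.fieldRange (s : Set L)) L) :
    SeparablyGeneratedVia F := by
  let e : Fin s.card ≃ s := s.equivFin.symm
  refine ⟨s.card, fun i => (e i : L), hs.1.comp e e.injective, ?_⟩
  have h2 : Set.range (fun i => (e i : L)) = s := by
    have : (fun i => (e i : L)) = Subtype.val ∘ e := rfl
    rw [this, Set.range_comp, e.range_eq_univ, Set.image_univ, Subtype.range_coe]
  rw [h2]
  exact hsep

theorem essFiniteType_fieldRange [Algebra.EssFiniteType K L] (E : IntermediateField K L) :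
    Algebra.EssFiniteType (E.val : E →+* L).fieldRange L := by
  letI : Algebra K (E.val : E →+* L).fieldRange :=
    ((E.val : E →+* L).rangeRestrictField.comp (algebraMap K E)).toAlgebra
  haveI : IsScalarTower K (E.val : E →+* L).fieldRange L :=
    IsScalarTower.of_algebraMap_eq fun c => rfl
  exact .of_comp K _ L

section
variable (p : ℕ) [hp : Fact p.Prime] [CharP L p]

theorem eq_zero_of_sum_pow_mul_pow_eq_zero {g : L} (hg : ∀ v : L, v ^ p ≠ g) {u : Fin p → L}
    (hu : ∑ i : Fin p, g ^ (i : ℕ) * u i ^ p = 0) (i : Fin p) : u i = 0 := by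
  have hp0 : p.Prime := Fact.out
  let E := (frobenius L p).fieldRange
  let e : L → E := fun v => ⟨v ^ p, v, rfl⟩
  have hirr : Irreducible (Polynomial.X ^ p - Polynomial.C (e g)) := by
    rw [X_pow_sub_C_irreducible_iff_of_prime hp0]
    rintro ⟨_, v, rfl⟩ h
    have h1 : ((v ^ p) ^ p : L) = g ^ p := congrArg Subtype.val h
    exact hg v (frobenius_inj L p h1)
  have hmon : (Polynomial.X ^ p - Polynomial.C (e g)).Monic :=
    Polynomial.monic_X_pow_sub_C _ hp0.ne_zero
  have hmin : Polynomial.X ^ p - Polynomial.C (e g) = minpoly E g := by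
    refine minpoly.eq_of_irreducible_of_monic hirr ?_ hmon
    simp only [map_sub, map_pow, Polynomial.aeval_X, Polynomial.aeval_C]
    exact sub_self _
  let P : Polynomial E := ∑ i : Fin p, Polynomial.monomial (i : ℕ) (e (u i))
  have hP : Polynomial.aeval g P = 0 := by
    rw [map_sum, ← hu]
    refine Finset.sum_congr rfl fun i _ => ?_
    rw [Polynomial.aeval_monomial, mul_comm]
    rfl
  have hP0 : P = 0 := by
    by_contra h0
    have h1 := minpoly.degree_le_of_ne_zero E g h0 hP
    rw [← hmin, Polynomial.degree_X_pow_sub_C hp0.pos] at h1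
    refine (h1.trans_lt ?_).false
    refine (Polynomial.degree_sum_le _ _).trans_lt ((Finset.sup_lt_iff (WithBot.bot_lt_coe p)).2
      fun i _ => (Polynomial.degree_monomial_le _ _).trans_lt ?_)
    exact WithBot.coe_lt_coe.2 i.2
  have h2 : P.coeff i = e (u i) := by
    rw [Polynomial.finsetSum_coeff]
    simp only [Polynomial.coeff_monomial, Fin.val_inj]
    simp
  rw [hP0, Polynomial.coeff_zero] at h2
  exact pow_eq_zero_iff hp0.ne_zero |>.1 (congrArg Subtype.val h2).symm

theorem exists_eq_sum_pow_mul_pow [PerfectField K] (g : L) {c : L} (hc : c ∈ K⟮g⟯) :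
    ∃ d : Fin p → L, (∀ i, d i ∈ K⟮g⟯) ∧ c = ∑ i : Fin p, g ^ (i : ℕ) * d i ^ p := by
  classical
  have hp0 : p.Prime := Fact.out
  haveI : CharP K p := (algebraMap K L).charP_iff (algebraMap K L).injective p |>.2 inferInstance
  haveI : ExpChar K p := .prime hp0
  haveI : ExpChar L p := .prime hp0
  haveI : PerfectRing K p := PerfectField.toPerfectRing p
  have hgm : g ∈ K⟮g⟯ := mem_adjoin_simple_self K g
  have hpoly : ∀ P : Polynomial K, ∃ d : Fin p → L, (∀ i, d i ∈ K⟮g⟯) ∧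
      Polynomial.aeval g P = ∑ i : Fin p, g ^ (i : ℕ) * d i ^ p := by
    intro P
    induction P using Polynomial.induction_on' with
    | add P Q hP hQ =>
      obtain ⟨d, hd, h1⟩ := hP
      obtain ⟨d', hd', h2⟩ := hQ
      refine ⟨fun i => d i + d' i, fun i => add_mem (hd i) (hd' i), ?_⟩
      simp only [map_add, h1, h2, add_pow_expChar, mul_add, Finset.sum_add_distrib]
    | monomial n a =>
      obtain ⟨a, rfl⟩ := surjective_frobenius K p a
      refine ⟨Pi.single ⟨n % p, Nat.mod_lt _ hp0.pos⟩ (algebraMap K L a * g ^ (n / p)),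
        fun i => ?_, ?_⟩
      · rw [Pi.single_apply]
        split_ifs
        · exact mul_mem (_root_.algebraMap_mem _ _) (pow_mem hgm _)
        · exact zero_mem _
      · rw [Finset.sum_eq_single ⟨n % p, Nat.mod_lt _ hp0.pos⟩]
        · rw [Pi.single_eq_same, Polynomial.aeval_monomial, frobenius_def, map_pow, mul_pow,
            ← pow_mul, mul_left_comm, ← pow_add, mul_comm (n / p), Nat.mod_add_div]
        · intro i _ hi
          rw [Pi.single_eq_of_ne hi, zero_pow hp0.ne_zero, mul_zero]
        · exact fun h => (h (Finset.mem_univ _)).elim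
  obtain ⟨P, Q, rfl⟩ := (mem_adjoin_simple_iff K c).1 hc
  obtain ⟨d, hd, h1⟩ := hpoly (P * Q ^ (p - 1))
  refine ⟨fun i => d i / Polynomial.aeval g Q, fun i => div_mem (hd i) ?_, ?_⟩
  · exact Polynomial.aeval_mem_adjoin_singleton K g |> fun h => algebra_adjoin_le_adjoin K _ h
  · by_cases hQ : Polynomial.aeval g Q = 0
    · simp [hQ, hp0.ne_zero]
    · simp only [div_pow, mul_div, ← Finset.sum_div, ← h1, map_mul, map_pow]
      rw [div_eq_div_iff hQ (pow_ne_zero _ hQ), mul_assoc, ← pow_succ,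
        Nat.sub_add_cancel hp0.one_le]

theorem separablyGeneratedVia_of_forall_pow_ne [PerfectField K] [Algebra.EssFiniteType K L] {g : L}
    (hg : ∀ v : L, v ^ p ≠ g) : SeparablyGeneratedVia (K⟮g⟯.val : K⟮g⟯ →+* L) := by
  have hp0 : p.Prime := Fact.out
  haveI : ExpChar L p := .prime hp0
  let k := (K⟮g⟯.val : K⟮g⟯ →+* L).fieldRange
  have hk : ∀ u : k, (u : L) ∈ K⟮g⟯ := by
    rintro ⟨_, u, rfl⟩
    exact u.2
  haveI : Algebra.EssFiniteType k L := essFiniteType_fieldRange _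
  haveI : CharP k p := (algebraMap k L).charP (algebraMap k L).injective p
  haveI : ExpChar k p := .prime hp0
  obtain ⟨s, hs, hsep⟩ :=
    exists_isTranscendenceBasis_and_isSeparable_of_linearIndepOn_pow_of_essFiniteType (k := k)
      (K := L) p hp0 (fun s hs => by
        rw [linearIndepOn_finset_iff] at hs ⊢
        intro c hc
        choose d hd hcd using fun u : L => exists_eq_sum_pow_mul_pow p g (hk (c u))
        have h1 : ∑ i : Fin p, g ^ (i : ℕ) * (∑ u ∈ s, d u i * u) ^ p = 0 := by
          rw [← hc]
          simp only [sum_pow_char, Finset.mul_sum, Algebra.smul_def]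
          rw [Finset.sum_comm]
          refine Finset.sum_congr rfl fun u _ => ?_
          change _ = (c u : L) * _
          rw [hcd, Finset.sum_mul]
          exact Finset.sum_congr rfl fun i _ => by rw [mul_pow, mul_assoc]
        have h2 := eq_zero_of_sum_pow_mul_pow_eq_zero p hg h1
        intro u hu
        apply Subtype.ext
        rw [hcd]
        refine Finset.sum_eq_zero fun i _ => ?_
        have h3 := hs (fun v => ⟨d v i, ⟨d v i, hd v i⟩, rfl⟩) (h2 i) u hu
        have h4 : d u i = 0 := congrArg Subtype.val h3
        rw [h4, zero_pow hp0.ne_zero, mul_zero])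
  exact .of_finset hs hsep

end

theorem finSepOver_gen {g : L} (htr : Transcendental K g) :
    FinSepOver (evalAt K fun _ : Fin 1 => AdjoinSimple.gen K g) := by
  have h2 : AlgebraicIndependent K (fun _ : Fin 1 => AdjoinSimple.gen K g) := by
    rw [algebraicIndependent_unique_type_iff]
    exact fun h => htr (IsAlgebraic.algHom K⟮g⟯.val h)
  haveI : Algebra.EssFiniteType K K⟮g⟯ :=
    IntermediateField.essFiniteType_iff.2 (fg_adjoin_of_finite (Set.finite_singleton g))
  refine .of_isSeparable h2 ?_
  set E := Subfield.closure (Set.range (evalAt K fun _ : Fin 1 => AdjoinSimple.gen K g)) with hE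
  have hP : ∀ P : Polynomial K, Polynomial.aeval (AdjoinSimple.gen K g) P ∈ E := fun P => by
    refine Subfield.subset_closure ⟨Polynomial.aeval (MvPolynomial.X 0) P, ?_⟩
    change MvPolynomial.aeval _ _ = _
    rw [← Polynomial.aeval_algHom_apply, MvPolynomial.aeval_X]
  refine ⟨fun u => ?_⟩
  obtain ⟨P, Q, h⟩ := (mem_adjoin_simple_iff K (u : L)).1 u.2
  have hu : u = Polynomial.aeval (AdjoinSimple.gen K g) P /
      Polynomial.aeval (AdjoinSimple.gen K g) Q := by
    apply Subtype.ext
    rw [h]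
    change _ = K⟮g⟯.val (_ / _)
    rw [map_div₀, ← Polynomial.aeval_algHom_apply, ← Polynomial.aeval_algHom_apply]
    rfl
  exact isSeparable_algebraMap (F := E) (⟨u, hu ▸ div_mem (hP P) (hP Q)⟩ : E)

theorem exists_mem_finSepOver [IsAlgClosed K] [Algebra.EssFiniteType K L]
    {L₀ : IntermediateField K L} (hroot : ∀ p : ℕ, p.Prime → CharP L p → ∀ u : L, u ^ p ∈ L₀ → u ∈ L₀) {g₀ : L}
    (hg₀ : g₀ ∈ L₀) (htr : Transcendental K g₀) :
    ∃ g ∈ L₀, ∃ (r : ℕ) (t : Fin r → L),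
      FinSepOver (evalAt K (Sum.elim (fun _ : Fin 1 => g) t)) := by
  obtain ⟨g, hg, hg', hs⟩ : ∃ g ∈ L₀, Transcendental K g ∧
      SeparablyGeneratedVia (K⟮g⟯.val : K⟮g⟯ →+* L) := by
    obtain hp | ⟨p, hp, hpk⟩ := CharP.exists' K
    · haveI : CharZero K⟮g₀⟯ :=
        charZero_of_injective_algebraMap (algebraMap K K⟮g₀⟯).injective
      haveI : CharZero (K⟮g₀⟯.val : K⟮g₀⟯ →+* L).fieldRange :=
        ((K⟮g₀⟯.val : K⟮g₀⟯ →+* L).rangeRestrictField.charZero_iff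
          (RingHom.injective _)).1 inferInstance
      haveI := essFiniteType_fieldRange K⟮g₀⟯
      obtain ⟨s, h1, h2⟩ := exists_isTranscendenceBasis_and_isSeparable_of_perfectField
        (K⟮g₀⟯.val : K⟮g₀⟯ →+* L).fieldRange L
      exact ⟨g₀, hg₀, htr, .of_finset h1 h2⟩
    · haveI : CharP L p := charP_of_injective_algebraMap (algebraMap K L).injective p
      obtain ⟨g, hg, hgp⟩ := exists_mem_forall_pow_ne p (hroot p hp.out inferInstance) hg₀ htr
      refine ⟨g, hg, ?_, separablyGeneratedVia_of_forall_pow_ne p hgp⟩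
      intro hal
      obtain ⟨c, rfl⟩ := minpoly.mem_range_of_degree_eq_one K g
        (IsAlgClosed.degree_eq_one_of_irreducible K (minpoly.irreducible hal.isIntegral))
      obtain ⟨d, rfl⟩ := IsAlgClosed.exists_pow_nat_eq c hp.out.pos
      exact hgp (algebraMap K L d) (map_pow _ _ _).symm
  obtain ⟨r, t, h⟩ := (finSepOver_gen hg').exists_extend (F := K⟮g⟯.val) hs
  exact ⟨g, hg, r, t, h⟩

end

end

section
open Polynomial

section
variable {A M : Type*} [CommRing A] [IsDomain A] [Field M] {φ : A →+* M} {w : M} {G : A[X]}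

/-- The fibre of `A[w]` over a prime element not dividing a discriminant multiple is reduced. -/
theorem exists_eq_mul_of_pow_eq_mul (hG : G.Monic) (hker : ∀ p : A[X], p.eval₂ φ w = 0 ↔ G ∣ p)
    {δ : A} {p q : A[X]} (hδ : C δ = p * derivative G + q * G) {ℓ : A} (hℓ : Prime ℓ)
    (hℓδ : ¬ ℓ ∣ δ) {P Q : A[X]} {n : ℕ} (h : P.eval₂ φ w ^ n = φ ℓ * Q.eval₂ φ w) :
    ∃ W : A[X], P.eval₂ φ w = φ ℓ * W.eval₂ φ w := by
  let I := Ideal.span {ℓ}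
  haveI : I.IsPrime := (Ideal.span_singleton_prime hℓ.ne_zero).2 hℓ
  let π := Ideal.Quotient.mk I
  let κ := FractionRing (A ⧸ I)
  let j : A ⧸ I →+* κ := algebraMap _ _
  have hj : Function.Injective j := IsFractionRing.injective _ _
  have hπ : ∀ a, π a = 0 ↔ ℓ ∣ a := fun a => by
    rw [Ideal.Quotient.eq_zero_iff_mem, Ideal.mem_span_singleton]
  obtain ⟨T, hT⟩ : G ∣ P ^ n - C ℓ * Q := by
    rw [← hker, eval₂_sub, eval₂_pow, eval₂_mul, eval₂_C, h, sub_self]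
  have hsep : ((G.map π).map j).Separable := by
    have h1 := congrArg (Polynomial.map j) (congrArg (Polynomial.map π) hδ)
    simp only [map_C, Polynomial.map_add, Polynomial.map_mul] at h1
    have hu : j (π δ) ≠ 0 := by
      rw [Ne, map_eq_zero_iff j hj, hπ]
      exact hℓδ
    refine ⟨C (j (π δ))⁻¹ * (q.map π).map j, C (j (π δ))⁻¹ * (p.map π).map j, ?_⟩
    rw [derivative_map, derivative_map, mul_assoc, mul_assoc, ← mul_add, add_comm, ← h1, ← C_mul,
      inv_mul_cancel₀ hu, C_1]
  have hdvd : (G.map π).map j ∣ (P.map π).map j := by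
    refine hsep.squarefree.isRadical n _ ⟨(T.map π).map j, ?_⟩
    have h1 := congrArg (Polynomial.map π) hT
    have h2 : π ℓ = 0 := (hπ ℓ).2 dvd_rfl
    rw [Polynomial.map_sub, Polynomial.map_mul, map_C, h2, C_0, zero_mul, sub_zero] at h1
    rw [← Polynomial.map_pow, ← Polynomial.map_pow, h1, Polynomial.map_mul, Polynomial.map_mul]
  rw [Polynomial.map_dvd_map _ hj (hG.map π)] at hdvd
  obtain ⟨U, hU⟩ := hdvd
  obtain ⟨U, rfl⟩ := Polynomial.map_surjective π Ideal.Quotient.mk_surjective U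
  obtain ⟨W, hW⟩ : C ℓ ∣ P - G * U := by
    rw [C_dvd_iff_dvd_coeff]
    intro i
    rw [← hπ, ← Polynomial.coeff_map, Polynomial.map_sub, Polynomial.map_mul, hU, sub_self,
      coeff_zero]
  refine ⟨W, ?_⟩
  have h3 : P = G * U + C ℓ * W := by rw [← hW]; ring
  rw [h3, eval₂_add, eval₂_mul, eval₂_mul, eval₂_C, (hker G).2 dvd_rfl, zero_mul, zero_add]

theorem exists_C_eq_add (hker : ∀ p : A[X], p.eval₂ φ w = 0 ↔ G ∣ p)
    (hG' : (derivative G).eval₂ φ w ≠ 0)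
    (hden : ∀ u : M, ∃ b : A, b ≠ 0 ∧ ∃ p : A[X], φ b * u = p.eval₂ φ w) :
    ∃ δ : A, δ ≠ 0 ∧ ∃ p q : A[X], C δ = p * derivative G + q * G := by
  obtain ⟨δ, hδ, p, hp⟩ := hden ((derivative G).eval₂ φ w)⁻¹
  obtain ⟨q, hq⟩ : G ∣ C δ - p * derivative G := by
    rw [← hker, eval₂_sub, eval₂_C, eval₂_mul, ← hp, mul_assoc, inv_mul_cancel₀ hG', mul_one,
      sub_self]
  exact ⟨δ, hδ, p, q, by rw [mul_comm q, ← hq]; ring⟩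

theorem dvd_of_isIntegralElem [IsIntegrallyClosed A] (hφ : Function.Injective φ) {a b : A} {u : M}
    (hu : φ.IsIntegralElem u) (h : φ a * u = φ b) : a ∣ b := by
  by_cases ha : a = 0
  · subst ha
    rw [map_zero, zero_mul, eq_comm, map_eq_zero_iff φ hφ] at h
    rw [h]
  letI : Algebra A M := φ.toAlgebra
  let E := Subfield.closure (Set.range φ)
  letI : Algebra A E := (toClosure φ).toAlgebra
  haveI : IsScalarTower A E M := IsScalarTower.of_algebraMap_eq fun a => rfl
  haveI hfr : IsFractionRing A E := isFractionRing_toClosure φ hφ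
  have ha' : φ a ≠ 0 := (map_ne_zero_iff φ hφ).2 ha
  have hmem : ∀ c, φ c ∈ E := fun c => Subfield.subset_closure ⟨c, rfl⟩
  have huE : u ∈ E := by
    rw [eq_div_of_mul_eq ha' ((mul_comm _ _).trans h)]
    exact div_mem (hmem b) (hmem a)
  have h1 : IsIntegral A (⟨u, huE⟩ : E) :=
    (isIntegral_algebraMap_iff (algebraMap E M).injective).1 hu
  obtain ⟨c, hc⟩ := IsIntegrallyClosed.isIntegral_iff.1 h1
  have hc' : φ c = u := congrArg Subtype.val hc
  exact ⟨c, hφ (by rw [map_mul, hc', h])⟩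

/-- A nonzero element lies over only finitely many primes of the base. -/
theorem FinSepOver.exists_forall_dvd [IsIntegrallyClosed A] (h : FinSepOver φ) {v : M}
    (hv : v ≠ 0) : ∃ N : A, N ≠ 0 ∧ ∀ (ℓ : A) (n : ℕ) (u : M), Prime ℓ → φ.IsIntegralElem u →
      φ ℓ * u = v ^ n → ℓ ∣ N := by
  obtain ⟨N, hN, hint⟩ := h.exists_isIntegralElem v⁻¹
  refine ⟨N, hN, fun ℓ n u hℓ hu huv => hℓ.dvd_of_dvd_pow (n := n) ?_⟩
  refine dvd_of_isIntegralElem h.inj (u := u * (φ N * v⁻¹) ^ n) ?_ ?_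
  · letI : Algebra A M := φ.toAlgebra
    exact IsIntegral.mul hu (IsIntegral.pow hint n)
  · rw [← mul_assoc, huv, ← mul_pow, map_pow, mul_left_comm, mul_inv_cancel₀ hv, mul_one]

end

end

section
open MvPolynomial

section
variable {K L R ι : Type*} [Field K] [Field L] [Algebra K L] [CommRing R] [IsDomain R]
  [Algebra K R] [Algebra R L] [IsScalarTower K R L] [IsFractionRing R L]

/-- The saturation of the principal ideal `(d)` with respect to `b`. -/
def satIdeal (b d : R) : Ideal R where
  carrier := {r | ∃ m : ℕ, d ∣ b ^ m * r}
  zero_mem' := ⟨0, by rw [mul_zero]; exact dvd_zero d⟩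
  add_mem' := by
    rintro r s ⟨m, hm⟩ ⟨n, hn⟩
    refine ⟨m + n, ?_⟩
    rw [show b ^ (m + n) * (r + s) = b ^ n * (b ^ m * r) + b ^ m * (b ^ n * s) by ring]
    exact dvd_add (hm.mul_left _) (hn.mul_left _)
  smul_mem' := by
    rintro c r ⟨m, hm⟩
    refine ⟨m, ?_⟩
    rw [smul_eq_mul, mul_left_comm]
    exact hm.mul_left _

theorem finite_dvd_X_sub_C [Infinite K] {Δ : MvPolynomial ι K} (hΔ : Δ ≠ 0) (i : ι) :
    {c : K | X i - C c ∣ Δ}.Finite := by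
  classical
  obtain ⟨v, hv⟩ : ∃ v, eval v Δ ≠ 0 := by
    by_contra! h
    exact hΔ (MvPolynomial.funext fun v => by rw [h, map_zero])
  let q : Polynomial K := aeval (fun j => if j = i then Polynomial.X else Polynomial.C (v j)) Δ
  have hq : ∀ c, q.eval c = eval (Function.update v i c) Δ := fun c => by
    change Polynomial.evalRingHom c (aeval _ Δ) = _
    rw [aeval_def, eval₂_eq_eval_map, ← eval₂_eq_eval_map, hom_eval₂]
    rw [← coe_eval₂Hom, ← eval₂_id, ← coe_eval₂Hom]
    congr 2
    · ext; simp
    · funext j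
      by_cases hj : j = i
      · subst hj; simp
      · simp [hj]
  have hq0 : q ≠ 0 := by
    intro h
    have h1 := hq (v i)
    rw [h, Polynomial.eval_zero, Function.update_eq_self] at h1
    exact hv h1.symm
  refine (q.roots.toFinset.finite_toSet).subset fun c hc => ?_
  rw [Finset.mem_coe, Multiset.mem_toFinset, Polynomial.mem_roots hq0, Polynomial.IsRoot, hq]
  obtain ⟨p, rfl⟩ := hc
  rw [map_mul, map_sub, eval_X, eval_C, Function.update_self, sub_self, zero_mul]

theorem MvPolynomial.prime_X_sub_C (i : ι) (c : K) : Prime (X i - C c : MvPolynomial ι K) := by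
  let f : K → MvPolynomial ι K →ₐ[K] MvPolynomial ι K := fun c => aeval fun j => X j - C c
  have hf : ∀ c c', c + c' = 0 → (f c).comp (f c') = AlgHom.id K _ := fun c c' h => by
    ext1 j
    simp only [f, AlgHom.comp_apply, aeval_X, map_sub, aeval_C, MvPolynomial.algebraMap_eq,
      AlgHom.id_apply]
    rw [sub_sub, ← C_add, h, C_0, sub_zero]
  let e := AlgEquiv.ofAlgHom (f c) (f (-c)) (hf _ _ (add_neg_cancel c)) (hf _ _ (neg_add_cancel c))
  have h1 : e (X i) = X i - C c := aeval_X _ _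
  rw [← h1]
  exact (MulEquiv.prime_iff e.toMulEquiv).2 (X_prime (i := i))

variable {x : ι → L} {y : L} {b : R} {a : Polynomial (MvPolynomial ι K)}

theorem CommonChart.exists_pow_eq (hc : CommonChart x y b a) {N : ℕ} {h : Polynomial (MvPolynomial ι K)}
    {j : ℕ} (hj : evalPair K x y a ^ j * algebraMap R L b = evalPair K x y h)
    {d : R} {ℓ : L} (hd : algebraMap R L d = algebraMap R L b ^ N * ℓ)
    {r : R} {n : ℕ} (hr : r ^ n ∈ satIdeal b d) {P : Polynomial (MvPolynomial ι K)} {k : ℕ}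
    (hP : evalPair K x y a ^ k * algebraMap R L r = evalPair K x y P) :
    ∃ (M : ℕ) (Q : Polynomial (MvPolynomial ι K)),
      evalPair K x y (a * h * P) ^ M = ℓ * evalPair K x y Q := by
  obtain ⟨m, s, hs⟩ := hr
  obtain ⟨k', Q, hQ⟩ := hc.den s
  have hs' := congrArg (algebraMap R L) hs
  simp only [map_mul, map_pow, hd] at hs'
  refine ⟨n + m + j * N + k', a ^ (j * m + k * n) * h ^ N * Q * (a ^ (n + m) *
    h ^ (n + j * N + k') * P ^ (m + j * N + k')), ?_⟩
  simp only [map_mul, map_pow, ← hj, ← hP, ← hQ]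
  generalize evalPair K x y a = a' at *
  generalize algebraMap R L b = b' at *
  generalize algebraMap R L r = r' at *
  generalize algebraMap R L s = s' at *
  calc _ = (b' ^ m * r' ^ n) * a' ^ (n + m + j * N + k') * (a' ^ j) ^ (n + m + j * N + k')  *
        (a' ^ k) ^ (n + m + j * N + k') * b' ^ (n + j * N + k') * r' ^ (m + j * N + k') := by ring
    _ = _ := by rw [hs']; ring

theorem CommonChart.mem_satIdeal (hc : CommonChart x y b a) {N : ℕ}
    {h : Polynomial (MvPolynomial ι K)}
    {j : ℕ} (hj : evalPair K x y a ^ j * algebraMap R L b = evalPair K x y h)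
    {d : R} {ℓ : L} (hd : algebraMap R L d = algebraMap R L b ^ N * ℓ)
    {r : R} {P : Polynomial (MvPolynomial ι K)} {k : ℕ}
    (hP : evalPair K x y a ^ k * algebraMap R L r = evalPair K x y P)
    {W : Polynomial (MvPolynomial ι K)} (hW : evalPair K x y (a * h * P) = ℓ * evalPair K x y W) :
    r ∈ satIdeal b d := by
  obtain ⟨ρ, hρ⟩ := hc.inv
  obtain ⟨N', w, hw⟩ := hc.num W
  refine ⟨N' + N + 2 + j + k, w * ρ ^ (1 + j + k), IsFractionRing.injective R L ?_⟩
  simp only [map_mul, map_pow, hd, ← hw]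
  simp only [map_mul, ← hj, ← hP] at hW
  generalize evalPair K x y a = a' at *
  generalize algebraMap R L b = b' at *
  generalize algebraMap R L r = r' at *
  generalize algebraMap R L ρ = s' at *
  calc _ = b' ^ (N' + N) * b' ^ (1 + j + k) * b' * r' := by ring
    _ = b' ^ (N' + N) * s' ^ (1 + j + k) * (a' * (a' ^ j * b') * (a' ^ k * r')) := by
        rw [← hρ]; ring
    _ = _ := by rw [hW]; ring

/-- The level sets of a coordinate of a separating transcendence basis: all but finitely many are
reduced and nonempty on a suitable basic open subset. -/
theorem exists_levelSets [Infinite K] [Algebra.FiniteType K R] [Finite ι]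
    (hx : FinSepOver (evalAt K x)) (i : ι) :
    ∃ (b α : R) (N : ℕ), b ≠ 0 ∧ algebraMap R L α = algebraMap R L b ^ N * x i ∧
      {c : K | ¬ ((satIdeal b (α - algebraMap K R c * b ^ N)).IsRadical ∧
        satIdeal b (α - algebraMap K R c * b ^ N) ≠ ⊤)}.Finite := by
  obtain ⟨y, G, hG, hker, hG', hden⟩ := hx.exists_primitive
  obtain ⟨b, a, hGa, hc⟩ := exists_commonChart (R := R) hx.inj hden hG'
  obtain ⟨N, α, hα⟩ := hc.num (Polynomial.C (X i))
  rw [evalPair_C] at hα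
  obtain ⟨j, h, hj⟩ := hc.den b
  have hb : algebraMap R L b ≠ 0 := (map_ne_zero_iff _ (IsFractionRing.injective R L)).2 hc.ne_zero
  have ha : evalPair K x y a ≠ 0 := by
    obtain ⟨r, hr⟩ := hc.inv
    intro h0
    rw [h0, zero_mul] at hr
    exact hb hr.symm
  obtain ⟨δ, hδ0, p, q, hδ⟩ := exists_C_eq_add hker hG' hden
  obtain ⟨N₁, hN₁, hdvd⟩ := hx.exists_forall_dvd (v := evalPair K x y (a * h))
    (by rw [map_mul, ← hj]; exact mul_ne_zero ha (mul_ne_zero (pow_ne_zero _ ha) hb))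
  have hxi : evalAt K x (X i) = x i := aeval_X _ _
  refine ⟨b, α, N, hc.ne_zero, by rw [← hα, hxi], ?_⟩
  refine (finite_dvd_X_sub_C (mul_ne_zero hδ0 hN₁) i).subset fun c hcc => ?_
  by_contra hndvd
  refine hcc ?_
  have hℓ := MvPolynomial.prime_X_sub_C i c
  have hd : algebraMap R L (α - algebraMap K R c * b ^ N) =
      algebraMap R L b ^ N * evalAt K x (X i - C c) := by
    rw [map_sub, map_sub, map_mul, map_pow, ← hα, ← IsScalarTower.algebraMap_apply]
    change _ = _ * (_ - aeval x (C c))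
    rw [aeval_C]
    ring
  constructor
  · rintro r ⟨n, hr⟩
    obtain ⟨k, P, hP⟩ := hc.den r
    obtain ⟨M, Q, hM⟩ := hc.exists_pow_eq hj hd hr hP
    obtain ⟨W, hW⟩ := exists_eq_mul_of_pow_eq_mul hG hker hδ hℓ
      (fun h => hndvd (h.mul_right _)) hM
    exact hc.mem_satIdeal hj hd hP hW
  · intro htop
    have h1 : (1 : R) ^ 1 ∈ satIdeal b (α - algebraMap K R c * b ^ N) := htop ▸ Submodule.mem_top
    obtain ⟨M, Q, hM⟩ := hc.exists_pow_eq hj hd h1 (P := 1) (k := 0) (by simp)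
    rw [mul_one] at hM
    refine hndvd ((hdvd _ M _ hℓ ?_ hM.symm).mul_left _)
    letI : Algebra (MvPolynomial ι K) L := (evalAt K x).toAlgebra
    have hy : IsIntegral (MvPolynomial ι K) y := ⟨G, hG, (hker G).2 dvd_rfl⟩
    have h2 : evalPair K x y Q = Polynomial.aeval y Q := rfl
    change IsIntegral (MvPolynomial ι K) (evalPair K x y Q)
    rw [h2]
    exact IsIntegral.of_mem_of_fg _ hy.fg_adjoin_singleton _ (Polynomial.aeval_mem_adjoin_singleton _ y)

end

end

section
variable {R S : Type*} [CommRing R] [CommRing S] {b d : R} {P : Ideal R}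

theorem satIdeal_le (hP : P.IsPrime) (hb : b ∉ P) (hd : d ∈ P) : satIdeal b d ≤ P := by
  rintro r ⟨m, hm⟩
  exact (hP.mem_or_mem (P.mem_of_dvd hm hd)).resolve_left fun h => hb (hP.mem_of_pow_mem _ h)

theorem self_mem_satIdeal : d ∈ satIdeal b d := ⟨0, by simp⟩

theorem notMem_of_mem_minimalPrimes_satIdeal (hP : P ∈ (satIdeal b d).minimalPrimes) : b ∉ P := by
  intro hb
  obtain ⟨y, hy, m, hm⟩ := Ideal.exists_mul_mem_of_mem_minimalPrimes hP hb
  exact hy ⟨m + 1, by rwa [pow_succ, mul_assoc]⟩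

theorem heightOnePrime_of_mem_minimalPrimes_span [IsDomain R] [IsNoetherianRing R] (hd : d ≠ 0)
    (hP : P ∈ (Ideal.span {d}).minimalPrimes) : HeightOnePrime P := by
  haveI := hP.1.1
  have hdP : d ∈ P := hP.1.2 (Ideal.mem_span_singleton_self d)
  refine ⟨hP.1.1, fun h => hd (by simpa [h] using hdP), fun Q hQ hlt => ?_⟩
  by_contra hQ0
  have h1 := Ideal.height_le_one_of_isPrincipal_of_mem_minimalPrimes (Ideal.span {d}) P hP
  haveI : (⊥ : Ideal R).IsPrime := Ideal.isPrime_bot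
  have h2 := Ideal.height_add_one_le_of_lt_of_isPrime (bot_lt_iff_ne_bot.2 hQ0)
  have h3 := Ideal.height_add_one_le_of_lt_of_isPrime hlt
  have h4 : (⊥ : Ideal R).height + 1 + 1 ≤ 1 := (add_le_add_left h2 1).trans (h3.trans h1)
  rw [Ideal.height_bot] at h4
  exact absurd h4 (by decide)

theorem isHypersurfaceIdeal_satIdeal [IsDomain R] [IsNoetherianRing R] (hd : d ≠ 0)
    (hrad : (satIdeal b d).IsRadical) (htop : satIdeal b d ≠ ⊤) :
    IsHypersurfaceIdeal (satIdeal b d) := by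
  refine ⟨hrad, htop, fun P hP => heightOnePrime_of_mem_minimalPrimes_span hd ⟨⟨hP.1.1, ?_⟩, ?_⟩⟩
  · exact (Ideal.span_singleton_le_iff_mem _).2 (hP.1.2 self_mem_satIdeal)
  · rintro Q ⟨hQ, hdQ⟩ hle
    exact hP.2 ⟨hQ, satIdeal_le hQ (fun h => notMem_of_mem_minimalPrimes_satIdeal hP (hle h))
      ((Ideal.span_singleton_le_iff_mem _).1 hdQ)⟩ hle

variable {f : R →+* S} {Q : Ideal S}

theorem heightOnePrime_of_mem_minimalPrimes_map [IsDomain S] [IsNoetherianRing S]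
    (hd : f d ≠ 0) (hQ : Q ∈ ((satIdeal b d).map f).minimalPrimes) (hb : f b ∉ Q) :
    HeightOnePrime Q := by
  refine heightOnePrime_of_mem_minimalPrimes_span hd ⟨⟨hQ.1.1, ?_⟩, ?_⟩
  · exact (Ideal.span_singleton_le_iff_mem _).2 (hQ.1.2 (Ideal.mem_map_of_mem f self_mem_satIdeal))
  · rintro Q' ⟨hQ', hdQ⟩ hle
    refine hQ.2 ⟨hQ', Ideal.map_le_iff_le_comap.2 (satIdeal_le (hQ'.comap f) (fun h => hb (hle h))
      (show f d ∈ Q' from (Ideal.span_singleton_le_iff_mem _).1 hdQ))⟩ hle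

/-- If `d` and its image agree up to functions that are invertible at `Q`, then `Q` occurs in the
proper transform. -/
theorem mem_minimalPrimes_map_satIdeal (hd : f d ≠ 0) (hQ : HeightOnePrime Q) (hb : f b ∉ Q)
    (hdQ : f d ∈ Q) (hht : ∀ P : Ideal R, P.IsPrime → P < Q.comap f → P = ⊥) :
    Q ∈ ((satIdeal b d).map f).minimalPrimes ∧ Q.comap f ∈ (satIdeal b d).minimalPrimes := by
  have hle : satIdeal b d ≤ Q.comap f := satIdeal_le (hQ.1.comap f) hb hdQ
  refine ⟨⟨⟨hQ.1, Ideal.map_le_iff_le_comap.2 hle⟩, ?_⟩, ⟨⟨hQ.1.comap f, hle⟩, ?_⟩⟩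
  · rintro Q' ⟨hQ', hle'⟩ h
    by_contra hcon
    have h0 := hQ.2.2 Q' hQ' (lt_of_le_not_ge h hcon)
    have h1 := hle' (Ideal.mem_map_of_mem f self_mem_satIdeal)
    rw [h0] at h1
    exact hd (by simpa using h1)
  · rintro P ⟨hP, hle'⟩ h
    by_contra hcon
    have h0 := hht P hP (lt_of_le_not_ge h hcon)
    have h1 := hle' self_mem_satIdeal
    rw [h0, Ideal.mem_bot] at h1
    exact hd (by rw [h1, map_zero])

end

section
variable {K R S : Type*} [Field K] [CommRing R] [IsDomain R] [Algebra K R]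
  [CommRing S] [IsDomain S] [Algebra K S] [IsNoetherianRing S]

/-- For all but finitely many members of a pencil, every component of the first proper transform is
a component of the second one. -/
theorem finite_not_forall_mem_minimalPrimes {f₁ f₂ : R →ₐ[K] S} (hf₁ : Function.Injective f₁)
    (hf₂ : Function.Injective f₂) {b α : R} {N : ℕ} (hb : b ≠ 0)
    (hα : ∀ c : K, α - algebraMap K R c * b ^ N ≠ 0)
    (heq : f₁ α * f₂ (b ^ N) = f₂ α * f₁ (b ^ N))
    (hfin : {Q : Ideal S | HeightOnePrime Q ∧
      ¬ ∀ P : Ideal R, P.IsPrime → P < Q.comap (f₂ : R →+* S) → P = ⊥}.Finite) :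
    {c : K | ¬ ({Q | Q ∈ ((satIdeal b (α - algebraMap K R c * b ^ N)).map
        (f₁ : R →+* S)).minimalPrimes ∧ Q.comap (f₁ : R →+* S) ∈
        (satIdeal b (α - algebraMap K R c * b ^ N)).minimalPrimes} ⊆
      {Q | Q ∈ ((satIdeal b (α - algebraMap K R c * b ^ N)).map
        (f₂ : R →+* S)).minimalPrimes ∧ Q.comap (f₂ : R →+* S) ∈
        (satIdeal b (α - algebraMap K R c * b ^ N)).minimalPrimes})}.Finite := by
  have hfin2 := (finite_heightOnePrime_mem ((map_ne_zero_iff f₂ hf₂).2 hb)).union hfin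
  refine (hfin2.biUnion (t := fun Q => {c : K | f₁ b ∉ Q ∧ Q.IsPrime ∧
    f₁ (α - algebraMap K R c * b ^ N) ∈ Q}) fun Q _ => ?_).subset ?_
  · refine Set.Subsingleton.finite ?_
    rintro c ⟨hbQ, hQ, h1⟩ c' ⟨-, -, h2⟩
    by_contra hne
    have h3 := sub_mem h1 h2
    rw [← map_sub, sub_sub_sub_cancel_left, ← sub_mul, ← map_sub, map_mul, f₁.commutes,
      map_pow] at h3
    rcases hQ.mem_or_mem h3 with h4 | h4
    · refine hQ.ne_top (Ideal.eq_top_of_isUnit_mem _ h4 ?_)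
      exact (isUnit_iff_ne_zero.2 (sub_ne_zero.2 (Ne.symm hne))).map _
    · exact hbQ (hQ.mem_of_pow_mem _ h4)
  · intro c hc
    obtain ⟨Q, ⟨hQ, hQ'⟩, hcon⟩ := Set.not_subset.1 hc
    have hbQ : f₁ b ∉ Q := fun h => notMem_of_mem_minimalPrimes_satIdeal hQ' h
    have hdQ : f₁ (α - algebraMap K R c * b ^ N) ∈ Q := hQ'.1.2 self_mem_satIdeal
    have h1 : HeightOnePrime Q := heightOnePrime_of_mem_minimalPrimes_map
      ((map_ne_zero_iff f₁ hf₁).2 (hα c)) hQ hbQ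
    refine Set.mem_biUnion (x := Q) ?_ ⟨hbQ, hQ.1.1, hdQ⟩
    by_contra hnot
    rw [Set.mem_union, not_or] at hnot
    have hb₂ : f₂ b ∉ Q := fun h => hnot.1 ⟨h1, h⟩
    refine hcon (mem_minimalPrimes_map_satIdeal ((map_ne_zero_iff f₂ hf₂).2 (hα c)) h1 hb₂ ?_ ?_)
    · have h2 : f₁ (α - algebraMap K R c * b ^ N) * f₂ (b ^ N) =
          f₂ (α - algebraMap K R c * b ^ N) * f₁ (b ^ N) := by
        simp only [map_sub, map_mul, f₁.commutes, f₂.commutes, sub_mul, heq]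
        ring
      have h3 := Ideal.mul_mem_right (f₂ (b ^ N)) Q hdQ
      rw [h2] at h3
      refine (hQ.1.1.mem_or_mem h3).resolve_right fun h => hbQ ?_
      rw [map_pow] at h
      exact hQ.1.1.mem_of_pow_mem _ h
    · by_contra h
      exact hnot.2 ⟨h1, h⟩

theorem finite_properTransform_ne {f₁ f₂ : R →ₐ[K] S} (hf₁ : Function.Injective f₁)
    (hf₂ : Function.Injective f₂) {b α : R} {N : ℕ} (hb : b ≠ 0)
    (hα : ∀ c : K, α - algebraMap K R c * b ^ N ≠ 0)
    (heq : f₁ α * f₂ (b ^ N) = f₂ α * f₁ (b ^ N))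
    (hfin₁ : {Q : Ideal S | HeightOnePrime Q ∧
      ¬ ∀ P : Ideal R, P.IsPrime → P < Q.comap (f₁ : R →+* S) → P = ⊥}.Finite)
    (hfin₂ : {Q : Ideal S | HeightOnePrime Q ∧
      ¬ ∀ P : Ideal R, P.IsPrime → P < Q.comap (f₂ : R →+* S) → P = ⊥}.Finite) :
    {c : K | properTransform (f₁ : R →+* S) (satIdeal b (α - algebraMap K R c * b ^ N)) ≠
      properTransform (f₂ : R →+* S) (satIdeal b (α - algebraMap K R c * b ^ N))}.Finite := by
  refine ((finite_not_forall_mem_minimalPrimes hf₁ hf₂ hb hα heq hfin₂).union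
    (finite_not_forall_mem_minimalPrimes hf₂ hf₁ hb hα heq.symm hfin₁)).subset fun c hc => ?_
  by_contra h
  rw [Set.mem_union, not_or] at h
  exact hc (congrArg sInf (Set.Subset.antisymm (not_not.1 h.1) (not_not.1 h.2)))

end

section
open MvPolynomial

section
variable {K ι κ : Type*} [Field K]

theorem MvPolynomial.rename_dvd_rename_iff {f : ι → κ} (hf : Function.Injective f)
    {p q : MvPolynomial ι K} : rename f p ∣ rename f q ↔ p ∣ q := by
  refine ⟨fun ⟨r, hr⟩ => ⟨killCompl hf r, ?_⟩, fun h => map_dvd _ h⟩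
  have h := congrArg (killCompl hf) hr
  rwa [map_mul, killCompl_rename_app, killCompl_rename_app] at h

theorem MvPolynomial.exists_prime_associated_rename {f : ι → κ} (hf : Function.Injective f)
    {q : MvPolynomial κ K} (hq : Prime q) {p : MvPolynomial ι K} (hp : p ≠ 0)
    (hqp : q ∣ rename f p) : ∃ π, Prime π ∧ Associated q (rename f π) := by
  obtain ⟨s, hs, hsp⟩ := UniqueFactorizationMonoid.exists_prime_factors p hp
  have h1 : q ∣ (s.map (rename f)).prod := by
    rw [← map_multiset_prod]
    exact hqp.trans (map_dvd _ hsp.dvd')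
  obtain ⟨a, ha, hqa⟩ := hq.exists_mem_multiset_dvd h1
  obtain ⟨π, hπ, rfl⟩ := Multiset.mem_map.1 ha
  have hπ' : Prime (rename f π) := by
    have h2 := (prime_rename_iff (Set.range f)).2
      ((MulEquiv.prime_iff (renameEquiv K (Equiv.ofInjective f hf))).2 (hs π hπ))
    rwa [renameEquiv_apply, rename_rename] at h2
  exact ⟨π, hs π hπ, (hq.irreducible.dvd_irreducible_iff_associated hπ'.irreducible).1 hqa⟩

end

section
variable {K L M R S : Type*} [Field K] [PerfectField K] [Field L] [Algebra K L] [Field M]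
  [Algebra K M] [CommRing R] [IsDomain R] [Algebra K R] [Algebra.FiniteType K R] [Algebra R L]
  [IsScalarTower K R L] [IsFractionRing R L] [CommRing S] [IsDomain S] [Algebra K S]
  [Algebra.FiniteType K S] [Algebra S M] [IsScalarTower K S M] [IsFractionRing S M]

/-- All but finitely many prime divisors of `S` map to a prime divisor or to the generic point. -/
theorem finite_heightOnePrime_comap {f : R →ₐ[K] S} {F : L →ₐ[K] M}
    (hF : ∀ r, F (algebraMap R L r) = algebraMap S M (f r))
    (hsep : SeparablyGeneratedVia (F : L →+* M)) :
    {Q : Ideal S | HeightOnePrime Q ∧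
      ¬ ∀ P : Ideal R, P.IsPrime → P < Q.comap (f : R →+* S) → P = ⊥}.Finite := by
  haveI : IsNoetherianRing S := Algebra.FiniteType.isNoetherianRing K S
  haveI : Algebra.EssFiniteType R L := .of_isLocalization _ (nonZeroDivisors R)
  haveI : Algebra.EssFiniteType S M := .of_isLocalization _ (nonZeroDivisors S)
  haveI : Algebra.EssFiniteType K L := .comp K R L
  haveI : Algebra.EssFiniteType K M := .comp K S M
  obtain ⟨n, x, hx⟩ := exists_finSepOver K L
  obtain ⟨m, t, hz⟩ := hx.exists_extend hsep
  set z := Sum.elim (F ∘ x) t with hzdef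
  obtain ⟨y, G, hG, hker, hG', hden⟩ := hz.exists_primitive
  obtain ⟨b, a, hGa, hc⟩ := exists_commonChart (R := S) hz.inj hden hG'
  obtain ⟨H, hH, hHht⟩ := hx.exists_centre_heightOne (S := R)
  have hFx : ∀ p, F (evalAt K x p) = evalAt K z (rename Sum.inl p) := fun p => by
    simp only [evalAt, RingHom.coe_coe, aeval_rename, hzdef, Sum.elim_comp_inl]
    exact comp_aeval_apply _ F p
  obtain ⟨s₁, s₂, hs₂, hs⟩ := IsFractionRing.div_surjective (A := S) (F (evalAt K x H))
  have hinj := IsFractionRing.injective S M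
  have hs₂0 : algebraMap S M s₂ ≠ 0 :=
    (map_ne_zero_iff _ hinj).2 (nonZeroDivisors.ne_zero hs₂)
  have hs₁0 : s₁ ≠ 0 := by
    rintro rfl
    rw [map_zero, zero_div, eq_comm, map_eq_zero, map_eq_zero_iff _ hx.inj] at hs
    exact hH hs
  refine ((finite_heightOnePrime_mem hc.ne_zero).union (finite_heightOnePrime_mem hs₁0)).subset ?_
  rintro Q ⟨hQ, hQnot⟩
  by_contra hcon
  rw [Set.mem_union, not_or] at hcon
  have hbQ : b ∉ Q := fun h => hcon.1 ⟨hQ, h⟩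
  have hsQ : s₁ ∉ Q := fun h => hcon.2 ⟨hQ, h⟩
  refine hQnot ?_
  obtain ⟨P', hP'⟩ := hc.exists_sameCentre hQ.1 hbQ
  have hdiv := hc.mem_primeDivisors hz.inj hG ((hker G).2 dvd_rfl) hGa hQ hP' hbQ
  obtain ⟨q, hq, hqP⟩ := hdiv.2.2.2
  obtain ⟨V, h, h', hVQ, hVP⟩ := hP'
  have hqV : ∀ p, evalAt K z p ∈ V.nonunits ↔ q ∣ p := fun p => by
    rw [← Ideal.mem_span_singleton, ← hqP, Ideal.mem_comap, ← hVP, V.mem_centre, evalPair_C]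
  have hzV : ∀ p, evalAt K z p ∈ V := fun p => by
    rw [← evalPair_C (y := y)]
    exact h' _
  set W := V.comap (F : L →+* M) with hW
  have hnon : ∀ u, u ∈ W.nonunits ↔ F u ∈ V.nonunits := fun u => by
    rw [ValuationSubring.mem_nonunits_iff_or, ValuationSubring.mem_nonunits_iff_or,
      ValuationSubring.mem_comap, map_eq_zero, ← map_inv₀]
    rfl
  have hxW : ∀ p, evalAt K x p ∈ W := fun p => by
    rw [hW, ValuationSubring.mem_comap]
    change F _ ∈ V
    rw [hFx]
    exact hzV _
  have hcom : ∀ r, r ∈ Q.comap (f : R →+* S) ↔ algebraMap R L r ∈ W.nonunits := fun r => by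
    rw [Ideal.mem_comap, hnon, hF, ← hVQ, V.mem_centre]
    rfl
  by_cases hex : ∃ p ≠ 0, q ∣ rename Sum.inl p
  · obtain ⟨p, hp, hqp⟩ := hex
    obtain ⟨π, hπ, hqπ⟩ := exists_prime_associated_rename Sum.inl_injective hq hp hqp
    have hWπ : W ∈ ValOver (evalAt K x) π := ⟨hxW, fun p => by
      rw [hnon, hFx, hqV, hqπ.dvd_iff_dvd_left, rename_dvd_rename_iff Sum.inl_injective]⟩
    have hπH : ¬ π ∣ H := by
      intro hd
      have h1 := (hWπ.2 H).2 hd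
      rw [hnon] at h1
      refine hsQ ?_
      rw [← hVQ, V.mem_centre]
      have h2 : algebraMap S M s₁ = algebraMap S M s₂ * F (evalAt K x H) := by
        rw [← hs, mul_div_cancel₀ _ hs₂0]
      rw [h2]
      exact ValuationSubring.nonunits_mul_left (h _) h1
    obtain ⟨hR, hht⟩ := hHht π hπ hπH W hWπ
    have heq : W.centre (algebraMap R L) hR = Q.comap (f : R →+* S) := by
      ext r
      rw [W.mem_centre, hcom]
    exact heq ▸ hht.2.2
  · push Not at hex
    have hW0 : W ∈ ValOver (evalAt K x) 0 := ⟨hxW, fun p => by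
      rw [hnon, hFx, hqV, zero_dvd_iff]
      refine ⟨fun hd => by_contra fun h0 => hex p h0 hd, ?_⟩
      rintro rfl
      rw [map_zero]
      exact dvd_zero q⟩
    have hbot : Q.comap (f : R →+* S) = ⊥ := by
      rw [eq_bot_iff]
      intro r hr
      rw [hcom, W.mem_nonunits_iff_or] at hr
      obtain ⟨b', hb', hu⟩ := hx.exists_isIntegralElem (algebraMap R L r)⁻¹
      have h1 := mem_of_valOver_of_isIntegralElem (fun h0 => hb' (zero_dvd_iff.1 h0)) hu hW0
      have h2 := hr.resolve_right fun h => h h1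
      exact (map_eq_zero_iff _ (IsFractionRing.injective R L)).1 h2
    intro P _ hlt
    rw [hbot] at hlt
    exact absurd hlt not_lt_bot

end

end

section
open TensorProduct

section
variable {E K B R : Type*} [Field E] [Field K] [Algebra E K] [CommRing B] [Algebra E B] [CommRing R]
  [Algebra K R]

/-- The inclusion of a form of `R` over a subfield. -/
noncomputable def formMap (e : K ⊗[E] B ≃ₐ[K] R) : B →+* R :=
  (e : K ⊗[E] B →+* R).comp (Algebra.TensorProduct.includeRight : B →ₐ[E] K ⊗[E] B).toRingHom

variable (e : K ⊗[E] B ≃ₐ[K] R)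

theorem formMap_apply (m : B) : formMap e m = e (1 ⊗ₜ m) := rfl

theorem algebraMap_mul_formMap (c : K) (m : B) : algebraMap K R c * formMap e m = e (c ⊗ₜ m) := by
  rw [formMap_apply, ← e.commutes, ← map_mul, Algebra.TensorProduct.algebraMap_apply,
    Algebra.TensorProduct.tmul_mul_tmul, mul_one, one_mul]
  rfl

theorem algebraMap_mul_mem_range_formMap (c : E) {r : R} (hr : r ∈ (formMap e).range) :
    algebraMap K R (algebraMap E K c) * r ∈ (formMap e).range := by
  obtain ⟨m, rfl⟩ := hr
  refine ⟨c • m, ?_⟩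
  rw [algebraMap_mul_formMap, formMap_apply, ← smul_tmul, ← Algebra.algebraMap_eq_smul_one]

theorem span_range_formMap : Submodule.span K ((formMap e).range : Set R) = ⊤ := by
  rw [eq_top_iff]
  intro r _
  obtain ⟨t, rfl⟩ := e.surjective r
  induction t using TensorProduct.induction_on with
  | zero => simp
  | add x y hx hy =>
    rw [map_add]
    exact add_mem (hx trivial) (hy trivial)
  | tmul c m =>
    rw [← algebraMap_mul_formMap, ← Algebra.smul_def]
    exact Submodule.smul_mem _ _ (Submodule.subset_span ⟨m, rfl⟩)

theorem eq_zero_of_sum_mul_formMap {ι : Type*} [Fintype ι] {m : ι → B} (hm : LinearIndependent E m)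
    {c : ι → K} (h : ∑ i, algebraMap K R (c i) * formMap e (m i) = 0) (i : ι) : c i = 0 := by
  classical
  let ℬ := Module.Basis.ofVectorSpace E K
  simp_rw [algebraMap_mul_formMap, ← map_sum] at h
  rw [map_eq_zero_iff e e.injective] at h
  refine ℬ.ext_elem fun j => ?_
  have h1 := DFunLike.congr_fun (congrArg (TensorProduct.equivFinsuppOfBasisLeft ℬ) h) j
  rw [map_sum, Finsupp.finsetSum_apply] at h1
  simp only [TensorProduct.equivFinsuppOfBasisLeft_apply_tmul_apply, map_zero, Finsupp.zero_apply] at h1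
  rw [Fintype.linearIndependent_iff.1 hm _ h1 i, map_zero, Finsupp.zero_apply]

theorem satIdeal_eq_span_of_mem_range_formMap {b d : R} (hb : b ∈ (formMap e).range)
    (hd : d ∈ (formMap e).range) :
    satIdeal b d = Ideal.span {x : R | x ∈ satIdeal b d ∧ x ∈ (formMap e).range} := by
  classical
  refine le_antisymm ?_ (Ideal.span_le.2 fun x hx => hx.1)
  obtain ⟨b, rfl⟩ := hb
  obtain ⟨d, rfl⟩ := hd
  let ℬ := Module.Basis.ofVectorSpace E K
  have hmul : ∀ (u : B) (x : K ⊗[E] B) j, TensorProduct.equivFinsuppOfBasisLeft ℬ ((1 ⊗ₜ u) * x) j =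
      u * TensorProduct.equivFinsuppOfBasisLeft ℬ x j := by
    intro u x j
    induction x using TensorProduct.induction_on with
    | zero => simp
    | add x y hx hy => rw [mul_add, map_add, map_add, Finsupp.add_apply, Finsupp.add_apply, hx, hy, mul_add]
    | tmul c m =>
      rw [Algebra.TensorProduct.tmul_mul_tmul, one_mul,
        TensorProduct.equivFinsuppOfBasisLeft_apply_tmul_apply,
        TensorProduct.equivFinsuppOfBasisLeft_apply_tmul_apply, mul_smul_comm]
  rintro r ⟨m, s, hs⟩
  obtain ⟨r, rfl⟩ := e.surjective r
  obtain ⟨s, rfl⟩ := e.surjective s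
  rw [← map_pow, formMap_apply, formMap_apply, ← map_mul, ← map_mul, e.injective.eq_iff] at hs
  rw [← (TensorProduct.equivFinsuppOfBasisLeft ℬ).symm_apply_apply r,
    TensorProduct.equivFinsuppOfBasisLeft_symm_apply, Finsupp.sum, map_sum]
  refine sum_mem fun j _ => ?_
  rw [← algebraMap_mul_formMap]
  refine Ideal.mul_mem_left _ _ (Ideal.subset_span ⟨⟨m, ?_⟩, _, rfl⟩)
  rw [← map_pow, ← map_mul, ← hmul, hs, hmul]
  exact map_dvd _ (dvd_mul_right _ _)

end

section
variable {K : Type*} [Field K]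

theorem sepAlgOver_iff (k : Subfield K) (c : K) : SepAlgOver k c ↔ c ∈ separableClosure k K := by
  rw [mem_separableClosure_iff]
  constructor
  · rintro ⟨p, hp, hsep, hk, hc⟩
    obtain ⟨q, rfl⟩ : p ∈ Polynomial.lifts (algebraMap k K) := by
      rw [Polynomial.lifts_iff_coeff_lifts]
      exact fun i => ⟨⟨_, hk i⟩, rfl⟩
    have hq : q.Separable := (Polynomial.separable_map (algebraMap k K)).1 hsep
    refine hq.of_dvd (minpoly.dvd _ _ ?_)
    rwa [Polynomial.aeval_def, ← Polynomial.eval_map]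
  · intro h
    refine ⟨(minpoly k c).map (algebraMap k K), (minpoly.monic h.isIntegral).map _, ?_, ?_, ?_⟩
    · exact Polynomial.Separable.map h
    · intro i
      rw [Polynomial.coeff_map]
      exact ((minpoly k c).coeff i).2
    · rw [Polynomial.eval_map, ← Polynomial.aeval_def, minpoly.aeval]

theorem infinite_sepAlgOver [IsSepClosed K] (k : Subfield K) : {c : K | SepAlgOver k c}.Infinite := by
  have h1 : Infinite (separableClosure k K) := by
    by_contra h
    haveI := not_infinite_iff_finite.1 h
    haveI : IsSepClosed (separableClosure k K) := (separableClosure.isSepClosure k K).sep_closed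
    haveI : IsAlgClosed (separableClosure k K) := IsSepClosed.isAlgClosed_of_perfectField _
    exact h inferInstance
  refine (Set.infinite_coe_iff.1 h1).mono fun c hc => (sepAlgOver_iff k c).2 hc

variable {R : Type*} [CommRing R] [IsDomain R] [Algebra K R] [Algebra.FiniteType K R]

/-- Finitely many elements of `R` lie in a form of `R` over a separably closed subfield. -/
theorem exists_form (T : Finset R) : ∃ k : Subfield K, (∃ s : Finset K, k = Subfield.closure ↑s) ∧
    ∃ R₀ : Subring R,
      (∀ c : K, SepAlgOver k c → ∀ r ∈ R₀, algebraMap K R c * r ∈ R₀) ∧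
      Submodule.span K (R₀ : Set R) = ⊤ ∧
      (∀ (m : ℕ) (v : Fin m → R), (∀ i, v i ∈ R₀) →
        (∀ c : Fin m → K, (∀ i, SepAlgOver k (c i)) →
          ∑ i, algebraMap K R (c i) * v i = 0 → ∀ i, c i = 0) →
        ∀ c : Fin m → K, ∑ i, algebraMap K R (c i) * v i = 0 → ∀ i, c i = 0) ∧
      (T : Set R) ⊆ R₀ ∧
      ∀ b ∈ R₀, ∀ d ∈ R₀, satIdeal b d = Ideal.span {x : R | x ∈ satIdeal b d ∧ x ∈ R₀} := by
  classical
  haveI : Algebra.FinitePresentation K R := Algebra.FinitePresentation.of_finiteType.1 inferInstance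
  let P := Algebra.Presentation.ofFinitePresentation K R
  have hsurj : ∀ r : R, ∃ p, MvPolynomial.aeval P.val p = r := fun r => ⟨P.σ r, P.aeval_val_σ r⟩
  choose τ hτ using hsurj
  let s : Finset K := P.finite_coeffs.toFinset ∪ T.biUnion fun r => (τ r).coeffs
  let k := Subfield.closure (s : Set K)
  let E := separableClosure k K
  have hkE : ∀ c ∈ s, c ∈ Set.range (algebraMap E K) := fun c hc =>
    ⟨⟨c, E.algebraMap_mem ⟨c, Subfield.subset_closure hc⟩⟩, rfl⟩
  haveI : P.HasCoeffs E := ⟨fun c hc => hkE c (by simp [s, hc])⟩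
  let e : K ⊗[E] P.ModelOfHasCoeffs E ≃ₐ[K] R := P.tensorModelOfHasCoeffsEquiv E
  refine ⟨k, ⟨s, rfl⟩, (formMap e).range, ?_, span_range_formMap e, ?_, ?_, ?_⟩
  · intro c hc r hr
    exact algebraMap_mul_mem_range_formMap e (⟨c, (sepAlgOver_iff k c).1 hc⟩ : E) hr
  · intro m v hv h c hc
    choose u hu using hv
    obtain rfl : (fun i => formMap e (u i)) = v := funext hu
    refine eq_zero_of_sum_mul_formMap e (Fintype.linearIndependent_iff.2 fun g hg i => ?_) hc
    have h1 := h (fun i => algebraMap E K (g i)) (fun i => (sepAlgOver_iff k _).2 (g i).2) ?_ i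
    · exact (map_eq_zero (algebraMap E K)).1 h1
    · rw [← map_zero (formMap e), ← hg, map_sum]
      refine Finset.sum_congr rfl fun i _ => ?_
      rw [algebraMap_mul_formMap, formMap_apply, ← smul_tmul, ← Algebra.algebraMap_eq_smul_one]
  · intro r hr
    obtain ⟨q, hq⟩ : τ r ∈ Set.range (MvPolynomial.map (algebraMap E K)) := by
      rw [MvPolynomial.mem_range_map_iff_coeffs_subset]
      exact fun c hc => hkE c (Finset.mem_union_right _ (Finset.mem_biUnion.2 ⟨r, hr, hc⟩))
    refine ⟨Ideal.Quotient.mk _ q, ?_⟩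
    rw [formMap_apply, Algebra.Presentation.tensorModelOfHasCoeffsEquiv_tmul, map_one, one_mul,
      ← MvPolynomial.aeval_map_algebraMap K, hq, hτ]
  · intro b hb d hd
    exact satIdeal_eq_span_of_mem_range_formMap e hb hd

end

end

section
variable {K L M R S : Type*} [Field K] [IsAlgClosed K] [Field L] [Algebra K L] [Field M]
  [Algebra K M] [CommRing R] [IsDomain R] [Algebra K R] [Algebra.FiniteType K R] [Algebra R L]
  [IsScalarTower K R L] [IsFractionRing R L] [CommRing S] [IsDomain S] [Algebra K S]
  [Algebra.FiniteType K S] [Algebra S M] [IsScalarTower K S M] [IsFractionRing S M]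

theorem satIdeal_eq_top_of_pow_mem {b d : R} {N : ℕ} (h : b ^ N ∈ satIdeal b d) :
    satIdeal b d = ⊤ := by
  rw [Ideal.eq_top_iff_one]
  obtain ⟨m, hm⟩ := h
  exact ⟨m + N, by rwa [mul_one, pow_add]⟩

theorem injOn_satIdeal (b α : R) (N : ℕ) : Set.InjOn
    (fun c : K => satIdeal b (α - algebraMap K R c * b ^ N))
    {c | satIdeal b (α - algebraMap K R c * b ^ N) ≠ ⊤} := by
  intro c hc c' _ (h : satIdeal _ _ = satIdeal _ _)
  by_contra hne
  have h2 : α - algebraMap K R c' * b ^ N ∈ satIdeal b (α - algebraMap K R c * b ^ N) :=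
    h ▸ self_mem_satIdeal
  have h3 := sub_mem h2 self_mem_satIdeal
  rw [sub_sub_sub_cancel_left, ← sub_mul, ← map_sub] at h3
  have hu : IsUnit (algebraMap K R (c - c')) := (isUnit_iff_ne_zero.2 (sub_ne_zero.2 hne)).map _
  exact hc (satIdeal_eq_top_of_pow_mem ((Ideal.unit_mul_mem_iff_mem _ hu).1 h3))

/-- The level sets of a function on which the two maps agree have the same proper transforms, and
infinitely many of them are defined over the separable closure of a finitely generated field. -/
theorem exists_form_and_hypersurfaces {f₁ f₂ : R →ₐ[K] S} {F₁ F₂ : L →ₐ[K] M}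
    (hf₁ : Function.Injective f₁) (hf₂ : Function.Injective f₂)
    (hF₁ : ∀ r, F₁ (algebraMap R L r) = algebraMap S M (f₁ r))
    (hF₂ : ∀ r, F₂ (algebraMap R L r) = algebraMap S M (f₂ r))
    (hsep₁ : SeparablyGeneratedVia (F₁ : L →+* M)) (hsep₂ : SeparablyGeneratedVia (F₂ : L →+* M))
    {g₀ : L} (hg₀ : g₀ ∉ Set.range (algebraMap K L)) (heq₀ : F₁ g₀ = F₂ g₀) :
    ∃ k : Subfield K, (∃ s : Finset K, k = Subfield.closure ↑s) ∧ ∃ R₀ : Subring R,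
      (∀ c : K, SepAlgOver k c → ∀ r ∈ R₀, algebraMap K R c * r ∈ R₀) ∧
      Submodule.span K (R₀ : Set R) = ⊤ ∧
      (∀ (m : ℕ) (v : Fin m → R), (∀ i, v i ∈ R₀) →
        (∀ c : Fin m → K, (∀ i, SepAlgOver k (c i)) →
          ∑ i, algebraMap K R (c i) * v i = 0 → ∀ i, c i = 0) →
        ∀ c : Fin m → K, ∑ i, algebraMap K R (c i) * v i = 0 → ∀ i, c i = 0) ∧
      {I : Ideal R | IsHypersurfaceIdeal I ∧ I = Ideal.span {x : R | x ∈ I ∧ x ∈ R₀} ∧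
        properTransform (f₁ : R →+* S) I = properTransform (f₂ : R →+* S) I}.Infinite := by
  classical
  haveI : IsNoetherianRing R := Algebra.FiniteType.isNoetherianRing K R
  haveI : IsNoetherianRing S := Algebra.FiniteType.isNoetherianRing K S
  haveI : Algebra.EssFiniteType R L := .of_isLocalization _ (nonZeroDivisors R)
  haveI : Algebra.EssFiniteType K L := .comp K R L
  let L₀ : IntermediateField K L := { AlgHom.equalizer F₁ F₂ with
    inv_mem' := fun u (hu : F₁ u = F₂ u) => show F₁ u⁻¹ = F₂ u⁻¹ by rw [map_inv₀, map_inv₀, hu] }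
  have hroot : ∀ p : ℕ, p.Prime → CharP L p → ∀ u : L, u ^ p ∈ L₀ → u ∈ L₀ := by
    intro p hp _ u (hu : F₁ (u ^ p) = F₂ (u ^ p))
    haveI := Fact.mk hp
    haveI : CharP M p := charP_of_injective_ringHom F₁.injective p
    rw [map_pow, map_pow] at hu
    exact frobenius_inj M p hu
  have htrans : ∀ u : L, u ∉ Set.range (algebraMap K L) → Transcendental K u := fun u hu hal =>
    hu (minpoly.mem_range_of_degree_eq_one K u
      (IsAlgClosed.degree_eq_one_of_irreducible K (minpoly.irreducible hal.isIntegral)))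
  obtain ⟨g, hg, r, t, hx⟩ := exists_mem_finSepOver hroot (L₀ := L₀) heq₀ (htrans g₀ hg₀)
  obtain ⟨b, α, N, hb, hα, hbad⟩ := exists_levelSets (R := R) hx (Sum.inl 0)
  rw [Sum.elim_inl] at hα
  have hgtr : ∀ c : K, g ≠ algebraMap K L c := by
    rintro c rfl
    have h1 : evalAt K (Sum.elim (fun _ : Fin 1 => algebraMap K L c) t)
        (MvPolynomial.X (Sum.inl 0)) = evalAt K (Sum.elim (fun _ : Fin 1 => algebraMap K L c) t)
        (MvPolynomial.C c) := by simp [evalAt]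
    have h2 := congrArg (MvPolynomial.coeff (Finsupp.single (Sum.inl 0) 1)) (hx.inj h1)
    rw [MvPolynomial.coeff_X, if_pos rfl, MvPolynomial.coeff_C, if_neg] at h2
    · exact one_ne_zero h2
    · exact fun h => one_ne_zero (Finsupp.single_eq_zero.1 h.symm)
  have hinjR := IsFractionRing.injective R L
  have hinjS := IsFractionRing.injective S M
  have hb0 : algebraMap R L b ≠ 0 := (map_ne_zero_iff _ hinjR).2 hb
  have hαc : ∀ c : K, α - algebraMap K R c * b ^ N ≠ 0 := by
    intro c h
    refine hgtr c (mul_left_cancel₀ (pow_ne_zero N hb0) ?_)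
    rw [← hα, sub_eq_zero.1 h, map_mul, map_pow, ← IsScalarTower.algebraMap_apply, mul_comm]
  have heq : f₁ α * f₂ (b ^ N) = f₂ α * f₁ (b ^ N) := by
    refine hinjS ?_
    have hg' : F₁ g = F₂ g := hg
    rw [map_mul, map_mul, ← hF₁, ← hF₁, ← hF₂, ← hF₂, hα, map_pow, map_mul, map_mul, hg']
    ring
  have hpt := finite_properTransform_ne hf₁ hf₂ hb hαc heq
    (finite_heightOnePrime_comap hF₁ hsep₁) (finite_heightOnePrime_comap hF₂ hsep₂)
  obtain ⟨k, hk, R₀, hstab, hspan, hind, hT, hsat⟩ := exists_form (K := K) ({b, α} : Finset R)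
  refine ⟨k, hk, R₀, hstab, hspan, hind, ?_⟩
  have hbR : b ∈ R₀ := hT (by simp)
  have hαR : α ∈ R₀ := hT (by simp)
  have hinf := (infinite_sepAlgOver k).sdiff (hbad.union hpt)
  refine (hinf.image ((injOn_satIdeal b α N).mono ?_)).mono ?_
  · rintro c ⟨-, hc⟩
    exact (not_not.1 (not_or.1 hc).1).2
  · rintro _ ⟨c, ⟨hck, hc⟩, rfl⟩
    obtain ⟨hrad, htop⟩ := not_not.1 (not_or.1 hc).1
    exact ⟨isHypersurfaceIdeal_satIdeal (hαc c) hrad htop,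
      hsat b hbR _ (R₀.sub_mem hαR (hstab c hck _ (R₀.pow_mem hbR N))),
      not_not.1 (not_or.1 hc).2⟩

end

/-- **Theorem 8.1.** -/
theorem main_positive_characteristic
    (K : Type*) [Field K] [IsAlgClosed K]
    (R : Type*) [CommRing R] [IsDomain R] [Algebra K R] [Algebra.FiniteType K R]
    (S : Type*) [CommRing S] [IsDomain S] [Algebra K S] [Algebra.FiniteType K S]
    (f₁ f₂ : R →ₐ[K] S)
    (hdom₁ : Function.Injective f₁) (hdom₂ : Function.Injective f₂)
    (FR : Type*) [Field FR] [Algebra R FR] [IsFractionRing R FR]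
    (FS : Type*) [Field FS] [Algebra S FS] [IsFractionRing S FS]
    (F₁ F₂ : FR →+* FS)
    (hF₁ : F₁.comp (algebraMap R FR) = (algebraMap S FS).comp (f₁ : R →+* S))
    (hF₂ : F₂.comp (algebraMap R FR) = (algebraMap S FS).comp (f₂ : R →+* S))
    -- the generic fibres of `φ₁` and `φ₂` are geometrically reduced
    (hsep₁ : SeparablyGeneratedVia F₁) (hsep₂ : SeparablyGeneratedVia F₂) :
    -- (1):
    (∃ k : Subfield K,
      -- `k` is a finitely generated subfield of `K`
      (∃ s : Finset K, k = Subfield.closure ↑s) ∧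
      -- a `k^sep`-form `R₀` of `R`:
      ∃ R₀ : Subring R,
        (∀ c : K, SepAlgOver k c → ∀ r ∈ R₀, algebraMap K R c * r ∈ R₀) ∧
        Submodule.span K (R₀ : Set R) = ⊤ ∧
        (∀ (m : ℕ) (v : Fin m → R), (∀ i, v i ∈ R₀) →
          (∀ c : Fin m → K, (∀ i, SepAlgOver k (c i)) →
            ∑ i, algebraMap K R (c i) * v i = 0 → ∀ i, c i = 0) →
          ∀ c : Fin m → K, ∑ i, algebraMap K R (c i) * v i = 0 → ∀ i, c i = 0) ∧
        -- infinitely many hypersurfaces defined over `k^sep` with `φ₁*H = φ₂*H`: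
        {I : Ideal R | IsHypersurfaceIdeal I ∧
          I = Ideal.span {x : R | x ∈ I ∧ x ∈ R₀} ∧
          properTransform (f₁ : R →+* S) I = properTransform (f₂ : R →+* S) I}.Infinite)
    ↔
    -- (2):
    (∃ a b : R, b ≠ 0 ∧ (∀ c : K, a ≠ algebraMap K R c * b) ∧
      f₁ a * f₂ b = f₂ a * f₁ b) := by
  refine ⟨fun ⟨k, _, R₀, _, _, _, hinf⟩ => exists_mul_eq_mul_of_properTransform hdom₁ hdom₂ hF₁ hF₂
    hsep₁ hsep₂ hinf (fun I hI => hI.1) fun I hI => hI.2.2, ?_⟩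
  rintro ⟨a, b, hb, hab, heq⟩
  letI : Algebra K FR := ((algebraMap R FR).comp (algebraMap K R)).toAlgebra
  letI : Algebra K FS := ((algebraMap S FS).comp (algebraMap K S)).toAlgebra
  haveI : IsScalarTower K R FR := .of_algebraMap_eq fun _ => rfl
  haveI : IsScalarTower K S FS := .of_algebraMap_eq fun _ => rfl
  have e₁ : ∀ r, F₁ (algebraMap R FR r) = algebraMap S FS (f₁ r) := fun r => RingHom.congr_fun hF₁ r
  have e₂ : ∀ r, F₂ (algebraMap R FR r) = algebraMap S FS (f₂ r) := fun r => RingHom.congr_fun hF₂ r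
  let G₁ : FR →ₐ[K] FS := ⟨F₁, fun c => by
    change F₁ (algebraMap K FR c) = _
    rw [IsScalarTower.algebraMap_apply K R FR, e₁, AlgHom.commutes,
      ← IsScalarTower.algebraMap_apply K S FS]⟩
  let G₂ : FR →ₐ[K] FS := ⟨F₂, fun c => by
    change F₂ (algebraMap K FR c) = _
    rw [IsScalarTower.algebraMap_apply K R FR, e₂, AlgHom.commutes,
      ← IsScalarTower.algebraMap_apply K S FS]⟩
  have hR := IsFractionRing.injective R FR
  have hS := IsFractionRing.injective S FS
  have hb0 : algebraMap R FR b ≠ 0 := (map_ne_zero_iff _ hR).2 hb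
  refine exists_form_and_hypersurfaces (F₁ := G₁) (F₂ := G₂) hdom₁ hdom₂ e₁ e₂ hsep₁ hsep₂
    (g₀ := algebraMap R FR a / algebraMap R FR b) ?_ ?_
  · rintro ⟨c, hc⟩
    refine hab c (hR ?_)
    rw [map_mul, ← IsScalarTower.algebraMap_apply, hc, div_mul_cancel₀ _ hb0]
  · change F₁ _ = F₂ _
    rw [map_div₀, map_div₀, e₁, e₁, e₂, e₂, div_eq_div_iff]
    · rw [← map_mul, ← map_mul, heq]
    · exact (map_ne_zero_iff _ hS).2 ((map_ne_zero_iff _ hdom₁).2 hb)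
    · exact (map_ne_zero_iff _ hS).2 ((map_ne_zero_iff _ hdom₂).2 hb)
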